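/- Let K be a number field with ring of integers 𝓞_K. Then for every finite subset S ⊆ 𝓞_K there exist an element α ∈ 𝓞_K and a positive integer k such that for every s ∈ S the element α + k·s is a prime element of 𝓞_K. (Constellation theorem in the prime elements of a number field.) -/

import Mathlib

open NumberField

namespace Constellation

open Finset

section Average

universe u v
variable {X : Type u} {Y : Type v}

/-- The average of a real function over a finite type. -/
noncomputable def av (f : X → ℝ) : ℝ := (∑ᶠ x, f x) / Nat.card X

open Classical in
/-- The indicator of a proposition, as a real number. -/
noncomputable def ind (P : Prop) : ℝ := if P then 1 else 0

lemma ind_true {P : Prop} (h : P) : ind P = 1 := by simp [ind, h]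
lemma ind_false {P : Prop} (h : ¬ P) : ind P = 0 := by simp [ind, h]
lemma ind_nonneg (P : Prop) : 0 ≤ ind P := by unfold ind; split_ifs <;> norm_num
lemma ind_le_one (P : Prop) : ind P ≤ 1 := by unfold ind; split_ifs <;> norm_num
lemma ind_mono {P Q : Prop} (h : P → Q) : ind P ≤ ind Q := by
  by_cases hP : P
  · rw [ind_true hP, ind_true (h hP)]
  · rw [ind_false hP]; exact ind_nonneg Q
lemma ind_and (P Q : Prop) : ind (P ∧ Q) = ind P * ind Q := by
  by_cases hP : P <;> by_cases hQ : Q <;> simp [ind, hP, hQ]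
lemma ind_not (P : Prop) : ind (¬ P) = 1 - ind P := by
  by_cases hP : P <;> simp [ind, hP]
lemma ind_sq (P : Prop) : ind P * ind P = ind P := by
  by_cases hP : P <;> simp [ind, hP]
lemma ind_congr {P Q : Prop} (h : P ↔ Q) : ind P = ind Q := by rw [propext h]

lemma av_eq [Fintype X] (f : X → ℝ) : av f = (∑ x, f x) / Fintype.card X := by
  rw [av, finsum_eq_sum_of_fintype, Nat.card_eq_fintype_card]

lemma av_congr {f g : X → ℝ} (h : ∀ x, f x = g x) : av f = av g := by
  rw [funext h]

variable [Finite X] [Finite Y]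

omit [Finite X] in
lemma card_mul_av [Fintype X] (f : X → ℝ) : Fintype.card X * av f = ∑ x, f x := by
  rw [av_eq]
  rcases isEmpty_or_nonempty X with h | h
  · simp
  · have : (Fintype.card X : ℝ) ≠ 0 := by simp
    field_simp

lemma av_add (f g : X → ℝ) : av (fun x => f x + g x) = av f + av g := by
  have := Fintype.ofFinite X
  simp only [av_eq, sum_add_distrib, add_div]

lemma av_sub (f g : X → ℝ) : av (fun x => f x - g x) = av f - av g := by
  have := Fintype.ofFinite X
  simp only [av_eq, sum_sub_distrib, sub_div]

lemma av_neg (f : X → ℝ) : av (fun x => - f x) = - av f := by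
  have := Fintype.ofFinite X
  simp only [av_eq, sum_neg_distrib, neg_div]

lemma av_mul_left (c : ℝ) (f : X → ℝ) : av (fun x => c * f x) = c * av f := by
  have := Fintype.ofFinite X
  simp only [av_eq, ← mul_sum, mul_div_assoc]

lemma av_mul_right (c : ℝ) (f : X → ℝ) : av (fun x => f x * c) = av f * c := by
  simp only [mul_comm _ c, av_mul_left]

lemma av_div (c : ℝ) (f : X → ℝ) : av (fun x => f x / c) = av f / c := by
  simp only [div_eq_mul_inv, av_mul_right]

lemma av_sum {ι : Type*} (s : Finset ι) (f : ι → X → ℝ) :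
    av (fun x => ∑ i ∈ s, f i x) = ∑ i ∈ s, av (f i) := by
  have := Fintype.ofFinite X
  simp only [av_eq]
  rw [sum_comm, sum_div]

lemma av_const [Nonempty X] (c : ℝ) : av (fun _ : X => c) = c := by
  have := Fintype.ofFinite X
  have : (Fintype.card X : ℝ) ≠ 0 := by simp
  simp [av_eq, this]

lemma av_mono {f g : X → ℝ} (h : ∀ x, f x ≤ g x) : av f ≤ av g := by
  have := Fintype.ofFinite X
  simp only [av_eq]
  gcongr with x
  exact h x

lemma av_nonneg {f : X → ℝ} (h : ∀ x, 0 ≤ f x) : 0 ≤ av f := by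
  have := Fintype.ofFinite X
  rw [av_eq]
  exact div_nonneg (sum_nonneg fun x _ => h x) (Nat.cast_nonneg _)

lemma av_le [Nonempty X] {f : X → ℝ} {c : ℝ} (h : ∀ x, f x ≤ c) : av f ≤ c :=
  (av_mono h).trans (av_const c).le

lemma le_av [Nonempty X] {f : X → ℝ} {c : ℝ} (h : ∀ x, c ≤ f x) : c ≤ av f :=
  (av_const c).ge.trans (av_mono h)

lemma exists_le_of_av_le [Nonempty X] {f g : X → ℝ} (h : av f ≤ av g) : ∃ x, f x ≤ g x := by
  by_contra! hc
  have := Fintype.ofFinite X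
  rw [av_eq, av_eq] at h
  have hp : (0 : ℝ) < Fintype.card X := by exact_mod_cast Fintype.card_pos
  rw [div_le_div_iff_of_pos_right hp] at h
  exact absurd (sum_lt_sum_of_nonempty univ_nonempty fun x _ => hc x) (not_lt.mpr h)

lemma exists_av_le [Nonempty X] (f : X → ℝ) : ∃ x, av f ≤ f x := by
  obtain ⟨x, hx⟩ := exists_le_of_av_le (X := X) (g := f) (f := fun _ => av f) (by rw [av_const])
  exact ⟨x, hx⟩

lemma abs_av_le (f : X → ℝ) : |av f| ≤ av (fun x => |f x|) := by
  rw [abs_le]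
  constructor
  · rw [← av_neg]; exact av_mono fun x => neg_abs_le _
  · exact av_mono fun x => le_abs_self _

omit [Finite X] [Finite Y] in
lemma av_comp_equiv (e : X ≃ Y) (f : Y → ℝ) : av (fun x => f (e x)) = av f := by
  rw [av, av, Nat.card_congr e, finsum_comp_equiv e]

lemma av_prod (f : X × Y → ℝ) : av f = av (fun x => av fun y => f (x, y)) := by
  have := Fintype.ofFinite X
  have := Fintype.ofFinite Y
  simp only [av_eq, Fintype.card_prod, Fintype.sum_prod_type, Nat.cast_mul, ← sum_div]
  rw [div_div, mul_comm]

lemma av_comm (f : X → Y → ℝ) : (av fun x => av fun y => f x y) = av fun y => av fun x => f x y := by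
  have := Fintype.ofFinite X
  have := Fintype.ofFinite Y
  simp only [av_eq, ← sum_div]
  rw [sum_comm, div_div, div_div, mul_comm]

lemma av_mul_av (f : X → ℝ) (g : Y → ℝ) :
    av f * av g = av (fun x => av fun y => f x * g y) := by
  simp only [av_mul_left, av_mul_right]

lemma le_card_mul_av {f : X → ℝ} (h : ∀ x, 0 ≤ f x) (x : X) : f x ≤ Nat.card X * av f := by
  have := Fintype.ofFinite X
  rw [Nat.card_eq_fintype_card, card_mul_av]
  exact single_le_sum (fun i _ => h i) (mem_univ x)

lemma av_mul_sq_le (f g : X → ℝ) :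
    av (fun x => f x * g x) ^ 2 ≤ av (fun x => f x ^ 2) * av (fun x => g x ^ 2) := by
  have := Fintype.ofFinite X
  simp only [av_eq]
  rw [div_pow, div_mul_div_comm, ← sq]
  gcongr
  exact sum_mul_sq_le_sq_mul_sq _ _ _

/-- Cauchy–Schwarz for averages with a weight. -/
lemma av_mul_mul_sq_le {w : X → ℝ} (hw : ∀ x, 0 ≤ w x) (f g : X → ℝ) :
    av (fun x => w x * f x * g x) ^ 2 ≤
      av (fun x => w x * f x ^ 2) * av (fun x => w x * g x ^ 2) := by
  have h := av_mul_sq_le (fun x => √(w x) * f x) (fun x => √(w x) * g x)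
  have h1 : ∀ x, √(w x) * f x * (√(w x) * g x) = w x * f x * g x := fun x => by
    linear_combination f x * g x * Real.mul_self_sqrt (hw x)
  simpa only [h1, mul_pow, Real.sq_sqrt (hw _)] using h

lemma av_sq_le [Nonempty X] (f : X → ℝ) : av f ^ 2 ≤ av (fun x => f x ^ 2) := by
  simpa [av_const] using av_mul_sq_le f (fun _ => 1)

lemma av_pow_two_mul (f : X → ℝ) : av f ^ 2 = av fun x => av fun y => f x * f y := by
  rw [sq, av_mul_av]

end Average

section Pi

universe u
variable {ι κ : Type*} {β : Type u}

lemma av_sum_arrow [Finite ι] [Finite κ] [Finite β] (f : (ι ⊕ κ → β) → ℝ) :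
    av f = av fun x : ι → β => av fun y : κ → β => f (Sum.elim x y) := by
  rw [← av_prod fun p : (ι → β) × (κ → β) => f (Sum.elim p.1 p.2)]
  exact (av_comp_equiv (Equiv.sumArrowEquivProdArrow ι κ β).symm f).symm

/-- The average of a function of one coordinate. -/
lemma av_eval {X : ι → Type*} [Finite ι] [∀ i, Finite (X i)] [∀ i, Nonempty (X i)] (i : ι)
    (f : X i → ℝ) : av (fun x : ∀ i, X i => f (x i)) = av f := by
  classical
  have h := av_comp_equiv (Equiv.piSplitAt i X).symm (fun x => f (x i))
  rw [← h, av_prod]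
  refine av_congr fun x => ?_
  simp [Equiv.piSplitAt, av_const]

/-- The average of a product of functions of independent coordinates. -/
lemma av_prod_eval {X : ι → Type*} [Fintype ι] [∀ i, Finite (X i)]
    (f : ∀ i, X i → ℝ) : av (fun x : ∀ i, X i => ∏ i, f i (x i)) = ∏ i, av (f i) := by
  classical
  have := fun i => Fintype.ofFinite (X i)
  simp only [av_eq, prod_div_distrib, Fintype.card_pi, Nat.cast_prod]
  congr 1
  exact (Finset.prod_univ_sum (fun _ => univ) fun i x => f i x).symm

end Pi

end Constellation

namespace Constellation

open Finset Combinatorics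

section DensityHalesJewett

variable {α β η κ κ' ι : Type}

/-- The density Hales–Jewett property of an alphabet. -/
def DHJ (α : Type) : Prop :=
  ∀ δ : ℝ, 0 < δ → ∃ ι : Type, Finite ι ∧ ∀ A : Set (ι → α),
    δ ≤ av (fun x => ind (x ∈ A)) → ∃ l : Line α ι, ∀ i, l i ∈ A

instance instFiniteLine [Finite α] [Finite ι] : Finite (Line α ι) :=
  Finite.of_injective Line.idxFun fun _ _ h => Line.ext h

instance instFiniteSubspace [Finite α] [Finite ι] [Finite η] : Finite (Subspace η α ι) :=
  Finite.of_injective Subspace.idxFun fun _ _ h => Subspace.ext h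

lemma one_le_of_av_ind {X : Type*} [Finite X] [Nonempty X] {P : X → Prop} {δ : ℝ} (hδ : 0 < δ)
    (h : δ ≤ av fun x => ind (P x)) : ∃ x, P x := by
  by_contra! hc
  rw [av_congr fun x => ind_false (hc x), av_const] at h
  linarith

lemma av_ind_le_one {X : Type*} [Finite X] {P : X → Prop} : av (fun x => ind (P x)) ≤ 1 := by
  rcases isEmpty_or_nonempty X with h | h
  · simp [av]
  · exact av_le fun x => ind_le_one _

lemma le_av_ind {X : Type*} [Finite X] {f : X → ℝ} (hf : ∀ x, f x ≤ 1) {δ : ℝ} (hδ : 0 ≤ δ)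
    [Nonempty X] (h : 2 * δ ≤ av f) : δ ≤ av fun x => ind (δ ≤ f x) := by
  have h1 : av f ≤ av (fun x => ind (δ ≤ f x)) + δ := by
    rw [← av_const (X := X) δ, ← av_add, av_const]
    refine av_mono fun x => ?_
    by_cases hx : δ ≤ f x
    · rw [ind_true hx]; linarith [hf x]
    · rw [ind_false hx]; linarith
  linarith

/-- If an event of probability at least `δ` is covered by finitely many events, one of them has
proportionally large probability. -/
lemma exists_popular {X L : Type*} [Finite X] [Finite L] {P : X → Prop}
    {Q : L → X → Prop} (h : ∀ x, P x → ∃ l, Q l x) {δ : ℝ} (hδ : 0 < δ)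
    (hP : δ ≤ av fun x => ind (P x)) :
    ∃ l, δ / (Nat.card L + 1) ≤ av fun x => ind (Q l x) := by
  have := Fintype.ofFinite L
  by_contra! hc
  have h1 : av (fun x => ind (P x)) ≤ ∑ l, av (fun x => ind (Q l x)) := by
    rw [← av_sum]
    refine av_mono fun x => ?_
    by_cases hx : P x
    · obtain ⟨l, hl⟩ := h x hx
      rw [ind_true hx, ← ind_true hl]
      exact single_le_sum (f := fun l => ind (Q l x)) (fun i _ => ind_nonneg _) (mem_univ l)
    · rw [ind_false hx]
      exact sum_nonneg fun i _ => ind_nonneg _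
  have h2 : ∑ l, av (fun x => ind (Q l x)) ≤ ∑ l : L, δ / (Nat.card L + 1) :=
    sum_le_sum fun l _ => (hc l).le
  rw [sum_const, card_univ, nsmul_eq_mul, ← Nat.card_eq_fintype_card, mul_div_assoc'] at h2
  have h3 : (Nat.card L : ℝ) * δ / (Nat.card L + 1) < δ := by
    rw [div_lt_iff₀ (by positivity)]
    nlinarith
  linarith

/-- The measure-theoretic form of the density Hales–Jewett property. -/
lemma DHJ.measure [Finite α] (h : DHJ α) {δ : ℝ} (hδ : 0 < δ) :
    ∃ ι : Type, Finite ι ∧ ∃ θ : ℝ, 0 < θ ∧ ∀ {Ω : Type*} [Finite Ω] [Nonempty Ω]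
      (A : (ι → α) → Ω → Prop), (δ ≤ av fun t => av fun ω => ind (A t ω)) →
      ∃ l : Line α ι, θ ≤ av fun ω => ind (∀ i, A (l i) ω) := by
  obtain ⟨ι, hι, H⟩ := h (δ / 2) (by positivity)
  refine ⟨ι, hι, δ / 2 / (Nat.card (Line α ι) + 1), by positivity, fun {Ω} _ _ A hA => ?_⟩
  rw [av_comm] at hA
  refine exists_popular (P := fun ω => δ / 2 ≤ av fun t => ind (A t ω))
    (Q := fun (l : Line α ι) ω => ∀ i, A (l i) ω) (fun ω hω => H {t | A t ω} hω) (by positivity)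
    (le_av_ind (fun ω => av_ind_le_one) (by positivity) (by linarith))

lemma DHJ.of_equiv (e : α ≃ β) (h : DHJ α) : DHJ β := by
  intro δ hδ
  obtain ⟨ι, hι, H⟩ := h δ hδ
  refine ⟨ι, hι, fun A hA => ?_⟩
  obtain ⟨l, hl⟩ := H {x | e ∘ x ∈ A} (by
    rw [← av_comp_equiv (Equiv.arrowCongr (Equiv.refl ι) e)] at hA
    exact hA)
  refine ⟨l.map e, fun i => ?_⟩
  obtain ⟨a, rfl⟩ := e.surjective i
  rw [Line.map_apply]
  exact hl a

/-- Composition of combinatorial subspaces. -/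
def Subspace.comp (W : Subspace κ β ι) (V : Subspace η β κ) : Subspace η β ι where
  idxFun i := (W.idxFun i).elim Sum.inl V.idxFun
  proper e := by
    obtain ⟨k, hk⟩ := V.proper e
    obtain ⟨i, hi⟩ := W.proper k
    exact ⟨i, by simp [hi, hk]⟩

lemma Subspace.comp_apply (W : Subspace κ β ι) (V : Subspace η β κ) (p : η → β) :
    Subspace.comp W V p = W (V p) := by
  funext i
  simp only [Subspace.comp, Subspace.coe_apply]
  cases W.idxFun i <;> rfl

/-- The image of a line under a subspace. -/
def Subspace.compLine (W : Subspace κ β ι) (l : Line β κ) : Line β ι where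
  idxFun i := (W.idxFun i).elim some l.idxFun
  proper := by
    obtain ⟨k, hk⟩ := l.proper
    obtain ⟨i, hi⟩ := W.proper k
    exact ⟨i, by simp [hi, hk]⟩

lemma Subspace.compLine_apply (W : Subspace κ β ι) (l : Line β κ) (b : β) :
    Subspace.compLine W l b = W (l b) := by
  funext i
  simp only [Subspace.compLine, Subspace.coe_apply, Line.coe_apply]
  cases W.idxFun i <;> rfl

/-- A subspace of the first factor of a product. -/
def Subspace.extRight (V : Subspace η β κ) (t : κ' → β) : Subspace η β (κ ⊕ κ') where
  idxFun := Sum.elim V.idxFun (fun i => Sum.inl (t i))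
  proper e := by
    obtain ⟨k, hk⟩ := V.proper e
    exact ⟨Sum.inl k, hk⟩

lemma Subspace.extRight_apply (V : Subspace η β κ) (t : κ' → β) (p : η → β) :
    Subspace.extRight V t p = Sum.elim (V p) t := by
  funext i
  cases i <;> rfl

/-- A subspace of the second factor of a product. -/
def Subspace.extLeft (s : κ → β) (V : Subspace η β κ') : Subspace η β (κ ⊕ κ') where
  idxFun := Sum.elim (fun i => Sum.inl (s i)) V.idxFun
  proper e := by
    obtain ⟨k, hk⟩ := V.proper e
    exact ⟨Sum.inr k, hk⟩

lemma Subspace.extLeft_apply (s : κ → β) (V : Subspace η β κ') (p : η → β) :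
    Subspace.extLeft s V p = Sum.elim s (V p) := by
  funext i
  cases i <;> rfl

lemma Subspace.injective (V : Subspace η β κ) : Function.Injective (V : (η → β) → κ → β) := by
  intro p q h
  funext e
  obtain ⟨i, hi⟩ := V.proper e
  have := congrFun h i
  rwa [Subspace.apply_inr hi, Subspace.apply_inr hi] at this

/-- The multidimensional density Hales–Jewett theorem, from the one-dimensional one. -/
lemma DHJ.multidim [Finite α] [Nonempty α] (h : DHJ α) (η : Type) [Finite η] :
    ∀ δ : ℝ, 0 < δ → ∃ ι : Type, Finite ι ∧ ∀ A : Set (ι → α),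
    δ ≤ av (fun x => ind (x ∈ A)) → ∃ V : Subspace η α ι, ∀ p, V p ∈ A := by
  revert η
  intro η hη
  induction η using Finite.induction_empty_option with
  | of_equiv e ih =>
    intro δ hδ
    obtain ⟨ι, hι, H⟩ := ih δ hδ
    refine ⟨ι, hι, fun A hA => ?_⟩
    obtain ⟨V, hV⟩ := H A hA
    refine ⟨V.reindex e (Equiv.refl α) (Equiv.refl ι), fun p => ?_⟩
    convert hV (p ∘ e)
    funext i
    simp
  | h_empty =>
    intro δ hδ
    refine ⟨Empty, inferInstance, fun A hA => ?_⟩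
    obtain ⟨x, hx⟩ := one_le_of_av_ind hδ hA
    refine ⟨⟨fun i => i.elim, fun i => i.elim⟩, fun p => ?_⟩
    convert hx
  | h_option ih =>
    rename_i η _
    intro δ hδ
    obtain ⟨κ₁, _, θ, hθ, H₁⟩ := h.measure hδ
    obtain ⟨κ₂, _, H₂⟩ := ih θ hθ
    refine ⟨κ₁ ⊕ κ₂, inferInstance, fun A hA => ?_⟩
    rw [av_sum_arrow] at hA
    obtain ⟨l, hl⟩ := H₁ (fun t s => Sum.elim t s ∈ A) hA
    obtain ⟨V, hV⟩ := H₂ {s | ∀ i, Sum.elim (l i) s ∈ A} hl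
    refine ⟨⟨Sum.elim (fun i => (l.idxFun i).elim (Sum.inr none) Sum.inl)
      (fun j => (V.idxFun j).map id some), ?_⟩, fun p => ?_⟩
    · rintro (_ | e)
      · obtain ⟨i, hi⟩ := l.proper
        exact ⟨Sum.inl i, by simp [hi]⟩
      · obtain ⟨i, hi⟩ := V.proper e
        exact ⟨Sum.inr i, by simp [hi]⟩
    · convert hV (fun e => p (some e)) (p none) using 1
      funext i
      rcases i with i | j
      · simp only [Subspace.coe_apply, Sum.elim_inl, Line.coe_apply]
        cases l.idxFun i <;> rfl
      · simp only [Subspace.coe_apply, Sum.elim_inr]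
        cases V.idxFun j <;> rfl

/-- A set of words over `Option α` is `j`-insensitive if membership does not change when letters
`none` and `some j` are interchanged. -/
def Insens (j : α) (B : Set (κ → Option α)) : Prop :=
  ∀ x y : κ → Option α, (∀ i, (x i).getD j = (y i).getD j) → x ∈ B → y ∈ B

lemma Insens.compl {j : α} {B : Set (κ → Option α)} (h : Insens j B) : Insens j Bᶜ :=
  fun x y hxy hx hy => hx (h y x (fun i => (hxy i).symm) hy)

lemma Insens.univ {j : α} : Insens j (Set.univ : Set (κ → Option α)) := fun _ _ _ _ => trivial

lemma Insens.preimage {j : α} {B : Set (κ → Option α)} (h : Insens j B)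
    (V : Subspace η (Option α) κ) : Insens j {p | V p ∈ B} := by
  intro x y hxy hx
  refine h _ _ (fun i => ?_) hx
  simp only [Subspace.coe_apply]
  cases V.idxFun i <;> simp [hxy]

lemma av_ind_eq {X : Type*} [Finite X] (c : X) : av (fun x => ind (x = c)) = 1 / Nat.card X := by
  classical
  have := Fintype.ofFinite X
  simp [av_eq, ind]

open Classical in
/-- Exchange some letter different from `none` in a word with a given letter. -/
noncomputable def swapLetter {L : Type} (p : (L → Option α) × α) : (L → Option α) × α :=
  if h : {m | p.1 m ≠ none}.Nonempty then
    (Function.update p.1 h.some (some p.2), (p.1 h.some).getD p.2)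
  else p

lemma swapLetter_involutive {L : Type} :
    Function.Involutive (swapLetter : (L → Option α) × α → (L → Option α) × α) := by
  classical
  intro p
  by_cases h : {m | p.1 m ≠ none}.Nonempty
  · have hs : {m | Function.update p.1 h.some (some p.2) m ≠ none} = {m | p.1 m ≠ none} := by
      ext m
      by_cases hm : m = h.some
      · simpa [hm] using h.some_mem
      · simp [hm]
    have hq : swapLetter p = (Function.update p.1 h.some (some p.2), (p.1 h.some).getD p.2) := by
      rw [swapLetter, dif_pos h]
    have key : ∀ (s : Set L) (_ : s = {m | p.1 m ≠ none}) (h' : s.Nonempty), h'.some = h.some := by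
      rintro s rfl h'; rfl
    have hx : p.1 h.some ≠ none := h.some_mem
    rw [hq, swapLetter, dif_pos (by rw [hs]; exact h)]
    simp only [key _ hs]
    obtain ⟨a, ha⟩ := Option.ne_none_iff_exists'.mp hx
    ext m
    · by_cases hm : m = h.some
      · simp [hm, ha]
      · simp [hm]
    · simp
  · have hq : swapLetter p = p := by rw [swapLetter, dif_neg h]
    rw [hq, hq]

lemma av_swapLetter {L : Type} [Finite α] [Nonempty α] [Finite κ] [Finite L]
    (f : (κ → L → Option α) → ℝ) :
    av f = av fun x : κ → L → Option α => av fun a : κ → α =>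
      f (fun i => (swapLetter (x i, a i)).1) := by
  let e : (κ → (L → Option α) × α) ≃ (κ → (L → Option α) × α) :=
    Equiv.arrowCongr (Equiv.refl κ) swapLetter_involutive.toPerm
  have h1 : av f = av fun q : κ → (L → Option α) × α => f (fun i => (q i).1) := by
    rw [← av_comp_equiv (Equiv.arrowProdEquivProdArrow κ (fun _ => L → Option α) fun _ => α).symm,
      av_prod]
    refine av_congr fun x => ?_
    exact (av_const _).symm
  rw [h1, ← av_comp_equiv e,
    ← av_comp_equiv (Equiv.arrowProdEquivProdArrow κ (fun _ => L → Option α) fun _ => α).symm,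
    av_prod]
  rfl

lemma exists_subspace_of_insens [Finite α] [Nonempty α] (h : DHJ α) (η : Type) [Finite η]
    {ρ : ℝ} (hρ : 0 < ρ) : ∃ κ : Type, Finite κ ∧ ∀ (j : α) (B : Set (κ → Option α)),
      Insens j B → ρ ≤ av (fun x => ind (x ∈ B)) →
      ∃ V : Subspace η (Option α) κ, ∀ p, V p ∈ B := by
  classical
  obtain ⟨κ, _, H⟩ := h.multidim η (ρ / 2) (by positivity)
  have := Fintype.ofFinite κ
  obtain ⟨l, hl⟩ := exists_nat_gt (2 * (Fintype.card κ : ℝ) / ρ)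
  refine ⟨κ × Fin l, inferInstance, fun j B hB hd => ?_⟩
  rw [← av_comp_equiv (Equiv.curry κ (Fin l) (Option α)).symm, av_swapLetter] at hd
  set g : (κ → Fin l → Option α) → (κ → α) → Prop :=
    fun x a => (Equiv.curry κ (Fin l) (Option α)).symm (fun i => (swapLetter (x i, a i)).1) ∈ B
  have hbad : av (fun x : κ → Fin l → Option α => ind (∃ i, x i = fun _ => none)) < ρ / 2 := by
    have h1 : av (fun x : κ → Fin l → Option α => ind (∃ i, x i = fun _ => none)) ≤
        ∑ i : κ, av (fun x : κ → Fin l → Option α => ind (x i = fun _ => none)) := by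
      rw [← av_sum]
      refine av_mono fun x => ?_
      by_cases hx : ∃ i, x i = fun _ => none
      · obtain ⟨i, hi⟩ := hx
        refine (ind_le_one _).trans ((ind_true hi).ge.trans ?_)
        exact single_le_sum (f := fun i => ind (x i = fun _ => none)) (fun i _ => ind_nonneg _)
          (mem_univ i)
      · rw [ind_false hx]
        exact sum_nonneg fun i _ => ind_nonneg _
    have h2 : ∀ i, av (fun x : κ → Fin l → Option α => ind (x i = fun _ => none)) =
        1 / Nat.card (Fin l → Option α) := fun i => by
      rw [av_eval (X := fun _ : κ => Fin l → Option α) i (fun z => ind (z = fun _ => none)),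
        av_ind_eq]
    have h3 : l < Nat.card (Fin l → Option α) := by
      rw [Nat.card_fun, Nat.card_eq_fintype_card (α := Fin l), Fintype.card_fin]
      have : 1 < Nat.card (Option α) := Finite.one_lt_card
      exact Nat.lt_pow_self this
    simp only [h2, sum_const, card_univ, nsmul_eq_mul] at h1
    refine h1.trans_lt ?_
    have h3' : (l : ℝ) < Nat.card (Fin l → Option α) := by exact_mod_cast h3
    have hl0 : (0 : ℝ) ≤ l := Nat.cast_nonneg l
    rw [mul_one_div, div_lt_iff₀ (by linarith)]
    rw [div_lt_iff₀ hρ] at hl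
    nlinarith
  have hgood : av (fun x => av fun a => ind (g x a)) ≤
      av (fun x : κ → Fin l → Option α => ind (∃ i, x i = fun _ => none)) +
        av (fun x => (1 - ind (∃ i, x i = fun _ => none)) * av fun a => ind (g x a)) := by
    rw [← av_add]
    refine av_mono fun x => ?_
    by_cases hx : ∃ i, x i = fun _ => none
    · rw [ind_true hx]; linarith [av_ind_le_one (P := fun a => g x a)]
    · rw [ind_false hx]; linarith
  obtain ⟨x, hx⟩ := exists_av_le
    (fun x => (1 - ind (∃ i, x i = fun _ => none)) * av fun a => ind (g x a))
  have hx' : ρ / 2 < (1 - ind (∃ i, x i = fun _ => none)) * av fun a => ind (g x a) := by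
    have : ρ ≤ av (fun x => av fun a => ind (g x a)) := hd
    linarith
  have hne : ¬ ∃ i, x i = fun _ => none := fun hc => by
    rw [ind_true hc] at hx'; linarith
  rw [ind_false hne, sub_zero, one_mul] at hx'
  obtain ⟨W, hW⟩ := H {a | g x a} hx'.le
  have hs : ∀ i, {m | x i m ≠ none}.Nonempty := fun i => by
    by_contra hc
    rw [Set.not_nonempty_iff_eq_empty, Set.eq_empty_iff_forall_notMem] at hc
    exact hne ⟨i, funext fun m => by simpa using hc m⟩
  refine ⟨⟨fun q => if q.2 = (hs q.1).some then (W.idxFun q.1).map some id else Sum.inl (x q.1 q.2),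
    fun e => ?_⟩, fun p => ?_⟩
  · obtain ⟨i, hi⟩ := W.proper e
    exact ⟨(i, (hs i).some), by simp [hi]⟩
  · refine hB _ _ (fun q => ?_) (hW fun e => (p e).getD j)
    obtain ⟨i, m⟩ := q
    have h4 : ∀ a : α, (swapLetter (x i, a)).1 = Function.update (x i) (hs i).some (some a) :=
      fun a => by
        rw [swapLetter, dif_pos (hs i)]
        congr!
    simp only [Equiv.curry_symm_apply, Function.uncurry, h4, Subspace.coe_apply]
    by_cases hm : m = (hs i).some
    · simp only [hm, if_true, Function.update_self]
      cases W.idxFun i <;> rfl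
    · simp [hm]

lemma av_ind_range {X Y : Type*} [Finite X] [Finite Y] [Nonempty X] {V : X → Y}
    (hV : Function.Injective V) (g : Y → ℝ) : av (fun y => ind (y ∈ Set.range V) * g y) =
      av (fun y => ind (y ∈ Set.range V)) * av (fun x => g (V x)) := by
  classical
  have := Fintype.ofFinite X
  have := Fintype.ofFinite Y
  have h : ∀ k : Y → ℝ, av (fun y => ind (y ∈ Set.range V) * k y) =
      (∑ x, k (V x)) / Fintype.card Y := fun k => by
    rw [av_eq]
    congr 1
    rw [← sum_image (f := k) (s := univ) (g := V) (fun x _ y _ h => hV h)]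
    rw [← sum_filter_add_sum_filter_not univ (fun y => y ∈ Set.range V)]
    rw [add_eq_left.mpr]
    · refine sum_congr (by ext; simp) fun y hy => ?_
      rw [ind_true (by simpa using hy), one_mul]
    · refine sum_eq_zero fun y hy => ?_
      rw [ind_false (by simpa using hy), zero_mul]
  have h1 := h fun _ => 1
  simp only [mul_one] at h1
  rw [h, h1, av_eq]
  have : (Fintype.card X : ℝ) ≠ 0 := by simp
  simp

lemma tiling_insens_aux [Finite α] [Nonempty α] (h : DHJ α) (η : Type) [Finite η]
    {ε : ℝ} (hε : 0 < ε) (hε1 : ε ≤ 1) : ∃ θ : ℝ, 0 < θ ∧ θ ≤ 1 ∧ ∀ T : ℕ,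
      ∃ κ : Type, Finite κ ∧ ∀ (j : α) (C : Set (κ → Option α)),
      Insens j C → ∀ f : (κ → Option α) → ℝ, (∀ x, 0 ≤ f x) → (∀ x, f x ≤ 1) → ∀ c : ℝ, 0 ≤ c →
      (∀ V : Subspace η (Option α) κ, av (fun p => f (V p)) ≤ c) →
      av (fun x => ind (x ∈ C) * f x) ≤ c * av (fun x => ind (x ∈ C)) +
        (ε / 2 + (1 - θ) ^ T * av (fun x => ind (x ∈ C))) := by
  classical
  obtain ⟨κ₀, _, H₀⟩ := exists_subspace_of_insens h η (ρ := ε / 4) (by positivity)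
  set θ₁ : ℝ := ε / 4 / (Nat.card (Subspace η (Option α) κ₀) + 1) with hθ₁
  set θ : ℝ := θ₁ / Nat.card (κ₀ → Option α) with hθ
  have hcard1 : (1 : ℝ) ≤ Nat.card (κ₀ → Option α) := by exact_mod_cast Nat.card_pos
  have hcard : (0 : ℝ) < Nat.card (κ₀ → Option α) := by linarith
  have hθ₁0 : 0 < θ₁ := by positivity
  have hθ₁1 : θ₁ ≤ 1 := (div_le_self (by positivity) (by simp)).trans (by linarith)
  have hθ0 : 0 < θ := by positivity
  have hθ1 : θ ≤ 1 := (div_le_self hθ₁0.le hcard1).trans hθ₁1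
  refine ⟨θ, hθ0, hθ1, fun T => ?_⟩
  induction T with
  | zero =>
    refine ⟨Empty, inferInstance, fun j C _ f hf0 hf1 c hc _ => ?_⟩
    have h1 : av (fun x => ind (x ∈ C) * f x) ≤ av (fun x => ind (x ∈ C)) :=
      av_mono fun x => mul_le_of_le_one_right (ind_nonneg _) (hf1 x)
    have h2 : 0 ≤ c * av (fun x => ind (x ∈ C)) := mul_nonneg hc (av_nonneg fun x => ind_nonneg _)
    linarith
  | succ T ih =>
    obtain ⟨κ, _, ih⟩ := ih
    refine ⟨κ₀ ⊕ κ, inferInstance, fun j C hC f hf0 hf1 c hc hV => ?_⟩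
    have hC0 : 0 ≤ av (fun x => ind (x ∈ C)) := av_nonneg fun x => ind_nonneg _
    have hpow : 0 ≤ (1 - θ) ^ T := pow_nonneg (by linarith) _
    rcases lt_or_ge (av (fun x => ind (x ∈ C))) (ε / 2) with hlt | hge
    · have h1 : av (fun x => ind (x ∈ C) * f x) ≤ av (fun x => ind (x ∈ C)) :=
        av_mono fun x => mul_le_of_le_one_right (ind_nonneg _) (hf1 x)
      have h2 : 0 ≤ (1 - θ) ^ (T + 1) := pow_nonneg (by linarith) _
      have h3 := mul_nonneg hc hC0
      have h4 := mul_nonneg h2 hC0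
      linarith
    · have hge' : 2 * (ε / 4) ≤ av fun t => av fun s => ind (Sum.elim s t ∈ C) := by
        rw [av_comm, ← av_sum_arrow fun x => ind (x ∈ C)]; linarith
      obtain ⟨V, hVΘ⟩ := exists_popular
        (P := fun t : κ → Option α => ε / 4 ≤ av fun s => ind (Sum.elim s t ∈ C))
        (Q := fun (V : Subspace η (Option α) κ₀) t => ∀ p, Sum.elim (V p) t ∈ C)
        (fun t ht => H₀ j {s | Sum.elim s t ∈ C} (fun x y hxy hx => hC _ _ (by
          rintro (i | i)
          · exact hxy i
          · rfl) hx) ht) (by positivity) (le_av_ind (fun t => av_ind_le_one) (by positivity) hge')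
      rw [← hθ₁] at hVΘ
      set Θ : Set (κ → Option α) := {t | ∀ p, Sum.elim (V p) t ∈ C} with hΘ
      have hVΘ : θ₁ ≤ av fun t => ind (t ∈ Θ) := hVΘ
      set r := av (fun s => ind (s ∈ Set.range (V : (η → Option α) → κ₀ → Option α))) with hr
      have hr1 : 1 ≤ Nat.card (κ₀ → Option α) * r := by
        have := le_card_mul_av (f := fun s => ind (s ∈ Set.range (V : (η → Option α) → κ₀ → Option α)))
          (fun s => ind_nonneg _) (V fun _ => none)
        rwa [ind_true ⟨_, rfl⟩] at this
      have hrθ : θ ≤ r * av fun t => ind (t ∈ Θ) := by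
        rw [hθ, div_le_iff₀ hcard]
        nlinarith
      have hΘj : Insens j Θ := fun x y hxy hx p => hC _ _ (by
          rintro (i | i)
          · rfl
          · exact hxy i) (hx p)
      let C' : (κ₀ → Option α) → Set (κ → Option α) := fun s =>
        {t | Sum.elim s t ∈ C ∧ ¬ (s ∈ Set.range (V : (η → Option α) → κ₀ → Option α) ∧ t ∈ Θ)}
      have hC'j : ∀ s, Insens j (C' s) := fun s x y hxy hx => by
        refine ⟨hC _ _ (by
          rintro (i | i)
          · rfl
          · exact hxy i) hx.1, fun hy => hx.2 ⟨hy.1, hΘj y x (fun i => (hxy i).symm) hy.2⟩⟩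
      have hsplit : ∀ s t, ind (Sum.elim s t ∈ C) = ind (t ∈ C' s) +
          ind (s ∈ Set.range (V : (η → Option α) → κ₀ → Option α)) * ind (t ∈ Θ) := fun s t => by
        rw [← ind_and]
        by_cases h1 : s ∈ Set.range (V : (η → Option α) → κ₀ → Option α) ∧ t ∈ Θ
        · have h2 : Sum.elim s t ∈ C := by
            obtain ⟨⟨p, rfl⟩, ht⟩ := h1
            exact ht p
          rw [ind_true h1, ind_true h2, ind_false fun h => h.2 h1, zero_add]
        · rw [ind_false h1, add_zero]
          exact ind_congr ⟨fun h => ⟨h, h1⟩, fun h => h.1⟩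
      have hdens : av (fun x => ind (x ∈ C)) =
          av (fun s => av fun t => ind (t ∈ C' s)) + r * av fun t => ind (t ∈ Θ) := by
        rw [av_sum_arrow, hr, ← av_mul_right, ← av_add]
        refine av_congr fun s => ?_
        rw [av_congr (hsplit s), av_add, av_mul_left]
      have hmain : av (fun x => ind (x ∈ C) * f x) =
          av (fun s => av fun t => ind (t ∈ C' s) * f (Sum.elim s t)) +
          av fun t => ind (t ∈ Θ) * (av fun s =>
            ind (s ∈ Set.range (V : (η → Option α) → κ₀ → Option α)) * f (Sum.elim s t)) := by
        simp only [← av_mul_left]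
        rw [av_sum_arrow, av_comm (X := κ → Option α), ← av_add]
        refine av_congr fun s => ?_
        rw [← av_add]
        refine av_congr fun t => ?_
        rw [hsplit]; ring
      have hfirst : av (fun s => av fun t => ind (t ∈ C' s) * f (Sum.elim s t)) ≤
          (c + (1 - θ) ^ T) * av (fun s => av fun t => ind (t ∈ C' s)) + ε / 2 := by
        rw [← av_const (X := κ₀ → Option α) (ε / 2), ← av_mul_left, ← av_add]
        refine av_mono fun s => ?_
        have := ih j (C' s) (hC'j s) (fun t => f (Sum.elim s t)) (fun _ => hf0 _) (fun _ => hf1 _)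
          c hc fun W => by
            simpa only [Subspace.extLeft_apply] using hV (Subspace.extLeft s W)
        linarith
      have hsecond : av (fun t => ind (t ∈ Θ) * (av fun s =>
            ind (s ∈ Set.range (V : (η → Option α) → κ₀ → Option α)) * f (Sum.elim s t))) ≤
          c * (r * av fun t => ind (t ∈ Θ)) := by
        rw [← mul_assoc, ← av_mul_left]
        refine av_mono fun t => ?_
        rw [av_ind_range (Subspace.injective V)]
        have h1 : av (fun p => f (Sum.elim (V p) t)) ≤ c := by
          simpa only [Subspace.extRight_apply] using hV (Subspace.extRight V t)
        have h2 : 0 ≤ r := av_nonneg fun s => ind_nonneg _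
        rw [← hr, mul_comm c r, mul_comm (ind _)]
        exact mul_le_mul_of_nonneg_right (mul_le_mul_of_nonneg_left h1 h2) (ind_nonneg _)
      have hd1 : av (fun x => ind (x ∈ C)) ≤ 1 := av_ind_le_one
      have hfin : (1 - θ) ^ T * av (fun s => av fun t => ind (t ∈ C' s)) ≤
          (1 - θ) ^ (T + 1) * av (fun x => ind (x ∈ C)) := by
        rw [pow_succ, mul_assoc]
        refine mul_le_mul_of_nonneg_left ?_ hpow
        nlinarith
      rw [hmain]
      have : c * av (fun x => ind (x ∈ C)) = c * av (fun s => av fun t => ind (t ∈ C' s)) +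
        c * (r * av fun t => ind (t ∈ Θ)) := by rw [hdens]; ring
      linarith

/-- Tiling an insensitive set by subspaces: a function with small averages on all subspaces has
small average on an insensitive set, relative to the density of that set. -/
lemma tiling_insens [Finite α] [Nonempty α] (h : DHJ α) (η : Type) [Finite η]
    {ε : ℝ} (hε : 0 < ε) : ∃ κ : Type, Finite κ ∧ ∀ (j : α) (C : Set (κ → Option α)),
      Insens j C → ∀ f : (κ → Option α) → ℝ, (∀ x, 0 ≤ f x) → (∀ x, f x ≤ 1) → ∀ c : ℝ, 0 ≤ c →
      (∀ V : Subspace η (Option α) κ, av (fun p => f (V p)) ≤ c) →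
      av (fun x => ind (x ∈ C) * f x) ≤ c * av (fun x => ind (x ∈ C)) + ε := by
  obtain ⟨θ, hθ0, hθ1, H⟩ := tiling_insens_aux h η (ε := min ε 1) (by positivity) (min_le_right _ _)
  obtain ⟨T, hT⟩ := exists_pow_lt_of_lt_one (x := ε / 2) (y := 1 - θ) (by positivity) (by linarith)
  obtain ⟨κ, hκ, H⟩ := H T
  refine ⟨κ, hκ, fun j C hC f hf0 hf1 c hc hV => (H j C hC f hf0 hf1 c hc hV).trans ?_⟩
  have h1 : (1 - θ) ^ T * av (fun x => ind (x ∈ C)) ≤ (1 - θ) ^ T :=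
    mul_le_of_le_one_right (pow_nonneg (by linarith) _) av_ind_le_one
  have := min_le_left ε 1
  linarith

/-- Tiling an intersection of insensitive sets by subspaces. -/
lemma tiling_inter [Finite α] [Nonempty α] (h : DHJ α) (J : Finset α) : ∀ (η : Type) [Finite η]
    {ε : ℝ} (_ : 0 < ε), ∃ κ : Type, Finite κ ∧ ∀ (C : α → Set (κ → Option α)),
      (∀ j, Insens j (C j)) → ∀ f : (κ → Option α) → ℝ, (∀ x, 0 ≤ f x) → (∀ x, f x ≤ 1) →
      ∀ c : ℝ, 0 ≤ c → c ≤ 1 →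
      (∀ V : Subspace η (Option α) κ, av (fun p => f (V p)) ≤ c) →
      av (fun x => ind (∀ j ∈ J, x ∈ C j) * f x) ≤ c * av (fun x => ind (∀ j ∈ J, x ∈ C j)) + ε := by
  classical
  induction J using Finset.induction_on with
  | empty =>
    intro η _ ε hε
    refine ⟨η, inferInstance, fun C _ f _ _ c _ _ hV => ?_⟩
    have h1 := hV ⟨Sum.inr, fun e => ⟨e, rfl⟩⟩
    have h2 : ∀ x : η → Option α, ind (∀ j ∈ (∅ : Finset α), x ∈ C j) = 1 :=
      fun x => ind_true (by simp)
    simp only [h2, one_mul, av_const]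
    have h3 : av (fun p => f (((⟨Sum.inr, fun e => ⟨e, rfl⟩⟩ : Subspace η (Option α) η) :
      (η → Option α) → η → Option α) p)) = av f := rfl
    linarith
  | insert j J hj ih =>
    intro η _ ε hε
    obtain ⟨κ₁, _, H₁⟩ := ih η (ε := ε / 2) (by positivity)
    obtain ⟨κ, _, H⟩ := tiling_insens h κ₁ (ε := ε / 2) (by positivity)
    refine ⟨κ, inferInstance, fun C hC f hf0 hf1 c hc hc1 hV => ?_⟩
    have key := H j (C j) (hC j)
      (fun x => ind (∀ i ∈ J, x ∈ C i) * f x + c * (1 - ind (∀ i ∈ J, x ∈ C i)))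
      (fun x => ?_) (fun x => ?_) (c + ε / 2) (by positivity) fun W => ?_
    · have h1 : av (fun x => ind (∀ i ∈ insert j J, x ∈ C i) * f x) =
          av (fun x => ind (x ∈ C j) *
            (ind (∀ i ∈ J, x ∈ C i) * f x + c * (1 - ind (∀ i ∈ J, x ∈ C i)))) -
          c * (av (fun x => ind (x ∈ C j)) - av (fun x => ind (∀ i ∈ insert j J, x ∈ C i))) := by
        rw [← av_sub, ← av_mul_left, ← av_sub]
        refine av_congr fun x => ?_
        simp only [forall_mem_insert, ind_and]
        ring
      have h2 : av (fun x => ind (x ∈ C j)) ≤ 1 := av_ind_le_one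
      rw [h1]
      nlinarith
    · by_cases hx : ∀ i ∈ J, x ∈ C i
      · simp [ind_true hx, hf0 x]
      · simp [ind_false hx, hc]
    · by_cases hx : ∀ i ∈ J, x ∈ C i
      · simp [ind_true hx, hf1 x]
      · simp [ind_false hx, hc1]
    · have := H₁ (fun i => {p | W p ∈ C i}) (fun i => (hC i).preimage W) (fun p => f (W p))
        (fun _ => hf0 _) (fun _ => hf1 _) c hc hc1 fun V => by
          simpa only [Subspace.comp_apply] using hV (Subspace.comp W V)
      rw [av_add, av_mul_left, av_sub, av_const]
      simp only [Set.mem_ofPred_eq] at this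
      linarith

/-- Tiling the complement of an intersection of insensitive sets by subspaces. -/
lemma tiling_compl [Finite α] [Nonempty α] (h : DHJ α) (η : Type) [Finite η]
    {ε : ℝ} (hε : 0 < ε) : ∃ κ : Type, Finite κ ∧ ∀ (D : α → Set (κ → Option α)),
      (∀ j, Insens j (D j)) → ∀ f : (κ → Option α) → ℝ, (∀ x, 0 ≤ f x) → (∀ x, f x ≤ 1) →
      ∀ c : ℝ, 0 ≤ c → c ≤ 1 →
      (∀ V : Subspace η (Option α) κ, av (fun p => f (V p)) ≤ c) →
      av (fun x => (1 - ind (∀ j, x ∈ D j)) * f x) ≤ c * (1 - av (fun x => ind (∀ j, x ∈ D j))) + ε := by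
  classical
  have := Fintype.ofFinite α
  have hα : (0 : ℝ) < Fintype.card α := by exact_mod_cast Fintype.card_pos
  obtain ⟨κ, hκ, H⟩ := tiling_inter h univ η (ε := ε / Fintype.card α) (by positivity)
  refine ⟨κ, hκ, fun D hD f hf0 hf1 c hc hc1 hV => ?_⟩
  have key : ∀ J : Finset α, av (fun x => (1 - ind (∀ j ∈ J, x ∈ D j)) * f x) ≤
      c * (1 - av (fun x => ind (∀ j ∈ J, x ∈ D j))) + J.card * (ε / Fintype.card α) := by
    intro J
    induction J using Finset.induction_on with
    | empty =>
      simp [ind_true trivial, av_const]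
    | insert j J hj ih =>
      have h1 := H (fun i => if i = j then (D j)ᶜ else if i ∈ J then D i else Set.univ) (fun i => by
        split_ifs with h1 h2
        · rw [h1]; exact (hD j).compl
        · exact hD i
        · exact Insens.univ) f hf0 hf1 c hc hc1 hV
      have h2 : ∀ x, ind (∀ i ∈ univ, x ∈
          (fun i => if i = j then (D j)ᶜ else if i ∈ J then D i else Set.univ) i) =
          ind (∀ i ∈ J, x ∈ D i) - ind (∀ i ∈ insert j J, x ∈ D i) := fun x => by
        simp only [forall_mem_insert, ind_and]
        rw [← one_sub_mul, ← ind_not, ← ind_and]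
        refine ind_congr ⟨fun h => ⟨by simpa using h j, fun i hi => ?_⟩, fun h i _ => ?_⟩
        · have := h i (mem_univ _)
          rwa [if_neg (by rintro rfl; exact hj hi), if_pos hi] at this
        · by_cases hij : i = j
          · simpa [hij] using h.1
          · by_cases hi : i ∈ J
            · simpa [hij, hi] using h.2 i hi
            · simp [hij, hi]
      rw [funext fun x => congrArg (· * f x) (h2 x)] at h1
      rw [funext h2, av_sub] at h1
      have h3 : av (fun x => (1 - ind (∀ i ∈ insert j J, x ∈ D i)) * f x) =
          av (fun x => (1 - ind (∀ i ∈ J, x ∈ D i)) * f x) +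
          av (fun x => (ind (∀ i ∈ J, x ∈ D i) - ind (∀ i ∈ insert j J, x ∈ D i)) * f x) := by
        rw [← av_add]
        exact av_congr fun x => by ring
      rw [h3, card_insert_of_notMem hj]
      push_cast
      linarith
  have := key univ
  simp only [mem_univ, true_implies, card_univ] at this
  rwa [mul_div_cancel₀ _ hα.ne'] at this

/-- The set of points of a word over `Option α`: replace `none` by `i`. -/
def fillStar (i : α) (x : κ → Option α) : κ → Option α := fun e => some ((x e).getD i)

lemma insens_fillStar (i : α) (A : Set (κ → Option α)) : Insens i {x | fillStar i x ∈ A} := by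
  intro x y hxy hx
  have : fillStar i x = fillStar i y := funext fun e => congrArg some (hxy e)
  rwa [Set.mem_ofPred_eq, this] at hx

/-- A line-free set does not contain a word with a star together with all its fillings. -/
lemma exists_fillStar_notMem {A : Set (κ → Option α)}
    (hA : ∀ l : Line (Option α) κ, ∃ i, l i ∉ A) (x : κ → Option α) (hx : ∃ e, x e = none)
    (hxA : x ∈ A) : ∃ i, fillStar i x ∉ A := by
  obtain ⟨o, ho⟩ := hA ⟨fun e => (x e).map some, by simpa using hx⟩
  rcases o with _ | i
  · refine absurd ?_ ho
    convert hxA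
    funext e
    simp only [Line.coe_apply]
    cases x e <;> rfl
  · refine ⟨i, ?_⟩
    convert ho
    funext e
    simp only [Line.coe_apply, fillStar]
    cases x e <;> rfl

/-- A substitute for the Graham–Rothschild theorem. -/
lemma exists_subspace_fillStar [Finite α] [Nonempty α] (h : DHJ α) {δ : ℝ} (hδ : 0 < δ) :
    ∃ θ : ℝ, 0 < θ ∧ ∀ (κ : Type) [Finite κ], ∃ ι : Type, Finite ι ∧
      ∀ {Ω : Type} [Finite Ω] [Nonempty Ω] (A : (ι → Option α) → Ω → Prop),
      (∀ w, δ ≤ av fun ω => ind (A w ω)) → ∃ V : Subspace κ (Option α) ι,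
        (∃ e, V.idxFun e = Sum.inl none) ∧
        ∀ p, θ ≤ av fun ω => ind (∀ i, A (fillStar i (V p)) ω) := by
  classical
  obtain ⟨M, _, θ, hθ, H⟩ := h.measure hδ
  refine ⟨θ, hθ, fun κ _ => ?_⟩
  obtain ⟨ι, hι, HJ⟩ := Subspace.exists_mono_in_high_dimension (M ⊕ α) (Line α M) κ
  refine ⟨M ⊕ ι, inferInstance, fun {Ω} _ _ A hA => ?_⟩
  let T : (ι → M ⊕ α) → (M → α) → (M ⊕ ι → Option α) := fun Q t =>
    Sum.elim (fun m => some (t m)) (fun e => some ((Q e).elim t id))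
  have hQ : ∀ Q : ι → M ⊕ α, ∃ l : Line α M, θ ≤ av fun ω => ind (∀ i, A (T Q (l i)) ω) :=
    fun Q => H (fun t ω => A (T Q t) ω) (le_av fun t => hA _)
  choose C hC using hQ
  obtain ⟨σ, l, hσ⟩ := HJ C
  refine ⟨⟨Sum.elim (fun m => Sum.inl (l.idxFun m)) fun e =>
    (σ.idxFun e).elim (fun b => Sum.inl (b.elim l.idxFun some)) Sum.inr, fun e => ?_⟩, ?_,
    fun p => ?_⟩
  · obtain ⟨i, hi⟩ := σ.proper e
    exact ⟨Sum.inr i, by simp [hi]⟩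
  · obtain ⟨m, hm⟩ := l.proper
    exact ⟨Sum.inl m, by simp [hm]⟩
  · obtain ⟨m₀, hm₀⟩ := l.proper
    have := hC (σ fun e => (p e).elim (Sum.inl m₀) Sum.inr)
    rw [hσ] at this
    convert this using 6 with ω i
    funext e
    rcases e with m | e
    · rfl
    · simp only [fillStar, T, Sum.elim_inr, Subspace.coe_apply]
      rcases σ.idxFun e with (m | a) | k
      · rfl
      · rfl
      · rcases hp : p k with _ | a <;> simp [hp, hm₀]

/-- The density Hales–Jewett induction step: add one letter. -/
lemma DHJ.option [Finite α] [Nonempty α] (h : DHJ α) : DHJ (Option α) := by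
  classical
  let P : ℝ → Prop := fun δ => ∃ ι : Type, Finite ι ∧ ∀ A : Set (ι → Option α),
    δ ≤ av (fun x => ind (x ∈ A)) → ∃ l : Line (Option α) ι, ∀ i, l i ∈ A
  have hmono : ∀ δ δ', δ ≤ δ' → P δ → P δ' := fun δ δ' hd ⟨ι, hι, H⟩ =>
    ⟨ι, hι, fun A hA => H A (hd.trans hA)⟩
  by_contra hcon
  obtain ⟨δ₁, hδ₁, hP₁⟩ : ∃ δ : ℝ, 0 < δ ∧ ¬ P δ := by
    by_contra! hc
    exact hcon hc
  set δ₀ := sInf {δ | P δ} with hδ₀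
  have hbdd : BddBelow {δ | P δ} := ⟨δ₁, fun δ hδ => by
    by_contra! hc
    exact hP₁ (hmono _ _ hc.le hδ)⟩
  have hP2 : P 2 := ⟨Empty, inferInstance, fun A hA => by
    have := av_ind_le_one (P := fun x => x ∈ A)
    linarith⟩
  have hδ₀pos : 0 < δ₀ := hδ₁.trans_le (le_csInf ⟨2, hP2⟩ fun δ hδ => by
    by_contra! hc
    exact hP₁ (hmono _ _ hc.le hδ))
  have habove : ∀ ε > 0, P (δ₀ + ε) := fun ε hε => by
    obtain ⟨δ, hδ, hlt⟩ := exists_lt_of_csInf_lt (s := {δ | P δ}) ⟨2, hP2⟩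
      (show sInf {δ | P δ} < δ₀ + ε by linarith)
    exact hmono _ _ hlt.le hδ
  have hbelow : ∀ ε > 0, ¬ P (δ₀ - ε) := fun ε hε hc => by
    have := csInf_le hbdd hc
    linarith
  have hδ₀1 : δ₀ ≤ 1 := by
    by_contra! hc
    refine hbelow ((δ₀ - 1) / 2) (by linarith) ⟨Empty, inferInstance, fun A hA => ?_⟩
    have := av_ind_le_one (P := fun x => x ∈ A)
    linarith
  obtain ⟨θ, hθ, H₁⟩ := exists_subspace_fillStar h (δ := δ₀ / 2) (by positivity)
  obtain ⟨ε, hε, hε1, hε2⟩ : ∃ ε : ℝ, 0 < ε ∧ 3 * ε < δ₀ * θ ∧ ε ≤ δ₀ / 2 :=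
    ⟨min (δ₀ * θ / 4) (δ₀ / 2), by positivity,
      by linarith [min_le_left (δ₀ * θ / 4) (δ₀ / 2), mul_pos hδ₀pos hθ], min_le_right _ _⟩
  obtain ⟨η, _, Hη⟩ := habove ε hε
  obtain ⟨κ, _, Hκ⟩ := tiling_compl h η (ε := ε) hε
  obtain ⟨ι₁, _, H₁⟩ := H₁ κ
  have hcard : (0 : ℝ) < Nat.card (ι₁ → Option α) := by exact_mod_cast Nat.card_pos
  set ε' : ℝ := ε / (2 * Nat.card (ι₁ → Option α)) with hε'
  have hε'0 : 0 < ε' := by positivity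
  obtain ⟨ι₂, _, H₂⟩ := habove ε' hε'0
  obtain ⟨A, hA, hfree⟩ : ∃ A : Set (ι₁ ⊕ ι₂ → Option α),
      δ₀ - ε' ≤ av (fun x => ind (x ∈ A)) ∧ ∀ l : Line (Option α) (ι₁ ⊕ ι₂), ∃ i, l i ∉ A := by
    by_contra! hc
    exact hbelow ε' hε'0 ⟨_, inferInstance, hc⟩
  rw [av_sum_arrow] at hA
  have hup : ∀ w : ι₁ → Option α, av (fun y => ind (Sum.elim w y ∈ A)) ≤ δ₀ + ε' := fun w => by
    by_contra! hc
    obtain ⟨l, hl⟩ := H₂ {y | Sum.elim w y ∈ A} hc.le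
    obtain ⟨i, hi⟩ := hfree (l.vertical w)
    rw [Line.vertical_apply] at hi
    exact hi (hl i)
  have hlow : ∀ w : ι₁ → Option α, δ₀ - ε ≤ av (fun y => ind (Sum.elim w y ∈ A)) := fun w => by
    have h1 := le_card_mul_av (X := ι₁ → Option α)
      (f := fun w => δ₀ + ε' - av (fun y => ind (Sum.elim w y ∈ A)))
      (fun w => by linarith [hup w]) w
    rw [av_sub, av_const] at h1
    have h2 : Nat.card (ι₁ → Option α) * (2 * ε') = ε := by
      rw [hε']; field_simp
    have h3 : Nat.card (ι₁ → Option α) *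
        (δ₀ + ε' - av (fun w => av (fun y => ind (Sum.elim w y ∈ A)))) ≤
        Nat.card (ι₁ → Option α) * (2 * ε') := by gcongr; linarith
    linarith
  obtain ⟨V, ⟨e, he⟩, hV⟩ := H₁ (fun w y => Sum.elim w y ∈ A) fun w => by linarith [hlow w]
  have hline : ∀ y, av (fun p => ind (Sum.elim (V p) y ∈ A)) ≤
      (δ₀ + ε) * (1 - av (fun p => ind (∀ i, Sum.elim (fillStar i (V p)) y ∈ A))) + ε := fun y => by
    have hfree' : ∀ l : Line (Option α) ι₁, ∃ i, l i ∉ {x | Sum.elim x y ∈ A} := fun l => by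
      obtain ⟨i, hi⟩ := hfree (l.horizontal y)
      rw [Line.horizontal_apply] at hi
      exact ⟨i, hi⟩
    rcases le_or_gt (δ₀ + ε) 1 with hc1 | hc1
    · have := Hκ (fun i => {p | Sum.elim (fillStar i (V p)) y ∈ A})
        (fun i => (insens_fillStar i {x | Sum.elim x y ∈ A}).preimage V)
        (fun p => ind (Sum.elim (V p) y ∈ A)) (fun _ => ind_nonneg _) (fun _ => ind_le_one _)
        (δ₀ + ε) (by positivity) hc1 fun W => by
          by_contra! hc
          obtain ⟨l, hl⟩ := Hη {q | Sum.elim (V (W q)) y ∈ A} hc.le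
          obtain ⟨i, hi⟩ := hfree' (Subspace.compLine (Subspace.comp V W) l)
          rw [Subspace.compLine_apply, Subspace.comp_apply] at hi
          exact hi (hl i)
      refine le_trans (le_of_eq ?_) this
      refine av_congr fun p => ?_
      by_cases hp : Sum.elim (V p) y ∈ A
      · obtain ⟨i, hi⟩ := exists_fillStar_notMem hfree' (V p)
          ⟨e, Subspace.apply_inl he⟩ hp
        rw [ind_true hp, ind_false fun hall => hi (hall i)]
        norm_num
      · rw [ind_false hp, mul_zero]
    · have h1 : av (fun p => ind (Sum.elim (V p) y ∈ A)) ≤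
          1 - av (fun p => ind (∀ i, Sum.elim (fillStar i (V p)) y ∈ A)) := by
        rw [le_sub_iff_add_le, ← av_add]
        refine av_le fun p => ?_
        by_cases hp : Sum.elim (V p) y ∈ A
        · obtain ⟨i, hi⟩ := exists_fillStar_notMem hfree' (V p)
            ⟨e, Subspace.apply_inl he⟩ hp
          rw [ind_true hp, ind_false fun hall => hi (hall i)]
          norm_num
        · rw [ind_false hp, zero_add]; exact ind_le_one _
      have h2 : av (fun p => ind (∀ i, Sum.elim (fillStar i (V p)) y ∈ A)) ≤ 1 := av_ind_le_one
      nlinarith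
  have h1 : δ₀ - ε ≤ av fun y => av fun p => ind (Sum.elim (V p) y ∈ A) := by
    rw [av_comm]
    exact le_av fun p => hlow _
  have h2 : θ ≤ av fun y => av fun p => ind (∀ i, Sum.elim (fillStar i (V p)) y ∈ A) := by
    rw [av_comm]
    exact le_av fun p => hV p
  have h3 := av_mono hline
  rw [av_add, av_mul_left, av_sub, av_const, av_const] at h3
  nlinarith

/-- The density Hales–Jewett theorem. -/
theorem DHJ.all (α : Type) [Finite α] : DHJ α := by
  classical
  induction α using Finite.induction_empty_option with
  | of_equiv e ih => exact ih.of_equiv e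
  | h_empty =>
    intro δ _
    exact ⟨Unit, inferInstance, fun A _ => ⟨default, fun i => i.elim⟩⟩
  | h_option ih =>
    rename_i α _
    rcases isEmpty_or_nonempty α with he | hne
    · intro δ hδ
      refine ⟨Unit, inferInstance, fun A hA => ?_⟩
      obtain ⟨x, hx⟩ := one_le_of_av_ind hδ hA
      refine ⟨default, fun i => ?_⟩
      convert hx
      exact funext fun _ => Subsingleton.elim _ _
    · exact ih.option

end DensityHalesJewett

section Averages

variable {X Y : Type*}

lemma av_add_right [AddGroup X] (a : X) (f : X → ℝ) : av (fun x => f (x + a)) = av f :=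
  av_comp_equiv (Equiv.addRight a) f

lemma av_add_left [AddGroup X] (a : X) (f : X → ℝ) : av (fun x => f (a + x)) = av f :=
  av_comp_equiv (Equiv.addLeft a) f

lemma av_mul_unit {T : Type*} [Field T] {a : T} (ha : a ≠ 0) (f : T → ℝ) :
    av (fun x => f (x * a)) = av f :=
  av_comp_equiv (Equiv.mulRight₀ a ha) f

/-- Resampling one coordinate does not change an average. -/
lemma av_update {ι : Type*} [DecidableEq ι] {T : ι → Type*} [Finite ι] [∀ i, Finite (T i)]
    [∀ i, Nonempty (T i)] (a : ι) (f : (∀ i, T i) → ℝ) :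
    av (fun y => av fun t => f (Function.update y a t)) = av f := by
  have h1 := av_comp_equiv (Equiv.piSplitAt a T).symm f
  have h2 := av_comp_equiv (Equiv.piSplitAt a T).symm
    (fun y => av fun t => f (Function.update y a t))
  rw [← h1, ← h2, av_prod, av_prod]
  have key : ∀ (x t : T a) (y : ∀ j : { j // j ≠ a }, T j),
      Function.update ((Equiv.piSplitAt a T).symm (x, y)) a t = (Equiv.piSplitAt a T).symm (t, y) := by
    intro x t y
    funext i
    by_cases h : i = a
    · subst h; simp [Equiv.piSplitAt]
    · simp [h, Equiv.piSplitAt]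
  simp only [key]
  rw [av_const, av_comm]

end Averages

section DenseSzemeredi

/-- Multidimensional Szemerédi theorem in a vector space over a finite field whose
characteristic is large. -/
theorem dense_szemeredi (J : Type) [Fintype J] [Nonempty J] {δ : ℝ} (hδ : 0 < δ) :
    ∃ c : ℝ, 0 < c ∧ ∃ N₀ : ℕ, ∀ (T Z : Type) [Field T] [Finite T] [AddCommGroup Z] [Finite Z]
      [Module T Z], (∀ m : ℕ, 0 < m → m ≤ N₀ → (m : T) ≠ 0) → ∀ (s : J → Z) (f : Z → ℝ),
      (∀ x, 0 ≤ f x) → (∀ x, f x ≤ 1) → δ ≤ av f →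
      c ≤ av fun z => av fun k : T => ∏ j, f (z + k • s j) := by
  classical
  obtain ⟨ι, hι, θ, hθ, H⟩ := (DHJ.all J).measure (δ := δ / 2) (by positivity)
  have := Fintype.ofFinite ι
  refine ⟨(δ / 2) ^ Fintype.card J * (θ / (Nat.card (Line J ι) + 1)), by positivity,
    Fintype.card ι, ?_⟩
  intro T Z _ _ _ _ _ hT s f hf0 hf1 hf
  have hE : δ / 2 ≤ av fun z => ind (δ / 2 ≤ f z) := le_av_ind hf1 (by positivity) (by linarith)
  have h1 : ∀ k : T, ∃ l : Line J ι,
      θ ≤ av fun z => ind (∀ j, δ / 2 ≤ f (z + k • ∑ i, s (l j i))) := fun k =>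
    H (fun t z => δ / 2 ≤ f (z + k • ∑ i, s (t i))) (le_av fun t => by
      rw [av_add_right (k • ∑ i, s (t i)) fun z => ind (δ / 2 ≤ f z)]
      exact hE)
  have h2 : ∃ l : Line J ι, θ / (Nat.card (Line J ι) + 1) ≤
      av fun k : T => av fun z => ind (∀ j, δ / 2 ≤ f (z + k • ∑ i, s (l j i))) := by
    have := Fintype.ofFinite (Line J ι)
    by_contra! hc
    have h3 : θ ≤ ∑ l : Line J ι,
        av fun k : T => av fun z => ind (∀ j, δ / 2 ≤ f (z + k • ∑ i, s (l j i))) := by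
      rw [← av_sum]
      refine le_av fun k => ?_
      obtain ⟨l, hl⟩ := h1 k
      exact hl.trans (single_le_sum (f := fun l : Line J ι =>
        av fun z => ind (∀ j, δ / 2 ≤ f (z + k • ∑ i, s (l j i))))
        (fun i _ => av_nonneg fun _ => ind_nonneg _) (mem_univ l))
    have h4 := h3.trans (sum_le_sum fun l _ => (hc l).le)
    rw [sum_const, card_univ, nsmul_eq_mul, ← Nat.card_eq_fintype_card, mul_div_assoc',
      le_div_iff₀ (by positivity)] at h4
    nlinarith
  obtain ⟨l, hl⟩ := h2
  set W := univ.filter fun i => l.idxFun i = none with hW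
  set u := ∑ i ∈ univ.filter (fun i => ¬ l.idxFun i = none),
    s (l (Classical.arbitrary J) i) with hu
  have hsum : ∀ j, ∑ i, s (l j i) = u + (#W : T) • s j := fun j => by
    rw [← sum_filter_add_sum_filter_not univ (fun i => l.idxFun i = none), add_comm]
    congr 1
    · refine sum_congr rfl fun i hi => ?_
      obtain ⟨a, ha⟩ := Option.ne_none_iff_exists'.mp (mem_filter.mp hi).2
      rw [Line.apply_some ha, Line.apply_some ha]
    · rw [Nat.cast_smul_eq_nsmul, ← sum_const]
      refine sum_congr rfl fun i hi => ?_
      rw [Line.apply_none l j i (mem_filter.mp hi).2]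
  have hW0 : 0 < #W := by
    obtain ⟨i, hi⟩ := l.proper
    exact card_pos.mpr ⟨i, by simp [hW, hi]⟩
  have hunit := hT _ hW0 (card_le_univ W)
  have h5 : av (fun k : T => av fun z => ind (∀ j, δ / 2 ≤ f (z + k • ∑ i, s (l j i)))) =
      av fun k : T => av fun z => ind (∀ j, δ / 2 ≤ f (z + k • s j)) := by
    rw [← av_mul_unit hunit fun k => av fun z => ind (∀ j, δ / 2 ≤ f (z + k • s j))]
    refine av_congr fun k => ?_
    refine Eq.trans ?_ (av_add_right (k • u) fun z => ind (∀ j, δ / 2 ≤ f (z + (k * #W) • s j)))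
    refine av_congr fun z => ind_congr (forall_congr' fun j => ?_)
    rw [hsum, smul_add, smul_smul, add_assoc]
  rw [h5, av_comm] at hl
  calc _ ≤ (δ / 2) ^ Fintype.card J *
        av fun z => av fun k : T => ind (∀ j, δ / 2 ≤ f (z + k • s j)) := by gcongr
    _ ≤ _ := by
      rw [← av_mul_left]
      refine av_mono fun z => ?_
      rw [← av_mul_left]
      refine av_mono fun k => ?_
      by_cases h : ∀ j, δ / 2 ≤ f (z + k • s j)
      · rw [ind_true h, mul_one]
        calc (δ / 2) ^ Fintype.card J = ∏ _j : J, δ / 2 := (prod_const _).symm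
          _ ≤ _ := prod_le_prod (fun _ _ => by positivity) fun j _ => h j
      · rw [ind_false h, mul_zero]
        exact prod_nonneg fun j _ => hf0 _

end DenseSzemeredi

section DenseModel

/-- The closed convex hull of a multiplicative family of functions. -/
lemma mul_mem_closedConvexHull {X : Type*} {F : Set (X → ℝ)}
    (hmul : ∀ f ∈ F, ∀ g ∈ F, f * g ∈ closedConvexHull ℝ F) {f g : X → ℝ}
    (hf : f ∈ closedConvexHull ℝ F) (hg : g ∈ closedConvexHull ℝ F) :
    f * g ∈ closedConvexHull ℝ F := by
  have hstep : ∀ h : X → ℝ, (∀ k ∈ F, h * k ∈ closedConvexHull ℝ F) →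
      ∀ k ∈ closedConvexHull ℝ F, h * k ∈ closedConvexHull ℝ F := fun h hh => by
    have hsub : closedConvexHull ℝ F ⊆ (LinearMap.mulLeft ℝ h) ⁻¹' closedConvexHull ℝ F := by
      refine closedConvexHull_min hh (convex_closedConvexHull.linear_preimage _)
        (isClosed_closedConvexHull.preimage ?_)
      exact continuous_const.mul continuous_id
    exact fun k hk => hsub hk
  refine hstep f (fun k hk => ?_) g hg
  rw [mul_comm]
  exact hstep k (hmul k hk) f hf

lemma continuous_av {X Y : Type*} [Finite X] [TopologicalSpace Y] {f : Y → X → ℝ}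
    (hf : Continuous f) : Continuous fun y => av (f y) := by
  have := Fintype.ofFinite X
  simp only [av_eq]
  fun_prop

open Polynomial in
lemma exists_polynomial_near_posPart {ε : ℝ} (hε : 0 < ε) :
    ∃ P : ℝ[X], ∀ x ∈ Set.Icc (-1 : ℝ) 1, |P.eval x - max x 0| < ε := by
  obtain ⟨P, hP⟩ := exists_polynomial_near_of_continuousOn (-1) 1 (fun x => max x 0)
    (by fun_prop) ε hε
  exact ⟨P, hP⟩

lemma exists_saddlePoint {E : Type*} [TopologicalSpace E] [AddCommGroup E] [Module ℝ E]
    [IsTopologicalAddGroup E] [ContinuousSMul ℝ E] {A B : Set E} (hA : IsCompact A)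
    (hB : IsCompact B) (hA0 : A.Nonempty) (hB0 : B.Nonempty) (f : E → E → ℝ)
    (hcA : ∀ y ∈ B, Continuous fun x => f x y) (hcB : ∀ x ∈ A, Continuous (f x))
    (hfA : ∀ y ∈ B, ConvexOn ℝ A fun x => f x y) (hfB : ∀ x ∈ A, ConcaveOn ℝ B (f x)) :
    ∃ a ∈ A, ∃ b ∈ B, ∀ x ∈ A, ∀ y ∈ B, f a y ≤ f x b := by
  obtain ⟨x, hx⟩ := hA0
  obtain ⟨y, hy⟩ := hB0
  exact Sion.exists_isSaddlePointOn ⟨x, hx⟩ (hfA y hy).1 hA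
    (fun y hy => (hcA y hy).lowerSemicontinuous.lowerSemicontinuousOn _)
    (fun y hy => (hfA y hy).quasiconvexOn) (hfB x hx).1 ⟨y, hy⟩ hB
    (fun x hx => (hcB x hx).upperSemicontinuous.upperSemicontinuousOn _)
    (fun x hx => (hfB x hx).quasiconcaveOn)

/-- The dense model theorem. -/
theorem dense_model {ε : ℝ} (hε : 0 < ε) : ∃ ε' : ℝ, 0 < ε' ∧ ∀ (X : Type) [Finite X]
    [Nonempty X] (ν f : X → ℝ) (F : Set (X → ℝ)), (∀ x, 0 ≤ f x) → (∀ x, f x ≤ ν x) →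
    (∀ g ∈ F, ∀ x, |g x| ≤ 1) → 1 ∈ F → (∀ g ∈ F, -g ∈ F) →
    (∀ g ∈ F, ∀ h ∈ F, g * h ∈ closedConvexHull ℝ F) →
    (∀ g ∈ F, |av fun x => (ν x - 1) * g x| ≤ ε') →
    ∃ f' : X → ℝ, (∀ x, 0 ≤ f' x) ∧ (∀ x, f' x ≤ 1) ∧
      ∀ g ∈ F, |av fun x => (f x - f' x) * g x| ≤ ε := by
  obtain ⟨P, hP⟩ := exists_polynomial_near_posPart (ε := ε / 8) (by positivity)
  set M : ℝ := ∑ i ∈ range (P.natDegree + 1), |P.coeff i| with hM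
  have hM0 : 0 ≤ M := sum_nonneg fun i _ => abs_nonneg _
  refine ⟨min 1 (ε / (4 * (M + 1))), by positivity, ?_⟩
  intro X _ _ ν f F hf0 hfν hF1 h1F hneg hmul hν
  set C := closedConvexHull ℝ F with hC
  have hFC : F ⊆ C := subset_closedConvexHull
  have hconv : Convex ℝ C := convex_closedConvexHull
  have hlin : ∀ w : X → ℝ, IsLinearMap ℝ fun g : X → ℝ => av fun x => w x * g x := fun w =>
    { map_add := fun g h => by simp only [Pi.add_apply, mul_add, av_add]
      map_smul := fun a g => by
        simp only [Pi.smul_apply, smul_eq_mul]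
        rw [← av_mul_left]
        exact av_congr fun x => by ring }
  have hcont : ∀ w : X → ℝ, Continuous fun g : X → ℝ => av fun x => w x * g x := fun w =>
    continuous_av (by fun_prop)
  have hC1 : ∀ g ∈ C, ∀ x, |g x| ≤ 1 := by
    have : C ⊆ Set.Icc (-1) 1 := closedConvexHull_min
      (fun g hg => ⟨fun x => (abs_le.mp (hF1 g hg x)).1, fun x => (abs_le.mp (hF1 g hg x)).2⟩)
      (convex_Icc _ _) isClosed_Icc
    exact fun g hg x => abs_le.mpr ⟨(this hg).1 x, (this hg).2 x⟩
  have hνC : ∀ g ∈ C, |av fun x => (ν x - 1) * g x| ≤ min 1 (ε / (4 * (M + 1))) := by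
    have : C ⊆ (fun g : X → ℝ => av fun x => (ν x - 1) * g x) ⁻¹'
        Set.Icc (-min 1 (ε / (4 * (M + 1)))) (min 1 (ε / (4 * (M + 1)))) :=
      closedConvexHull_min (fun g hg => abs_le.mp (hν g hg))
      ((convex_Icc _ _).is_linear_preimage (hlin _)) (isClosed_Icc.preimage (hcont _))
    exact fun g hg => abs_le.mpr (this hg)
  have hpowC : ∀ g ∈ C, ∀ k : ℕ, g ^ k ∈ C := fun g hg k => by
    induction k with
    | zero => rw [pow_zero]; exact hFC h1F
    | succ k ih => rw [pow_succ]; exact mul_mem_closedConvexHull hmul ih hg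
  have hcompC : IsCompact C :=
    (isCompact_Icc (a := (-1 : X → ℝ)) (b := 1)).of_isClosed_subset isClosed_closedConvexHull
      fun g hg => ⟨fun x => (abs_le.mp (hC1 g hg x)).1, fun x => (abs_le.mp (hC1 g hg x)).2⟩
  clear_value C
  have hcd : ∀ g : X → ℝ, Continuous fun h : X → ℝ => av fun x => (f x - h x) * g x :=
    fun g => continuous_av (by fun_prop)
  have hadd : ∀ g h h' : X → ℝ, ∀ p q : ℝ, p + q = 1 →
      (av fun x => (f x - (p • h + q • h') x) * g x) =
        p * (av fun x => (f x - h x) * g x) + q * (av fun x => (f x - h' x) * g x) := by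
    intro g h h' p q hpq
    rw [← av_mul_left, ← av_mul_left, ← av_add]
    refine av_congr fun x => ?_
    simp only [Pi.add_apply, Pi.smul_apply, smul_eq_mul]
    linear_combination (- f x * g x) * hpq
  have hcx : ∀ g ∈ C, ConvexOn ℝ (Set.Icc (0 : X → ℝ) 1)
      fun h : X → ℝ => av fun x => (f x - h x) * g x := fun g _ =>
    ⟨convex_Icc _ _, fun h _ h' _ p q _ _ hpq => (hadd g h h' p q hpq).le⟩
  have hcv : ∀ h ∈ Set.Icc (0 : X → ℝ) 1, ConcaveOn ℝ C
      fun g : X → ℝ => av fun x => (f x - h x) * g x := fun h _ =>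
    (IsLinearMap.mk' _ (hlin fun x => f x - h x)).concaveOn hconv
  have hI : IsCompact (Set.Icc (0 : X → ℝ) 1) := isCompact_Icc
  have hI0 : (Set.Icc (0 : X → ℝ) 1).Nonempty := ⟨0, by simp⟩
  have hC0 : C.Nonempty := ⟨1, hFC h1F⟩
  have hmin := exists_saddlePoint hI hcompC hI0 hC0
    (fun h g : X → ℝ => av fun x => (f x - h x) * g x) (fun g _ => hcd g)
    (fun h _ => hcont fun x => f x - h x) hcx hcv
  obtain ⟨a, ha, b, hb, hab⟩ := hmin
  have hsmall : (av fun x => (f x - a x) * b x) ≤ ε := by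
    have hb1 := hC1 b hb
    by_contra! hlt
    have h1 := hab (fun x => ind (0 ≤ b x))
      ⟨fun x => ind_nonneg _, fun x => ind_le_one _⟩ b hb
    have hpos : ∀ x, ind (0 ≤ b x) * b x = max (b x) 0 := fun x => by
      rcases le_or_gt 0 (b x) with h | h
      · rw [ind_true h, one_mul, max_eq_left h]
      · rw [ind_false h.not_ge, zero_mul, max_eq_right h.le]
    have h2 : av (fun x => (ν x - 1) * P.eval (b x)) ≤ ε / 4 := by
      have : ∀ x, (ν x - 1) * P.eval (b x) =
          ∑ i ∈ range (P.natDegree + 1), P.coeff i * ((ν x - 1) * (b ^ i) x) := fun x => by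
        rw [Polynomial.eval_eq_sum_range, mul_sum]
        exact sum_congr rfl fun i _ => by rw [Pi.pow_apply]; ring
      rw [av_congr this, av_sum]
      calc _ ≤ ∑ i ∈ range (P.natDegree + 1), |P.coeff i| * (ε / (4 * (M + 1))) := by
            refine sum_le_sum fun i _ => ?_
            rw [av_mul_left]
            refine (le_abs_self _).trans ?_
            rw [abs_mul]
            gcongr
            exact (hνC _ (hpowC b hb i)).trans (min_le_right _ _)
        _ = M / (M + 1) * (ε / 4) := by rw [← sum_mul, ← hM]; field_simp
        _ ≤ 1 * (ε / 4) := by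
            gcongr
            rw [div_le_one (by positivity)]
            linarith
        _ = ε / 4 := one_mul _
    have h3 : av (fun x => ν x - 1) ≤ 1 := by
      have := (le_abs_self _).trans ((hνC 1 (hFC h1F)).trans (min_le_left _ _))
      simpa using this
    have h4 : ∀ x, (f x - ind (0 ≤ b x)) * b x ≤
        (ν x - 1) * P.eval (b x) + (ν x - 1) * (ε / 8) + ε / 4 := fun x => by
      have hP' := hP (b x) (abs_le.mp (hb1 x))
      have h5 : f x * b x ≤ ν x * max (b x) 0 := by
        calc f x * b x ≤ f x * max (b x) 0 := by gcongr; exacts [hf0 x, le_max_left _ _]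
          _ ≤ _ := by gcongr; exact hfν x
      rw [sub_mul, hpos]
      have h6 := abs_lt.mp hP'
      have h7 := (hf0 x).trans (hfν x)
      nlinarith
    have h5 := av_mono h4
    rw [av_add, av_add, av_const, av_mul_right] at h5
    nlinarith
  refine ⟨a, ha.1, ha.2, fun g hg => abs_le.mpr ⟨?_, ?_⟩⟩
  · have h1 := hab a ha _ (hFC (hneg g hg))
    have h2 : (av fun x => (f x - a x) * (-g) x) = - av fun x => (f x - a x) * g x := by
      rw [← av_neg]
      exact av_congr fun x => by simp
    linarith
  · exact (hab a ha _ (hFC hg)).trans hsmall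

end DenseModel

end Constellation

namespace Constellation

open Finset Function

section WeightedCauchySchwarz

lemma av_mul_sq_le_of_abs_le {X : Type*} [Finite X] {W B : X → ℝ} (h : ∀ x, |W x| ≤ B x)
    (G : X → ℝ) : av (fun x => W x * G x) ^ 2 ≤ av B * av fun x => B x * G x ^ 2 := by
  have hB : ∀ x, 0 ≤ B x := fun x => (abs_nonneg _).trans (h x)
  have h1 := av_mul_mul_sq_le hB (fun _ => 1) fun x => |G x|
  simp only [mul_one, one_pow, sq_abs] at h1
  refine le_trans ?_ h1
  rw [← sq_abs (av fun x => W x * G x)]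
  gcongr
  refine (abs_av_le _).trans (av_mono fun x => ?_)
  rw [abs_mul]
  gcongr
  exact h x

end WeightedCauchySchwarz

section Box

variable {X D T : Type} [Fintype D] [DecidableEq D]

/-- The point of a discrete box selected by a vertex of the cube. -/
def sel (Y : D × Bool → T) (A : Finset D) : D → T := fun d => Y (d, decide (d ∈ A))

omit [Fintype D] in
lemma sel_update_true {Y : D × Bool → T} {d : D} {A : Finset D} (h : d ∉ A) (t : T) :
    sel (update Y (d, true) t) A = sel Y A := by
  funext e
  rw [sel, sel, update_of_ne]
  rintro h'
  obtain ⟨rfl, h2⟩ := Prod.mk.inj h'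
  simp [h] at h2

omit [Fintype D] in
lemma sel_update_false {Y : D × Bool → T} {d : D} {A : Finset D} (h : d ∉ A) (t : T) :
    sel (update Y (d, false) t) A = update (sel Y A) d t := by
  funext e
  by_cases he : e = d
  · subst he; simp [sel, h]
  · simp [sel, he]

omit [Fintype D] in
lemma sel_insert (Y : D × Bool → T) (d : D) (A : Finset D) :
    sel Y (insert d A) = update (sel Y A) d (Y (d, true)) := by
  funext e
  by_cases he : e = d
  · subst he; simp [sel]
  · simp [sel, he]

omit [Fintype D] in
lemma sel_update_update {Y : D × Bool → T} {d : D} {A : Finset D} (h : d ∉ A) (t t' : T) :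
    sel (update (update Y (d, false) t) (d, true) t') A = update (sel Y A) d t := by
  rw [sel_update_true h, sel_update_false h]

omit [Fintype D] in
lemma prod_powerset_insert_sel {Y : D × Bool → T} {d : D} {R : Finset D} (hR : d ∉ R)
    (φ : (D → T) → ℝ) (t t' : T) :
    ∏ A ∈ (insert d R).powerset, φ (sel (update (update Y (d, false) t) (d, true) t') A) =
      (∏ A ∈ R.powerset, φ (update (sel Y A) d t)) *
        ∏ A ∈ R.powerset, φ (update (sel Y A) d t') := by
  rw [prod_powerset_insert hR]
  congr 1 <;> refine prod_congr rfl fun A hA => ?_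
  · rw [sel_update_update fun h => hR (mem_powerset.mp hA h)]
  · rw [sel_insert, sel_update_update fun h => hR (mem_powerset.mp hA h), update_idem, update_self]

/-- The intermediate forms in the iterated Cauchy–Schwarz inequality for box norms. -/
noncomputable def boxForm (h : X → (D → T) → ℝ) (b u : D → X → (D → T) → ℝ) (S : Finset D) : ℝ :=
  av fun x => av fun Y : D × Bool → T =>
    (∏ A ∈ S.powerset, h x (sel Y A)) *
      (∏ d ∈ S, ∏ A ∈ (S.erase d).powerset, b d x (sel Y A)) *
      ∏ d ∈ Sᶜ, ∏ A ∈ S.powerset, u d x (sel Y A)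

variable [Finite X] [Finite T] [Nonempty T]

lemma boxForm_sq_le {h : X → (D → T) → ℝ} {b u : D → X → (D → T) → ℝ} {S : Finset D} {d₀ : D}
    (hd : d₀ ∉ S) (hub : ∀ x y, |u d₀ x y| ≤ b d₀ x y)
    (hbi : ∀ x y t, b d₀ x (update y d₀ t) = b d₀ x y)
    (hui : ∀ x y t, u d₀ x (update y d₀ t) = u d₀ x y) :
    boxForm h b u S ^ 2 ≤
      (av fun x => av fun Y : D × Bool → T => ∏ A ∈ S.powerset, b d₀ x (sel Y A)) *
        boxForm h b u (insert d₀ S) := by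
  set P : X → (D × Bool → T) → T → ℝ := fun x Y t =>
    (∏ A ∈ S.powerset, h x (update (sel Y A) d₀ t)) *
      (∏ d ∈ S, ∏ A ∈ (S.erase d).powerset, b d x (update (sel Y A) d₀ t)) *
      ∏ d ∈ (insert d₀ S)ᶜ, ∏ A ∈ S.powerset, u d x (update (sel Y A) d₀ t) with hP
  set W : X → (D × Bool → T) → ℝ := fun x Y => ∏ A ∈ S.powerset, u d₀ x (sel Y A) with hW
  set B : X → (D × Bool → T) → ℝ := fun x Y => ∏ A ∈ S.powerset, b d₀ x (sel Y A) with hB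
  have hmem : ∀ {A}, A ∈ S.powerset → d₀ ∉ A := fun hA h => hd (mem_powerset.mp hA h)
  have hmem' : ∀ {d A}, A ∈ (S.erase d).powerset → d₀ ∉ A := fun hA h =>
    hd (mem_of_mem_erase (mem_powerset.mp hA h))
  have h1 : boxForm h b u S = av fun x => av fun Y => W x Y * av fun t => P x Y t := by
    refine av_congr fun x => ?_
    rw [← av_update (d₀, false)]
    refine av_congr fun Y => ?_
    rw [← av_mul_left]
    refine av_congr fun t => ?_
    have hc : Sᶜ = insert d₀ (insert d₀ S)ᶜ := by
      ext a; by_cases ha : a = d₀ <;> simp [ha, hd]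
    rw [hc, prod_insert (by simp)]
    have e1 : ∀ A ∈ S.powerset, sel (update Y (d₀, false) t) A = update (sel Y A) d₀ t :=
      fun A hA => sel_update_false (hmem hA) t
    have e2 : ∏ A ∈ S.powerset, h x (sel (update Y (d₀, false) t) A) =
        ∏ A ∈ S.powerset, h x (update (sel Y A) d₀ t) :=
      prod_congr rfl fun A hA => by rw [e1 A hA]
    have e3 : ∏ d ∈ S, ∏ A ∈ (S.erase d).powerset, b d x (sel (update Y (d₀, false) t) A) =
        ∏ d ∈ S, ∏ A ∈ (S.erase d).powerset, b d x (update (sel Y A) d₀ t) :=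
      prod_congr rfl fun d _ => prod_congr rfl fun A hA => by
        rw [sel_update_false (hmem' hA)]
    have e4 : ∏ A ∈ S.powerset, u d₀ x (sel (update Y (d₀, false) t) A) = W x Y :=
      prod_congr rfl fun A hA => by rw [e1 A hA, hui]
    have e5 : ∏ d ∈ (insert d₀ S)ᶜ, ∏ A ∈ S.powerset, u d x (sel (update Y (d₀, false) t) A) =
        ∏ d ∈ (insert d₀ S)ᶜ, ∏ A ∈ S.powerset, u d x (update (sel Y A) d₀ t) :=
      prod_congr rfl fun d _ => prod_congr rfl fun A hA => by rw [e1 A hA]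
    rw [e2, e3, e4, e5]
    ring
  have h2 : boxForm h b u (insert d₀ S) =
      av fun x => av fun Y => B x Y * (av fun t => P x Y t) ^ 2 := by
    refine av_congr fun x => ?_
    rw [← av_update (d₀, true), av_comm, ← av_comm]
    rw [← av_update (d₀, false)]
    refine av_congr fun Y => ?_
    rw [av_pow_two_mul, ← av_mul_left]
    refine av_congr fun t => ?_
    rw [← av_mul_left]
    refine av_congr fun t' => ?_
    have hpow := fun (R : Finset D) (φ : (D → T) → ℝ) (hR : d₀ ∉ R) =>
      prod_powerset_insert_sel (Y := Y) hR φ t t'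
    rw [hpow S (h x) hd, prod_insert hd, erase_insert hd]
    have e3 : ∏ A ∈ S.powerset, b d₀ x
        (sel (update (update Y (d₀, false) t) (d₀, true) t') A) = B x Y :=
      prod_congr rfl fun A hA => by rw [sel_update_update (hmem hA), hbi]
    have e4 : ∏ d ∈ S, ∏ A ∈ ((insert d₀ S).erase d).powerset,
          b d x (sel (update (update Y (d₀, false) t) (d₀, true) t') A) =
        (∏ d ∈ S, ∏ A ∈ (S.erase d).powerset, b d x (update (sel Y A) d₀ t)) *
          ∏ d ∈ S, ∏ A ∈ (S.erase d).powerset, b d x (update (sel Y A) d₀ t') := by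
      rw [← prod_mul_distrib]
      refine prod_congr rfl fun d hdS => ?_
      rw [erase_insert_of_ne (by rintro rfl; exact hd hdS)]
      exact hpow _ (b d x) fun h => hd (mem_of_mem_erase h)
    have e5 : ∏ d ∈ (insert d₀ S)ᶜ, ∏ A ∈ (insert d₀ S).powerset,
          u d x (sel (update (update Y (d₀, false) t) (d₀, true) t') A) =
        (∏ d ∈ (insert d₀ S)ᶜ, ∏ A ∈ S.powerset, u d x (update (sel Y A) d₀ t)) *
          ∏ d ∈ (insert d₀ S)ᶜ, ∏ A ∈ S.powerset, u d x (update (sel Y A) d₀ t') := by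
      rw [← prod_mul_distrib]
      exact prod_congr rfl fun d _ => hpow S (u d x) hd
    rw [e3, e4, e5]
    simp only [hP]
    ring
  rw [h1, h2, ← av_prod fun p : X × (D × Bool → T) => W p.1 p.2 * av fun t => P p.1 p.2 t,
    ← av_prod fun p : X × (D × Bool → T) => B p.1 p.2 * (av fun t => P p.1 p.2 t) ^ 2,
    ← av_prod fun p : X × (D × Bool → T) => B p.1 p.2]
  refine av_mul_sq_le_of_abs_le (fun p => ?_) _
  simp only [hW, hB, abs_prod]
  exact prod_le_prod (fun _ _ => abs_nonneg _) fun A _ => hub _ _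

/-- Iterated Cauchy–Schwarz inequality for box norms. -/
lemma abs_boxForm_pow_le {h : X → (D → T) → ℝ} {b u : D → X → (D → T) → ℝ} {S : Finset D}
    (hub : ∀ d ∈ S, ∀ x y, |u d x y| ≤ b d x y)
    (hbi : ∀ d ∈ S, ∀ x y t, b d x (update y d t) = b d x y)
    (hui : ∀ d ∈ S, ∀ x y t, u d x (update y d t) = u d x y)
    (h2 : ∀ R ⊆ S, ∀ d ∈ S, d ∉ R →
      (av fun x => av fun Y : D × Bool → T => ∏ A ∈ R.powerset, b d x (sel Y A)) ≤ 2) :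
    ∀ R ⊆ S, (|boxForm h b u ∅| / 2) ^ 2 ^ #R ≤ |boxForm h b u R| / 2 := by
  intro R
  induction R using Finset.induction_on with
  | empty => intro _; simp
  | insert d R hd ih =>
    intro hR
    have hdS := hR (mem_insert_self _ _)
    have hRS := (subset_insert _ _).trans hR
    have h1 := boxForm_sq_le (h := h) hd (hub d hdS) (hbi d hdS) (hui d hdS)
    rw [card_insert_of_notMem hd, pow_succ, pow_mul]
    calc ((|boxForm h b u ∅| / 2) ^ 2 ^ #R) ^ 2 ≤ (|boxForm h b u R| / 2) ^ 2 := by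
          gcongr; exact ih hRS
      _ = boxForm h b u R ^ 2 / 4 := by rw [div_pow, sq_abs]; norm_num
      _ ≤ (2 * |boxForm h b u (insert d R)|) / 4 := by
          gcongr
          refine h1.trans ?_
          calc _ ≤ _ := mul_le_mul_of_nonneg_left (le_abs_self _) (av_nonneg fun x =>
                av_nonneg fun Y => prod_nonneg fun A _ => (abs_nonneg _).trans (hub d hdS _ _))
            _ ≤ _ := by gcongr; exact h2 R hRS d hdS hd
      _ = _ := by ring

end Box

section LinearForms

variable {Ω ι : Type*} [Finite Ω]

/-- A family of functions all of whose product averages are close to one. -/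
def NearOne (φ : ι → Ω → ℝ) (B : Finset ι) (ε : ℝ) : Prop :=
  ∀ C ⊆ B, |(av fun ω => ∏ a ∈ C, φ a ω) - 1| ≤ ε

omit [Finite Ω] in
lemma NearOne.weaken {φ : ι → Ω → ℝ} {B : Finset ι} {ε ε' : ℝ} (h : NearOne φ B ε) (hε : ε ≤ ε') :
    NearOne φ B ε' := fun C hC => (h C hC).trans hε

lemma NearOne.abs_av_prod_sub_one_mul_le [DecidableEq ι] {φ : ι → Ω → ℝ} {B : Finset ι} {ε : ℝ}
    (h : NearOne φ B ε) : ∀ {A C : Finset ι}, A.Nonempty → Disjoint A C → A ⊆ B → C ⊆ B →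
    |av fun ω => (∏ a ∈ A, (φ a ω - 1)) * ∏ a ∈ C, φ a ω| ≤ 2 ^ #A * ε := by
  intro A C hA hAC hAB hCB
  induction hA using Finset.Nonempty.cons_induction generalizing C with
  | singleton a =>
    have haC : a ∉ C := by simpa using hAC
    have e : ∀ ω, (∏ x ∈ {a}, (φ x ω - 1)) * ∏ x ∈ C, φ x ω =
        ∏ x ∈ insert a C, φ x ω - ∏ x ∈ C, φ x ω := fun ω => by
      rw [prod_singleton, prod_insert haC]; ring
    rw [av_congr e, av_sub]
    have h1 := abs_le.mp (h (insert a C) (insert_subset (hAB (by simp)) hCB))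
    have h2 := abs_le.mp (h C hCB)
    rw [abs_le, card_singleton]
    constructor <;> linarith
  | cons a A ha hA ih =>
    have hAC' := disjoint_left.mp hAC
    have haC : a ∉ C := hAC' (mem_cons_self _ _)
    have hAB' : A ⊆ B := (subset_cons ha).trans hAB
    have e : ∀ ω, (∏ x ∈ cons a A ha, (φ x ω - 1)) * ∏ x ∈ C, φ x ω =
        (∏ x ∈ A, (φ x ω - 1)) * ∏ x ∈ insert a C, φ x ω -
          (∏ x ∈ A, (φ x ω - 1)) * ∏ x ∈ C, φ x ω := fun ω => by
      rw [prod_cons, prod_insert haC]; ring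
    rw [av_congr e, av_sub, card_cons, pow_succ]
    have h1 := ih (C := insert a C) (disjoint_insert_right.mpr ⟨ha, disjoint_left.mpr fun x hx =>
      hAC' (mem_cons_of_mem hx)⟩) hAB' (insert_subset (hAB (mem_cons_self _ _)) hCB)
    have h2 := ih (C := C) (disjoint_left.mpr fun x hx => hAC' (mem_cons_of_mem hx)) hAB' hCB
    rw [abs_le] at h1 h2 ⊢
    constructor <;> linarith

lemma NearOne.mix {φ : ι → Ω → ℝ} {B : Finset ι} {ε : ℝ} (h : NearOne φ B ε) :
    NearOne (fun a ω => (φ a ω + 1) / 2) B ε := by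
  intro C hC
  have e : ∀ ω, ∏ a ∈ C, (φ a ω + 1) / 2 = (2 ^ #C)⁻¹ * ∑ E ∈ C.powerset, ∏ a ∈ E, φ a ω :=
    fun ω => by
      rw [prod_div_distrib, prod_add_one, prod_const, div_eq_inv_mul]
  have e2 : (1 : ℝ) = (2 ^ #C)⁻¹ * ∑ E ∈ C.powerset, 1 := by simp
  rw [av_congr e, av_mul_left, av_sum]
  nth_rw 1 [e2]
  rw [← mul_sub, ← sum_sub_distrib, abs_mul, abs_of_pos (by positivity)]
  calc _ ≤ (2 ^ #C)⁻¹ * ∑ E ∈ C.powerset, ε := by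
        gcongr
        exact (abs_sum_le_sum_abs _ _).trans (sum_le_sum fun E hE =>
          h E ((mem_powerset.mp hE).trans hC))
    _ = ε := by simp

end LinearForms

section Sampling

variable {D D' T : Type} [Finite D] [Finite D'] [Finite T] [Nonempty T]

lemma av_comp_injective {e : D → D'} (he : Injective e) (f : (D → T) → ℝ) :
    av (fun Y : D' → T => f (Y ∘ e)) = av f := by
  classical
  set E : D ⊕ ↥(Set.range e)ᶜ ≃ D' :=
    ((Equiv.ofInjective e he).sumCongr (Equiv.refl _)).trans (Equiv.Set.sumCompl (Set.range e))
    with hE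
  rw [← av_comp_equiv (Equiv.arrowCongr E (Equiv.refl T)), av_sum_arrow]
  refine av_congr fun x => ?_
  rw [← av_const (X := ↥(Set.range e)ᶜ → T) (f x)]
  refine av_congr fun y => congrArg f (funext fun d => ?_)
  have : E.symm (e d) = Sum.inl d := by
    rw [Equiv.symm_apply_eq]
    simp [hE]
  simp [this]

lemma av_sel [DecidableEq D] (A : Finset D) (f : (D → T) → ℝ) :
    av (fun Y : D × Bool → T => f (sel Y A)) = av f :=
  av_comp_injective (e := fun d : D => (d, decide (d ∈ A))) (fun _ _ h => (Prod.mk.inj h).1) f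

end Sampling

section Counting

variable {J T : Type} [Fintype J] [DecidableEq J] [Finite T] [Nonempty T] {X : Type} [Finite X]
  [Nonempty X]

/-- The pairs indexing the linear forms that occur in the counting lemma. -/
def cubePairs (J : Type) [Fintype J] [DecidableEq J] : Finset (Σ _ : J, Finset J) :=
  univ.sigma fun j => (univ.erase j).powerset

/-- The linear forms condition for a family of majorants. -/
def LinForms (ν : J → X → (J → T) → ℝ) (ε : ℝ) : Prop :=
  NearOne (fun (p : Σ _ : J, Finset J) (ω : X × (J × Bool → T)) => ν p.1 ω.1 (sel ω.2 p.2))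
    (cubePairs J) ε

/-- Independence of a coordinate. -/
def Indep (d : J) (g : X → (J → T) → ℝ) : Prop := ∀ x y t, g x (update y d t) = g x y

omit [Fintype J] [Finite T] [Nonempty T] [Finite X] [Nonempty X] in
lemma Indep.update_comm {d o : J} {g : X → (J → T) → ℝ} (h : Indep d g) (hdo : d ≠ o) (x : X)
    (y : J → T) (t t' : T) : g x (update (update y d t) o t') = g x (update y o t') := by
  rw [Function.update_comm hdo]; exact h _ _ _

omit [Nonempty X] in
/-- Splitting off both copies of a coordinate in an average over boxes. -/
lemma av_split_coord (o : J) (Ψ : X → (J × Bool → T) → ℝ) :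
    (av fun x => av fun Y => Ψ x Y) = av fun p : X × T × T => av fun Y : J × Bool → T =>
      Ψ p.1 (update (update Y (o, false) p.2.1) (o, true) p.2.2) := by
  rw [av_prod]
  refine av_congr fun x => ?_
  rw [av_prod, ← av_update (o, true), av_comm, ← av_comm, ← av_update (o, false), av_comm]
  refine av_congr fun t => ?_
  rw [av_comm]

lemma majorant_box (J : Type) [Fintype J] [DecidableEq J] {η : ℝ} (hη : 0 < η) :
    ∃ ε : ℝ, 0 < ε ∧ ∀ (T X : Type) [Finite T] [Nonempty T] [Finite X] [Nonempty X]
      (ν : J → X → (J → T) → ℝ), (∀ j, Indep j (ν j)) → (∀ j x y, 0 ≤ ν j x y) →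
      LinForms ν ε → ∀ (o : J) (g g' : J → X → (J → T) → ℝ), (∀ j, Indep j (g j)) →
      (∀ j, Indep j (g' j)) → (∀ j x y, |g j x y| ≤ ν j x y + 1) →
      (∀ j x y, |g' j x y| ≤ ν j x y + 1) →
      |av fun x => av fun y => (ν o x y - 1) *
        ((av fun t => ∏ j ∈ univ.erase o, g j x (update y o t)) *
        (av fun t => ∏ j ∈ univ.erase o, g' j x (update y o t)))| ≤ η := by
  set m := Fintype.card J with hm
  set a : ℝ := η / (4 * 4 ^ m) with ha
  have ha0 : 0 < a := by positivity
  refine ⟨min 1 (a ^ 2 ^ (m - 1) / 2 ^ 2 ^ (m - 1)), by positivity, ?_⟩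
  intro T X _ _ _ _ ν hνi hν0 hLF o g g' hgi hgi' hg hg'
  set μ : J → X → (J → T) → ℝ := fun j x y => (ν j x y + 1) / 2 with hμ
  have hμLF : LinForms μ (min 1 (a ^ 2 ^ (m - 1) / 2 ^ 2 ^ (m - 1))) := hLF.mix
  have hμ0 : ∀ j x y, 0 ≤ μ j x y := fun j x y => by have := hν0 j x y; simp only [hμ]; linarith
  have hμi : ∀ j, Indep j (μ j) := fun j x y t => by simp only [hμ, hνi j x y t]
  set S : Finset J := univ.erase o with hS
  have hoS : o ∉ S := by simp [hS]
  have hScard : #S = m - 1 := by rw [hS, card_erase_of_mem (mem_univ _), card_univ]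
  set h : X × T × T → (J → T) → ℝ := fun p y => μ o p.1 y - 1 with hh
  set u : J → X × T × T → (J → T) → ℝ := fun j p y => if j = o then 1 else
    g j p.1 (update y o p.2.1) * g' j p.1 (update y o p.2.2) / 4 with hu
  set b : J → X × T × T → (J → T) → ℝ := fun j p y => if j = o then 1 else
    μ j p.1 (update y o p.2.1) * μ j p.1 (update y o p.2.2) with hb
  have hne : ∀ j ∈ S, j ≠ o := fun j hj => ne_of_mem_erase hj
  have hQ0 : (av fun x => av fun y => (ν o x y - 1) *
        ((av fun t => ∏ j ∈ univ.erase o, g j x (update y o t)) *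
        (av fun t => ∏ j ∈ univ.erase o, g' j x (update y o t)))) =
      2 * 4 ^ (m - 1) * boxForm h b u ∅ := by
    rw [boxForm, av_prod, ← av_mul_left]
    refine av_congr fun x => ?_
    rw [av_prod, ← av_mul_left]
    simp only [av_mul_av]
    simp only [← av_mul_left]
    rw [av_comm]
    refine av_congr fun t => ?_
    rw [av_comm]
    refine av_congr fun t' => ?_
    simp only [powerset_empty, prod_singleton, prod_empty, mul_one, compl_empty]
    rw [← av_sel ∅]
    refine av_congr fun Y => ?_
    have e1 : ∏ j, u j (x, t, t') (sel Y ∅) =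
        (∏ j ∈ S, g j x (update (sel Y ∅) o t)) *
          (∏ j ∈ S, g' j x (update (sel Y ∅) o t')) / 4 ^ (m - 1) := by
      rw [← mul_prod_erase univ _ (mem_univ o), ← hS, ← hScard, ← prod_const, ← prod_mul_distrib,
        ← prod_div_distrib]
      simp only [hu, if_true, one_mul]
      exact prod_congr rfl fun j hj => by rw [if_neg (hne j hj)]
    rw [e1]
    simp only [hh, hμ]
    field_simp
    ring
  have hpre : ∀ R ⊆ S, ∀ j ∈ S, j ∉ R →
      (av fun p => av fun Y : J × Bool → T => ∏ A ∈ R.powerset, b j p (sel Y A)) ≤ 2 := by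
    intro R hR j hj hjR
    have e : (av fun p => av fun Y : J × Bool → T => ∏ A ∈ R.powerset, b j p (sel Y A)) =
        av fun x => av fun Y => ∏ A ∈ (insert o R).powerset, μ j x (sel Y A) := by
      refine Eq.trans ?_ (av_split_coord o _).symm
      refine av_congr fun p => av_congr fun Y => ?_
      rw [prod_powerset_insert_sel (fun h => hoS (hR h)) (μ j p.1), ← prod_mul_distrib]
      exact prod_congr rfl fun A hA => by simp only [hb, if_neg (hne j hj)]
    have h1 := hμLF (({j} : Finset J).sigma fun _ => (insert o R).powerset) fun p hp => by
      obtain ⟨h1, h2⟩ := mem_sigma.mp hp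
      rw [mem_singleton] at h1
      refine mem_sigma.mpr ⟨mem_univ _, mem_powerset.mpr fun i hi => mem_erase.mpr ⟨?_, mem_univ _⟩⟩
      rintro rfl
      have := mem_powerset.mp h2 hi
      rw [h1, mem_insert] at this
      exact this.elim (hne j hj) hjR
    simp only [prod_sigma, prod_singleton] at h1
    rw [av_prod] at h1
    rw [e]
    have := (abs_le.mp (h1.trans (min_le_left _ _))).2
    linarith
  have hQS : |boxForm h b u S| ≤ 2 ^ 2 ^ (m - 1) * (a ^ 2 ^ (m - 1) / 2 ^ 2 ^ (m - 1)) := by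
    have e : boxForm h b u S = av fun x => av fun Y : J × Bool → T =>
        (∏ A ∈ S.powerset, (μ o x (sel Y A) - 1)) *
          ∏ j ∈ S, ∏ A ∈ (univ.erase j).powerset, μ j x (sel Y A) := by
      refine Eq.trans ?_ (av_split_coord o _).symm
      refine av_congr fun p => av_congr fun Y => ?_
      have hSc : Sᶜ = {o} := by simp [hS]
      rw [hSc, prod_singleton]
      have e1 : ∏ A ∈ S.powerset, u o p (sel Y A) = 1 := prod_eq_one fun A _ => by simp [hu]
      rw [e1, mul_one]
      congr 1
      · refine prod_congr rfl fun A hA => ?_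
        rw [sel_update_update fun h => hoS (mem_powerset.mp hA h), hμi o]
      · refine prod_congr rfl fun j hj => ?_
        have : univ.erase j = insert o (S.erase j) := by
          ext i
          by_cases hi : i = o
          · simp [hi, (hne j hj).symm]
          · simp [hi, hS]
        rw [this, prod_powerset_insert_sel (by simp [hS]) (μ j p.1), ← prod_mul_distrib]
        exact prod_congr rfl fun A hA => by simp only [hb, if_neg (hne j hj)]
    have h1 := hμLF.abs_av_prod_sub_one_mul_le
      (A := ({o} : Finset J).sigma fun _ => S.powerset)
      (C := S.sigma fun j => (univ.erase j).powerset) ⟨⟨o, ∅⟩, by simp⟩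
      (disjoint_left.mpr fun p hp hp' => by
        rw [mem_sigma] at hp hp'
        rw [mem_singleton.mp hp.1] at hp'
        exact hoS hp'.1)
      (fun p hp => by
        rw [mem_sigma, mem_singleton] at hp
        exact mem_sigma.mpr ⟨mem_univ _, by rw [hp.1]; exact hp.2⟩)
      (sigma_mono (subset_univ _) fun _ => subset_rfl)
    simp only [prod_sigma, prod_singleton, card_sigma, sum_singleton, card_powerset, hScard] at h1
    rw [av_prod] at h1
    rw [e]
    refine h1.trans ?_
    gcongr
    exact min_le_right _ _
  have hmain := abs_boxForm_pow_le (h := h) (b := b) (u := u) (S := S)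
    (fun j hj p y => by
      simp only [hu, hb, if_neg (hne j hj), hμ, abs_div, abs_mul]
      rw [abs_of_pos (by norm_num : (0 : ℝ) < 4)]
      have := mul_le_mul (hg j p.1 (update y o p.2.1)) (hg' j p.1 (update y o p.2.2))
        (abs_nonneg _) ((abs_nonneg _).trans (hg j p.1 (update y o p.2.1)))
      linarith)
    (fun j hj p y t => by
      simp only [hb, if_neg (hne j hj), (hμi j).update_comm (hne j hj)])
    (fun j hj p y t => by
      simp only [hu, if_neg (hne j hj), (hgi j).update_comm (hne j hj),
        (hgi' j).update_comm (hne j hj)])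
    hpre S subset_rfl
  have hfin : |boxForm h b u ∅| / 2 ≤ a := by
    rw [mul_div_cancel₀ _ (by positivity)] at hQS
    rw [hScard] at hmain
    refine le_of_pow_le_pow_left₀ (n := 2 ^ (m - 1)) (by positivity) ha0.le (hmain.trans ?_)
    have := pow_pos ha0 (2 ^ (m - 1))
    linarith
  rw [hQ0, abs_mul, abs_of_pos (by positivity)]
  calc 2 * 4 ^ (m - 1) * |boxForm h b u ∅| ≤ 2 * 4 ^ m * (2 * a) := by
        gcongr
        · norm_num
        · omega
        · linarith
    _ = η := by rw [ha]; field_simp; ring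

end Counting

section Counting

variable {J T : Type} [Fintype J] [DecidableEq J] [Finite T] [Nonempty T] {X : Type} [Finite X]
  [Nonempty X]

omit [Nonempty X] in
lemma av_mul_prod_erase {o : J} {Φ : X → (J → T) → ℝ} (hΦ : Indep o Φ)
    (g : J → X → (J → T) → ℝ) :
    (av fun ω : X × (J → T) => Φ ω.1 ω.2 * ∏ j ∈ univ.erase o, g j ω.1 ω.2) =
      av fun ω : X × (J → T) => Φ ω.1 ω.2 *
        av fun t => ∏ j ∈ univ.erase o, g j ω.1 (update ω.2 o t) := by
  rw [av_prod, av_prod]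
  refine av_congr fun x => ?_
  rw [← av_update o]
  refine av_congr fun y => ?_
  rw [← av_mul_left]
  exact av_congr fun t => by rw [hΦ]

omit [Nonempty X] in
lemma LinForms.abs_av_sub_one_le {ν : J → X → (J → T) → ℝ} {ε : ℝ} (h : LinForms ν ε)
    (A : Finset J) :
    |(av fun ω : X × (J → T) => ∏ j ∈ A, ν j ω.1 ω.2) - 1| ≤ ε := by
  have h1 := h (A.sigma fun _ => {∅}) (sigma_mono (subset_univ _) fun j => by simp)
  simp only [prod_sigma, prod_singleton] at h1
  rw [av_prod] at h1 ⊢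
  have : ∀ x, (av fun Y : J × Bool → T => ∏ j ∈ A, ν j x (sel Y ∅)) =
      av fun y => ∏ j ∈ A, ν j x y := fun x =>
    av_sel ∅ fun y => ∏ j ∈ A, ν j x y
  simpa only [this] using h1

lemma LinForms.av_sub_one_sq_le {ν : J → X → (J → T) → ℝ} {ε : ℝ} (h : LinForms ν ε)
    {o : J} {A : Finset J} (ho : o ∉ A) :
    (av fun ω : X × (J → T) => ((av fun t => ∏ j ∈ A, ν j ω.1 (update ω.2 o t)) - 1) ^ 2) ≤
      3 * ε := by
  have h1 := abs_le.mp (h.abs_av_sub_one_le A)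
  have h2 := h (A.sigma fun _ => (insert o ∅ : Finset J).powerset)
    fun p hp => ?_
  · have e1 : (av fun ω : X × (J → T) => ∏ j ∈ A, ν j ω.1 ω.2) =
        av fun ω : X × (J → T) => av fun t => ∏ j ∈ A, ν j ω.1 (update ω.2 o t) := by
      rw [av_prod, av_prod]
      exact av_congr fun x => (av_update o _).symm
    have e2 : (av fun ω : X × (J × Bool → T) => ∏ p ∈ A.sigma fun _ =>
          (insert o ∅ : Finset J).powerset, ν p.1 ω.1 (sel ω.2 p.2)) =
        av fun ω : X × (J → T) => (av fun t => ∏ j ∈ A, ν j ω.1 (update ω.2 o t)) ^ 2 := by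
      simp only [prod_sigma]
      rw [av_prod, av_split_coord o, av_prod, av_prod]
      refine av_congr fun x => ?_
      rw [av_prod]
      simp only [av_pow_two_mul]
      rw [av_comm (X := J → T)]
      refine av_congr fun t => ?_
      rw [av_comm (X := J → T)]
      refine av_congr fun t' => ?_
      refine Eq.trans ?_ (av_sel ∅ fun y =>
        (∏ j ∈ A, ν j x (update y o t)) * ∏ j ∈ A, ν j x (update y o t'))
      refine av_congr fun Y => ?_
      rw [← prod_mul_distrib]
      refine prod_congr rfl fun j _ => ?_
      rw [prod_powerset_insert_sel (notMem_empty o) (ν j x)]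
      simp
    rw [e2] at h2
    rw [e1] at h1
    have e3 : ∀ ω : X × (J → T), ((av fun t => ∏ j ∈ A, ν j ω.1 (update ω.2 o t)) - 1) ^ 2 =
        (av fun t => ∏ j ∈ A, ν j ω.1 (update ω.2 o t)) ^ 2 -
          2 * (av fun t => ∏ j ∈ A, ν j ω.1 (update ω.2 o t)) + 1 := fun ω => by ring
    rw [av_congr e3, av_add, av_sub, av_mul_left, av_const]
    have := abs_le.mp h2
    linarith
  · obtain ⟨h2, h3⟩ := mem_sigma.mp hp
    refine mem_sigma.mpr ⟨mem_univ _, mem_powerset.mpr fun i hi => mem_erase.mpr ⟨?_, mem_univ _⟩⟩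
    have := mem_powerset.mp h3 hi
    rw [insert_empty_eq, mem_singleton] at this
    rintro rfl
    exact ho (this ▸ h2)

/-- The relative counting lemma. -/
theorem counting (J : Type) [Fintype J] [DecidableEq J] (m : ℕ) : ∀ {κ : ℝ}, 0 < κ →
    ∃ ε : ℝ, 0 < ε ∧ ∀ (T X : Type) [Finite T] [Nonempty T] [Finite X] [Nonempty X]
      (ν F F' : J → X → (J → T) → ℝ), (∀ j, Indep j (ν j)) → (∀ j, Indep j (F j)) →
      (∀ j, Indep j (F' j)) → (∀ j x y, 0 ≤ F j x y) → (∀ j x y, F j x y ≤ ν j x y) →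
      (∀ j x y, 0 ≤ F' j x y) → (∀ j x y, F' j x y ≤ 1) → LinForms ν ε →
      (∀ o, ∀ g : J → X → (J → T) → ℝ, (∀ j, Indep j (g j)) → (∀ j x y, 0 ≤ g j x y) →
        (∀ j x y, g j x y ≤ 1) → |av fun ω : X × (J → T) => (F o ω.1 ω.2 - F' o ω.1 ω.2) *
          ∏ j ∈ univ.erase o, g j ω.1 ω.2| ≤ ε) →
      ∀ A : Finset J, #A = m → ∀ H : J → X → (J → T) → ℝ, (∀ j, Indep j (H j)) →
        (∀ j x y, 0 ≤ H j x y) → (∀ j x y, H j x y ≤ 1) →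
        |(av fun ω : X × (J → T) => ∏ j, (if j ∈ A then F j else H j) ω.1 ω.2) -
          av fun ω : X × (J → T) => ∏ j, (if j ∈ A then F' j else H j) ω.1 ω.2| ≤ κ := by
  induction m with
  | zero =>
    intro κ hκ
    refine ⟨1, one_pos, ?_⟩
    intro T X _ _ _ _ ν F F' _ _ _ _ _ _ _ _ _ A hA H _ _ _
    rw [card_eq_zero] at hA
    simpa [hA] using hκ.le
  | succ m ih =>
    intro κ hκ
    set e₀ : ℝ := min 1 (κ ^ 2 / 100) with he₀
    have he0 : 0 < e₀ := by positivity
    have he1 : e₀ ≤ 1 := min_le_left _ _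
    have heκ : e₀ ≤ κ ^ 2 / 100 := min_le_right _ _
    obtain ⟨ε₁, hε₁, h₁⟩ := majorant_box J he0
    obtain ⟨ε₂, hε₂, h₂⟩ := ih he0
    refine ⟨min (min ε₁ ε₂) (min (e₀ ^ 2) (κ / 2)), by positivity, ?_⟩
    intro T X _ _ _ _ ν F F' hνi hFi hFi' hF0 hFν hF0' hF1' hLF htest A hA H hHi hH0 hH1
    set ε := min (min ε₁ ε₂) (min (e₀ ^ 2) (κ / 2)) with hε
    have l₁ : ε ≤ ε₁ := (min_le_left _ _).trans (min_le_left _ _)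
    have l₂ : ε ≤ ε₂ := (min_le_left _ _).trans (min_le_right _ _)
    have l₃ : ε ≤ e₀ ^ 2 := (min_le_right _ _).trans (min_le_left _ _)
    have l₄ : ε ≤ κ / 2 := (min_le_right _ _).trans (min_le_right _ _)
    clear_value ε e₀
    have hν0 : ∀ j x y, 0 ≤ ν j x y := fun j x y => (hF0 j x y).trans (hFν j x y)
    obtain ⟨o, ho⟩ : A.Nonempty := card_pos.mp (by omega)
    set A' := A.erase o with hA'
    have hoA' : o ∉ A' := notMem_erase o A
    set g : J → X → (J → T) → ℝ := fun j => if j ∈ A' then F j else H j with hg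
    set g' : J → X → (J → T) → ℝ := fun j => if j ∈ A' then F' j else H j with hg'
    have hgi : ∀ j, Indep j (g j) := fun j => by
      simp only [hg]; split_ifs; exacts [hFi j, hHi j]
    have hgi' : ∀ j, Indep j (g' j) := fun j => by
      simp only [hg']; split_ifs; exacts [hFi' j, hHi j]
    have hg0 : ∀ j x y, 0 ≤ g j x y := fun j x y => by
      simp only [hg]; split_ifs; exacts [hF0 j x y, hH0 j x y]
    have hg0' : ∀ j x y, 0 ≤ g' j x y := fun j x y => by
      simp only [hg']; split_ifs; exacts [hF0' j x y, hH0 j x y]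
    have hg1' : ∀ j x y, g' j x y ≤ 1 := fun j x y => by
      simp only [hg']; split_ifs; exacts [hF1' j x y, hH1 j x y]
    have hgν : ∀ j x y, |g j x y| ≤ ν j x y + 1 := fun j x y => by
      rw [abs_of_nonneg (hg0 j x y)]
      have := hν0 j x y
      simp only [hg]; split_ifs
      · linarith [hFν j x y]
      · linarith [hH1 j x y]
    have hgν' : ∀ j x y, |g' j x y| ≤ ν j x y + 1 := fun j x y => by
      rw [abs_of_nonneg (hg0' j x y)]
      linarith [hν0 j x y, hg1' j x y]
    set G : X → (J → T) → ℝ := fun x y => av fun t => ∏ j ∈ univ.erase o, g j x (update y o t)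
      with hG
    set G' : X → (J → T) → ℝ := fun x y => av fun t => ∏ j ∈ univ.erase o, g' j x (update y o t)
      with hG'
    have hG0 : ∀ x y, 0 ≤ G x y := fun x y => av_nonneg fun t => prod_nonneg fun j _ => hg0 j _ _
    have hG0' : ∀ x y, 0 ≤ G' x y := fun x y => av_nonneg fun t => prod_nonneg fun j _ => hg0' j _ _
    have hG1' : ∀ x y, G' x y ≤ 1 := fun x y =>
      av_le fun t => prod_le_one (fun j _ => hg0' j _ _) fun j _ => hg1' j _ _
    have hGi : Indep o G := fun x y t => by simp only [hG, update_idem]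
    have hGi' : Indep o G' := fun x y t => by simp only [hG', update_idem]
    have hsplit : ∀ (K K' : J → X → (J → T) → ℝ), Indep o (K o) → (∀ j ≠ o, K j = K' j) →
        (av fun ω : X × (J → T) => ∏ j, K j ω.1 ω.2) = av fun ω : X × (J → T) => K o ω.1 ω.2 *
          av fun t => ∏ j ∈ univ.erase o, K' j ω.1 (update ω.2 o t) := by
      intro K K' hK hKK'
      rw [← av_mul_prod_erase hK]
      refine av_congr fun ω => ?_
      rw [← mul_prod_erase univ _ (mem_univ o)]
      congr 1
      exact prod_congr rfl fun j hj => by rw [hKK' j (ne_of_mem_erase hj)]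
    have hL : (av fun ω : X × (J → T) => ∏ j, (if j ∈ A then F j else H j) ω.1 ω.2) =
        av fun ω : X × (J → T) => F o ω.1 ω.2 * G ω.1 ω.2 := by
      refine (hsplit _ g (by simpa only [if_pos ho] using hFi o) fun j hj => ?_).trans
        (by simp only [if_pos ho, hG])
      simp only [hg, hA', mem_erase, ne_eq, hj, not_false_eq_true, true_and]
    have hL' : (av fun ω : X × (J → T) => ∏ j, (if j ∈ A then F' j else H j) ω.1 ω.2) =
        av fun ω : X × (J → T) => F' o ω.1 ω.2 * G' ω.1 ω.2 := by
      refine (hsplit _ g' (by simpa only [if_pos ho] using hFi' o) fun j hj => ?_).trans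
        (by simp only [if_pos ho, hG'])
      simp only [hg', hA', mem_erase, ne_eq, hj, not_false_eq_true, true_and]
    have hih : ∀ K : X → (J → T) → ℝ, Indep o K → (∀ x y, 0 ≤ K x y) → (∀ x y, K x y ≤ 1) →
        |(av fun ω : X × (J → T) => K ω.1 ω.2 * G ω.1 ω.2) -
          av fun ω : X × (J → T) => K ω.1 ω.2 * G' ω.1 ω.2| ≤ e₀ := by
      intro K hKi hK0 hK1
      have := h₂ T X ν F F' hνi hFi hFi' hF0 hFν hF0' hF1' (hLF.weaken l₂)
        (fun o g h1 h2 h3 => (htest o g h1 h2 h3).trans l₂) A'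
        (by rw [hA', card_erase_of_mem ho, hA]; rfl) (update H o K)
        (fun j => by
          rcases eq_or_ne j o with rfl | hj
          · simpa using hKi
          · simpa [hj] using hHi j)
        (fun j => by
          rcases eq_or_ne j o with rfl | hj
          · simpa using hK0
          · simpa [hj] using hH0 j)
        (fun j => by
          rcases eq_or_ne j o with rfl | hj
          · simpa using hK1
          · simpa [hj] using hH1 j)
      rwa [hsplit _ g (by simpa [if_neg hoA'] using hKi) fun j hj => by simp [hg, hj],
        hsplit _ g' (by simpa [if_neg hoA'] using hKi) fun j hj => by simp [hg', hj],
        if_neg hoA', if_neg hoA', update_self] at this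
    have hbox : ∀ q q' : J → X → (J → T) → ℝ, (∀ j, Indep j (q j)) → (∀ j, Indep j (q' j)) →
        (∀ j x y, |q j x y| ≤ ν j x y + 1) → (∀ j x y, |q' j x y| ≤ ν j x y + 1) →
        |av fun ω : X × (J → T) => (ν o ω.1 ω.2 - 1) *
        ((av fun t => ∏ j ∈ univ.erase o, q j ω.1 (update ω.2 o t)) *
        (av fun t => ∏ j ∈ univ.erase o, q' j ω.1 (update ω.2 o t)))| ≤ e₀ := by
      intro q q' hq hq' hqν hqν'
      rw [av_prod]
      exact h₁ T X ν hνi hν0 (hLF.weaken l₁) o q q' hq hq' hqν hqν'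
    have b1 := abs_le.mp (hbox g g hgi hgi hgν hgν)
    have b2 := abs_le.mp (hbox g g' hgi hgi' hgν hgν')
    have b3 := abs_le.mp (hbox g' g' hgi' hgi' hgν' hgν')
    have hN := hLF.av_sub_one_sq_le hoA'
    set N : X → (J → T) → ℝ := fun x y => av fun t => ∏ j ∈ A', ν j x (update y o t) with hNdef
    have hGN : ∀ x y, G x y ≤ N x y := fun x y => av_mono fun t => by
      rw [← prod_sdiff (s₁ := A') (s₂ := univ.erase o) fun j hj => mem_erase.mpr
        ⟨fun h => hoA' (h ▸ hj), mem_univ _⟩]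
      rw [← one_mul (∏ j ∈ A', ν j x (update y o t))]
      refine mul_le_mul (prod_le_one (fun j _ => hg0 _ _ _) fun j hj => ?_)
        (prod_le_prod (fun j _ => hg0 _ _ _) fun j hj => ?_) (prod_nonneg fun j _ => hg0 _ _ _)
        zero_le_one
      · simp only [hg, if_neg (mem_sdiff.mp hj).2]; exact hH1 _ _ _
      · simp only [hg, if_pos hj]; exact hFν _ _ _
    set M : X → (J → T) → ℝ := fun x y => min (G x y) 1 with hM
    have c1 := abs_le.mp (hih M (fun x y t => by simp only [hM, hGi x y t])
      (fun x y => le_min (hG0 x y) zero_le_one) fun x y => min_le_right _ _)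
    have c2 := abs_le.mp (hih G' hGi' hG0' hG1')
    have hNabs : (av fun ω : X × (J → T) => |N ω.1 ω.2 - 1|) ≤ 2 * e₀ := by
      refine le_of_pow_le_pow_left₀ (n := 2) (by norm_num) (by positivity)
        ((av_sq_le _).trans ?_)
      simp only [sq_abs]
      refine hN.trans ?_
      nlinarith
    have hsq : (av fun ω : X × (J → T) => (G ω.1 ω.2 - G' ω.1 ω.2) ^ 2) ≤ 7 * e₀ := by
      have hp : ∀ ω : X × (J → T), (G ω.1 ω.2 - G' ω.1 ω.2) ^ 2 ≤
          (N ω.1 ω.2 - 1) ^ 2 + |N ω.1 ω.2 - 1| +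
          ((M ω.1 ω.2 * G ω.1 ω.2 - M ω.1 ω.2 * G' ω.1 ω.2) -
            (G' ω.1 ω.2 * G ω.1 ω.2 - G' ω.1 ω.2 * G' ω.1 ω.2)) := by
        rintro ⟨x, y⟩
        have h1 := hG0 x y
        have h2 := hG0' x y
        have h3 := hG1' x y
        have h4 := hGN x y
        have h5 := le_abs_self (N x y - 1)
        have h6 := abs_nonneg (N x y - 1)
        simp only [hM]
        rcases le_total (G x y) 1 with h | h
        · rw [min_eq_left h]
          nlinarith [sq_nonneg (N x y - 1)]
        · rw [min_eq_right h]
          nlinarith [mul_nonneg h2 (sub_nonneg.mpr h),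
            mul_nonneg (sub_nonneg.mpr h4) (sub_nonneg.mpr h),
            mul_nonneg (sub_nonneg.mpr h4) (h1.trans h4)]
      have h1 := av_mono hp
      rw [av_add, av_add, av_sub, av_sub, av_sub] at h1
      nlinarith
    have hfirst : (av fun ω : X × (J → T) => F o ω.1 ω.2 * (G ω.1 ω.2 - G' ω.1 ω.2)) ^ 2 ≤
        (κ / 2) ^ 2 := by
      have h1 := av_mul_sq_le_of_abs_le (W := fun ω : X × (J → T) => F o ω.1 ω.2)
        (B := fun ω => ν o ω.1 ω.2)
        (fun ω => by rw [abs_of_nonneg (hF0 _ _ _)]; exact hFν _ _ _)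
        fun ω => G ω.1 ω.2 - G' ω.1 ω.2
      have h2 : (av fun ω : X × (J → T) => ν o ω.1 ω.2) ≤ 2 := by
        have := abs_le.mp (hLF.abs_av_sub_one_le {o})
        simp only [prod_singleton] at this
        nlinarith
      have hp : ∀ ω : X × (J → T), ν o ω.1 ω.2 * (G ω.1 ω.2 - G' ω.1 ω.2) ^ 2 =
          (ν o ω.1 ω.2 - 1) * (G ω.1 ω.2 * G ω.1 ω.2) -
          2 * ((ν o ω.1 ω.2 - 1) * (G ω.1 ω.2 * G' ω.1 ω.2)) +
          (ν o ω.1 ω.2 - 1) * (G' ω.1 ω.2 * G' ω.1 ω.2) + (G ω.1 ω.2 - G' ω.1 ω.2) ^ 2 :=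
        fun ω => by ring
      have h3 : (av fun ω : X × (J → T) => ν o ω.1 ω.2 * (G ω.1 ω.2 - G' ω.1 ω.2) ^ 2) ≤
          11 * e₀ := by
        rw [av_congr hp, av_add, av_add, av_sub, av_mul_left]
        linarith
      calc _ ≤ _ := h1
        _ ≤ 2 * (11 * e₀) := mul_le_mul h2 h3 (av_nonneg fun ω =>
            mul_nonneg (hν0 _ _ _) (sq_nonneg _)) (by norm_num)
        _ ≤ _ := by linarith
    have hsecond := abs_le.mp ((htest o g' hgi' hg0' hg1').trans l₄)
    rw [av_mul_prod_erase (Φ := fun x y => F o x y - F' o x y) (fun x y t => by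
      simp only [hFi o x y t, hFi' o x y t])] at hsecond
    have hfirst' := abs_le_of_sq_le_sq' hfirst (by positivity)
    have hsum : (av fun ω : X × (J → T) => F o ω.1 ω.2 * G ω.1 ω.2) -
        (av fun ω : X × (J → T) => F' o ω.1 ω.2 * G' ω.1 ω.2) =
        (av fun ω : X × (J → T) => F o ω.1 ω.2 * (G ω.1 ω.2 - G' ω.1 ω.2)) +
        av fun ω : X × (J → T) => (F o ω.1 ω.2 - F' o ω.1 ω.2) * G' ω.1 ω.2 := by
      rw [← av_sub, ← av_add]
      exact av_congr fun ω => by ring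
    rw [hL, hL', hsum, abs_le]
    constructor <;> linarith [hsecond.1, hsecond.2, hfirst'.1, hfirst'.2]

end Counting

section TestFunctions

variable {D T Z : Type} [Fintype D] [DecidableEq D] [Field T] [Finite T] [AddCommGroup Z]
  [Finite Z] [Module T Z]

/-- The test functions attached to a family of directions. -/
def testFns (T : Type) [Field T] [Module T Z] (v : D → Z) : Set (Z → ℝ) :=
  {F | ∃ w : D → Z → (D → T) → ℝ, (∀ d x y, |w d x y| ≤ 1) ∧
    (∀ d x y t, w d (x + t • v d) (update y d (y d + t)) = w d x y) ∧
    ∀ x, F x = av fun y => ∏ d, w d x y}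

omit [DecidableEq D] [AddCommGroup Z] [Finite Z] [Finite T] [Field T] [Fintype D] [Module T Z] in
lemma abs_prod_le_one {ι : Type*} {s : Finset ι} {f : ι → ℝ} (h : ∀ i ∈ s, |f i| ≤ 1) :
    |∏ i ∈ s, f i| ≤ 1 := by
  rw [abs_prod]
  exact prod_le_one (fun i _ => abs_nonneg _) h

omit [Finite Z] in
lemma testFns_abs_le {v : D → Z} {F : Z → ℝ} (hF : F ∈ testFns T v) (x : Z) : |F x| ≤ 1 := by
  obtain ⟨w, hw, -, hF⟩ := hF
  rw [hF]
  exact (abs_av_le _).trans (av_le fun y => abs_prod_le_one fun d _ => hw d x y)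

omit [Finite Z] in
lemma one_mem_testFns (v : D → Z) : 1 ∈ testFns T v :=
  ⟨fun _ _ _ => 1, by simp, by simp, fun x => by simp [av_const]⟩

omit [Finite Z] in
lemma neg_mem_testFns [Nonempty D] {v : D → Z} {F : Z → ℝ} (hF : F ∈ testFns T v) :
    -F ∈ testFns T v := by
  obtain ⟨w, hw, hinv, hF⟩ := hF
  obtain ⟨e⟩ := ‹Nonempty D›
  refine ⟨fun d x y => (if d = e then -1 else 1) * w d x y, fun d x y => ?_, fun d x y t => ?_,
    fun x => ?_⟩
  · rw [abs_mul]; split_ifs <;> simpa using hw d x y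
  · dsimp only
    rw [hinv]
  · rw [Pi.neg_apply, hF, ← av_neg]
    refine av_congr fun y => ?_
    rw [prod_mul_distrib, prod_ite_eq' univ e, if_pos (mem_univ e), neg_one_mul]

omit [Finite Z] in
lemma mul_mem_closedConvexHull_testFns {v : D → Z} {F G : Z → ℝ} (hF : F ∈ testFns T v)
    (hG : G ∈ testFns T v) : F * G ∈ closedConvexHull ℝ (testFns T v) := by
  obtain ⟨w, hw, hwi, hF⟩ := hF
  obtain ⟨w', hw', hwi', hG⟩ := hG
  have := Fintype.ofFinite T
  set K : (D → T) → Z → ℝ := fun t x => av fun y => ∏ d, (w d x y * w' d x (t + y)) with hK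
  have hmem : ∀ t, K t ∈ testFns T v := fun t => by
    refine ⟨fun d x y => w d x y * w' d x (t + y), fun d x y => ?_, fun d x y τ => ?_, fun x => rfl⟩
    · rw [abs_mul]; exact mul_le_one₀ (hw d x y) (abs_nonneg _) (hw' d x _)
    · dsimp only
      rw [hwi, ← hwi' d x (t + y) τ]
      congr 3
      funext e
      by_cases he : e = d
      · subst he; simp [add_assoc]
      · simp [he]
  have e : F * G = ∑ t : D → T, (Fintype.card (D → T) : ℝ)⁻¹ • K t := by
    funext x
    rw [Pi.mul_apply, hF, hG, ← av_mul_right, Finset.sum_apply]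
    simp only [Pi.smul_apply, smul_eq_mul]
    rw [← mul_sum, inv_mul_eq_div, ← av_eq, hK, av_comm]
    refine av_congr fun y => ?_
    rw [← av_add_right y, ← av_mul_left]
    exact av_congr fun t => by rw [prod_mul_distrib]
  rw [e]
  refine convexHull_subset_closedConvexHull ((convex_convexHull ℝ _).sum_mem (fun t _ => by positivity)
    ?_ fun t _ => subset_convexHull ℝ _ (hmem t))
  rw [sum_const, nsmul_eq_mul, card_univ, mul_inv_cancel₀]
  exact_mod_cast Fintype.card_ne_zero

/-- Linear forms estimates imply that `ν - 1` does not correlate with test functions. -/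
lemma abs_av_mul_testFn_le {v : D → Z} {ν F : Z → ℝ} {ε κ : ℝ} (hκ : 0 ≤ κ)
    (hε : 2 ^ 2 ^ Fintype.card D * ε ≤ 2 * (κ / 2) ^ 2 ^ Fintype.card D)
    (hν : NearOne (fun (A : Finset D) (ω : Z × (D × Bool → T)) =>
      ν (ω.1 + ∑ d, sel ω.2 A d • v d)) univ ε)
    (hF : F ∈ testFns T v) : |av fun x => (ν x - 1) * F x| ≤ κ := by
  obtain ⟨w, hw, hwi, hF⟩ := hF
  set h : Z → (D → T) → ℝ := fun x y => ν (x + ∑ d, y d • v d) - 1 with hh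
  set u : D → Z → (D → T) → ℝ := fun d z y => w d (z + ∑ e, y e • v e) y with hu
  have hui : ∀ d ∈ univ, ∀ x y t, u d x (update y d t) = u d x y := fun d _ x y t => by
    rw [hu]
    dsimp only
    rw [← hwi d (x + ∑ e, y e • v e) y (t - y d)]
    congr 1
    · rw [Fintype.sum_eq_add_sum_compl d, Fintype.sum_eq_add_sum_compl d (fun e => y e • v e)]
      have : ∑ e ∈ {d}ᶜ, update y d t e • v e = ∑ e ∈ {d}ᶜ, y e • v e :=
        sum_congr rfl fun e he => by rw [update_of_ne (by simpa using he)]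
      rw [this, update_self, sub_smul]
      abel
    · simp
  have key := abs_boxForm_pow_le (h := h) (b := fun _ _ _ => 1) (u := u) (S := univ)
    (fun d _ x y => hw _ _ _) (by simp) hui (fun R _ d _ _ => by simp [av_const]) univ subset_rfl
  have e0 : boxForm h (fun _ _ _ => 1) u ∅ = av fun x => (ν x - 1) * F x := by
    simp only [boxForm, powerset_empty, prod_singleton, prod_empty, mul_one, compl_empty]
    calc _ = av fun x => av fun y => h x y * ∏ d, u d x y :=
          av_congr fun x => av_sel ∅ fun y => h x y * ∏ d, u d x y
      _ = av fun y => av fun x => h x y * ∏ d, u d x y := av_comm _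
      _ = av fun y => av fun x => (ν x - 1) * ∏ d, w d x y := av_congr fun y =>
          av_add_right (∑ d, y d • v d) fun x => (ν x - 1) * ∏ d, w d x y
      _ = _ := by
          rw [av_comm]
          exact av_congr fun x => by rw [av_mul_left, hF]
  have e1 : |boxForm h (fun _ _ _ => 1) u univ| ≤ 2 ^ 2 ^ Fintype.card D * ε := by
    have := hν.abs_av_prod_sub_one_mul_le (A := univ) (C := ∅) univ_nonempty (by simp) subset_rfl
      (by simp)
    simp only [prod_empty, mul_one] at this
    rw [av_prod] at this
    simpa [boxForm, hh, Fintype.card_finset] using this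
  rw [e0, card_univ] at key
  have h3 : (|av fun x => (ν x - 1) * F x| / 2) ^ 2 ^ Fintype.card D ≤
      (κ / 2) ^ 2 ^ Fintype.card D := by linarith
  have := (pow_le_pow_iff_left₀ (by positivity) (by positivity) (by positivity)).mp h3
  linarith

end TestFunctions

section Relative

variable {J T Z : Type} [Fintype J] [DecidableEq J] [Field T] [AddCommGroup Z] [Module T Z]

/-- The linear forms parametrising homothetic copies of a configuration. -/
def configForm (s : J → Z) (j : J) (z : Z) (y : J → T) : Z := z + ∑ i, y i • (s i - s j)

lemma configForm_update (s : J → Z) (j : J) (z : Z) (y : J → T) (t : T) :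
    configForm s j z (update y j t) = configForm s j z y := by
  rw [configForm, configForm]
  congr 1
  refine sum_congr rfl fun i _ => ?_
  by_cases h : i = j
  · subst h; simp
  · rw [update_of_ne h]

variable [Finite T] [Finite Z]

lemma av_prod_configForm [Nonempty J] (s : J → Z) (f : Z → ℝ) :
    (av fun ω : Z × (J → T) => ∏ j, f (configForm s j ω.1 ω.2)) =
      av fun z => av fun k : T => ∏ j, f (z + k • s j) := by
  obtain ⟨o⟩ := ‹Nonempty J›
  rw [av_prod, av_comm, av_comm (Y := T)]
  set φ : T → ℝ := fun k => av fun z => ∏ j, f (z + k • s j) with hφ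
  have h1 : ∀ y : J → T, (av fun z => ∏ j, f (configForm s j z y)) = φ (-∑ i, y i) := fun y => by
    rw [hφ]
    dsimp only
    rw [← av_add_right (-∑ i, y i • s i)]
    refine av_congr fun z => prod_congr rfl fun j _ => ?_
    rw [configForm]
    simp only [smul_sub, sum_sub_distrib, ← sum_smul, neg_smul]
    congr 1
    abel
  rw [av_congr h1, ← av_update o]
  have h2 : ∀ y : J → T, (av fun t => φ (-∑ i, update y o t i)) = av φ := fun y => by
    have e := av_comp_equiv (Equiv.neg T) φ
    rw [← e, ← av_add_right (∑ i ∈ univ.erase o, y i) fun t => φ (Equiv.neg T t)]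
    refine av_congr fun t => ?_
    rw [← add_sum_erase _ _ (mem_univ o), update_self, Equiv.neg_apply]
    rw [sum_congr rfl fun i hi => update_of_ne (ne_of_mem_erase hi) t y]
  rw [av_congr h2, av_const]

/-- The functions occurring in the counting lemma are averages of test functions. -/
lemma abs_av_mul_prod_le {s : J → Z} {v : J × J → Z} (hv : ∀ i j, i ≠ j → v (i, j) = s i - s j)
    {h : Z → ℝ} {ε : ℝ} (hh : ∀ F ∈ testFns T v, |av fun x => h x * F x| ≤ ε) (o : J)
    {g : J → Z → (J → T) → ℝ} (hg : ∀ j, Indep j (g j)) (hg1 : ∀ j x y, |g j x y| ≤ 1) :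
    |av fun ω : Z × (J → T) => h (configForm s o ω.1 ω.2) * ∏ j ∈ univ.erase o, g j ω.1 ω.2| ≤
      ε := by
  set G : J → Z → (J → T) → ℝ := fun j x y => g j (x - ∑ i, y i • (s i - s o)) y with hG
  have e1 : (av fun ω : Z × (J → T) => h (configForm s o ω.1 ω.2) *
      ∏ j ∈ univ.erase o, g j ω.1 ω.2) =
      av fun t : T => av fun x => h x * av fun y : J → T =>
        ∏ j ∈ univ.erase o, G j x (update y o t) := by
    rw [av_prod, av_comm]
    calc _ = av fun y : J → T => av fun x => h x * ∏ j ∈ univ.erase o, G j x y :=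
          av_congr fun y => by
            rw [← av_add_right (∑ i, y i • (s i - s o)) fun x => h x * ∏ j ∈ univ.erase o, G j x y]
            refine av_congr fun x => ?_
            simp [configForm, hG]
      _ = av fun y : J → T => av fun t : T => av fun x => h x *
            ∏ j ∈ univ.erase o, G j x (update y o t) :=
          (av_update o fun y => av fun x => h x * ∏ j ∈ univ.erase o, G j x y).symm
      _ = _ := by
          rw [av_comm]
          refine av_congr fun t => ?_
          rw [av_comm]
          exact av_congr fun x => av_mul_left _ _
  rw [e1]
  refine (abs_av_le _).trans (av_le fun t => hh _ ?_)
  refine ⟨fun d x Y => if d.2 = o ∧ d.1 ≠ o then G d.1 x (update (fun i => Y (i, o)) o t) else 1,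
    fun d x Y => ?_, fun d x Y τ => ?_, fun x => ?_⟩
  · dsimp only
    split_ifs
    exacts [hg1 _ _ _, by simp]
  · dsimp only
    split_ifs with hd
    · obtain ⟨i, j⟩ := d
      obtain ⟨rfl, hij⟩ := hd
      dsimp only at hij ⊢
      have e : (fun k => update Y (i, j) (Y (i, j) + τ) (k, j)) =
          update (fun k => Y (k, j)) i (Y (i, j) + τ) := by
        funext k
        by_cases hk : k = i
        · subst hk; simp
        · rw [update_of_ne hk, update_of_ne (by simpa using hk)]
      rw [e, Function.update_comm hij]
      simp only [hG]
      rw [hg i]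
      congr 1
      rw [hv i j hij, Fintype.sum_eq_add_sum_compl i,
        Fintype.sum_eq_add_sum_compl i (fun k => update (fun k => Y (k, j)) j t k • (s k - s j))]
      have : ∑ k ∈ {i}ᶜ, update (update (fun k => Y (k, j)) j t) i (Y (i, j) + τ) k • (s k - s j) =
          ∑ k ∈ {i}ᶜ, update (fun k => Y (k, j)) j t k • (s k - s j) :=
        sum_congr rfl fun k hk => by rw [update_of_ne (by simpa using hk)]
      rw [this, update_self, update_of_ne hij, add_smul]
      abel
    · rfl
  · dsimp only
    rw [← av_comp_injective (e := fun i : J => (i, o)) (fun _ _ h => (Prod.mk.inj h).1)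
      fun y => ∏ j ∈ univ.erase o, G j x (update y o t)]
    refine av_congr fun Y => ?_
    rw [Fintype.prod_prod_type, ← mul_prod_erase univ _ (mem_univ o)]
    have h1 : ∏ y, (if (o, y).2 = o ∧ (o, y).1 ≠ o then
        G (o, y).1 x (update (fun i => Y (i, o)) o t) else 1) = 1 :=
      prod_eq_one fun y _ => by simp
    rw [h1, one_mul]
    refine prod_congr rfl fun j hj => ?_
    have hj' := ne_of_mem_erase hj
    simp [hj', Function.comp_def]

end Relative

/-- The multidimensional Szemerédi theorem relative to a pseudorandom majorant. -/
theorem relative_szemeredi (J : Type) [Fintype J] [DecidableEq J] [Nonempty J] {δ : ℝ}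
    (hδ : 0 < δ) : ∃ c : ℝ, 0 < c ∧ ∃ ε : ℝ, 0 < ε ∧ ∃ N₀ : ℕ, ∀ (T Z : Type) [Field T] [Finite T]
      [AddCommGroup Z] [Finite Z] [Module T Z], (∀ m : ℕ, 0 < m → m ≤ N₀ → (m : T) ≠ 0) →
      ∀ (s : J → Z) (v : J × J → Z), (∀ i j, i ≠ j → v (i, j) = s i - s j) →
      ∀ (ν f : Z → ℝ), (∀ x, 0 ≤ f x) → (∀ x, f x ≤ ν x) →
      LinForms (fun j z (y : J → T) => ν (configForm s j z y)) ε →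
      NearOne (fun (A : Finset (J × J)) (ω : Z × ((J × J) × Bool → T)) =>
        ν (ω.1 + ∑ d, sel ω.2 A d • v d)) univ ε →
      δ ≤ av f → c ≤ av fun z => av fun k : T => ∏ j, f (z + k • s j) := by
  obtain ⟨c₀, hc₀, N₀, hds⟩ := dense_szemeredi J (half_pos hδ)
  obtain ⟨ε₁, hε₁, hcount⟩ := counting J (Fintype.card J) (half_pos hc₀)
  obtain ⟨ε', hε', hdm⟩ := dense_model (lt_min hε₁ (half_pos hδ))
  set q := 2 ^ Fintype.card (J × J)
  refine ⟨c₀ / 2, half_pos hc₀, min ε₁ (2 * (ε' / 2) ^ q / 2 ^ q), by positivity, N₀, ?_⟩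
  intro T Z _ _ _ _ _ hT s v hv ν f hf0 hfν hLF hNO hδf
  have hν : ∀ F ∈ testFns T v, |av fun x => (ν x - 1) * F x| ≤ ε' := fun F hF =>
    abs_av_mul_testFn_le hε'.le (by
      rw [mul_comm, ← le_div_iff₀ (by positivity)]) (hNO.weaken (min_le_right _ _)) hF
  obtain ⟨f', hf'0, hf'1, hff'⟩ := hdm Z ν f (testFns T v) hf0 hfν
    (fun g hg x => testFns_abs_le hg x) (one_mem_testFns v) (fun g hg => neg_mem_testFns hg)
    (fun g hg h hh => mul_mem_closedConvexHull_testFns hg hh) hν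
  have hind : ∀ φ : Z → ℝ, ∀ j, Indep j fun z (y : J → T) => φ (configForm s j z y) :=
    fun φ j x y t => by dsimp only; rw [configForm_update]
  have h1 := hcount T Z (fun j z y => ν (configForm s j z y)) (fun j z y => f (configForm s j z y))
    (fun j z y => f' (configForm s j z y)) (hind ν) (hind f) (hind f') (fun _ _ _ => hf0 _)
    (fun _ _ _ => hfν _) (fun _ _ _ => hf'0 _) (fun _ _ _ => hf'1 _)
    (hLF.weaken (min_le_left _ _)) (fun o g hg hg0 hg1 =>
      abs_av_mul_prod_le (h := fun x => f x - f' x) hv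
        (fun F hF => (hff' F hF).trans (min_le_left _ _)) o hg
        fun j x y => abs_le.mpr ⟨by linarith [hg0 j x y], hg1 j x y⟩)
    univ card_univ (fun _ _ _ => 0) (fun _ _ _ _ => rfl) (fun _ _ _ => le_rfl)
    (fun _ _ _ => zero_le_one)
  simp only [mem_univ, if_true] at h1
  rw [av_prod_configForm, av_prod_configForm] at h1
  have h2 := (hff' 1 (one_mem_testFns v)).trans (min_le_right _ _)
  simp only [Pi.one_apply, mul_one] at h2
  rw [av_sub] at h2
  have h3 := hds T Z hT s f' hf'0 hf'1 (by linarith [(abs_le.mp h2).2])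
  linarith [(abs_le.mp h1).1]

section Comparison

variable {α Θ : Type*} [Fintype α] [DecidableEq α] [Fintype Θ] [DecidableEq Θ]

lemma sum_prod_compl_le {o : Θ} {ok : Finset (α → Θ)}
    (hok : ∀ τ ∈ ok, ∀ S : Finset α, S.piecewise (fun _ => o) τ ∈ ok) {c : α → Θ → ℝ}
    (h0 : ∀ p, c p o = 1) (hc : ∀ p θ, 0 ≤ c p θ) (S : Finset α) :
    ∑ τ ∈ ok, ∏ p ∈ Sᶜ, c p (τ p) ≤ (Fintype.card Θ : ℝ) ^ #S * ∑ τ ∈ ok, ∏ p, c p (τ p) := by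
  have e : ∀ τ : α → Θ, ∏ p ∈ Sᶜ, c p (τ p) = ∏ p, c p (S.piecewise (fun _ => o) τ p) := fun τ => by
    rw [← prod_compl_mul_prod S]
    have h1 : ∏ p ∈ S, c p (S.piecewise (fun _ => o) τ p) = 1 :=
      prod_eq_one fun p hp => by rw [piecewise_eq_of_mem _ _ _ hp, h0]
    rw [h1, mul_one]
    exact prod_congr rfl fun p hp => by
      rw [piecewise_eq_of_notMem _ _ _ (mem_compl.mp hp)]
  rw [sum_congr rfl fun τ _ => e τ, mul_sum, ← sum_fiberwise_of_maps_to (t := ok)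
    (g := fun τ => S.piecewise (fun _ => o) τ) fun τ hτ => hok τ hτ S]
  refine sum_le_sum fun σ hσ => ?_
  rw [sum_congr rfl (g := fun _ => ∏ p, c p (σ p)) fun τ hτ => by rw [(mem_filter.mp hτ).2],
    sum_const, nsmul_eq_mul]
  refine mul_le_mul_of_nonneg_right ?_ (prod_nonneg fun p _ => hc _ _)
  have : #{τ ∈ ok | S.piecewise (fun _ => o) τ = σ} ≤ Fintype.card (S → Θ) := by
    rw [← card_univ]
    refine card_le_card_of_injOn (fun τ p => τ p) (fun _ _ => mem_univ _) fun τ hτ τ' hτ' h => ?_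
    have h1 := (mem_filter.mp hτ).2.trans (mem_filter.mp hτ').2.symm
    funext p
    by_cases hp : p ∈ S
    · exact congrFun h ⟨p, hp⟩
    · simpa [hp] using congrFun h1 p
  calc _ ≤ ((Fintype.card (S → Θ) : ℕ) : ℝ) := by exact_mod_cast this
    _ = _ := by simp

/-- Two sums of products over local states agree up to the contribution of the bad states. -/
lemma abs_sum_prod_sub_le {o : Θ} {ok : Finset (α → Θ)}
    (hok : ∀ τ ∈ ok, ∀ S : Finset α, S.piecewise (fun _ => o) τ ∈ ok) {c c' : α → Θ → ℝ}
    {bad : Θ → Prop} {κ : α → ℝ} (hκ : ∀ p, 0 ≤ κ p) (h0 : ∀ p, c' p o = 1)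
    (hc' : ∀ p θ, 0 ≤ c' p θ) (hgood : ∀ p θ, ¬ bad θ → c p θ = c' p θ)
    (hbad : ∀ p θ, bad θ → |c p θ| ≤ κ p) (hbad' : ∀ p θ, bad θ → c' p θ ≤ κ p) :
    |∑ τ ∈ ok, ∏ p, c p (τ p) - ∑ τ ∈ ok, ∏ p, c' p (τ p)| ≤
      2 * (∏ p, (1 + Fintype.card Θ * κ p) - 1) * ∑ τ ∈ ok, ∏ p, c' p (τ p) := by
  classical
  have h1 : ∀ τ : α → Θ, |∏ p, c p (τ p) - ∏ p, c' p (τ p)| ≤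
      2 * ∑ S ∈ univ.powerset.erase (∅ : Finset α), (∏ p ∈ S, κ p) * ∏ p ∈ Sᶜ, c' p (τ p) := by
    intro τ
    set B : Finset α := {p | bad (τ p)} with hB
    have hmem : ∀ p, p ∈ B ↔ bad (τ p) := fun p => by simp [hB]
    have hnn : ∀ S : Finset α, 0 ≤ (∏ p ∈ S, κ p) * ∏ p ∈ Sᶜ, c' p (τ p) := fun S =>
      mul_nonneg (prod_nonneg fun p _ => hκ p) (prod_nonneg fun p _ => hc' _ _)
    by_cases hBe : B = ∅
    · have : ∏ p, c p (τ p) = ∏ p, c' p (τ p) := prod_congr rfl fun p _ =>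
        hgood _ _ fun hp => by simpa [hBe] using (hmem p).mpr hp
      rw [this, sub_self, abs_zero]
      exact mul_nonneg zero_le_two (sum_nonneg fun S _ => hnn S)
    · have h2 : |∏ p, c p (τ p)| ≤ (∏ p ∈ B, κ p) * ∏ p ∈ Bᶜ, c' p (τ p) := by
        rw [← prod_mul_prod_compl B, abs_mul, abs_prod, abs_prod]
        gcongr with p hp p hp
        · exact prod_nonneg fun p _ => hκ p
        · exact hbad _ _ ((hmem p).mp hp)
        · rw [hgood _ _ fun h => (mem_compl.mp hp) ((hmem p).mpr h), abs_of_nonneg (hc' _ _)]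
      have h3 : |∏ p, c' p (τ p)| ≤ (∏ p ∈ B, κ p) * ∏ p ∈ Bᶜ, c' p (τ p) := by
        rw [← prod_mul_prod_compl B, abs_mul, abs_of_nonneg (prod_nonneg fun p _ => hc' _ _),
          abs_of_nonneg (prod_nonneg fun p _ => hc' _ _)]
        refine mul_le_mul_of_nonneg_right ?_ (prod_nonneg fun p _ => hc' _ _)
        exact prod_le_prod (fun p _ => hc' _ _) fun p hp => hbad' _ _ ((hmem p).mp hp)
      have h4 := single_le_sum (f := fun S => (∏ p ∈ S, κ p) * ∏ p ∈ Sᶜ, c' p (τ p))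
        (fun S _ => hnn S) (mem_erase.mpr ⟨hBe, mem_powerset.mpr (subset_univ B)⟩)
      have := abs_sub (∏ p, c p (τ p)) (∏ p, c' p (τ p))
      linarith
  have h2 : ∏ p, (1 + Fintype.card Θ * κ p) - 1 =
      ∑ S ∈ univ.powerset.erase (∅ : Finset α), (Fintype.card Θ : ℝ) ^ #S * ∏ p ∈ S, κ p := by
    rw [prod_one_add, ← add_sum_erase _ _ (mem_powerset.mpr (empty_subset _)), prod_empty,
      add_sub_cancel_left]
    exact sum_congr rfl fun S _ => by rw [prod_mul_distrib, prod_const]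
  rw [← sum_sub_distrib, h2]
  refine (abs_sum_le_sum_abs _ _).trans ((sum_le_sum fun τ _ => h1 τ).trans ?_)
  rw [← mul_sum, sum_comm, mul_assoc, sum_mul]
  refine mul_le_mul_of_nonneg_left (sum_le_sum fun S _ => ?_) zero_le_two
  rw [← mul_sum]
  calc _ ≤ (∏ p ∈ S, κ p) * ((Fintype.card Θ : ℝ) ^ #S * ∑ τ ∈ ok, ∏ p, c' p (τ p)) :=
        mul_le_mul_of_nonneg_left (sum_prod_compl_le hok h0 hc' S) (prod_nonneg fun p _ => hκ p)
    _ = _ := by ring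

end Comparison

section Local

variable {T Z I V : Type} {B : Set Z}

/-- The Selberg weight attached to a set of density `g`, namely `g / (1 - g)`. -/
noncomputable def selbergWt (B : Set Z) : ℝ :=
  (av fun x => ind (x ∈ B)) / (1 - av fun x => ind (x ∈ B))

/-- The normalised balanced indicator function of a set. -/
noncomputable def balanced (B : Set Z) (x : Z) : ℝ :=
  selbergWt B - (1 + selbergWt B) * ind (x ∈ B)

lemma balanced_of_mem {x : Z} (hx : x ∈ B) : balanced B x = -1 := by
  rw [balanced, ind_true hx]; ring

lemma balanced_of_notMem {x : Z} (hx : x ∉ B) : balanced B x = selbergWt B := by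
  rw [balanced, ind_false hx]; ring

variable [Finite Z]

lemma selbergWt_nonneg (hB : (av fun x => ind (x ∈ B)) ≤ 1 / 2) : 0 ≤ selbergWt B :=
  div_nonneg (av_nonneg fun _ => ind_nonneg _) (by linarith)

lemma selbergWt_le {β : ℝ} (hB : (av fun x => ind (x ∈ B)) ≤ β) (hβ : β ≤ 1 / 2) :
    selbergWt B ≤ 2 * β := by
  have h0 : 0 ≤ av fun x => ind (x ∈ B) := av_nonneg fun _ => ind_nonneg _
  rw [selbergWt, div_le_iff₀ (by linarith)]
  nlinarith

lemma abs_balanced_le (hB : (av fun x => ind (x ∈ B)) ≤ 1 / 2) (x : Z) : |balanced B x| ≤ 1 := by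
  have h0 := selbergWt_nonneg hB
  have h1 := selbergWt_le hB le_rfl
  by_cases hx : x ∈ B
  · simp [balanced_of_mem hx]
  · rw [balanced_of_notMem hx, abs_of_nonneg h0]; linarith

lemma abs_balanced_le_add (hB : (av fun x => ind (x ∈ B)) ≤ 1 / 2) (x : Z) :
    |balanced B x| ≤ ind (x ∈ B) + selbergWt B := by
  have h0 := selbergWt_nonneg hB
  by_cases hx : x ∈ B
  · rw [balanced_of_mem hx, ind_true hx]; norm_num; exact h0
  · rw [balanced_of_notMem hx, ind_false hx, abs_of_nonneg h0, zero_add]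

lemma av_balanced [Nonempty Z] (hB : (av fun x => ind (x ∈ B)) ≤ 1 / 2) : av (balanced B) = 0 := by
  have h : (1 : ℝ) - (av fun x => ind (x ∈ B)) ≠ 0 := by linarith
  change (av fun x => selbergWt B - (1 + selbergWt B) * ind (x ∈ B)) = 0
  rw [av_sub, av_const, av_mul_left, selbergWt]
  field_simp
  ring

lemma av_balanced_sq [Nonempty Z] (hB : (av fun x => ind (x ∈ B)) ≤ 1 / 2) :
    (av fun x => balanced B x * balanced B x) = selbergWt B := by
  have h : (1 : ℝ) - (av fun x => ind (x ∈ B)) ≠ 0 := by linarith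
  have e : ∀ x, balanced B x * balanced B x =
      selbergWt B ^ 2 + (1 - selbergWt B ^ 2) * ind (x ∈ B) := fun x => by
    rw [balanced]; linear_combination (1 + selbergWt B) ^ 2 * ind_sq (x ∈ B)
  rw [av_congr e, av_add, av_const, av_mul_left, selbergWt]
  field_simp
  ring

section

variable [Field T] [Finite T] [AddCommGroup Z] [Module T Z] [Fintype V]

/-- The affine forms `(z, y) ↦ x + z + ∑ y_v c_v`. -/
def affForm (x : Z) (c : V → Z) (ω : Z × (V → T)) : Z := x + ω.1 + ∑ v, ω.2 v • c v

lemma av_comp_affForm (x : Z) (c : V → Z) (f : Z → ℝ) :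
    (av fun ω : Z × (V → T) => f (affForm x c ω)) = av f := by
  rw [av_prod, av_comm]
  have : ∀ y : V → T, (av fun z => f (affForm x c (z, y))) = av f := fun y => by
    rw [← av_add_right (x + ∑ v, y v • c v) f]
    exact av_congr fun z => by rw [affForm]; congr 1; dsimp only; abel
  rw [av_congr this, av_const]

lemma av_ind_mul_ind_le [DecidableEq V] {β : ℝ} (hB : (av fun x => ind (x ∈ B)) ≤ β) (hβ : 0 ≤ β) {c c' : V → Z}
    {v : V} (hv : ∀ ξ : Z, (av fun t : T => ind (ξ + t • (c' v - c v) ∈ B)) ≤ β) (x x' : Z) :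
    (av fun ω : Z × (V → T) => ind (affForm x c ω ∈ B) * ind (affForm x' c' ω ∈ B)) ≤ β ^ 2 := by
  rw [av_prod, av_comm]
  have h1 : ∀ y : V → T, (av fun z => ind (affForm x c (z, y) ∈ B) * ind (affForm x' c' (z, y) ∈ B))
      = av fun z => ind (z ∈ B) * ind (z + (x' - x) + ∑ v, y v • (c' v - c v) ∈ B) := fun y => by
    rw [← av_add_right (x + ∑ v, y v • c v) fun z =>
      ind (z ∈ B) * ind (z + (x' - x) + ∑ v, y v • (c' v - c v) ∈ B)]
    refine av_congr fun z => ?_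
    simp only [affForm, smul_sub, sum_sub_distrib]
    congr 3 <;> abel
  rw [av_congr h1, av_comm]
  have h2 : ∀ z, (av fun y : V → T => ind (z + (x' - x) + ∑ v, y v • (c' v - c v) ∈ B)) ≤ β := by
    intro z
    rw [← av_update v]
    refine av_le fun y => ?_
    refine le_trans (le_of_eq ?_)
      (hv (z + (x' - x) + ∑ u ∈ univ.erase v, y u • (c' u - c u)))
    refine av_congr fun t => ?_
    rw [← add_sum_erase _ _ (mem_univ v), update_self, sum_congr rfl fun u hu => by
      rw [update_of_ne (ne_of_mem_erase hu)]]
    congr 2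
    abel
  calc _ ≤ av fun z => ind (z ∈ B) * β := av_mono fun z => by
        rw [av_mul_left]; exact mul_le_mul_of_nonneg_left (h2 z) (ind_nonneg _)
    _ = (av fun z => ind (z ∈ B)) * β := av_mul_right _ _
    _ ≤ β ^ 2 := by rw [sq]; exact mul_le_mul_of_nonneg_right hB hβ

/-- The local correlations of balanced functions along affine forms. -/
noncomputable def corr (T : Type) [Field T] [Module T Z] (B : Set Z) (c : I → V → Z) (x : I → Z)
    (θ : Finset (I × Bool)) : ℝ :=
  av fun ω : Z × (V → T) => ∏ i ∈ θ, balanced B (affForm (x i.1) (c i.1) ω)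

end

/-- The value of the local correlations for independent forms. -/
noncomputable def indepCorr [Fintype I] [DecidableEq I] (B : Set Z) (θ : Finset (I × Bool)) : ℝ :=
  ∏ a, if (a, true) ∈ θ then if (a, false) ∈ θ then selbergWt B else 0
    else if (a, false) ∈ θ then 0 else 1

/-- A set of factors involving at least two forms. -/
def Mixed (θ : Finset (I × Bool)) : Prop := ∃ i ∈ θ, ∃ j ∈ θ, i.1 ≠ j.1

variable [Fintype I] [DecidableEq I]

omit [Finite Z] in
lemma indepCorr_empty : indepCorr B (∅ : Finset (I × Bool)) = 1 := by simp [indepCorr]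

lemma indepCorr_nonneg (hB : (av fun x => ind (x ∈ B)) ≤ 1 / 2) (θ : Finset (I × Bool)) :
    0 ≤ indepCorr B θ := by
  refine prod_nonneg fun a _ => ?_
  split_ifs
  exacts [selbergWt_nonneg hB, le_rfl, le_rfl, zero_le_one]

lemma indepCorr_le (hB : (av fun x => ind (x ∈ B)) ≤ 1 / 2) {θ : Finset (I × Bool)}
    (hθ : Mixed θ) : indepCorr B θ ≤ selbergWt B ^ 2 := by
  obtain ⟨⟨a, s⟩, ha, ⟨b, t⟩, hb, hab⟩ := hθ
  have h0 := selbergWt_nonneg hB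
  have h1 := selbergWt_le hB le_rfl
  set F : I → ℝ := fun a => if (a, true) ∈ θ then if (a, false) ∈ θ then selbergWt B else 0
    else if (a, false) ∈ θ then 0 else 1
  have hF0 : ∀ a, 0 ≤ F a := fun a => by dsimp only [F]; split_ifs <;> first | exact h0 | simp
  have hF1 : ∀ a, F a ≤ 1 := fun a => by
    dsimp only [F]; split_ifs <;> linarith
  have hF : ∀ a s, (a, s) ∈ θ → F a ≤ selbergWt B := fun a s h => by
    dsimp only [F]
    cases s <;> simp only [h, if_true] <;> split_ifs <;> first | exact le_rfl | exact h0
  calc indepCorr B θ = ∏ a, F a := rfl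
    _ = F a * (F b * ∏ i ∈ (univ.erase a).erase b, F i) := by
      rw [← mul_prod_erase univ F (mem_univ a), ← mul_prod_erase (univ.erase a) F
        (mem_erase.mpr ⟨fun h => hab h.symm, mem_univ b⟩)]
    _ ≤ selbergWt B * (selbergWt B * 1) := by
      have hP : 0 ≤ ∏ i ∈ (univ.erase a).erase b, F i := prod_nonneg fun i _ => hF0 i
      exact mul_le_mul (hF a s ha) (mul_le_mul (hF b t hb)
        (prod_le_one (fun i _ => hF0 i) fun i _ => hF1 i) hP h0)
        (mul_nonneg (hF0 b) hP) h0
    _ = _ := by ring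

variable [Field T] [Finite T] [AddCommGroup Z] [Module T Z] [Fintype V]

lemma corr_eq_of_not_mixed (hB : (av fun x => ind (x ∈ B)) ≤ 1 / 2) (c : I → V → Z) (x : I → Z)
    {θ : Finset (I × Bool)} (hθ : ¬ Mixed θ) : corr T B c x θ = indepCorr B θ := by
  rcases θ.eq_empty_or_nonempty with rfl | ⟨⟨a, s⟩, ha⟩
  · rw [indepCorr_empty]; simp [corr, av_const]
  have hθa : ∀ i ∈ θ, i.1 = a := fun i hi => by
    by_contra h; exact hθ ⟨i, hi, _, ha, h⟩
  have e1 : indepCorr B θ = if (a, true) ∈ θ then if (a, false) ∈ θ then selbergWt B else 0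
    else if (a, false) ∈ θ then 0 else 1 := by
    refine prod_eq_single a (fun b _ hb => ?_) (by simp)
    rw [if_neg fun h => hb (hθa _ h), if_neg fun h => hb (hθa _ h)]
  have e2 : corr T B c x θ = av fun z => ∏ i ∈ θ, balanced B z := by
    rw [← av_comp_affForm (T := T) (x a) (c a)]
    exact av_congr fun ω => prod_congr rfl fun i hi => by rw [hθa i hi]
  rw [e1, e2]
  simp only [prod_const]
  have hcase : ∀ φ : Finset (I × Bool), (∀ i, i ∈ θ ↔ i ∈ φ) → θ = φ := fun φ h => ext h
  by_cases ht : (a, true) ∈ θ <;> by_cases hf : (a, false) ∈ θ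
  · have : θ = {(a, true), (a, false)} := by
      ext ⟨b, u⟩
      refine ⟨fun h => ?_, fun h => ?_⟩
      · obtain rfl := hθa _ h
        cases u <;> simp
      · rcases mem_insert.mp h with h | h
        · rwa [h]
        · rwa [mem_singleton.mp h]
    have hc : #θ = 2 := by rw [this]; exact card_pair (by simp)
    rw [if_pos ht, if_pos hf, hc, ← av_balanced_sq hB]
    exact av_congr fun z => sq _
  · have hc : #θ = 1 := card_eq_one.mpr ⟨(a, true), by
      ext ⟨b, u⟩
      rw [mem_singleton]
      refine ⟨fun h => ?_, fun h => by rwa [h]⟩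
      obtain rfl := hθa _ h
      cases u
      · exact absurd h hf
      · rfl⟩
    rw [if_pos ht, if_neg hf, hc, ← av_balanced hB]
    exact av_congr fun z => pow_one _
  · have hc : #θ = 1 := card_eq_one.mpr ⟨(a, false), by
      ext ⟨b, u⟩
      rw [mem_singleton]
      refine ⟨fun h => ?_, fun h => by rwa [h]⟩
      obtain rfl := hθa _ h
      cases u
      · rfl
      · exact absurd h ht⟩
    rw [if_neg ht, if_pos hf, hc, ← av_balanced hB]
    exact av_congr fun z => pow_one _
  · cases s
    · exact absurd ha hf
    · exact absurd ha ht

omit [Fintype I] in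
lemma abs_corr_le [DecidableEq V] {β : ℝ} (hB : (av fun x => ind (x ∈ B)) ≤ β) (hβ0 : 0 ≤ β) (hβ : β ≤ 1 / 2)
    {c : I → V → Z} (hc : ∀ a a', a ≠ a' → ∃ v, ∀ ξ : Z,
      (av fun t : T => ind (ξ + t • (c a' v - c a v) ∈ B)) ≤ β) (x : I → Z)
    {θ : Finset (I × Bool)} (hθ : Mixed θ) : |corr T B c x θ| ≤ 9 * β ^ 2 := by
  obtain ⟨i, hi, j, hj, hij⟩ := hθ
  obtain ⟨v, hv⟩ := hc _ _ hij
  have hB' := hB.trans hβ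
  have h0 := selbergWt_nonneg hB'
  have h1 := selbergWt_le hB hβ
  have hav : ∀ i : I × Bool, (av fun ω : Z × (V → T) => ind (affForm (x i.1) (c i.1) ω ∈ B)) ≤ β :=
    fun i => by rw [av_comp_affForm _ _ fun z => ind (z ∈ B)]; exact hB
  have h2 := av_ind_mul_ind_le hB hβ0 hv (x i.1) (x j.1)
  have e : ∀ ω : Z × (V → T), |∏ i ∈ θ, balanced B (affForm (x i.1) (c i.1) ω)| ≤
      ind (affForm (x i.1) (c i.1) ω ∈ B) * ind (affForm (x j.1) (c j.1) ω ∈ B) +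
      selbergWt B * ind (affForm (x i.1) (c i.1) ω ∈ B) +
      selbergWt B * ind (affForm (x j.1) (c j.1) ω ∈ B) + selbergWt B ^ 2 := fun ω => by
    have hj' : j ∈ θ.erase i := mem_erase.mpr ⟨fun h => hij (by rw [h]), hj⟩
    rw [← mul_prod_erase θ _ hi, ← mul_prod_erase _ _ hj', abs_mul, abs_mul]
    have h3 := abs_balanced_le_add hB' (affForm (x i.1) (c i.1) ω)
    have h4 := abs_balanced_le_add hB' (affForm (x j.1) (c j.1) ω)
    have h5 : |∏ i ∈ (θ.erase i).erase j, balanced B (affForm (x i.1) (c i.1) ω)| ≤ 1 :=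
      abs_prod_le_one fun i _ => abs_balanced_le hB' _
    have h6 : 0 ≤ ind (affForm (x i.1) (c i.1) ω ∈ B) + selbergWt B :=
      add_nonneg (ind_nonneg _) h0
    have h7 : 0 ≤ ind (affForm (x j.1) (c j.1) ω ∈ B) + selbergWt B :=
      add_nonneg (ind_nonneg _) h0
    calc _ ≤ (ind (affForm (x i.1) (c i.1) ω ∈ B) + selbergWt B) *
          ((ind (affForm (x j.1) (c j.1) ω ∈ B) + selbergWt B) * 1) := by gcongr
      _ = _ := by ring
  refine (abs_av_le _).trans ((av_mono e).trans ?_)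
  rw [av_add, av_add, av_add, av_mul_left, av_mul_left, av_const]
  have h3 := mul_le_mul h1 (hav i) (av_nonneg fun _ => ind_nonneg _) (by positivity)
  have h4 := mul_le_mul h1 (hav j) (av_nonneg fun _ => ind_nonneg _) (by positivity)
  have h5 := pow_le_pow_left₀ h0 h1 2
  linarith

end Local

section Wrap

lemma av_ind_le_of_injective {X : Type*} [Finite X] {P : X → Prop} {g : X → ℤ} (hg : Injective g)
    {s : Finset ℤ} (h : ∀ x, P x → g x ∈ s) : (av fun x => ind (P x)) ≤ #s / Nat.card X := by
  classical
  have := Fintype.ofFinite X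
  rw [av_eq, Nat.card_eq_fintype_card]
  gcongr
  calc ∑ x, ind (P x) ≤ ∑ x, if g x ∈ s then (1 : ℝ) else 0 := sum_le_sum fun x _ => by
        by_cases hx : P x
        · rw [ind_true hx, if_pos (h x hx)]
        · rw [ind_false hx]; split_ifs <;> simp
    _ = #{x | g x ∈ s} := by simp
    _ ≤ #s := by
        exact_mod_cast card_le_card_of_injOn g (fun x hx => (mem_filter.mp hx).2) hg.injOn

lemma av_ind_valMinAbs_add_le {N : ℕ} [NeZero N] {E : ℕ} {e : ℤ} (he : |e| ≤ E) :
    (av fun x : ZMod N => ind ((x + e).valMinAbs ≠ x.valMinAbs + e)) ≤ (2 * E + 2) / N := by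
  have h := av_ind_le_of_injective (P := fun x : ZMod N => (x + e).valMinAbs ≠ x.valMinAbs + e)
    (ZMod.injective_valMinAbs (n := N))
    (s := Ioc ((N : ℤ) / 2 - E) (N / 2) ∪ Ioc (-(N : ℤ) / 2 - 1) (-(N : ℤ) / 2 + E + 1)) ?_
  · refine h.trans ?_
    rw [Nat.card_zmod]
    gcongr
    have := card_union_le (Ioc ((N : ℤ) / 2 - E) (N / 2))
      (Ioc (-(N : ℤ) / 2 - 1) (-(N : ℤ) / 2 + E + 1))
    have h2 : #(Ioc ((N : ℤ) / 2 - E) (N / 2)) + #(Ioc (-(N : ℤ) / 2 - 1) (-(N : ℤ) / 2 + E + 1))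
        = 2 * E + 2 := by
      rw [Int.card_Ioc, Int.card_Ioc]; omega
    exact_mod_cast this.trans h2.le
  · intro x hx
    have h1 := ZMod.valMinAbs_mem_Ioc x
    have h2 : ¬ (x.valMinAbs + e) * 2 ∈ Set.Ioc (-N : ℤ) N := fun h' =>
      hx ((ZMod.valMinAbs_spec _ _).mpr ⟨by simp, h'⟩)
    rw [Set.mem_Ioc] at h1 h2
    rw [abs_le] at he
    rw [mem_union, mem_Ioc, mem_Ioc]
    omega

variable {ι I V : Type} [Fintype ι] [Fintype I] [Fintype V] {N : ℕ}

/-- Reduction of an integer vector. -/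
def red (m : ℕ) (x : ι → ℤ) : ι → ZMod m := fun i => (x i : ZMod m)

/-- The lift of a vector of residues to the smallest integer vector. -/
def lift (x : ι → ZMod N) : ι → ℤ := fun i => (x i).valMinAbs

omit [Fintype ι] in
lemma red_lift (x : ι → ZMod N) : red N (lift x) = x := funext fun _ => ZMod.coe_valMinAbs _

omit [Fintype ι] in
lemma red_add (m : ℕ) (x y : ι → ℤ) : red m (x + y) = red m x + red m y :=
  funext fun _ => Int.cast_add _ _

omit [Fintype ι] in
lemma red_form (m : ℕ) (h : ι → ℤ) (k : V → ℤ) (c : V → ι → ℤ) :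
    red m (h + ∑ v, k v • c v) = red m h + ∑ v, red m k v • red m (c v) := by
  funext i
  simp [red]

variable [Fact N.Prime]

lemma abs_av_sub_av_shift_le (c : I → V → ι → ℤ) {H : Type*} [Finite H] [Nonempty H]
    (h : H → ι → ℤ) (k : H → V → ℤ) {E : ℕ}
    (hE : ∀ η a i, |(h η + ∑ v, k η v • c a v) i| ≤ E) {F : (I → ι → ℤ) → ℝ} (hF : ∀ x, |F x| ≤ 1) :
    |(av fun ω : (ι → ZMod N) × (V → ZMod N) =>
        F fun a => lift (affForm 0 (fun v => red N (c a v)) ω)) -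
      av fun ω : (ι → ZMod N) × (V → ZMod N) => av fun η =>
        F fun a => lift (affForm 0 (fun v => red N (c a v)) ω) + (h η + ∑ v, k η v • c a v)| ≤
      2 * (Fintype.card I * (Fintype.card ι * ((2 * E + 2) / N))) := by
  set L : I → (ι → ZMod N) × (V → ZMod N) → ι → ZMod N :=
    fun a => affForm 0 (fun v => red N (c a v)) with hL
  set e : H → I → ι → ℤ := fun η a => h η + ∑ v, k η v • c a v with he
  have hshift : ∀ η a ω, L a (ω + (red N (h η), red N (k η))) = L a ω + red N (e η a) := by
    intro η a ω
    simp only [hL, he, affForm, red_form, Prod.fst_add, Prod.snd_add, Pi.add_apply, add_smul,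
      sum_add_distrib]
    abel
  have h1 : (av fun ω => F fun a => lift (L a ω)) =
      av fun ω => av fun η => F fun a => lift (L a ω + red N (e η a)) := by
    rw [av_comm]
    refine ((av_congr fun η => ?_).trans (av_const _)).symm
    rw [← av_add_right (red N (h η), red N (k η)) fun ω => F fun a => lift (L a ω)]
    exact av_congr fun ω => by simp only [hshift]
  rw [h1, ← av_sub, av_congr fun ω => (av_sub _ _).symm, av_comm]
  refine (abs_av_le _).trans (av_le fun η => (abs_av_le _).trans ?_)
  calc _ ≤ av fun ω => 2 * ∑ a, ∑ i,
        ind ((L a ω i + (e η a i : ZMod N)).valMinAbs ≠ (L a ω i).valMinAbs + e η a i) :=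
        av_mono fun ω => ?_
    _ = 2 * ∑ a, ∑ i, av fun ω =>
        ind ((L a ω i + (e η a i : ZMod N)).valMinAbs ≠ (L a ω i).valMinAbs + e η a i) := by
        rw [av_mul_left, av_sum]
        simp only [av_sum]
    _ ≤ 2 * ∑ a : I, ∑ i : ι, ((2 * E + 2 : ℝ) / N) := by
        gcongr with a _ i _
        rw [hL, av_comp_affForm (T := ZMod N) 0 (fun v => red N (c a v)) fun z : ι → ZMod N =>
          ind ((z i + (e η a i : ZMod N)).valMinAbs ≠ (z i).valMinAbs + e η a i),
          av_eval (X := fun _ => ZMod N) i fun t => ind ((t + (e η a i : ZMod N)).valMinAbs ≠ t.valMinAbs + e η a i)]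
        exact av_ind_valMinAbs_add_le (hE η a i)
    _ = _ := by simp
  change |F (fun a => lift (L a ω + red N (e η a))) - F (fun a => lift (L a ω) + e η a)| ≤ _
  by_cases hbad : ∃ a i, (L a ω i + (e η a i : ZMod N)).valMinAbs ≠ (L a ω i).valMinAbs + e η a i
  · obtain ⟨a, i, hai⟩ := hbad
    have h2 : 1 ≤ ∑ a, ∑ i, ind ((L a ω i + (e η a i : ZMod N)).valMinAbs ≠
        (L a ω i).valMinAbs + e η a i) := by
      rw [← ind_true hai]
      exact (single_le_sum (f := fun i => ind ((L a ω i + (e η a i : ZMod N)).valMinAbs ≠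
        (L a ω i).valMinAbs + e η a i)) (fun _ _ => ind_nonneg _) (mem_univ i)).trans
        (single_le_sum (f := fun a => ∑ i, ind ((L a ω i + (e η a i : ZMod N)).valMinAbs ≠
        (L a ω i).valMinAbs + e η a i)) (fun _ _ => sum_nonneg fun _ _ => ind_nonneg _) (mem_univ a))
    have h3 := hF (fun a => lift (L a ω + red N (e η a)))
    have h4 := hF (fun a => lift (L a ω) + e η a)
    refine (abs_sub _ _).trans ?_
    linarith
  · push Not at hbad
    have h3 : (fun a => lift (L a ω + red N (e η a))) = fun a => lift (L a ω) + e η a := by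
      funext a i
      exact hbad a i
    rw [h3, sub_self, abs_zero]
    exact mul_nonneg zero_le_two (sum_nonneg fun _ _ => sum_nonneg fun _ _ => ind_nonneg _)

end Wrap

section CRT

/-- Averages over residues modulo a product of coprime moduli factor. -/
lemma av_prod_castHom {β κ κ' : Type} [Fintype β] [Finite κ] [Finite κ'] {q : β → ℕ} [∀ p, NeZero (q p)]
    (hq : Pairwise (Nat.Coprime on q)) (F : ∀ p, (κ → ZMod (q p)) × (κ' → ZMod (q p)) → ℝ) :
    (av fun ω : (κ → ZMod (∏ p, q p)) × (κ' → ZMod (∏ p, q p)) =>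
      ∏ p, F p (fun i => ZMod.castHom (dvd_prod_of_mem q (mem_univ p)) _ (ω.1 i),
        fun i => ZMod.castHom (dvd_prod_of_mem q (mem_univ p)) _ (ω.2 i))) = ∏ p, av (F p) := by
  let e := ZMod.prodEquivPi q hq
  let E : (κ → ZMod (∏ p, q p)) × (κ' → ZMod (∏ p, q p)) ≃
      ∀ p, (κ → ZMod (q p)) × (κ' → ZMod (q p)) :=
    { toFun := fun ω p => (fun i => e (ω.1 i) p, fun i => e (ω.2 i) p)
      invFun := fun x => (fun i => e.symm fun p => (x p).1 i, fun i => e.symm fun p => (x p).2 i)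
      left_inv := fun ω => by simp
      right_inv := fun x => by simp }
  rw [← av_prod_eval, ← av_comp_equiv E]
  refine av_congr fun ω => prod_congr rfl fun p _ => ?_
  simp only [E, e, Equiv.coe_fn_mk, ZMod.prodEquivPi_apply]

end CRT

section Sieve

variable {α ι : Type} [DecidableEq α] {q : α → ℕ}

/-- The total weight of a family of squarefree moduli. -/
noncomputable def sieveMass (B : ∀ p, Set (ι → ZMod (q p))) (𝓓 : Finset (Finset α)) : ℝ :=
  ∑ r ∈ 𝓓, ∏ p ∈ r, selbergWt (B p)

/-- The sum of the products of the balanced functions over a family of squarefree moduli. -/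
noncomputable def sieveSum (B : ∀ p, Set (ι → ZMod (q p))) (𝓓 : Finset (Finset α)) (x : ι → ℤ) : ℝ :=
  ∑ r ∈ 𝓓, ∏ p ∈ r, balanced (B p) (red (q p) x)

/-- The Selberg majorant. -/
noncomputable def majorant (B : ∀ p, Set (ι → ZMod (q p))) (𝓓 : Finset (Finset α)) (x : ι → ℤ) : ℝ :=
  sieveSum B 𝓓 x ^ 2 / sieveMass B 𝓓

omit [DecidableEq α] in
lemma majorant_of_notMem {B : ∀ p, Set (ι → ZMod (q p))} {𝓓 : Finset (Finset α)} {x : ι → ℤ}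
    (hx : ∀ r ∈ 𝓓, ∀ p ∈ r, red (q p) x ∉ B p) (h0 : sieveMass B 𝓓 ≠ 0) :
    majorant B 𝓓 x = sieveMass B 𝓓 := by
  have : sieveSum B 𝓓 x = sieveMass B 𝓓 :=
    sum_congr rfl fun r hr => prod_congr rfl fun p hp => balanced_of_notMem (hx r hr p hp)
  rw [majorant, this, sq, mul_div_assoc, div_self h0, mul_one]

variable {I : Type} [Fintype I] [DecidableEq I]

/-- The moduli attached to a choice of factors, prime by prime. -/
def flipFin {S : Type} [Fintype S] (ρ : S → Finset α) (p : α) : Finset S := {i | p ∈ ρ i}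

lemma prod_majorant {B : ∀ p, Set (ι → ZMod (q p))} {𝓓 : Finset (Finset α)} [Fintype α]
    (x : I → ι → ℤ) :
    ∏ a, majorant B 𝓓 (x a) = (∑ ρ ∈ Fintype.piFinset fun _ : I × Bool => 𝓓,
      ∏ p, ∏ i ∈ flipFin ρ p, balanced (B p) (red (q p) (x i.1))) / sieveMass B 𝓓 ^ Fintype.card I := by
  have h1 : ∏ a, sieveSum B 𝓓 (x a) ^ 2 = ∏ i : I × Bool, sieveSum B 𝓓 (x i.1) := by
    rw [Fintype.prod_prod_type]
    simp [sq]
  simp only [majorant, prod_div_distrib, prod_const, card_univ]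
  rw [h1]
  simp only [sieveSum, prod_univ_sum]
  congr 1
  refine sum_congr rfl fun ρ _ => ?_
  simp only [flipFin]
  rw [prod_sigma', prod_sigma']
  refine prod_nbij' (fun s => ⟨s.2, s.1⟩) (fun s => ⟨s.2, s.1⟩) ?_ ?_ ?_ ?_ ?_ <;> simp

lemma sum_prod_indepCorr {B : ∀ p, Set (ι → ZMod (q p))} {𝓓 : Finset (Finset α)} [Fintype α] :
    ∑ ρ ∈ Fintype.piFinset fun _ : I × Bool => 𝓓, ∏ p, indepCorr (B p) (flipFin ρ p) =
      sieveMass B 𝓓 ^ Fintype.card I := by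
  have h1 : sieveMass B 𝓓 ^ Fintype.card I = ∏ _a : I, sieveMass B 𝓓 := by simp
  rw [h1]
  simp only [sieveMass, prod_univ_sum]
  symm
  refine sum_of_injOn (fun r i => r i.1) ?_ ?_ ?_ ?_
  · intro r _ r' _ h
    funext a
    exact congrFun h (a, true)
  · intro r hr
    rw [mem_coe, Fintype.mem_piFinset] at *
    exact fun i => hr i.1
  · intro ρ hρ hρ'
    have h2 : ∃ a, ρ (a, true) ≠ ρ (a, false) := by
      by_contra! h
      refine hρ' ⟨fun a => ρ (a, true), ?_, ?_⟩
      · rw [mem_coe, Fintype.mem_piFinset] at *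
        exact fun a => hρ _
      · funext ⟨a, b⟩
        cases b
        · exact h a
        · rfl
    obtain ⟨a, ha⟩ := h2
    obtain ⟨p, hp⟩ : ∃ p, ¬ (p ∈ ρ (a, true) ↔ p ∈ ρ (a, false)) := by
      by_contra! h
      exact ha (ext h)
    refine prod_eq_zero (mem_univ p) (prod_eq_zero (mem_univ a) ?_)
    simp only [flipFin, mem_filter, mem_univ, true_and]
    split_ifs <;> tauto
  · intro r _
    have h3 : ∀ p, indepCorr (B p) (flipFin (fun i : I × Bool => r i.1) p) =
        ∏ a, if p ∈ r a then selbergWt (B p) else 1 := fun p => by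
      refine prod_congr rfl fun a _ => ?_
      simp only [flipFin, mem_filter, mem_univ, true_and]
      split_ifs <;> rfl
    simp only [h3]
    rw [prod_comm]
    exact prod_congr rfl fun a _ => by rw [prod_ite_mem, univ_inter]

end Sieve

section LinearForms

variable {α ι I V : Type} [DecidableEq α] [Fintype ι] [Fintype I] [Fintype V]
  {q : α → ℕ} [∀ p, Fact (q p).Prime] {N : ℕ} [Fact N.Prime]

omit [DecidableEq α] in
/-- The correlation sum attached to a choice of factors is asymptotically an Euler product. -/
lemma abs_av_prod_sub_le [Fintype α] (hq : Injective q) (B : ∀ p, Set (ι → ZMod (q p)))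
    (hB : ∀ p, (av fun x => ind (x ∈ B p)) ≤ 1 / 2) (c : I → V → ι → ℤ) {C : ℕ}
    (hC : ∀ a v i, |c a v i| ≤ C) (θ : α → Finset (I × Bool)) {r : Finset α}
    (hr : ∀ p, p ∉ r → θ p = ∅) {M : ℕ} (hM : ∏ p ∈ r, q p ≤ M) :
    |(av fun ω : (ι → ZMod N) × (V → ZMod N) => ∏ p, ∏ i ∈ θ p,
        balanced (B p) (red (q p) (lift (affForm 0 (fun v => red N (c i.1 v)) ω)))) -
      av fun ω : (ι → ZMod N) × (V → ZMod N) => ∏ p, corr (ZMod (q p)) (B p)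
        (fun a v => red (q p) (c a v))
        (fun a => red (q p) (lift (affForm 0 (fun v => red N (c a v)) ω))) (θ p)| ≤
      2 * (Fintype.card I * (Fintype.card ι *
        ((2 * ((1 + Fintype.card V * C) * M : ℕ) + 2) / N))) := by
  have hm : ∏ p : r, q p = ∏ p ∈ r, q p := prod_coe_sort r q
  have : NeZero (∏ p : r, q p) := ⟨prod_ne_zero_iff.mpr fun p _ => (Fact.out : (q p).Prime).ne_zero⟩
  set m := ∏ p : r, q p with hmdef
  let F : (I → ι → ℤ) → ℝ := fun x => ∏ p, ∏ i ∈ θ p, balanced (B p) (red (q p) (x i.1))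
  have hF : ∀ x, |F x| ≤ 1 := fun x => abs_prod_le_one fun p _ =>
    abs_prod_le_one fun i _ => abs_balanced_le (hB p) _
  let h : (ι → ZMod m) × (V → ZMod m) → ι → ℤ := fun η i => (η.1 i).val
  let k : (ι → ZMod m) × (V → ZMod m) → V → ℤ := fun η v => (η.2 v).val
  have hval : ∀ t : ZMod m, ((t.val : ℤ)) ≤ M := fun t => by
    exact_mod_cast (ZMod.val_lt t).le.trans (hm ▸ hM)
  have hE : ∀ η a i, |(h η + ∑ v, k η v • c a v) i| ≤ ((1 + Fintype.card V * C) * M : ℕ) := by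
    intro η a i
    simp only [Pi.add_apply, Finset.sum_apply, Pi.smul_apply, smul_eq_mul]
    calc _ ≤ |h η i| + ∑ v, |k η v * c a v i| :=
          (abs_add_le _ _).trans (add_le_add_right (abs_sum_le_sum_abs _ _) _)
      _ ≤ M + ∑ _v : V, (M * C : ℤ) := by
          gcongr with v
          · rw [abs_of_nonneg (Int.natCast_nonneg _)]; exact hval _
          · rw [abs_mul]
            refine mul_le_mul ?_ (hC a v i) (abs_nonneg _) (Int.natCast_nonneg _)
            rw [abs_of_nonneg (Int.natCast_nonneg _)]; exact hval _
      _ = _ := by simp; ring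
  have key := abs_av_sub_av_shift_le (N := N) c h k hE hF
  refine le_of_eq_of_le (congrArg abs (congrArg₂ _ rfl (av_congr fun ω => ?_))) key
  have hcop : Pairwise (Nat.Coprime on fun p : r => q p) := fun p p' hp =>
    (Nat.coprime_primes Fact.out Fact.out).mpr fun h => hp (Subtype.ext (hq h))
  have h1 := av_prod_castHom (κ := ι) (κ' := V) hcop fun p ω' => ∏ i ∈ θ p,
    balanced (B p) (affForm (red (q p) (lift (affForm 0 (fun v => red N (c i.1 v)) ω)))
      (fun v => red (q p) (c i.1 v)) ω')
  have h2 : ∏ p, corr (ZMod (q p)) (B p) (fun a v => red (q p) (c a v))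
      (fun a => red (q p) (lift (affForm 0 (fun v => red N (c a v)) ω))) (θ p) =
      ∏ p : r, corr (ZMod (q p)) (B p) (fun a v => red (q p) (c a v))
      (fun a => red (q p) (lift (affForm 0 (fun v => red N (c a v)) ω))) (θ p) := by
    rw [prod_coe_sort r fun p => corr (ZMod (q p)) (B p) (fun a v => red (q p) (c a v))
      (fun a => red (q p) (lift (affForm 0 (fun v => red N (c a v)) ω))) (θ p)]
    refine (prod_subset (subset_univ r) fun p _ hp => ?_).symm
    rw [hr p hp, corr]
    simp [av_const]
  rw [h2]
  refine h1.symm.trans (av_congr fun η => ?_)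
  have h3 : F (fun a => lift (affForm 0 (fun v => red N (c a v)) ω) + (h η + ∑ v, k η v • c a v)) =
      ∏ p : r, ∏ i ∈ θ p, balanced (B p) (red (q p)
        (lift (affForm 0 (fun v => red N (c i.1 v)) ω) + (h η + ∑ v, k η v • c i.1 v))) := by
    rw [prod_coe_sort r fun p => ∏ i ∈ θ p, balanced (B p) (red (q p)
        (lift (affForm 0 (fun v => red N (c i.1 v)) ω) + (h η + ∑ v, k η v • c i.1 v)))]
    refine (prod_subset (subset_univ r) fun p _ hp => ?_).symm
    rw [hr p hp, prod_empty]
  rw [h3]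
  refine prod_congr rfl fun p _ => prod_congr rfl fun i _ => ?_
  have hcast : ∀ t : ZMod m, ZMod.castHom (dvd_prod_of_mem (fun p : r => q p) (mem_univ p))
      (ZMod (q p)) t = (((t.val : ℕ) : ℤ) : ZMod (q p)) := fun t => by
    rw [ZMod.castHom_apply, Int.cast_natCast, ZMod.natCast_val]
  rw [red_add, red_form, affForm, add_assoc]
  simp only [hcast]
  rfl

variable [DecidableEq I] [DecidableEq V]

theorem abs_av_prod_majorant_sub_one_le [Fintype α] (hq : Injective q)
    (B : ∀ p, Set (ι → ZMod (q p))) {β : α → ℝ} (hβ0 : ∀ p, 0 ≤ β p) (hβ : ∀ p, β p ≤ 1 / 2)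
    (hB : ∀ p, (av fun x => ind (x ∈ B p)) ≤ β p) {𝓓 : Finset (Finset α)} (hempty : ∅ ∈ 𝓓)
    (hdown : ∀ r ∈ 𝓓, ∀ s ⊆ r, s ∈ 𝓓) {R : ℕ} (hR : ∀ r ∈ 𝓓, ∏ p ∈ r, q p ≤ R)
    (c : I → V → ι → ℤ) {C : ℕ} (hC : ∀ a v i, |c a v i| ≤ C)
    (hc : ∀ p a a', a ≠ a' → ∃ v, ∀ ξ, (av fun t : ZMod (q p) =>
      ind (ξ + t • (red (q p) (c a' v) - red (q p) (c a v)) ∈ B p)) ≤ β p) :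
    |(av fun ω : (ι → ZMod N) × (V → ZMod N) =>
        ∏ a, majorant B 𝓓 (lift (affForm 0 (fun v => red N (c a v)) ω))) - 1| ≤
      2 * (∏ p, (1 + Fintype.card (Finset (I × Bool)) * (9 * β p ^ 2)) - 1) +
      #𝓓 ^ (Fintype.card I * 2) * (2 * (Fintype.card I * (Fintype.card ι *
        ((2 * ((1 + Fintype.card V * C) * R ^ (Fintype.card I * 2) : ℕ) + 2) / N)))) := by
  have hB' : ∀ p, (av fun x => ind (x ∈ B p)) ≤ 1 / 2 := fun p => (hB p).trans (hβ p)
  have hG : 1 ≤ sieveMass B 𝓓 := by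
    refine le_trans (by simp) (single_le_sum (f := fun r => ∏ p ∈ r, selbergWt (B p))
      (fun r _ => prod_nonneg fun p _ => selbergWt_nonneg (hB' p)) hempty)
  have hGI : 1 ≤ sieveMass B 𝓓 ^ Fintype.card I := one_le_pow₀ hG
  set 𝓡 := Fintype.piFinset fun _ : I × Bool => 𝓓 with h𝓡
  set P := ∏ p, (1 + Fintype.card (Finset (I × Bool)) * (9 * β p ^ 2)) - 1 with hP
  set K := 2 * (Fintype.card I * (Fintype.card ι *
        ((2 * ((1 + Fintype.card V * C) * R ^ (Fintype.card I * 2) : ℕ) + 2 : ℝ) / N))) with hK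
  set x : (ι → ZMod N) × (V → ZMod N) → I → ι → ℤ :=
    fun ω a => lift (affForm 0 (fun v => red N (c a v)) ω) with hx
  set Φ : (I × Bool → Finset α) → ℝ := fun ρ => av fun ω => ∏ p, ∏ i ∈ flipFin ρ p,
    balanced (B p) (red (q p) (x ω i.1)) with hΦ
  set Ψ : (I × Bool → Finset α) → (ι → ZMod N) × (V → ZMod N) → ℝ := fun ρ ω =>
    ∏ p, corr (ZMod (q p)) (B p) (fun a v => red (q p) (c a v))
      (fun a => red (q p) (x ω a)) (flipFin ρ p) with hΨ
  have h1 : (av fun ω => ∏ a, majorant B 𝓓 (x ω a)) =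
      (∑ ρ ∈ 𝓡, Φ ρ) / sieveMass B 𝓓 ^ Fintype.card I := by
    rw [av_congr fun ω => prod_majorant (x ω), av_div, av_sum]
  have h2 : ∀ ρ ∈ 𝓡, |Φ ρ - av (Ψ ρ)| ≤ K := by
    intro ρ hρ
    rw [h𝓡, Fintype.mem_piFinset] at hρ
    refine abs_av_prod_sub_le hq B hB' c hC (flipFin ρ) (r := univ.filter fun p => ∃ i, p ∈ ρ i)
      (fun p hp => ?_) ?_
    · refine filter_eq_empty_iff.mpr fun i _ hi => hp ?_
      exact mem_filter.mpr ⟨mem_univ _, i, hi⟩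
    · have hq1 : ∀ p, 1 ≤ q p := fun p => (Fact.out : (q p).Prime).one_le
      calc ∏ p with ∃ i, p ∈ ρ i, q p ≤ ∏ p, ∏ i, (if p ∈ ρ i then q p else 1) := by
            rw [prod_filter]
            refine prod_le_prod' fun p _ => ?_
            have hone : ∀ i ∈ (univ : Finset (I × Bool)), 1 ≤ if p ∈ ρ i then q p else 1 :=
              fun i _ => by split_ifs <;> simp [hq1]
            split_ifs with hp
            · obtain ⟨i, hi⟩ := hp
              refine le_trans (by rw [if_pos hi]) (single_le_prod' hone (mem_univ i))
            · exact one_le_prod' hone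
        _ = ∏ i, ∏ p ∈ ρ i, q p := by
            rw [prod_comm]
            exact prod_congr rfl fun i _ => by rw [prod_ite_mem, univ_inter]
        _ ≤ ∏ _i : I × Bool, R := prod_le_prod' fun i _ => hR _ (hρ i)
        _ = _ := by simp
  have h3 : ∀ ω, |∑ ρ ∈ 𝓡, Ψ ρ ω - sieveMass B 𝓓 ^ Fintype.card I| ≤
      2 * P * sieveMass B 𝓓 ^ Fintype.card I := by
    intro ω
    have hinj : Injective (flipFin : (I × Bool → Finset α) → α → Finset (I × Bool)) := by
      intro ρ ρ' h
      funext i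
      ext p
      have := congrArg (i ∈ ·) (congrFun h p)
      simpa [flipFin] using this
    have hok : ∀ τ ∈ 𝓡.map ⟨flipFin, hinj⟩, ∀ S : Finset α,
        S.piecewise (fun _ => ∅) τ ∈ 𝓡.map ⟨flipFin, hinj⟩ := by
      intro τ hτ S
      obtain ⟨ρ, hρ, rfl⟩ := mem_map.mp hτ
      refine mem_map.mpr ⟨fun i => ρ i \ S, ?_, ?_⟩
      · rw [h𝓡, Fintype.mem_piFinset] at hρ ⊢
        exact fun i => hdown _ (hρ i) _ sdiff_subset
      · funext p
        by_cases hp : p ∈ S <;> simp [flipFin, hp]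
    have h4 := abs_sum_prod_sub_le hok (c := fun p θ => corr (ZMod (q p)) (B p)
      (fun a v => red (q p) (c a v)) (fun a => red (q p) (x ω a)) θ)
      (c' := fun p θ => indepCorr (B p) θ) (bad := Mixed) (κ := fun p => 9 * β p ^ 2)
      (fun p => by positivity) (fun p => indepCorr_empty) (fun p θ => indepCorr_nonneg (hB' p) θ)
      (fun p θ hθ => corr_eq_of_not_mixed (hB' p) _ _ hθ)
      (fun p θ hθ => abs_corr_le (hB p) (hβ0 p) (hβ p) (hc p) _ hθ)
      (fun p θ hθ => by
        refine (indepCorr_le (hB' p) hθ).trans ?_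
        have := pow_le_pow_left₀ (selbergWt_nonneg (hB' p)) (selbergWt_le (hB p) (hβ p)) 2
        nlinarith [sq_nonneg (β p)])
    simp only [sum_map, Embedding.coeFn_mk] at h4
    rw [sum_prod_indepCorr] at h4
    exact h4
  have hcard : (#𝓡 : ℝ) = #𝓓 ^ (Fintype.card I * 2) := by
    rw [h𝓡, Fintype.card_piFinset]; simp
  have h5 : |∑ ρ ∈ 𝓡, Φ ρ - sieveMass B 𝓓 ^ Fintype.card I| ≤
      2 * P * sieveMass B 𝓓 ^ Fintype.card I + #𝓡 * K := by
    have e : ∑ ρ ∈ 𝓡, Φ ρ - sieveMass B 𝓓 ^ Fintype.card I =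
        (av fun ω => ∑ ρ ∈ 𝓡, Ψ ρ ω - sieveMass B 𝓓 ^ Fintype.card I) +
          ∑ ρ ∈ 𝓡, (Φ ρ - av (Ψ ρ)) := by
      rw [av_sub, av_const, av_sum, sum_sub_distrib]; ring
    rw [e]
    refine (abs_add_le _ _).trans (add_le_add ?_ ?_)
    · exact (abs_av_le _).trans (av_le h3)
    · refine (abs_sum_le_sum_abs _ _).trans ((sum_le_card_nsmul _ _ _ h2).trans_eq ?_)
      rw [nsmul_eq_mul]
  have hK0 : 0 ≤ K := by positivity
  rw [h1, div_sub_one (by positivity), abs_div, abs_of_pos (zero_lt_one.trans_le hGI),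
    div_le_iff₀ (zero_lt_one.trans_le hGI), add_mul, ← hcard]
  refine h5.trans (add_le_add le_rfl ?_)
  exact le_mul_of_one_le_right (by positivity) hGI

end LinearForms

section SievePrimes

/-- The primes of the interval `(w, R]`. -/
abbrev SievePrime (w R : ℕ) : Type := {p // p ∈ (Ioc w R).filter Nat.Prime}

instance (w R : ℕ) (p : SievePrime w R) : Fact (Nat.Prime p.1) := ⟨(mem_filter.mp p.2).2⟩

/-- The squarefree moduli of size at most `R` composed of primes in `(w, R]`. -/
def levels (w R : ℕ) : Finset (Finset (SievePrime w R)) := {r | ∏ p ∈ r, p.1 ≤ R}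

/-- The Selberg majorant of level `R` attached to a family of sets of residues. -/
noncomputable def sieveMajorant {ι : Type} (B : ∀ p, Set (ι → ZMod p)) (w R : ℕ) (x : ι → ℤ) : ℝ :=
  majorant (fun p : SievePrime w R => B p) (levels w R) x

lemma prod_val_injective {w R : ℕ} :
    Injective fun r : Finset (SievePrime w R) => ∏ p ∈ r, (p : ℕ) := by
  intro r s h
  have e : ∀ r : Finset (SievePrime w R),
      (∏ p ∈ r, (p : ℕ)).primeFactors = r.map (Embedding.subtype _) := fun r => by
    rw [← Nat.primeFactors_prod (s := r.map (Embedding.subtype _)), prod_map]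
    · rfl
    · intro p hp
      obtain ⟨p, _, rfl⟩ := mem_map.mp hp
      exact (mem_filter.mp p.2).2
  have h' := congrArg Nat.primeFactors h
  simp only [e] at h'
  exact map_injective _ h'

lemma card_levels_le (w R : ℕ) : #(levels w R) ≤ R := by
  have h := card_le_card_of_injOn (s := levels w R) (t := Ioc 0 R) _
    (fun r hr => ?_) (prod_val_injective (w := w) (R := R)).injOn
  · simpa using h
  · rw [coe_Ioc, Set.mem_Ioc]
    exact ⟨prod_pos fun p _ => (Fact.out : p.1.Prime).pos, (mem_filter.mp hr).2⟩

variable {ι V : Type} [Fintype ι] [Fintype V] [DecidableEq V]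

lemma exists_abs_av_prod_sieveMajorant_le {I : Type} [Fintype I] (c : I → V → ι → ℤ) (C₀ : ℝ)
    {ε : ℝ} (hε : 0 < ε) :
    ∃ w₀ N₀ : ℕ, ∀ w ≥ w₀, ∀ N ≥ N₀, ∀ [Fact N.Prime], ∀ R : ℕ, 1 ≤ R →
      R ^ (8 * Fintype.card I) ≤ N → ∀ B : ∀ p, Set (ι → ZMod p),
      (∀ p, w < p → p.Prime → (av fun x => ind (x ∈ B p)) ≤ C₀ / p) →
      (∀ p, w < p → p.Prime → ∀ a a', a ≠ a' → ∃ v, ∀ ξ, (av fun t : ZMod p =>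
        ind (ξ + t • (red p (c a' v) - red p (c a v)) ∈ B p)) ≤ C₀ / p) →
      |(av fun ω : (ι → ZMod N) × (V → ZMod N) =>
        ∏ a, sieveMajorant B w R (lift (affForm 0 (fun v => red N (c a v)) ω))) - 1| ≤ ε := by
  classical
  obtain ⟨C, hC⟩ : ∃ C : ℕ, ∀ a v i, |c a v i| ≤ C := by
    refine ⟨∑ a, ∑ v, ∑ i, (c a v i).natAbs, fun a v i => ?_⟩
    rw [Int.abs_eq_natAbs]
    have h1 := single_le_sum (f := fun i => (c a v i).natAbs) (fun _ _ => Nat.zero_le _) (mem_univ i)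
    have h2 := single_le_sum (f := fun v => ∑ i, (c a v i).natAbs) (fun _ _ => Nat.zero_le _)
      (mem_univ v)
    have h3 := single_le_sum (f := fun a => ∑ v, ∑ i, (c a v i).natAbs) (fun _ _ => Nat.zero_le _)
      (mem_univ a)
    exact_mod_cast h1.trans (h2.trans h3)
  set k := Fintype.card I with hk
  set A : ℝ := Fintype.card (Finset (I × Bool)) * (9 * C₀ ^ 2) with hA
  have hA0 : 0 ≤ A := by positivity
  set D : ℝ := 2 * (k * (Fintype.card ι * (2 * (1 + Fintype.card V * C) + 2))) with hD
  have hD0 : 0 ≤ D := by positivity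
  obtain ⟨w₁, hw₁⟩ : ∃ w₁ : ℕ, ∀ w ≥ w₁, 2 * (Real.exp (A * (2 / (w + 1))) - 1) ≤ ε / 2 := by
    have : Filter.Tendsto (fun w : ℕ => 2 * (Real.exp (A * (2 / ((w : ℝ) + 1))) - 1)) Filter.atTop
        (nhds (2 * (Real.exp (A * 0) - 1))) := by
      refine ((Real.continuous_exp.tendsto _).comp (Filter.Tendsto.const_mul _ ?_)).sub_const _
        |>.const_mul _
      have := (tendsto_one_div_add_atTop_nhds_zero_nat (𝕜 := ℝ)).const_mul 2
      simpa [div_eq_mul_inv] using this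
    rw [mul_zero, Real.exp_zero, sub_self, mul_zero] at this
    obtain ⟨w₁, h⟩ := Filter.eventually_atTop.mp (this.eventually (Iic_mem_nhds (half_pos hε)))
    exact ⟨w₁, h⟩
  obtain ⟨w₂, hw₂⟩ := exists_nat_ge (2 * |C₀|)
  obtain ⟨N₀, hN₀⟩ := exists_nat_ge ((2 * D / ε) ^ 2)
  refine ⟨max w₁ w₂, N₀, fun w hw N hN _ R hR hRN B hB hc => ?_⟩
  have hwC : ∀ p : SievePrime w R, 2 * |C₀| ≤ p.1 := fun p => by
    have h1 := (mem_Ioc.mp (mem_filter.mp p.2).1).1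
    exact hw₂.trans (by exact_mod_cast ((le_max_right _ _).trans hw).trans h1.le)
  have hpp : ∀ p : SievePrime w R, (0 : ℝ) < p.1 := fun p => by
    exact_mod_cast (Fact.out : p.1.Prime).pos
  have hC0 : ∀ p : SievePrime w R, 0 ≤ C₀ / (p.1 : ℝ) := fun p =>
    (av_nonneg fun _ => ind_nonneg _).trans
      (hB p (mem_Ioc.mp (mem_filter.mp p.2).1).1 Fact.out)
  have key := abs_av_prod_majorant_sub_one_le (N := N) (q := fun p : SievePrime w R => p.1)
    Subtype.val_injective (fun p => B p) (β := fun p => C₀ / (p.1 : ℝ)) hC0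
    (fun p => by
      rw [div_le_iff₀ (hpp p)]
      linarith [hwC p, le_abs_self C₀])
    (fun p => hB p (mem_Ioc.mp (mem_filter.mp p.2).1).1 Fact.out) (𝓓 := levels w R) (R := R)
    (by simp [levels, hR])
    (fun r hr s hs => by
      rw [levels, mem_filter] at hr ⊢
      exact ⟨mem_univ _, (prod_le_prod_of_subset_of_one_le' hs
        fun p _ _ => (Fact.out : p.1.Prime).one_le).trans hr.2⟩)
    (fun r hr => (mem_filter.mp hr).2) c hC
    (fun p => hc p (mem_Ioc.mp (mem_filter.mp p.2).1).1 Fact.out)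
  refine key.trans ?_
  rw [← add_halves ε]
  refine add_le_add (le_trans ?_ (hw₁ w ((le_max_left _ _).trans hw))) ?_
  · refine mul_le_mul_of_nonneg_left (sub_le_sub_right ?_ _) zero_le_two
    have h1 : ∀ p : SievePrime w R,
        1 + (Fintype.card (Finset (I × Bool)) : ℝ) * (9 * (C₀ / (p.1 : ℝ)) ^ 2) ≤
          Real.exp (A * ((p.1 : ℝ) ^ 2)⁻¹) := fun p => by
      refine le_trans (le_of_eq ?_) (Real.add_one_le_exp _)
      rw [hA]; field_simp; ring
    refine (prod_le_prod (fun p _ => by positivity) fun p _ => h1 p).trans ?_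
    rw [← Real.exp_sum, ← mul_sum]
    gcongr
    calc ∑ p : SievePrime w R, ((p.1 : ℝ) ^ 2)⁻¹
        = ∑ p ∈ (Ioc w R).filter Nat.Prime, ((p : ℝ) ^ 2)⁻¹ :=
          sum_coe_sort _ fun p : ℕ => ((p : ℝ) ^ 2)⁻¹
      _ ≤ ∑ p ∈ Ioo w (R + 1), ((p : ℝ) ^ 2)⁻¹ := by
          refine sum_le_sum_of_subset_of_nonneg (fun p hp => ?_) fun _ _ _ => by positivity
          have := mem_Ioc.mp (mem_filter.mp hp).1
          exact mem_Ioo.mpr ⟨this.1, Nat.lt_succ_of_le this.2⟩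
      _ ≤ 2 / (w + 1) := sum_Ioo_inv_sq_le w (R + 1)
  · have hNpos : (0 : ℝ) < N := by exact_mod_cast (Fact.out : N.Prime).pos
    have hR1 : (1 : ℝ) ≤ R := by exact_mod_cast hR
    have hcard : (#(levels w R) : ℝ) ≤ R := by exact_mod_cast card_levels_le w R
    have hs : ((R : ℝ) ^ (4 * k)) ^ 2 ≤ N := by
      rw [← pow_mul, show 4 * k * 2 = 8 * k by ring]; exact_mod_cast hRN
    have hN' : (2 * D / ε) ^ 2 ≤ N := hN₀.trans (by exact_mod_cast hN)
    have hRk : (1 : ℝ) ≤ (R : ℝ) ^ (k * 2) := one_le_pow₀ hR1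
    have h1 : 2 * D * (R : ℝ) ^ (4 * k) ≤ ε * N := by
      refine le_of_sq_le_sq ?_ (by positivity)
      have h2 : (2 * D) ^ 2 ≤ ε ^ 2 * N := by
        rw [div_pow, div_le_iff₀ (by positivity)] at hN'; linarith
      calc (2 * D * (R : ℝ) ^ (4 * k)) ^ 2 = (2 * D) ^ 2 * ((R : ℝ) ^ (4 * k)) ^ 2 := by ring
        _ ≤ (ε ^ 2 * N) * N := by gcongr
        _ = _ := by ring
    calc _ ≤ (R : ℝ) ^ (k * 2) * (2 * (k * (Fintype.card ι *
          ((2 * ((1 + Fintype.card V * C) * R ^ (k * 2)) + 2 * R ^ (k * 2)) / N)))) := by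
          push_cast
          gcongr
          linarith
      _ = D * (R : ℝ) ^ (4 * k) / N := by rw [hD]; ring
      _ ≤ ε / 2 := by rw [div_le_iff₀ hNpos]; linarith

/-- The Selberg majorant satisfies the linear forms condition. -/
theorem exists_nearOne_sieveMajorant {I : Type} [Fintype I] (c : I → V → ι → ℤ) (C₀ : ℝ)
    {ε : ℝ} (hε : 0 < ε) :
    ∃ w₀ N₀ : ℕ, ∀ w ≥ w₀, ∀ N ≥ N₀, ∀ [Fact N.Prime], ∀ R : ℕ, 1 ≤ R →
      R ^ (8 * Fintype.card I) ≤ N → ∀ B : ∀ p, Set (ι → ZMod p),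
      (∀ p, w < p → p.Prime → (av fun x => ind (x ∈ B p)) ≤ C₀ / p) →
      (∀ p, w < p → p.Prime → ∀ a a', a ≠ a' → ∃ v, ∀ ξ, (av fun t : ZMod p =>
        ind (ξ + t • (red p (c a' v) - red p (c a v)) ∈ B p)) ≤ C₀ / p) →
      NearOne (fun (a : I) (ω : (ι → ZMod N) × (V → ZMod N)) =>
        sieveMajorant B w R (lift (affForm 0 (fun v => red N (c a v)) ω))) univ ε := by
  classical
  choose w₀ N₀ h using fun S : Finset I =>
    exists_abs_av_prod_sieveMajorant_le (I := S) (fun a => c a) C₀ hε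
  refine ⟨univ.sup w₀, univ.sup N₀, fun w hw N hN _ R hR hRN B hB hc S _ => ?_⟩
  have := h S w ((le_sup (mem_univ S)).trans hw) N ((le_sup (mem_univ S)).trans hN) R hR
    ((Nat.pow_le_pow_right hR (Nat.mul_le_mul_left _ ?_)).trans hRN) B hB
    fun p hp hp' a a' haa => hc p hp hp' a a' fun h => haa (Subtype.ext h)
  · refine le_of_eq_of_le (congrArg (fun t => |t - 1|) (av_congr fun ω => ?_)) this
    exact (prod_coe_sort S _).symm
  · rw [Fintype.card_coe]; exact card_le_univ S

end SievePrimes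

section ExponentWeights

variable {P : Type*}

/-- The completely multiplicative extension of `w` to exponent vectors. -/
noncomputable def expWt (w : P → ℝ) (m : P →₀ ℕ) : ℝ := m.prod fun v k => w v ^ k

variable (w : P → ℝ)

@[simp] lemma expWt_zero : expWt w 0 = 1 := by simp [expWt]

lemma expWt_add (m m' : P →₀ ℕ) : expWt w (m + m') = expWt w m * expWt w m' :=
  Finsupp.prod_add_index' (fun _ => pow_zero _) fun _ _ _ => pow_add _ _ _

lemma expWt_single (v : P) (k : ℕ) : expWt w (Finsupp.single v k) = w v ^ k :=
  Finsupp.prod_single_index (pow_zero _)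

lemma expWt_smul (j : ℕ) (m : P →₀ ℕ) : expWt w (j • m) = expWt w m ^ j := by
  induction j with
  | zero => simp
  | succ j ih => rw [succ_nsmul, expWt_add, ih, pow_succ]

lemma expWt_inv (m : P →₀ ℕ) : expWt (fun v => (w v)⁻¹) m = (expWt w m)⁻¹ := by
  simp [expWt, Finsupp.prod, Finset.prod_inv_distrib]

variable {w}

lemma expWt_nonneg (hw : ∀ v, 0 ≤ w v) (m : P →₀ ℕ) : 0 ≤ expWt w m :=
  Finset.prod_nonneg fun v _ => pow_nonneg (hw v) _

/-- Splitting exponent vectors along a set of primes bounds a sum of weights by a product. -/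
lemma sum_expWt_le_mul [DecidableEq P] (hw : ∀ v, 0 ≤ w v) (q : P → Prop) [DecidablePred q]
    {A B C : Finset (P →₀ ℕ)} (hB : ∀ m ∈ A, m.filter q ∈ B)
    (hC : ∀ m ∈ A, m.filter (fun v => ¬ q v) ∈ C) :
    ∑ m ∈ A, expWt w m ≤ (∑ m ∈ B, expWt w m) * ∑ m ∈ C, expWt w m := by
  rw [sum_mul_sum, ← sum_product']
  have hinj : Set.InjOn (fun m : P →₀ ℕ => (m.filter q, m.filter fun v => ¬ q v)) A := by
    intro m _ m' _ h
    simp only [Prod.mk.injEq] at h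
    rw [← Finsupp.filter_add_filter_not m q, ← Finsupp.filter_add_filter_not m' q, h.1, h.2]
  calc ∑ m ∈ A, expWt w m
      = ∑ z ∈ A.image (fun m : P →₀ ℕ => (m.filter q, m.filter fun v => ¬ q v)),
          expWt w z.1 * expWt w z.2 := by
        rw [sum_image hinj]
        refine sum_congr rfl fun m _ => ?_
        rw [← expWt_add, Finsupp.filter_add_filter_not]
    _ ≤ _ := by
        refine sum_le_sum_of_subset_of_nonneg ?_ fun _ _ _ =>
          mul_nonneg (expWt_nonneg hw _) (expWt_nonneg hw _)
        intro z hz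
        obtain ⟨m, hm, rfl⟩ := mem_image.mp hz
        exact mem_product.mpr ⟨hB m hm, hC m hm⟩

/-- A finite sum of weights of exponent vectors is at most the corresponding Euler product. -/
lemma sum_expWt_le_prod [DecidableEq P] (hw : ∀ v, 0 ≤ w v) (hw1 : ∀ v, w v < 1) (Q : Finset P) :
    ∀ A : Finset (P →₀ ℕ), (∀ m ∈ A, m.support ⊆ Q) →
      ∑ m ∈ A, expWt w m ≤ ∏ v ∈ Q, (1 - w v)⁻¹ := by
  induction Q using Finset.induction_on with
  | empty =>
    intro A hA
    have : A ⊆ {0} := fun m hm => by simpa using hA m hm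
    calc _ ≤ ∑ m ∈ {(0 : P →₀ ℕ)}, expWt w m :=
          sum_le_sum_of_subset_of_nonneg this fun m _ _ => expWt_nonneg hw m
      _ = _ := by simp
  | insert u Q hu ih =>
    intro A hA
    rw [prod_insert hu]
    set B := A.image fun m => m.filter (· = u)
    set C := A.image fun m => m.filter fun v => ¬ v = u
    refine (sum_expWt_le_mul hw (· = u) (B := B) (C := C)
      (fun m hm => mem_image_of_mem _ hm) fun m hm => mem_image_of_mem _ hm).trans ?_
    refine mul_le_mul ?_ (ih C ?_) (sum_nonneg fun m _ => expWt_nonneg hw m)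
      (inv_nonneg.mpr (sub_nonneg.mpr (hw1 u).le))
    · obtain ⟨E, hE⟩ : ∃ E, ∀ m ∈ A, m u ≤ E :=
        ⟨A.sup fun m => m u, fun m hm => le_sup (f := fun m : P →₀ ℕ => m u) hm⟩
      have hBs : B ⊆ (range (E + 1)).image (Finsupp.single u) := by
        intro z hz
        obtain ⟨m, hm, rfl⟩ := mem_image.mp hz
        refine mem_image.mpr ⟨m u, mem_range.mpr (Nat.lt_succ_of_le (hE m hm)), ?_⟩
        ext v
        by_cases hv : v = u
        · simp [hv]
        · simp [hv]
      calc _ ≤ _ := sum_le_sum_of_subset_of_nonneg hBs fun m _ _ => expWt_nonneg hw m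
        _ = ∑ k ∈ range (E + 1), w u ^ k := by
          rw [sum_image fun _ _ _ _ h => Finsupp.single_injective u h]
          simp_rw [expWt_single]
        _ ≤ ∑' k : ℕ, w u ^ k :=
          (summable_geometric_of_lt_one (hw u) (hw1 u)).sum_le_tsum _ fun _ _ => pow_nonneg (hw u) _
        _ = _ := tsum_geometric_of_lt_one (hw u) (hw1 u)
    · intro z hz
      obtain ⟨m, hm, rfl⟩ := mem_image.mp hz
      intro v hv
      rw [Finsupp.support_filter, mem_filter] at hv
      exact (mem_insert.mp (hA m hm hv.1)).resolve_left hv.2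

/-- Exponent vectors that meet each member of a family of sets of primes, and nothing else. -/
lemma sum_expWt_le_prod_sub_one [DecidableEq P] {β : Type*} [DecidableEq β] (hw : ∀ v, 0 ≤ w v)
    (hw1 : ∀ v, w v < 1) (F : β → Finset P) (r : Finset β)
    (hF : ∀ p ∈ r, ∀ p' ∈ r, p ≠ p' → Disjoint (F p) (F p')) :
    ∀ A : Finset (P →₀ ℕ), (∀ m ∈ A, m.support ⊆ r.biUnion F) →
      (∀ m ∈ A, ∀ p ∈ r, ∃ v ∈ F p, m v ≠ 0) →
      ∑ m ∈ A, expWt w m ≤ ∏ p ∈ r, (∏ v ∈ F p, (1 - w v)⁻¹ - 1) := by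
  induction r using Finset.induction_on with
  | empty =>
    intro A hA _
    have : A ⊆ {0} := fun m hm => by simpa using hA m hm
    calc _ ≤ ∑ m ∈ {(0 : P →₀ ℕ)}, expWt w m :=
          sum_le_sum_of_subset_of_nonneg this fun m _ _ => expWt_nonneg hw m
      _ = _ := by simp
  | insert u r hu ih =>
    intro A hA hA'
    rw [prod_insert hu]
    set B := A.image fun m => m.filter (· ∈ F u)
    set C := A.image fun m => m.filter fun v => ¬ v ∈ F u
    refine (sum_expWt_le_mul hw (· ∈ F u) (B := B) (C := C)
      (fun m hm => mem_image_of_mem _ hm) fun m hm => mem_image_of_mem _ hm).trans ?_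
    have h0 : (0 : P →₀ ℕ) ∉ B := by
      intro hz
      obtain ⟨m, hm, h⟩ := mem_image.mp hz
      obtain ⟨v, hv, hmv⟩ := hA' m hm u (mem_insert_self _ _)
      apply hmv
      have := DFunLike.congr_fun h v
      simpa [Finsupp.filter_apply, hv] using this
    have hB := sum_expWt_le_prod hw hw1 (F u) (insert 0 B) (by
      intro z hz
      rcases mem_insert.mp hz with rfl | hz
      · simp
      · obtain ⟨m, hm, rfl⟩ := mem_image.mp hz
        intro v hv
        rw [Finsupp.support_filter, mem_filter] at hv
        exact hv.2)
    rw [sum_insert h0, expWt_zero] at hB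
    have hC := ih (fun p hp p' hp' => hF p (mem_insert_of_mem hp) p' (mem_insert_of_mem hp')) C
      (by
        intro z hz
        obtain ⟨m, hm, rfl⟩ := mem_image.mp hz
        intro v hv
        rw [Finsupp.support_filter, mem_filter] at hv
        have := hA m hm hv.1
        rw [biUnion_insert, mem_union] at this
        exact this.resolve_left hv.2)
      (by
        intro z hz p hp
        obtain ⟨m, hm, rfl⟩ := mem_image.mp hz
        obtain ⟨v, hv, hmv⟩ := hA' m hm p (mem_insert_of_mem hp)
        refine ⟨v, hv, ?_⟩
        have hvu : v ∉ F u := fun h => disjoint_left.mp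
          (hF u (mem_insert_self _ _) p (mem_insert_of_mem hp) fun h => hu (h ▸ hp)) h hv
        simpa [Finsupp.filter_apply, hvu] using hmv)
    have hB0 : 0 ≤ ∑ m ∈ B, expWt w m := sum_nonneg fun m _ => expWt_nonneg hw m
    exact mul_le_mul (by linarith) hC (sum_nonneg fun m _ => expWt_nonneg hw m) (by linarith)

end ExponentWeights

end Constellation

namespace Constellation

open Finset Function IsDedekindDomain Real MeasureTheory Filter
open Finsupp (single)
open Module (finrank)
open MvPowerSeries (coeff)
open mixedEmbedding (mixedSpace normAtPlace)

variable {K : Type*} [Field K] [NumberField K]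

section IdealExponents

open UniqueFactorizationMonoid

variable (K)

/-- The index set of a basis of the ring of integers over `ℤ`. -/
abbrev Idx : Type := Fin (finrank ℤ (𝓞 K))

/-- The integers of `K` in coordinates. -/
noncomputable def intEquiv : (Idx K → ℤ) ≃ₗ[ℤ] 𝓞 K := (Module.finBasis ℤ (𝓞 K)).equivFun.symm

/-- The nonzero primes of the ring of integers. -/
abbrev PrimeIdeal : Type _ := HeightOneSpectrum (𝓞 K)

variable {K}

/-- The norm of a prime ideal. -/
noncomputable def pNorm (v : PrimeIdeal K) : ℝ := Ideal.absNorm v.asIdeal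

lemma one_lt_pNorm (v : PrimeIdeal K) : 1 < pNorm v := by
  rw [pNorm]
  exact_mod_cast NumberField.HeightOneSpectrum.one_lt_absNorm v

lemma pNorm_pos (v : PrimeIdeal K) : 0 < pNorm v := one_pos.trans (one_lt_pNorm v)

/-- The ideal with given exponents. -/
noncomputable def toIdeal (m : PrimeIdeal K →₀ ℕ) : Ideal (𝓞 K) := m.prod fun v k => v.asIdeal ^ k

omit [NumberField K] in
@[simp] lemma toIdeal_zero : toIdeal (0 : PrimeIdeal K →₀ ℕ) = 1 := by simp [toIdeal]

omit [NumberField K] in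
lemma toIdeal_add (m m' : PrimeIdeal K →₀ ℕ) : toIdeal (m + m') = toIdeal m * toIdeal m' :=
  Finsupp.prod_add_index' (fun _ => pow_zero _) fun _ _ _ => pow_add _ _ _

omit [NumberField K] in
lemma toIdeal_single (v : PrimeIdeal K) (k : ℕ) :
    toIdeal (single v k) = v.asIdeal ^ k := Finsupp.prod_single_index (pow_zero _)

omit [NumberField K] in
lemma toIdeal_ne_zero (m : PrimeIdeal K →₀ ℕ) : toIdeal m ≠ 0 :=
  Finset.prod_ne_zero_iff.mpr fun v _ => pow_ne_zero _ v.ne_bot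

lemma absNorm_toIdeal (m : PrimeIdeal K →₀ ℕ) :
    (Ideal.absNorm (toIdeal m) : ℝ) = expWt pNorm m := by
  simp only [toIdeal, expWt, Finsupp.prod, map_prod, map_pow, Nat.cast_prod, Nat.cast_pow, pNorm]

lemma one_le_expWt_pNorm (m : PrimeIdeal K →₀ ℕ) : 1 ≤ expWt pNorm m := by
  rw [← absNorm_toIdeal]
  exact_mod_cast Nat.one_le_iff_ne_zero.mpr (Ideal.absNorm_ne_zero_iff_mem_nonZeroDivisors.mpr
    (mem_nonZeroDivisors_of_ne_zero (toIdeal_ne_zero m)))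

open Classical in
lemma count_normalizedFactors_toIdeal (m : PrimeIdeal K →₀ ℕ) (v : PrimeIdeal K) :
    (normalizedFactors (toIdeal m)).count v.asIdeal = m v := by
  induction m using Finsupp.induction_linear with
  | zero => rw [toIdeal_zero, normalizedFactors_one]; simp
  | add m m' hm hm' =>
    rw [toIdeal_add, normalizedFactors_mul (toIdeal_ne_zero _) (toIdeal_ne_zero _),
      Multiset.count_add, hm, hm', Finsupp.add_apply]
  | single u k =>
    rw [toIdeal_single, normalizedFactors_pow, normalizedFactors_irreducible u.irreducible,
      Multiset.count_nsmul, normalize_eq, Multiset.count_singleton, Finsupp.single_apply]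
    by_cases h : u = v
    · simp [h]
    · have : v.asIdeal ≠ u.asIdeal := fun h' => h (HeightOneSpectrum.asIdeal_injective h'.symm)
      simp [h, this]

lemma toIdeal_injective : Injective (toIdeal (K := K)) := by
  classical
  intro m m' h
  ext v
  rw [← count_normalizedFactors_toIdeal, ← count_normalizedFactors_toIdeal, h]

lemma exists_toIdeal_eq {I : Ideal (𝓞 K)} (hI : I ≠ 0) : ∃ m, toIdeal m = I := by
  induction I using UniqueFactorizationMonoid.induction_on_prime with
  | h₁ => exact absurd rfl hI
  | h₂ I h => exact ⟨0, by rw [toIdeal_zero, Ideal.isUnit_iff.mp h, Ideal.one_eq_top]⟩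
  | h₃ I p hI0 hp ih =>
    obtain ⟨m, rfl⟩ := ih hI0
    exact ⟨single ⟨p, Ideal.isPrime_of_prime hp, hp.ne_zero⟩ 1 + m, by
      rw [toIdeal_add, toIdeal_single, pow_one]⟩

lemma finite_setOf_expWt_le (x : ℝ) : {m : PrimeIdeal K →₀ ℕ | expWt pNorm m ≤ x}.Finite := by
  refine Set.Finite.of_finite_image (f := toIdeal)
    ((Ideal.finite_setOfPred_absNorm_le (S := 𝓞 K) ⌊x⌋₊).subset ?_) toIdeal_injective.injOn
  rintro _ ⟨m, hm, rfl⟩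
  rw [Set.mem_ofPred_eq, ← absNorm_toIdeal] at hm
  exact Nat.le_floor hm

/-- The prime ideals that contain the natural number `p`. -/
noncomputable def fiber (p : ℕ) : Finset (PrimeIdeal K) :=
  if h : (Ideal.span {(p : 𝓞 K)}) = 0 then ∅ else (Ideal.finite_factors h).toFinset

lemma span_natCast_ne_zero {p : ℕ} (hp : p ≠ 0) : Ideal.span {(p : 𝓞 K)} ≠ 0 := by
  simpa using hp

lemma mem_fiber {p : ℕ} (hp : p ≠ 0) {v : PrimeIdeal K} : v ∈ fiber p ↔ (p : 𝓞 K) ∈ v.asIdeal := by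
  rw [fiber, dif_neg (span_natCast_ne_zero hp), Set.Finite.mem_toFinset, Set.mem_ofPred_eq,
    Ideal.dvd_span_singleton]

/-- Every prime ideal lies over a prime number. -/
lemma exists_prime_mem_fiber (v : PrimeIdeal K) : ∃ p : ℕ, p.Prime ∧ v ∈ fiber p := by
  have := v.isMaximal
  obtain ⟨p, n, -, hv, hp, -⟩ := Ideal.exists_prime_and_absNorm_eq_pow v.asIdeal
  exact ⟨p, hp, (mem_fiber hp.ne_zero).mpr hv⟩

lemma eq_of_mem_fiber {p q : ℕ} (hp : p.Prime) (hq : q.Prime) {v : PrimeIdeal K} (h : v ∈ fiber p)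
    (hv : v ∈ fiber q) : p = q := by
  rw [mem_fiber hp.ne_zero] at h
  rw [mem_fiber hq.ne_zero] at hv
  by_contra hpq
  obtain ⟨a, b, hab⟩ := Nat.isCoprime_iff_coprime.mpr ((Nat.coprime_primes hp hq).mpr hpq)
  refine v.isMaximal.ne_top ((Ideal.eq_top_iff_one _).mpr ?_)
  have : ((a * p + b * q : ℤ) : 𝓞 K) = 1 := by rw [hab]; simp
  rw [← this]
  push_cast
  exact add_mem (Ideal.mul_mem_left _ _ h) (Ideal.mul_mem_left _ _ hv)

/-- The norm of a prime over `p` is a positive power of `p`. -/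
lemma exists_absNorm_eq_pow {p : ℕ} (hp : p.Prime) {v : PrimeIdeal K} (h : v ∈ fiber p) :
    ∃ k, 0 < k ∧ Ideal.absNorm v.asIdeal = p ^ k := by
  have := v.isMaximal
  obtain ⟨q, n, hn, hv, hq, h'⟩ := Ideal.exists_prime_and_absNorm_eq_pow v.asIdeal
  rw [eq_of_mem_fiber hp hq h ((mem_fiber hq.ne_zero).mpr hv)]
  exact ⟨n, hn, h'⟩

lemma le_pNorm {p : ℕ} (hp : p.Prime) {v : PrimeIdeal K} (h : v ∈ fiber p) : (p : ℝ) ≤ pNorm v := by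
  obtain ⟨k, hk, h'⟩ := exists_absNorm_eq_pow hp h
  rw [pNorm, h']
  exact_mod_cast Nat.le_self_pow hk.ne' p

lemma natCast_mem_iff {p : ℕ} (hp : p.Prime) {v : PrimeIdeal K} (h : v ∈ fiber p) (a : ℤ) :
    (a : 𝓞 K) ∈ v.asIdeal ↔ (p : ℤ) ∣ a := by
  rw [mem_fiber hp.ne_zero] at h
  constructor
  · intro ha
    by_contra hpa
    obtain ⟨x, y, hxy⟩ := ((Nat.prime_iff_prime_int.mp hp).coprime_iff_not_dvd.mpr hpa)
    refine v.isMaximal.ne_top ((Ideal.eq_top_iff_one _).mpr ?_)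
    have : ((x * p + y * a : ℤ) : 𝓞 K) = 1 := by rw [hxy]; simp
    rw [← this]
    push_cast
    exact add_mem (Ideal.mul_mem_left _ _ h) (Ideal.mul_mem_left _ _ ha)
  · rintro ⟨b, rfl⟩
    push_cast
    exact Ideal.mul_mem_right _ _ h

lemma prod_fiber_dvd (p : ℕ) (hp : p ≠ 0) :
    ∏ v ∈ fiber (K := K) p, v.asIdeal ∣ Ideal.span {(p : 𝓞 K)} := by
  refine Finset.prod_dvd_of_coprime ?_ fun v hv => ?_
  · intro v _ u _ huv
    exact (Ideal.isCoprime_iff_sup_eq.mpr (v.isMaximal.coprime_of_ne u.isMaximal fun h =>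
      huv (HeightOneSpectrum.asIdeal_injective h)))
  · exact Ideal.dvd_span_singleton.mpr ((mem_fiber hp).mp hv)

lemma card_fiber_le {p : ℕ} (hp : p.Prime) : #(fiber (K := K) p) ≤ finrank ℤ (𝓞 K) := by
  have h := map_dvd (Ideal.absNorm (S := 𝓞 K)) (prod_fiber_dvd (K := K) p hp.ne_zero)
  rw [Ideal.absNorm_span_natCast, map_prod] at h
  have h2 : p ^ #(fiber (K := K) p) ∣ ∏ v ∈ fiber (K := K) p, Ideal.absNorm v.asIdeal := by
    rw [← prod_const]
    refine Finset.prod_dvd_prod_of_dvd _ _ fun v hv => ?_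
    obtain ⟨k, hk, h'⟩ := exists_absNorm_eq_pow hp hv
    rw [h']
    exact dvd_pow_self p hk.ne'
  exact (Nat.pow_dvd_pow_iff_le_right hp.one_lt).mp (h2.trans h)

end IdealExponents

section UnitDensity

variable (K)

/-- The residues modulo `m` of the integers that are not coprime to `m`. -/
def nonunitResidues (m : ℕ) : Set (Idx K → ZMod m) :=
  {x | ∃ v : PrimeIdeal K, (m : 𝓞 K) ∈ v.asIdeal ∧ intEquiv K (lift x) ∈ v.asIdeal}

/-- The proportion of residues modulo `m` that are coprime to `m`. -/
noncomputable def unitDensity (m : ℕ) : ℝ :=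
  av fun x : Idx K → ZMod m => ind (x ∉ nonunitResidues K m)

variable {K}

lemma intEquiv_mem_iff_of_red_eq {m : ℕ} {v : PrimeIdeal K} (hm : (m : 𝓞 K) ∈ v.asIdeal)
    {y y' : Idx K → ℤ} (h : red m y = red m y') :
    intEquiv K y ∈ v.asIdeal ↔ intEquiv K y' ∈ v.asIdeal := by
  have h1 : ∀ i, ∃ z : ℤ, y i - y' i = m * z := fun i => by
    have := congrFun h i
    simp only [red] at this
    exact (ZMod.intCast_eq_intCast_iff_dvd_sub _ _ _).mp this.symm
  choose z hz using h1
  have h2 : y = y' + m • z := by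
    funext i
    have := hz i
    simp only [Pi.add_apply, nsmul_eq_mul, Pi.mul_apply, Pi.natCast_apply]
    linarith
  rw [h2, map_add, map_nsmul, nsmul_eq_mul]
  exact Ideal.add_mem_iff_left _ (Ideal.mul_mem_right _ _ hm)

lemma red_mem_nonunitResidues {m : ℕ} {y : Idx K → ℤ} : red m y ∈ nonunitResidues K m ↔
    ∃ v : PrimeIdeal K, (m : 𝓞 K) ∈ v.asIdeal ∧ intEquiv K y ∈ v.asIdeal := by
  refine exists_congr fun v => and_congr_right fun hm => ?_
  exact intEquiv_mem_iff_of_red_eq hm (red_lift _)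

variable {p : ℕ} [hp : Fact p.Prime]

lemma mem_nonunitResidues {x : Idx K → ZMod p} : x ∈ nonunitResidues K p ↔
    ∃ v ∈ fiber (K := K) p, intEquiv K (lift x) ∈ v.asIdeal :=
  exists_congr fun _ => and_congr_left fun _ => (mem_fiber hp.out.ne_zero).symm

lemma av_line_mem_le {v : PrimeIdeal K} (hv : v ∈ fiber p) {d : Idx K → ℤ}
    (hd : intEquiv K d ∉ v.asIdeal) (ξ : Idx K → ZMod p) :
    (av fun t : ZMod p => ind (intEquiv K (lift (ξ + t • red p d)) ∈ v.asIdeal)) ≤ 1 / p := by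
  have hpv := (mem_fiber hp.out.ne_zero).mp hv
  have key : ∀ t t' : ZMod p, intEquiv K (lift (ξ + t • red p d)) ∈ v.asIdeal →
      intEquiv K (lift (ξ + t' • red p d)) ∈ v.asIdeal → t = t' := by
    intro t t' h h'
    have h1 : ∀ t : ZMod p, red p (lift (ξ + t • red p d)) = red p (lift ξ + t.valMinAbs • d) := by
      intro t
      rw [red_lift]
      funext i
      have : (lift ξ i : ZMod p) = ξ i := ZMod.coe_valMinAbs _
      simp [red, this]
    rw [intEquiv_mem_iff_of_red_eq hpv (h1 _), map_add, map_zsmul, zsmul_eq_mul] at h h'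
    have h2 : ((t.valMinAbs - t'.valMinAbs : ℤ) : 𝓞 K) * intEquiv K d ∈ v.asIdeal := by
      have := sub_mem h h'
      push_cast
      rwa [sub_mul, ← add_sub_add_left_eq_sub]
    have h3 := (natCast_mem_iff hp.out hv _).mp ((v.isPrime.mem_or_mem h2).resolve_right hd)
    have h4 := (ZMod.intCast_eq_intCast_iff_dvd_sub t'.valMinAbs t.valMinAbs p).mpr h3
    rwa [ZMod.coe_valMinAbs, ZMod.coe_valMinAbs, eq_comm] at h4
  by_cases h : ∃ t0 : ZMod p, intEquiv K (lift (ξ + t0 • red p d)) ∈ v.asIdeal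
  · obtain ⟨t0, h0⟩ := h
    have := av_ind_le_of_injective (X := ZMod p) (g := ZMod.valMinAbs)
      (P := fun t => intEquiv K (lift (ξ + t • red p d)) ∈ v.asIdeal)
      (ZMod.injective_valMinAbs (n := p)) (s := {t0.valMinAbs})
      fun t ht => mem_singleton.mpr (by rw [key t t0 ht h0])
    simpa using this
  · push Not at h
    rw [av_congr fun t => ind_false (h t), av_const]
    positivity

lemma av_line_nonunit_le {d : Idx K → ℤ} (hd : ∀ v ∈ fiber (K := K) p, intEquiv K d ∉ v.asIdeal)
    (ξ : Idx K → ZMod p) :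
    (av fun t : ZMod p => ind (ξ + t • red p d ∈ nonunitResidues K p)) ≤
      finrank ℤ (𝓞 K) / p := by
  calc _ ≤ av fun t : ZMod p => ∑ v ∈ fiber (K := K) p,
        ind (intEquiv K (lift (ξ + t • red p d)) ∈ v.asIdeal) := by
        refine av_mono fun t => ?_
        by_cases h : ξ + t • red p d ∈ nonunitResidues K p
        · obtain ⟨v, hv, h'⟩ := mem_nonunitResidues.mp h
          rw [ind_true h, ← ind_true h']
          exact single_le_sum (f := fun v : PrimeIdeal K =>
            ind (intEquiv K (lift (ξ + t • red p d)) ∈ v.asIdeal)) (fun _ _ => ind_nonneg _) hv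
        · rw [ind_false h]
          exact sum_nonneg fun _ _ => ind_nonneg _
    _ = ∑ v ∈ fiber (K := K) p, av fun t : ZMod p =>
        ind (intEquiv K (lift (ξ + t • red p d)) ∈ v.asIdeal) := av_sum _ _
    _ ≤ ∑ v ∈ fiber (K := K) p, (1 / p : ℝ) := sum_le_sum fun v hv => av_line_mem_le hv (hd v hv) ξ
    _ ≤ _ := by
        rw [sum_const, nsmul_eq_mul, mul_one_div]
        gcongr
        exact card_fiber_le hp.out

lemma intEquiv_symm_one_notMem (v : PrimeIdeal K) :
    intEquiv K ((intEquiv K).symm 1) ∉ v.asIdeal := by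
  rw [LinearEquiv.apply_symm_apply]
  exact (Ideal.ne_top_iff_one _).mp v.isMaximal.ne_top

variable (K p) in
lemma av_nonunit_le : (av fun x => ind (x ∈ nonunitResidues K p)) ≤ finrank ℤ (𝓞 K) / p := by
  have h : (av fun x => ind (x ∈ nonunitResidues K p)) = av fun x : Idx K → ZMod p =>
      av fun t : ZMod p => ind (x + t • red p ((intEquiv K).symm 1) ∈ nonunitResidues K p) := by
    rw [av_comm, ← av_const (X := ZMod p) (av fun x => ind (x ∈ nonunitResidues K p))]
    exact av_congr fun t => (av_add_right _ _).symm
  rw [h]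
  exact av_le fun x => av_line_nonunit_le (fun v _ => intEquiv_symm_one_notMem v) x

lemma unitDensity_eq : unitDensity K p = 1 - av fun x => ind (x ∈ nonunitResidues K p) := by
  rw [unitDensity, av_congr fun x => ind_not _, av_sub, av_const]

variable (K p) in
lemma unitDensity_pos : 0 < unitDensity K p := by
  have h : red p ((intEquiv K).symm 1) ∉ nonunitResidues K p := by
    rw [red_mem_nonunitResidues]
    rintro ⟨v, -, hv⟩
    exact intEquiv_symm_one_notMem v hv
  have := le_card_mul_av (f := fun x : Idx K → ZMod p => ind (x ∉ nonunitResidues K p))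
    (fun _ => ind_nonneg _) (red p ((intEquiv K).symm 1))
  rw [ind_true h] at this
  by_contra h'
  have h2 : (Nat.card (Idx K → ZMod p) : ℝ) * unitDensity K p ≤ 0 :=
    mul_nonpos_of_nonneg_of_nonpos (Nat.cast_nonneg _) (not_lt.mp h')
  rw [unitDensity] at h2
  linarith

lemma av_comp_of_surjective {X Y : Type*} [AddCommGroup X] [AddCommGroup Y] [Finite X] [Finite Y]
    (φ : X →+ Y) (hφ : Surjective φ) (f : Y → ℝ) : (av fun x => f (φ x)) = av f := by
  choose s hs using hφ
  have h1 : ∀ y, (av fun x => f (φ x)) = av fun x => f (φ x + y) := fun y => by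
    rw [← av_add_right (s y) fun x => f (φ x)]
    exact av_congr fun x => by rw [map_add, hs]
  rw [← av_const (X := Y) (av fun x => f (φ x)), av_congr h1, av_comm,
    ← av_const (X := X) (av f)]
  exact av_congr fun x => av_add_left _ _

variable (K p) in
lemma unitDensity_le : unitDensity K p ≤ ∏ v ∈ fiber (K := K) p, (1 - (pNorm v)⁻¹) := by
  classical
  have hm : ∀ v : fiber (K := K) p, (p : 𝓞 K) ∈ v.1.asIdeal := fun v =>
    (mem_fiber hp.out.ne_zero).mp v.2
  let φ : (Idx K → ZMod p) →+ ∀ v : fiber (K := K) p, 𝓞 K ⧸ v.1.asIdeal :=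
    { toFun := fun x v => Ideal.Quotient.mk _ (intEquiv K (lift x))
      map_zero' := by
        funext v
        rw [Pi.zero_apply, Ideal.Quotient.eq_zero_iff_mem, intEquiv_mem_iff_of_red_eq (hm v)
          (y' := 0) (by rw [red_lift]; funext i; simp [red]), map_zero]
        exact zero_mem _
      map_add' := fun x y => by
        funext v
        rw [Pi.add_apply, ← map_add, Ideal.Quotient.eq, ← map_add, ← map_sub,
          intEquiv_mem_iff_of_red_eq (hm v) (y' := 0) ?_, map_zero]
        · exact zero_mem _
        · have hl : ∀ (z : Idx K → ZMod p) i, ((lift z i : ℤ) : ZMod p) = z i :=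
            fun z i => ZMod.coe_valMinAbs _
          funext i
          simp [red, hl] }
  have hφ : ∀ y : Idx K → ℤ, ∀ v, φ (red p y) v = Ideal.Quotient.mk _ (intEquiv K y) := by
    intro y v
    refine (Ideal.Quotient.eq).mpr ?_
    rw [← map_sub, intEquiv_mem_iff_of_red_eq (hm v) (y' := 0) ?_, map_zero]
    · exact zero_mem _
    · have hl : ∀ (z : Idx K → ZMod p) i, ((lift z i : ℤ) : ZMod p) = z i :=
        fun z i => ZMod.coe_valMinAbs _
      funext i
      simp [red, hl]
  have hsurj : Surjective φ := by
    intro y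
    obtain ⟨r, hr⟩ := Ideal.exists_forall_sub_mem_ideal
      (I := fun v : fiber (K := K) p => v.1.asIdeal)
      (fun v u huv => Ideal.isCoprime_iff_sup_eq.mpr (v.1.isMaximal.coprime_of_ne u.1.isMaximal
        fun h => huv (Subtype.ext (HeightOneSpectrum.asIdeal_injective h))))
      (fun v => (Ideal.Quotient.mk_surjective (y v)).choose)
    refine ⟨red p ((intEquiv K).symm r), funext fun v => ?_⟩
    rw [hφ, LinearEquiv.apply_symm_apply, ← (Ideal.Quotient.mk_surjective (y v)).choose_spec]
    exact Ideal.Quotient.eq.mpr (hr v)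
  have hfin : ∀ v : fiber (K := K) p, Finite (𝓞 K ⧸ v.1.asIdeal) := fun v =>
    v.1.asIdeal.finiteQuotientOfFreeOfNeBot v.1.ne_bot
  calc unitDensity K p
      = av fun x : Idx K → ZMod p => ∏ v : fiber (K := K) p, ind (φ x v ≠ 0) := by
        refine av_congr fun x => ?_
        by_cases h : x ∈ nonunitResidues K p
        · rw [ind_false (not_not.mpr h)]
          obtain ⟨v, hv, h'⟩ := mem_nonunitResidues.mp h
          refine (prod_eq_zero (mem_univ (⟨v, hv⟩ : fiber (K := K) p)) (ind_false ?_)).symm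
          exact not_not.mpr (Ideal.Quotient.eq_zero_iff_mem.mpr h')
        · rw [ind_true h]
          refine (prod_eq_one fun v _ => ind_true fun h' => h ?_).symm
          exact mem_nonunitResidues.mpr ⟨v.1, v.2, Ideal.Quotient.eq_zero_iff_mem.mp h'⟩
    _ = av fun y : ∀ v : fiber (K := K) p, 𝓞 K ⧸ v.1.asIdeal => ∏ v, ind (y v ≠ 0) :=
        av_comp_of_surjective φ hsurj fun y => ∏ v, ind (y v ≠ 0)
    _ = ∏ v : fiber (K := K) p, av fun z : 𝓞 K ⧸ v.1.asIdeal => ind (z ≠ 0) :=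
        av_prod_eval fun v z => ind (z ≠ 0)
    _ = ∏ v : fiber (K := K) p, (1 - (pNorm v.1)⁻¹) := by
        refine prod_congr rfl fun v _ => ?_
        rw [av_congr fun z => ind_not _, av_sub, av_const]
        congr 1
        have := Fintype.ofFinite (𝓞 K ⧸ v.1.asIdeal)
        rw [av, finsum_eq_sum_of_fintype]
        have h1 : ∑ z : 𝓞 K ⧸ v.1.asIdeal, ind (z = 0) = 1 := by
          rw [sum_eq_single 0 (fun z _ hz => ind_false hz) (by simp), ind_true rfl]
        rw [h1, one_div]
        congr 1
    _ = _ := prod_coe_sort _ fun v => 1 - (pNorm v)⁻¹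
    _ ≤ _ := le_rfl

end UnitDensity

section SieveMass

variable (K)

lemma unitDensity_primorial (w : ℕ) :
    unitDensity K (primorial w) = ∏ p ∈ (range (w + 1)).filter Nat.Prime, unitDensity K p := by
  classical
  let q : {p // p ∈ (range (w + 1)).filter Nat.Prime} → ℕ := fun p => p.1
  have hpr : ∀ p, (q p).Prime := fun p => (mem_filter.mp p.2).2
  have : ∀ p, NeZero (q p) := fun p => ⟨(hpr p).ne_zero⟩
  have hqW : ∏ p, q p = primorial w := prod_coe_sort _ fun p => p
  have : NeZero (∏ p, q p) := ⟨Finset.prod_ne_zero_iff.mpr fun p _ => (hpr p).ne_zero⟩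
  have hq : Pairwise (Nat.Coprime on q) := fun p p' h =>
    (Nat.coprime_primes (hpr p) (hpr p')).mpr fun h' => h (Subtype.ext h')
  have key := av_prod_castHom (κ := Idx K) (κ' := Empty) hq
    fun p ω => ind (ω.1 ∉ nonunitResidues K (q p))
  rw [← hqW, ← prod_coe_sort _ fun p => unitDensity K p]
  have hr : ∀ p, av (fun ω : (Idx K → ZMod (q p)) × (Empty → ZMod (q p)) =>
      ind (ω.1 ∉ nonunitResidues K (q p))) = unitDensity K (q p) := fun p => by
    rw [av_prod]
    exact av_congr fun x => av_const (ind (x ∉ nonunitResidues K (q p)))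
  rw [← Finset.prod_congr rfl fun p _ => hr p, ← key, av_prod]
  refine av_congr fun x => ?_
  dsimp only
  rw [av_const]
  have hx : ∀ p, (fun i => ZMod.castHom (dvd_prod_of_mem q (mem_univ p)) (ZMod (q p)) (x i)) =
      red (q p) (lift x) := fun p => by
    conv_lhs => rw [← red_lift x]
    funext i
    exact map_intCast _ _
  simp_rw [hx, red_mem_nonunitResidues]
  by_cases h : x ∈ nonunitResidues K (∏ p, q p)
  · rw [ind_false (not_not.mpr h)]
    obtain ⟨v, hv, hx⟩ := h
    push_cast at hv
    obtain ⟨p, hp, hpv⟩ := (v.isPrime.prod_mem_iff).mp hv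
    exact (prod_eq_zero (mem_univ p) (ind_false (not_not.mpr ⟨v, hpv, hx⟩))).symm
  · rw [ind_true h]
    refine (prod_eq_one fun p _ => ind_true fun ⟨v, hpv, hx⟩ => h ⟨v, ?_, hx⟩).symm
    push_cast
    exact (v.isPrime.prod_mem_iff).mpr ⟨p, mem_univ p, hpv⟩

/-- The residues `x` modulo `p` for which the integer `W x + b` is not coprime to `p`. -/
def sieveSet (W : ℕ) (b : Idx K → ℤ) (p : ℕ) : Set (Idx K → ZMod p) :=
  {x | (W : ZMod p) • x + red p b ∈ nonunitResidues K p}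

variable {K}

lemma av_sieveSet {p : ℕ} [hp : Fact p.Prime] {W : ℕ} (hW : ¬ p ∣ W) (b : Idx K → ℤ) :
    (av fun x => ind (x ∈ sieveSet K W b p)) = 1 - unitDensity K p := by
  have hW' : (W : ZMod p) ≠ 0 := fun h => hW ((ZMod.natCast_eq_zero_iff _ _).mp h)
  rw [unitDensity_eq, sub_sub_cancel, ← av_add_right (red p b) fun x => ind (x ∈ nonunitResidues K p),
    ← av_comp_of_surjective (DistribSMul.toAddMonoidHom (Idx K → ZMod p) (W : ZMod p))
      (fun y => ⟨(W : ZMod p)⁻¹ • y, smul_inv_smul₀ hW' y⟩)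
      fun x => ind (x + red p b ∈ nonunitResidues K p)]
  rfl

lemma le_selbergWt_sieveSet {p : ℕ} [hp : Fact p.Prime] {W : ℕ} (hW : ¬ p ∣ W) (b : Idx K → ℤ) :
    ∏ v ∈ fiber (K := K) p, (1 - (pNorm v)⁻¹)⁻¹ - 1 ≤ selbergWt (sieveSet K W b p) := by
  rw [selbergWt, av_sieveSet hW, sub_sub_cancel, sub_div, div_self (unitDensity_pos K p).ne',
    prod_inv_distrib, one_div]
  gcongr
  · exact unitDensity_pos K p
  · exact unitDensity_le K p

lemma inv_pNorm_lt_one (v : PrimeIdeal K) : (pNorm v)⁻¹ < 1 := inv_lt_one_of_one_lt₀ (one_lt_pNorm v)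

lemma one_le_prod_inv (Q : Finset (PrimeIdeal K)) : 1 ≤ ∏ v ∈ Q, (1 - (pNorm v)⁻¹)⁻¹ :=
  prod_const_one.symm.le.trans (prod_le_prod (fun _ _ => zero_le_one) fun v _ =>
    (one_le_inv₀ (sub_pos.mpr (inv_pNorm_lt_one v))).mpr (by linarith [inv_pos.mpr (pNorm_pos v)]))

lemma prod_pow_le_expWt (Q : Finset (PrimeIdeal K)) (m : PrimeIdeal K →₀ ℕ) :
    ∏ v ∈ Q, pNorm v ^ m v ≤ expWt pNorm m := by
  classical
  rw [expWt, Finsupp.prod_of_support_subset m (subset_union_right (s₁ := Q)) _ fun _ _ => pow_zero _]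
  exact prod_le_prod_of_subset_of_one_le subset_union_left
    (fun v _ => (pow_pos (pNorm_pos v) _).le) fun v _ _ => one_le_pow₀ (one_lt_pNorm v).le

/-- The mass of the sieve is controlled from below by the harmonic sum over ideals. -/
theorem sum_inv_norm_le_sieveMass (w R : ℕ) (b : Idx K → ℤ) (A : Finset (PrimeIdeal K →₀ ℕ))
    (hA : ∀ m ∈ A, expWt pNorm m ≤ R) :
    ∑ m ∈ A, (expWt pNorm m)⁻¹ ≤ (unitDensity K (primorial w))⁻¹ *
      sieveMass (fun p : SievePrime w R => sieveSet K (primorial w) b p) (levels w R) := by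
  classical
  have : NeZero (primorial w) := ⟨(primorial_pos w).ne'⟩
  set wt : PrimeIdeal K → ℝ := fun v => (pNorm v)⁻¹
  have hw0 : ∀ v, 0 ≤ wt v := fun v => (inv_pos.mpr (pNorm_pos v)).le
  have hw1 : ∀ v, wt v < 1 := inv_pNorm_lt_one
  set Q : Finset (PrimeIdeal K) := ((range (w + 1)).filter Nat.Prime).biUnion fiber
  set B := A.image fun m => m.filter (· ∈ Q)
  set C := A.image fun m => m.filter fun v => ¬ v ∈ Q
  have hsplit := sum_expWt_le_mul hw0 (· ∈ Q) (A := A) (B := B) (C := C)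
    (fun m hm => mem_image_of_mem _ hm) fun m hm => mem_image_of_mem _ hm
  simp_rw [← expWt_inv]
  refine hsplit.trans (mul_le_mul ?_ ?_ (sum_nonneg fun m _ => expWt_nonneg hw0 m)
    (inv_nonneg.mpr (av_nonneg fun _ => ind_nonneg _)))
  · refine (sum_expWt_le_prod hw0 hw1 Q B ?_).trans ?_
    · intro z hz
      obtain ⟨m, hm, rfl⟩ := mem_image.mp hz
      intro v hv
      rw [Finsupp.support_filter, mem_filter] at hv
      exact hv.2
    · rw [unitDensity_primorial, ← prod_inv_distrib, prod_biUnion]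
      · refine prod_le_prod (fun p _ => zero_le_one.trans (one_le_prod_inv _)) fun p hp => ?_
        have : Fact p.Prime := ⟨(mem_filter.mp hp).2⟩
        rw [prod_inv_distrib]
        exact inv_anti₀ (unitDensity_pos K p) (unitDensity_le K p)
      · intro p hp p' hp' hne
        exact disjoint_left.mpr fun v hv hv' =>
          hne (eq_of_mem_fiber (mem_filter.mp hp).2 (mem_filter.mp hp').2 hv hv')
  · let ρ : (PrimeIdeal K →₀ ℕ) → Finset (SievePrime w R) := fun m =>
      univ.filter fun p => ∃ v ∈ fiber (K := K) p.1, m v ≠ 0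
    have hC : ∀ z ∈ C, expWt pNorm z ≤ R ∧ ∀ v, z v ≠ 0 → v ∉ Q := by
      intro z hz
      obtain ⟨m, hm, rfl⟩ := mem_image.mp hz
      refine ⟨le_trans ?_ (hA m hm), fun v hv => ?_⟩
      · conv_rhs => rw [← Finsupp.filter_add_filter_not m (· ∈ Q), expWt_add]
        exact le_mul_of_one_le_left (expWt_nonneg (fun v => (pNorm_pos v).le) _)
          (one_le_expWt_pNorm _)
      · intro h
        exact hv (by simp [h])
    have hlev : ∀ z ∈ C, ρ z ∈ levels w R := by
      intro z hz
      refine mem_filter.mpr ⟨mem_univ _, ?_⟩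
      have hch : ∀ p : SievePrime w R, p ∈ ρ z → ∃ v ∈ fiber (K := K) p.1, z v ≠ 0 :=
        fun p hp => (mem_filter.mp hp).2
      obtain hr | ⟨p₀, hp₀⟩ := (ρ z).eq_empty_or_nonempty
      · have h1 : (1 : ℝ) ≤ R := (one_le_expWt_pNorm z).trans (hC z hz).1
        rw [hr, prod_empty]
        exact_mod_cast h1
      have : Nonempty (PrimeIdeal K) := ⟨(hch p₀ hp₀).choose⟩
      choose! f hf1 hf2 using hch
      have hinj : Set.InjOn f (ρ z) := fun p hp p' hp' h => Subtype.ext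
        (eq_of_mem_fiber (mem_filter.mp p.2).2 (mem_filter.mp p'.2).2 (hf1 p hp) (h ▸ hf1 p' hp'))
      have : (∏ p ∈ ρ z, (p.1 : ℝ)) ≤ R := by
        calc ∏ p ∈ ρ z, (p.1 : ℝ) ≤ ∏ p ∈ ρ z, pNorm (f p) ^ z (f p) := by
              refine prod_le_prod (fun _ _ => Nat.cast_nonneg _) fun p hp => ?_
              exact (le_pNorm (mem_filter.mp p.2).2 (hf1 p hp)).trans
                (le_self_pow₀ (one_lt_pNorm _).le (hf2 p hp))
          _ = ∏ v ∈ (ρ z).image f, pNorm v ^ z v :=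
              (prod_image (f := fun v => pNorm v ^ z v) hinj).symm
          _ ≤ expWt pNorm z := prod_pow_le_expWt _ z
          _ ≤ R := (hC z hz).1
      exact_mod_cast this
    rw [← sum_fiberwise_of_maps_to hlev, sieveMass]
    refine sum_le_sum fun r _ => ?_
    refine (sum_expWt_le_prod_sub_one hw0 hw1 (fun p : SievePrime w R => fiber p.1) r ?_ _ ?_ ?_).trans
      ?_
    · intro p _ p' _ hne
      exact disjoint_left.mpr fun v hv hv' => hne (Subtype.ext
          (eq_of_mem_fiber (mem_filter.mp p.2).2 (mem_filter.mp p'.2).2 hv hv'))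
    · intro z hz v hv
      obtain ⟨hz, hzr⟩ := mem_filter.mp hz
      obtain ⟨p, hp, hvp⟩ := exists_prime_mem_fiber v
      have hv0 := Finsupp.mem_support_iff.mp hv
      have hvQ := (hC z hz).2 v hv0
      have hpw : w < p := by
        by_contra h
        exact hvQ (mem_biUnion.mpr ⟨p, mem_filter.mpr ⟨mem_range.mpr (by omega), hp⟩, hvp⟩)
      have hpR : p ≤ R := by
        have h1 : pNorm v ^ z v ≤ expWt pNorm z := by
          simpa using prod_pow_le_expWt {v} z
        have h2 := (le_pNorm hp hvp).trans (le_self_pow₀ (one_lt_pNorm v).le hv0)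
        exact_mod_cast h2.trans (h1.trans (hC z hz).1)
      refine mem_biUnion.mpr ⟨⟨p, mem_filter.mpr ⟨mem_Ioc.mpr ⟨hpw, hpR⟩, hp⟩⟩, ?_, hvp⟩
      rw [← hzr]
      exact mem_filter.mpr ⟨mem_univ _, v, hvp, hv0⟩
    · intro z hz p hp
      obtain ⟨hz, hzr⟩ := mem_filter.mp hz
      rw [← hzr] at hp
      exact (mem_filter.mp hp).2
    · refine prod_le_prod (fun p _ => sub_nonneg.mpr (one_le_prod_inv _)) fun p _ => ?_
      refine le_selbergWt_sieveSet ?_ b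
      intro h
      have hp := mem_filter.mp p.2
      obtain ⟨q, hq, hpq⟩ := (hp.2.prime.dvd_finsetProd_iff _).mp h
      have := (Nat.prime_dvd_prime_iff_eq hp.2 (mem_filter.mp hq).2).mp hpq
      have h3 := mem_range.mp (mem_filter.mp hq).1
      have h4 := (mem_Ioc.mp hp.1).1
      omega

end SieveMass

section VonMangoldt

/-- The logarithm of the norm of the ideal with given exponents. -/
noncomputable def logNorm (m : PrimeIdeal K →₀ ℕ) : ℝ := log (expWt pNorm m)

lemma expWt_pNorm_pos (m : PrimeIdeal K →₀ ℕ) : 0 < expWt pNorm m :=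
  one_pos.trans_le (one_le_expWt_pNorm m)

lemma exp_logNorm (m : PrimeIdeal K →₀ ℕ) : exp (logNorm m) = expWt pNorm m :=
  exp_log (expWt_pNorm_pos m)

@[simp] lemma logNorm_zero : logNorm (0 : PrimeIdeal K →₀ ℕ) = 0 := by simp [logNorm]

lemma logNorm_add (m m' : PrimeIdeal K →₀ ℕ) : logNorm (m + m') = logNorm m + logNorm m' := by
  rw [logNorm, expWt_add, log_mul (expWt_pNorm_pos m).ne' (expWt_pNorm_pos m').ne']
  rfl

lemma logNorm_nsmul (h : ℕ) (m : PrimeIdeal K →₀ ℕ) : logNorm (h • m) = h * logNorm m := by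
  rw [logNorm, expWt_smul, log_pow, logNorm]

lemma logNorm_single (v : PrimeIdeal K) (k : ℕ) :
    logNorm (single v k) = k * log (pNorm v) := by
  rw [logNorm, expWt_single, log_pow]

lemma logNorm_nonneg (m : PrimeIdeal K →₀ ℕ) : 0 ≤ logNorm m := log_nonneg (one_le_expWt_pNorm m)

lemma log_pNorm_pos (v : PrimeIdeal K) : 0 < log (pNorm v) := log_pos (one_lt_pNorm v)

lemma logNorm_eq_sum (m : PrimeIdeal K →₀ ℕ) :
    logNorm m = ∑ v ∈ m.support, m v * log (pNorm v) := by
  rw [logNorm, expWt, Finsupp.prod, log_prod fun v _ => (pow_pos (pNorm_pos v) _).ne']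
  exact sum_congr rfl fun v _ => log_pow _ _

lemma logNorm_pos {m : PrimeIdeal K →₀ ℕ} (hm : m ≠ 0) : 0 < logNorm m := by
  rw [logNorm_eq_sum]
  refine sum_pos (fun v hv => mul_pos ?_ (log_pNorm_pos v)) (Finsupp.support_nonempty_iff.mpr hm)
  exact_mod_cast Nat.pos_of_ne_zero (Finsupp.mem_support_iff.mp hv)

/-- The von Mangoldt function on ideals, given by their exponents. -/
noncomputable def mangoldt (m : PrimeIdeal K →₀ ℕ) : ℝ :=
  if #m.support = 1 then ∑ v ∈ m.support, log (pNorm v) else 0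

lemma mangoldt_nonneg (m : PrimeIdeal K →₀ ℕ) : 0 ≤ mangoldt m := by
  rw [mangoldt]
  split_ifs
  exacts [sum_nonneg fun v _ => (log_pNorm_pos v).le, le_rfl]

lemma mangoldt_single (v : PrimeIdeal K) {k : ℕ} (hk : k ≠ 0) :
    mangoldt (single v k) = log (pNorm v) := by
  simp [mangoldt, Finsupp.support_single, hk]

@[simp] lemma mangoldt_zero : mangoldt (0 : PrimeIdeal K →₀ ℕ) = 0 := by simp [mangoldt]

lemma exists_of_mangoldt_ne_zero {m : PrimeIdeal K →₀ ℕ} (h : mangoldt m ≠ 0) :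
    ∃ v k, k ≠ 0 ∧ m = single v k := by
  rw [mangoldt] at h
  split_ifs at h with h1
  · obtain ⟨v, hv⟩ := card_eq_one.mp h1
    exact ⟨v, m v, Finsupp.support_eq_singleton.mp hv⟩
  · exact absurd rfl h

/-- The ordered factorizations of `h • m` in which the second factor is the power with
exponent `h k`, `k ≥ 1`, of a prime ideal. -/
private noncomputable def powerPairs (h : ℕ) (m : PrimeIdeal K →₀ ℕ) :
    (Σ _ : PrimeIdeal K, ℕ) → (PrimeIdeal K →₀ ℕ) × (PrimeIdeal K →₀ ℕ) :=
  fun q => (h • (m - single q.1 q.2), h • single q.1 q.2)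

omit [NumberField K] in
lemma powerPairs_injOn {h : ℕ} (hh : h ≠ 0) (m : PrimeIdeal K →₀ ℕ) :
    Set.InjOn (powerPairs h m) (m.support.sigma fun v => Icc 1 (m v)) := by
  rintro ⟨v, k⟩ hq ⟨v', k'⟩ hq' heq
  obtain ⟨-, hk⟩ := mem_sigma.mp hq
  obtain ⟨-, hk'⟩ := mem_sigma.mp hq'
  have h1 : h • single v k = h • single v' k' := congrArg Prod.snd heq
  rw [Finsupp.smul_single, Finsupp.smul_single] at h1
  have hk0 := (mem_Icc.mp hk).1
  dsimp only at hk0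
  obtain ⟨rfl, h2⟩ | ⟨h2, -⟩ := Finsupp.single_eq_single_iff _ _ _ _ |>.mp h1
  · obtain rfl : k = k' := by simpa [hh] using h2
    rfl
  · simp [hh] at h2
    omega

omit [NumberField K] in
lemma powerPairs_mem {h : ℕ} {m : PrimeIdeal K →₀ ℕ} [DecidableEq (PrimeIdeal K)]
    {q : Σ _ : PrimeIdeal K, ℕ} (hq : q ∈ m.support.sigma fun v => Icc 1 (m v)) :
    m - single q.1 q.2 + single q.1 q.2 = m ∧
      powerPairs h m q ∈ antidiagonal (h • m) := by
  obtain ⟨-, hk⟩ := mem_sigma.mp hq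
  have : m - single q.1 q.2 + single q.1 q.2 = m :=
    tsub_add_cancel_of_le (Finsupp.single_le_iff.mpr (mem_Icc.mp hk).2)
  exact ⟨this, mem_antidiagonal.mpr (by rw [powerPairs, ← smul_add, this])⟩

lemma sum_antidiagonal_mangoldt [DecidableEq (PrimeIdeal K)] (m : PrimeIdeal K →₀ ℕ) :
    ∑ q ∈ antidiagonal m, mangoldt q.2 = logNorm m := by
  have himg : ((m.support.sigma fun v => Icc 1 (m v)).image (powerPairs 1 m)) ⊆ antidiagonal m := by
    intro q hq
    obtain ⟨q', hq', rfl⟩ := mem_image.mp hq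
    simpa using (powerPairs_mem (h := 1) hq').2
  rw [← sum_subset himg fun q hq hq' => ?_, sum_image (powerPairs_injOn one_ne_zero m), sum_sigma,
    logNorm_eq_sum]
  · refine sum_congr rfl fun v hv => ?_
    rw [sum_congr rfl fun k hk => show mangoldt (powerPairs 1 m ⟨v, k⟩).2 = log (pNorm v) by
      simp only [powerPairs, one_smul]
      exact mangoldt_single v (Nat.one_le_iff_ne_zero.mp (mem_Icc.mp hk).1)]
    simp
  · by_contra h0
    obtain ⟨v, k, hk, h1⟩ := exists_of_mangoldt_ne_zero h0
    have h2 := mem_antidiagonal.mp hq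
    have hk2 : k ≤ m v := by
      rw [← h2, h1]
      simp
    refine hq' (mem_image.mpr ⟨⟨v, k⟩, mem_sigma.mpr ⟨Finsupp.mem_support_iff.mpr
      (by dsimp only; omega), mem_Icc.mpr ⟨Nat.one_le_iff_ne_zero.mpr hk, hk2⟩⟩, ?_⟩)
    rw [powerPairs, one_smul, one_smul]
    refine Prod.ext ?_ h1.symm
    dsimp only
    rw [← h1, ← h2, add_tsub_cancel_right]

lemma le_sum_antidiagonal_nsmul [DecidableEq (PrimeIdeal K)] {h : ℕ} (hh : h ≠ 0)
    (m : PrimeIdeal K →₀ ℕ) (F : (PrimeIdeal K →₀ ℕ) × (PrimeIdeal K →₀ ℕ) → ℝ)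
    (hF : ∀ q ∈ antidiagonal (h • m), 0 ≤ F q)
    (hF1 : ∀ v k, k ≠ 0 → ∀ m', m' + single v k = m →
      log (pNorm v) ≤ F (h • m', h • single v k)) :
    logNorm m ≤ ∑ q ∈ antidiagonal (h • m), F q := by
  have himg : ((m.support.sigma fun v => Icc 1 (m v)).image (powerPairs h m)) ⊆
      antidiagonal (h • m) := by
    intro q hq
    obtain ⟨q', hq', rfl⟩ := mem_image.mp hq
    exact (powerPairs_mem hq').2
  refine le_trans ?_ (sum_le_sum_of_subset_of_nonneg himg fun q hq _ => hF q hq)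
  rw [sum_image (powerPairs_injOn hh m), sum_sigma, logNorm_eq_sum]
  refine sum_le_sum fun v hv => ?_
  refine le_trans (by simp) (sum_le_sum (f := fun _ => log (pNorm v)) fun k hk => ?_)
  exact hF1 v k (Nat.one_le_iff_ne_zero.mp (mem_Icc.mp hk).1) _
    (powerPairs_mem (h := h) (q := ⟨v, k⟩) (mem_sigma.mpr ⟨hv, hk⟩)).1

end VonMangoldt

section ClassCharacters

/-- The ideal class group, written additively. -/
abbrev AddClassGroup (K : Type*) [Field K] := Additive (ClassGroup (𝓞 K))

/-- The characters of the ideal class group. -/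
abbrev ClassChar (K : Type*) [Field K] [NumberField K] := AddChar (AddClassGroup K) ℂ

/-- The class of the ideal with given exponents, written additively. -/
noncomputable def idealClass : (PrimeIdeal K →₀ ℕ) →+ AddClassGroup K where
  toFun m := Additive.ofMul (ClassGroup.mk0 ⟨toIdeal m, mem_nonZeroDivisors_of_ne_zero (toIdeal_ne_zero m)⟩)
  map_zero' := by
    rw [← ofMul_one, ← map_one ClassGroup.mk0]
    congr 2
  map_add' l m := by
    rw [← ofMul_mul, ← map_mul]
    congr 2
    exact Subtype.ext (toIdeal_add l m)

/-- The Dirichlet series of a character of the class group, as a formal power series with one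
variable for each prime ideal. -/
noncomputable def charSeries (χ : ClassChar K) :
    MvPowerSeries (PrimeIdeal K) ℂ := fun m => χ (idealClass m)

lemma coeff_charSeries (χ : ClassChar K) (m : PrimeIdeal K →₀ ℕ) :
    coeff m (charSeries χ) = χ (idealClass m) := rfl

/-- The convolution of a set of characters of the class group. -/
noncomputable def charProd (F : Finset (ClassChar K)) :
    MvPowerSeries (PrimeIdeal K) ℂ := ∏ χ ∈ F, charSeries χ

lemma logNorm_mul_charSeries [DecidableEq (PrimeIdeal K)]
    (χ : ClassChar K) (m : PrimeIdeal K →₀ ℕ) :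
    logNorm m * χ (idealClass m) =
      ∑ q ∈ antidiagonal m, χ (idealClass q.1) * (χ (idealClass q.2) * mangoldt q.2) := by
  rw [← sum_antidiagonal_mangoldt m, Complex.ofReal_sum, sum_mul]
  refine sum_congr rfl fun q hq => ?_
  rw [← mem_antidiagonal.mp hq, map_add, AddChar.map_add_eq_mul]
  ring

lemma logNorm_mul_coeff_mul [DecidableEq (PrimeIdeal K)]
    {f g a b : MvPowerSeries (PrimeIdeal K) ℂ}
    (hf : ∀ m, logNorm m * coeff m f = coeff m (f * a))
    (hg : ∀ m, logNorm m * coeff m g = coeff m (g * b))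
    (m : PrimeIdeal K →₀ ℕ) :
    logNorm m * coeff m (f * g) = coeff m (f * g * (a + b)) := by
  rw [show f * g * (a + b) = f * a * g + f * (g * b) by ring, map_add, MvPowerSeries.coeff_mul,
    MvPowerSeries.coeff_mul _ (f * a), MvPowerSeries.coeff_mul _ f, mul_sum, ← sum_add_distrib]
  refine sum_congr rfl fun q hq => ?_
  rw [← hf, ← hg, ← mem_antidiagonal.mp hq, logNorm_add]
  push_cast
  ring

/-- The logarithmic derivative of a product of characters. -/
lemma logNorm_mul_coeff_charProd [DecidableEq (PrimeIdeal K)]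
    (F : Finset (ClassChar K)) (m : PrimeIdeal K →₀ ℕ) :
    logNorm m * coeff m (charProd F) = ∑ q ∈ antidiagonal m,
      coeff q.1 (charProd F) * ((∑ χ ∈ F, χ (idealClass q.2)) * mangoldt q.2) := by
  classical
  let L : ClassChar K → MvPowerSeries (PrimeIdeal K) ℂ :=
    fun χ m => χ (idealClass m) * mangoldt m
  have key : ∀ m, logNorm m * coeff m (charProd F) =
      coeff m (charProd F * ∑ χ ∈ F, L χ) := by
    induction F using Finset.induction_on with
    | empty =>
      intro m
      rw [charProd, prod_empty, sum_empty, mul_zero, map_zero, MvPowerSeries.coeff_one]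
      split_ifs with h
      · simp [h]
      · simp
    | insert χ F hχ ih =>
      rw [charProd, prod_insert hχ, sum_insert hχ]
      refine logNorm_mul_coeff_mul (fun m => ?_) ih
      rw [MvPowerSeries.coeff_mul]
      exact logNorm_mul_charSeries χ m
  rw [key, MvPowerSeries.coeff_mul]
  refine sum_congr rfl fun q _ => ?_
  rw [map_sum, sum_mul]
  rfl

/-- The convolution of all the characters has nonnegative coefficients, and coefficients at least
`1` at the powers whose exponent is the class number. -/
theorem exists_coeff_charProd_univ :
    ∃ r : (PrimeIdeal K →₀ ℕ) → ℝ, (∀ m, coeff m (charProd univ) = r m) ∧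
      (∀ m, 0 ≤ r m) ∧ ∀ m, 1 ≤ r (Fintype.card (AddClassGroup K) • m) := by
  classical
  set h := Fintype.card (AddClassGroup K)
  set d : (PrimeIdeal K →₀ ℕ) → ℂ := fun m => coeff m (charProd univ)
  have hd0 : d 0 = 1 := by
    simp only [d, charProd]
    rw [MvPowerSeries.coeff_zero_eq_constantCoeff_apply, map_prod]
    refine prod_eq_one fun χ _ => ?_
    rw [← MvPowerSeries.coeff_zero_eq_constantCoeff_apply, coeff_charSeries, map_zero,
      AddChar.map_zero_eq_one]
  set L : (PrimeIdeal K →₀ ℕ) → ℝ := fun m => (if idealClass m = 0 then (h : ℝ) else 0) * mangoldt m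
  have hL : ∀ m, 0 ≤ L m := fun m => mul_nonneg (by split_ifs <;> positivity) (mangoldt_nonneg m)
  have hrec : ∀ m, logNorm m * d m = ∑ q ∈ antidiagonal m, d q.1 * L q.2 := by
    intro m
    refine (logNorm_mul_coeff_charProd univ m).trans (sum_congr rfl fun q _ => ?_)
    rw [AddChar.sum_apply_eq_ite]
    simp only [L, h, d]
    split_ifs <;> simp
  have hreal : ∀ m, 0 ≤ (d m).re ∧ d m = ((d m).re : ℂ) := by
    intro m
    induction m using WellFoundedLT.induction with
    | _ m ih =>
    obtain rfl | hm := eq_or_ne m 0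
    · simp [hd0]
    have hl := logNorm_pos hm
    have hs : logNorm m * d m = ((∑ q ∈ antidiagonal m, (d q.1).re * L q.2 : ℝ) : ℂ) := by
      rw [hrec, Complex.ofReal_sum]
      refine sum_congr rfl fun q hq => ?_
      obtain h2 | h2 := eq_or_ne q.2 0
      · simp [L, h2]
      · have : q.1 < m := by
          rw [← mem_antidiagonal.mp hq]
          exact lt_add_of_pos_right _ (pos_iff_ne_zero.mpr h2)
        rw [(ih _ this).2, Complex.ofReal_re, ← Complex.ofReal_mul]
    have hdm : d m = (((∑ q ∈ antidiagonal m, (d q.1).re * L q.2) / logNorm m : ℝ) : ℂ) := by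
      rw [Complex.ofReal_div, ← hs, mul_div_cancel_left₀]
      exact_mod_cast hl.ne'
    rw [hdm, Complex.ofReal_re]
    refine ⟨div_nonneg (sum_nonneg fun q hq => ?_) hl.le, rfl⟩
    obtain h2 | h2 := eq_or_ne q.2 0
    · simp [L, h2]
    · have : q.1 < m := by
        rw [← mem_antidiagonal.mp hq]
        exact lt_add_of_pos_right _ (pos_iff_ne_zero.mpr h2)
      exact mul_nonneg (ih _ this).1 (hL _)
  refine ⟨fun m => (d m).re, fun m => (hreal m).2, fun m => (hreal m).1, fun m => ?_⟩
  have hh : h ≠ 0 := Fintype.card_ne_zero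
  induction m using WellFoundedLT.induction with
  | _ m ih =>
  obtain rfl | hm := eq_or_ne m 0
  · simp [hd0]
  have hl := logNorm_pos hm
  have hrec' : logNorm (h • m) * (d (h • m)).re =
      ∑ q ∈ antidiagonal (h • m), (d q.1).re * L q.2 := by
    have := hrec (h • m)
    rw [(hreal (h • m)).2, sum_congr rfl fun q _ => by rw [(hreal q.1).2, ← Complex.ofReal_mul],
      ← Complex.ofReal_sum] at this
    exact_mod_cast this
  have h1 : (h : ℝ)⁻¹ * ∑ q ∈ antidiagonal (h • m), (d q.1).re * L q.2 ≥ logNorm m := by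
    rw [mul_sum]
    refine le_sum_antidiagonal_nsmul hh m _ (fun q _ => ?_) fun v k hk m' hm' => ?_
    · exact mul_nonneg (by positivity) (mul_nonneg (hreal _).1 (hL _))
    · have hlt : m' < m := by
        rw [← hm']
        exact lt_add_of_pos_right _ (pos_iff_ne_zero.mpr (Finsupp.single_ne_zero.mpr hk))
      have hcl : idealClass (h • single v k) = 0 := by
        rw [map_nsmul]
        exact card_nsmul_eq_zero
      have hΛ : mangoldt (h • single v k) = log (pNorm v) := by
        rw [Finsupp.smul_single]
        exact mangoldt_single v (by simp [hh, hk])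
      simp only [L, hcl, hΛ, if_true]
      have hh' : (h : ℝ) ≠ 0 := by exact_mod_cast hh
      rw [mul_left_comm, inv_mul_cancel_left₀ hh']
      exact le_mul_of_one_le_left (log_pNorm_pos v).le (ih m' hlt)
  rw [← hrec', logNorm_nsmul, mul_assoc, inv_mul_cancel_left₀ (by exact_mod_cast hh)] at h1
  exact le_of_mul_le_mul_left (by simpa using h1) hl

end ClassCharacters

section SmoothSum

variable (K) in
lemma finite_setOf_logNorm_le (x : ℝ) : {m : PrimeIdeal K →₀ ℕ | logNorm m ≤ x}.Finite := by
  refine (finite_setOf_expWt_le (exp x)).subset fun m hm => ?_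
  exact (log_le_iff_le_exp (expWt_pNorm_pos m)).mp hm

variable (K) in
/-- The ideals, given by their exponents, whose logarithmic norm is at most `x`. -/
noncomputable def normBall (x : ℝ) : Finset (PrimeIdeal K →₀ ℕ) := (finite_setOf_logNorm_le K x).toFinset

@[simp] lemma mem_normBall {x : ℝ} {m : PrimeIdeal K →₀ ℕ} : m ∈ normBall K x ↔ logNorm m ≤ x := by
  simp [normBall]

/-- The sum of the coefficients of `a` against a translate of `φ` on the logarithmic scale. -/
noncomputable def smoothSum (a : MvPowerSeries (PrimeIdeal K) ℂ) (φ : ℝ → ℝ) (t : ℝ) : ℂ :=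
  ∑ᶠ m, coeff m a * φ (logNorm m - t)

variable {a b : MvPowerSeries (PrimeIdeal K) ℂ} {φ ψ : ℝ → ℝ} {R R' : ℝ}

lemma smoothSum_eq (hφ : ∀ y, R ≤ |y| → φ y = 0) {t x : ℝ} (h : t + R ≤ x) :
    smoothSum a φ t = ∑ m ∈ normBall K x, coeff m a * φ (logNorm m - t) := by
  refine finsum_eq_sum_of_support_subset _ fun m hm => ?_
  rw [mem_coe, mem_normBall]
  by_contra! h'
  refine hm ?_
  dsimp only
  rw [hφ _ (le_trans (by linarith) (le_abs_self _)), Complex.ofReal_zero, mul_zero]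

lemma smoothSum_of_le (hφ : ∀ y, R ≤ |y| → φ y = 0) {t : ℝ} (h : t ≤ -R) : smoothSum a φ t = 0 := by
  rw [smoothSum, finsum_congr fun m => ?_, finsum_zero]
  rw [hφ _ (le_trans (by linarith [logNorm_nonneg m]) (le_abs_self _)), Complex.ofReal_zero, mul_zero]

lemma continuous_smoothSum (hφ : ∀ y, R ≤ |y| → φ y = 0) (hc : Continuous φ) :
    Continuous (smoothSum a φ) := by
  refine continuous_iff_continuousAt.mpr fun t₀ => ?_
  refine ContinuousAt.congr (f := fun t => ∑ m ∈ normBall K (t₀ + 1 + R),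
    coeff m a * (φ (logNorm m - t) : ℂ)) (Continuous.continuousAt (by fun_prop)) ?_
  filter_upwards [Iic_mem_nhds (lt_add_one t₀)] with t ht
  exact (smoothSum_eq hφ (add_le_add_left ht R)).symm

lemma sum_coeff_mul (F : ℝ → ℂ) {X : ℝ} (hF : ∀ z, X < z → F z = 0) :
    ∑ m ∈ normBall K X, coeff m (a * b) * F (logNorm m) =
      ∑ x ∈ normBall K X, ∑ y ∈ normBall K X,
        coeff x a * coeff y b * F (logNorm x + logNorm y) := by
  classical
  rw [← sum_product', ← sum_filter_of_ne (s := normBall K X ×ˢ normBall K X)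
    (p := fun q => q.1 + q.2 ∈ normBall K X) fun q _ hq => ?_]
  · rw [← sum_fiberwise_of_maps_to (g := fun q : (PrimeIdeal K →₀ ℕ) × (PrimeIdeal K →₀ ℕ) => q.1 + q.2)
      fun q hq => (mem_filter.mp hq).2]
    refine sum_congr rfl fun m hm => ?_
    rw [MvPowerSeries.coeff_mul, sum_mul]
    refine sum_congr ?_ fun q hq => ?_
    · ext q
      simp only [HasAntidiagonal.mem_antidiagonal, mem_filter, mem_product, mem_normBall]
      refine ⟨fun h => ?_, fun h => h.2⟩
      rw [mem_normBall, ← h, logNorm_add] at hm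
      refine ⟨⟨⟨?_, ?_⟩, ?_⟩, h⟩ <;> try rw [logNorm_add]
      all_goals linarith [logNorm_nonneg q.1, logNorm_nonneg q.2]
    · rw [← logNorm_add, (mem_filter.mp hq).2]
  · by_contra h
    rw [mem_normBall, not_le, logNorm_add] at h
    exact hq (by rw [hF _ h, mul_zero])

lemma smoothSum_mul (hφ : ∀ y, R ≤ |y| → φ y = 0) {t x : ℝ} (h : t + R ≤ x) :
    smoothSum (a * b) φ t =
      ∑ m ∈ normBall K x, coeff m b * smoothSum a φ (t - logNorm m) := by
  rw [smoothSum_eq hφ h, sum_coeff_mul (fun z => (φ (z - t) : ℂ)) fun z hz => by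
    rw [hφ _ (le_trans (by linarith) (le_abs_self _)), Complex.ofReal_zero], sum_comm]
  refine sum_congr rfl fun m _ => ?_
  rw [smoothSum_eq hφ (x := x) (by linarith [logNorm_nonneg m]), mul_sum]
  refine sum_congr rfl fun m' _ => ?_
  rw [show logNorm m' - (t - logNorm m) = logNorm m' + logNorm m - t by ring]
  ring

/-- Additive convolution of test functions. -/
noncomputable def conv (φ ψ : ℝ → ℝ) (y : ℝ) : ℝ := ∫ x, φ x * ψ (y - x)

lemma conv_eq_zero (hφ : ∀ y, R ≤ |y| → φ y = 0) (hψ : ∀ y, R' ≤ |y| → ψ y = 0) {y : ℝ}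
    (hy : R + R' ≤ |y|) : conv φ ψ y = 0 := by
  rw [conv, ← integral_zero]
  congr 1
  ext x
  by_cases h : R ≤ |x|
  · rw [hφ x h, zero_mul]
  · rw [hψ, mul_zero]
    have := abs_add_le (y - x) x
    rw [sub_add_cancel] at this
    linarith

lemma smoothSum_conv (hφ : ∀ y, R ≤ |y| → φ y = 0) (hψ : ∀ y, R' ≤ |y| → ψ y = 0)
    (hφc : Continuous φ) (hψc : Continuous ψ) (hφs : HasCompactSupport φ) (t : ℝ) :
    smoothSum (a * b) (conv φ ψ) t = ∫ u, smoothSum a φ u * smoothSum b ψ (t - u) := by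
  set B := normBall K (t + (R + R'))
  have h1 : ∀ u, smoothSum a φ u * smoothSum b ψ (t - u) = ∑ x ∈ B, ∑ y ∈ B,
      coeff x a * coeff y b *
        ((φ (logNorm x - u) * ψ (logNorm y - (t - u)) : ℝ) : ℂ) := by
    intro u
    obtain h | h := le_or_gt u (-R)
    · rw [smoothSum_of_le hφ h, zero_mul]
      refine (sum_eq_zero fun x _ => sum_eq_zero fun y _ => ?_).symm
      rw [hφ _ (le_trans (by linarith [logNorm_nonneg x]) (le_abs_self _))]
      simp
    obtain h' | h' := le_or_gt (t - u) (-R')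
    · rw [smoothSum_of_le hψ h', mul_zero]
      refine (sum_eq_zero fun x _ => sum_eq_zero fun y _ => ?_).symm
      rw [hψ _ (le_trans (by linarith [logNorm_nonneg y]) (le_abs_self _))]
      simp
    rw [smoothSum_eq hφ (x := t + (R + R')) (by linarith),
      smoothSum_eq hψ (x := t + (R + R')) (by linarith), sum_mul_sum]
    refine sum_congr rfl fun x _ => sum_congr rfl fun y _ => ?_
    push_cast
    ring
  have hit : ∀ x y : PrimeIdeal K →₀ ℕ,
      Integrable fun u => φ (logNorm x - u) * ψ (logNorm y - (t - u)) := by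
    intro x y
    refine Continuous.integrable_of_hasCompactSupport (by fun_prop) ?_
    refine HasCompactSupport.mul_right ?_
    exact hφs.comp_homeomorph (Homeomorph.subLeft (logNorm x))
  simp_rw [h1]
  rw [integral_finsetSum _ fun x _ => integrable_finsetSum _ fun y _ =>
    ((hit x y).ofReal.const_mul _), smoothSum_eq (fun y => conv_eq_zero hφ hψ) le_rfl,
    sum_coeff_mul (fun z => (conv φ ψ (z - t) : ℂ)) fun z hz => by
      rw [conv_eq_zero hφ hψ (le_trans (by linarith) (le_abs_self _)), Complex.ofReal_zero]]
  refine sum_congr rfl fun x _ => ?_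
  rw [integral_finsetSum _ fun y _ => ((hit x y).ofReal.const_mul _)]
  refine sum_congr rfl fun y _ => ?_
  rw [integral_const_mul, integral_complex_ofReal, conv,
    ← integral_sub_left_eq_self _ _ (logNorm x)]
  congr 3
  ext u
  congr 2
  ring

end SmoothSum

section Growth

lemma norm_mul_ofReal_exp (z : ℂ) (x : ℝ) : ‖z * exp x‖ = ‖z‖ * exp x := by
  rw [norm_mul, Complex.norm_real, Real.norm_of_nonneg (exp_pos _).le]

/-- Functions on the line which vanish near `-∞` and grow at most polynomially at `∞`. -/
def PolyBounded (f : ℝ → ℂ) : Prop :=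
  ∃ (R C : ℝ) (k : ℕ), 0 ≤ R ∧ (∀ t, t ≤ -R → f t = 0) ∧ ∀ t, ‖f t‖ ≤ C * (1 + |t|) ^ k

lemma PolyBounded.conv {f g : ℝ → ℂ} (hf : PolyBounded f) (hg : PolyBounded g) :
    PolyBounded fun t => ∫ u, f u * g (t - u) := by
  obtain ⟨R, C, k, hR, hf0, hf1⟩ := hf
  obtain ⟨R', C', k', hR', hg0, hg1⟩ := hg
  have hC : 0 ≤ C := by simpa using (norm_nonneg _).trans (hf1 0)
  have hC' : 0 ≤ C' := by simpa using (norm_nonneg _).trans (hg1 0)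
  set ρ := 1 + R + R'
  have hz : ∀ t, ∀ u ∉ Set.Icc (-R) (t + R'), f u * g (t - u) = 0 := by
    intro t u hu
    by_cases h : u ≤ -R
    · rw [hf0 u h, zero_mul]
    · rw [hg0, mul_zero]
      by_contra h'
      exact hu ⟨by linarith, by linarith⟩
  refine ⟨R + R', C * C' * (ρ ^ (k + k') * ρ), k + k' + 1, by positivity, fun t ht => ?_, fun t => ?_⟩
  · refine integral_eq_zero_of_ae (Eventually.of_forall fun u => ?_)
    change f u * g (t - u) = 0
    by_cases hu : u ≤ -R
    · rw [hf0 u hu, zero_mul]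
    · rw [hg0 _ (by linarith), mul_zero]
  · dsimp only
    rw [← setIntegral_eq_integral_of_forall_compl_eq_zero (hz t)]
    have hρ : 1 + R + R' + |t| ≤ ρ * (1 + |t|) := by
      simp only [ρ]
      nlinarith [abs_nonneg t]
    have hb : ∀ u ∈ Set.Icc (-R) (t + R'), ‖f u * g (t - u)‖ ≤ C * C' * (ρ * (1 + |t|)) ^ (k + k') := by
      rintro u ⟨hu1, hu2⟩
      have h1 : 1 + |u| ≤ ρ * (1 + |t|) := by
        refine le_trans ?_ hρ
        have : |u| ≤ R + R' + |t| := abs_le.mpr ⟨by linarith [abs_nonneg t], by linarith [le_abs_self t]⟩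
        linarith
      have h2 : 1 + |t - u| ≤ ρ * (1 + |t|) := by
        refine le_trans ?_ hρ
        have : |t - u| ≤ R + R' + |t| := abs_le.mpr ⟨by linarith [abs_nonneg t], by linarith [le_abs_self t]⟩
        linarith
      rw [norm_mul, pow_add]
      calc ‖f u‖ * ‖g (t - u)‖ ≤ (C * (1 + |u|) ^ k) * (C' * (1 + |t - u|) ^ k') := by
            gcongr
            exacts [hf1 u, hg1 _]
        _ ≤ (C * (ρ * (1 + |t|)) ^ k) * (C' * (ρ * (1 + |t|)) ^ k') := by gcongr
        _ = _ := by ring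
    refine (norm_setIntegral_le_of_norm_le_const (by simp) hb).trans ?_
    have hvol : volume.real (Set.Icc (-R) (t + R')) ≤ ρ * (1 + |t|) := by
      rw [Real.volume_real_Icc]
      refine max_le (le_trans ?_ hρ) (by positivity)
      linarith [le_abs_self t]
    calc _ ≤ C * C' * (ρ * (1 + |t|)) ^ (k + k') * (ρ * (1 + |t|)) := by gcongr
      _ = _ := by rw [mul_pow]; ring

/-- If `g` is an exponential up to a bounded error, then convolving it with a bounded function whose
Laplace transform vanishes at the exponent leaves only polynomial growth. -/
lemma polyBounded_conv_of_integral_eq_zero {f g : ℝ → ℂ} {R C C' : ℝ} {A : ℂ}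
    (hfc : Continuous f) (hgc : Continuous g) (hR : 0 ≤ R)
    (hf0 : ∀ t, t ≤ -R → f t = 0) (hf1 : ∀ t, ‖f t‖ ≤ C)
    (hg0 : ∀ t, t ≤ -R → g t = 0) (hg1 : ∀ t, ‖g t - A * exp t‖ ≤ C')
    (hI : ∫ u, f u * exp (-u) = 0) :
    PolyBounded fun t => ∫ u, f u * g (t - u) := by
  have hC : 0 ≤ C := (norm_nonneg _).trans (hf1 0)
  have hC' : 0 ≤ C' := (norm_nonneg _).trans (hg1 0)
  have hit : Integrable fun u => f u * (exp (-u) : ℂ) := by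
    rw [← integrableOn_iff_integrable_of_support_subset (s := Set.Ioi (-R))]
    · refine ((integrableOn_exp_neg_Ioi (-R)).const_mul C).mono'
        (Continuous.aestronglyMeasurable (by fun_prop)) (Eventually.of_forall fun u => ?_)
      rw [norm_mul_ofReal_exp]
      gcongr
      exact hf1 u
    · intro u hu
      by_contra h
      exact hu (by simp [hf0 u (not_lt.mp h)])
  have hz : ∀ t, ∀ u ∉ Set.Icc (-R) (t + R), f u * g (t - u) = 0 := by
    intro t u hu
    by_cases h : u ≤ -R
    · rw [hf0 u h, zero_mul]
    · rw [hg0, mul_zero]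
      by_contra h'
      exact hu ⟨by linarith, by linarith⟩
  refine ⟨R + R, C * C' * (1 + R + R) + ‖A‖ * (C * exp R), 1, by positivity, fun t ht => ?_, fun t => ?_⟩
  · refine integral_eq_zero_of_ae (Eventually.of_forall fun u => ?_)
    change f u * g (t - u) = 0
    by_cases hu : u ≤ -R
    · rw [hf0 u hu, zero_mul]
    · rw [hg0 _ (by linarith), mul_zero]
  obtain ht | ht := lt_or_ge (t + R) (-R)
  · have h0 : ∫ u, f u * g (t - u) = 0 :=
      integral_eq_zero_of_ae (Eventually.of_forall fun u =>
        hz t u fun hu => by linarith [hu.1, hu.2])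
    dsimp only
    rw [h0, norm_zero]
    positivity
  have hsplit : ∫ u, f u * g (t - u) = (∫ u in Set.Icc (-R) (t + R), f u * (g (t - u) - A * exp (t - u)))
      - A * exp t * ∫ u in Set.Ioi (t + R), f u * exp (-u) := by
    have h2 : (∫ u in Set.Icc (-R) (t + R), f u * exp (-u)) = - ∫ u in Set.Ioi (t + R), f u * exp (-u) := by
      rw [eq_neg_iff_add_eq_zero, ← setIntegral_union (t := Set.Ioi (t + R))
        (Set.disjoint_left.mpr fun u hu hu' => not_lt.mpr hu.2 hu') measurableSet_Ioi
        hit.integrableOn hit.integrableOn,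
        Set.Icc_union_Ioi_eq_Ici ht, setIntegral_eq_integral_of_forall_compl_eq_zero, hI]
      intro u hu
      rw [hf0 u (not_le.mp hu).le, zero_mul]
    have he : ∀ u, f u * g (t - u) =
        f u * (g (t - u) - A * exp (t - u)) + A * exp t * (f u * exp (-u)) := by
      intro u
      rw [sub_eq_add_neg t u, exp_add]
      push_cast
      ring
    rw [← setIntegral_eq_integral_of_forall_compl_eq_zero (hz t),
      setIntegral_congr_fun measurableSet_Icc fun u _ => he u,
      integral_add, integral_const_mul, h2]
    · ring
    · exact (Continuous.integrableOn_Icc (by fun_prop))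
    · exact (hit.const_mul _).integrableOn
  dsimp only
  rw [hsplit]
  refine (norm_sub_le _ _).trans ?_
  have b1 : ‖∫ u in Set.Icc (-R) (t + R), f u * (g (t - u) - A * exp (t - u))‖ ≤
      C * C' * (1 + R + R) * (1 + |t|) := by
    refine (norm_setIntegral_le_of_norm_le_const (C := C * C') (by simp) fun u _ => ?_).trans ?_
    · rw [norm_mul]
      exact mul_le_mul (hf1 u) (hg1 _) (norm_nonneg _) hC
    · rw [Real.volume_real_Icc, mul_assoc (C * C')]
      refine mul_le_mul_of_nonneg_left (max_le ?_ (by positivity)) (by positivity)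
      nlinarith [le_abs_self t, abs_nonneg t]
  have b2 : ‖∫ u in Set.Ioi (t + R), f u * exp (-u)‖ ≤ C * exp (-(t + R)) := by
    refine (norm_integral_le_of_norm_le
      ((integrableOn_exp_neg_Ioi (t + R)).const_mul C) (Eventually.of_forall fun u => ?_)).trans ?_
    · rw [norm_mul_ofReal_exp]
      gcongr
      exact hf1 u
    · rw [integral_const_mul, integral_exp_neg_Ioi]
  have b3 : ‖A * exp t * ∫ u in Set.Ioi (t + R), f u * exp (-u)‖ ≤ ‖A‖ * (C * exp R) := by
    rw [norm_mul, norm_mul_ofReal_exp, mul_assoc]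
    refine mul_le_mul_of_nonneg_left ?_ (norm_nonneg _)
    calc _ ≤ exp t * (C * exp (-(t + R))) := by gcongr
      _ = C * exp (t + -(t + R)) := by rw [exp_add]; ring
      _ ≤ _ := by gcongr; linarith
  rw [pow_one, add_mul]
  refine add_le_add b1 (b3.trans (le_mul_of_one_le_right (by positivity) ?_))
  linarith [abs_nonneg t]

end Growth

section TestFunctions

open scoped ContDiff

/-- Smooth compactly supported functions on the line. -/
structure IsTest (φ : ℝ → ℝ) : Prop where
  contDiff : ContDiff ℝ ∞ φ
  compact : HasCompactSupport φ

/-- Nonnegative nonzero test functions. -/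
structure IsBump (φ : ℝ → ℝ) : Prop extends IsTest φ where
  nonneg : ∀ y, 0 ≤ φ y
  exists_ne_zero : ∃ y, φ y ≠ 0

variable {φ ψ : ℝ → ℝ}

lemma IsTest.continuous (hφ : IsTest φ) : Continuous φ := hφ.contDiff.continuous

lemma IsTest.exists_radius (hφ : IsTest φ) : ∃ R, 0 ≤ R ∧ ∀ y, R ≤ |y| → φ y = 0 := by
  obtain ⟨R, hR, h⟩ := hφ.compact.exists_pos_le_norm
  exact ⟨R, hR.le, h⟩

lemma IsTest.id_mul (hφ : IsTest φ) : IsTest fun y => y * φ y :=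
  ⟨contDiff_id.mul hφ.contDiff, hφ.compact.mul_left⟩

lemma exists_isBump : ∃ φ, IsBump φ := by
  obtain ⟨φ, -, h1, h2, h3, h4⟩ :=
    exists_contDiff_tsupport_subset (n := ⊤) (univ_mem : Set.univ ∈ nhds (0 : ℝ))
  exact ⟨φ, ⟨h2, h1⟩, fun y => (h3 ⟨y, rfl⟩).1, 0, by simp [h4]⟩

lemma IsBump.integral_mul_exp_pos (hφ : IsBump φ) : 0 < ∫ y, φ y * exp y := by
  obtain ⟨y, hy⟩ := hφ.exists_ne_zero
  exact Continuous.integral_pos_of_hasCompactSupport_nonneg_nonzero (x := y)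
    (hφ.continuous.mul Real.continuous_exp) hφ.compact.mul_right
    (fun y => mul_nonneg (hφ.nonneg y) (exp_pos y).le) (mul_ne_zero hy (exp_pos y).ne')

lemma IsBump.conv (hφ : IsBump φ) (hψ : IsBump ψ) : IsBump (conv φ ψ) := by
  refine ⟨⟨?_, ?_⟩, fun y => ?_, ?_⟩
  · exact hφ.compact.contDiff_convolution_left (n := ⊤) (ContinuousLinearMap.mul ℝ ℝ) hφ.contDiff
      hψ.continuous.locallyIntegrable
  · exact HasCompactSupport.convolution (ContinuousLinearMap.mul ℝ ℝ) hφ.compact hψ.compact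
  · exact integral_nonneg fun x => mul_nonneg (hφ.nonneg x) (hψ.nonneg _)
  · obtain ⟨x, hx⟩ := hφ.exists_ne_zero
    obtain ⟨y, hy⟩ := hψ.exists_ne_zero
    refine ⟨x + y, (Continuous.integral_pos_of_hasCompactSupport_nonneg_nonzero (x := x)
      (hφ.continuous.mul (hψ.continuous.comp (continuous_sub_left (x + y)))) hφ.compact.mul_right
      (fun x => mul_nonneg (hφ.nonneg x) (hψ.nonneg _)) ?_).ne'⟩
    simpa using ⟨hx, hy⟩

lemma IsBump.comp_mul (hφ : IsBump φ) {c : ℝ} (hc : c ≠ 0) : IsBump fun y => φ (c * y) := by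
  obtain ⟨y, hy⟩ := hφ.exists_ne_zero
  refine ⟨⟨hφ.contDiff.comp (contDiff_const.mul contDiff_id), ?_⟩, fun y => hφ.nonneg _, c⁻¹ * y, ?_⟩
  · exact hφ.compact.comp_homeomorph (Homeomorph.mulLeft₀ c hc)
  · rwa [mul_inv_cancel_left₀ hc]

end TestFunctions

section Nonvanishing

/-- The number of ideals in a class, weighted by a test function of the logarithm of the norm. -/
noncomputable def classSum (g : AddClassGroup K) (φ : ℝ → ℝ) (t : ℝ) : ℝ :=
  ∑ᶠ m, ind (idealClass m = g) * φ (logNorm m - t)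

variable (K) in
/-- Ideals are equidistributed among the classes, with bounded error in smooth counts. -/
def SmoothCount (κ : ℝ) : Prop := ∀ φ, IsTest φ → ∀ g : AddClassGroup K, ∃ C, ∀ t,
  |classSum g φ t - κ * (∫ y, φ y * exp y) * exp t| ≤ C

variable {φ ψ : ℝ → ℝ} {R : ℝ} {χ : ClassChar K} {κ : ℝ}

lemma classSum_eq (g : AddClassGroup K) (hφ : ∀ y, R ≤ |y| → φ y = 0) {t x : ℝ}
    (h : t + R ≤ x) :
    classSum g φ t = ∑ m ∈ normBall K x, ind (idealClass m = g) * φ (logNorm m - t) := by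
  refine finsum_eq_sum_of_support_subset _ fun m hm => ?_
  rw [mem_coe, mem_normBall]
  by_contra! h'
  refine hm ?_
  dsimp only
  rw [hφ _ (le_trans (by linarith) (le_abs_self _)), mul_zero]

lemma smoothSum_charSeries (χ : ClassChar K) (hφ : IsTest φ) (t : ℝ) :
    smoothSum (charSeries χ) φ t = ∑ g, χ g * classSum g φ t := by
  classical
  obtain ⟨R, -, hR⟩ := hφ.exists_radius
  rw [smoothSum_eq hR le_rfl]
  simp_rw [classSum_eq _ hR le_rfl, Complex.ofReal_sum, mul_sum]
  rw [sum_comm]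
  refine sum_congr rfl fun m _ => ?_
  rw [sum_eq_single (idealClass m)]
  · rw [ind_true rfl, one_mul, coeff_charSeries]
  · intro g _ hg
    rw [ind_false hg.symm]
    simp
  · simp

lemma SmoothCount.exists_norm_sub_le (hκ : SmoothCount K κ) (hφ : IsTest φ)
    (χ : ClassChar K) :
    ∃ C, ∀ t, ‖smoothSum (charSeries χ) φ t -
      (∑ g, χ g) * (κ * ∫ y, φ y * exp y : ℝ) * exp t‖ ≤ C := by
  choose C hC using hκ φ hφ
  refine ⟨∑ g, C g, fun t => ?_⟩
  rw [smoothSum_charSeries χ hφ, sum_mul, sum_mul, ← sum_sub_distrib]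
  refine (norm_sum_le _ _).trans (sum_le_sum fun g _ => ?_)
  rw [mul_assoc, ← mul_sub, norm_mul, AddChar.norm_apply, one_mul]
  refine le_trans (le_of_eq ?_) (hC g t)
  rw [← Real.norm_eq_abs, ← Complex.norm_real]
  push_cast
  rfl

lemma SmoothCount.exists_norm_le (hκ : SmoothCount K κ) (hφ : IsTest φ) (hχ : χ ≠ 0) :
    ∃ C, ∀ t, ‖smoothSum (charSeries χ) φ t‖ ≤ C := by
  classical
  obtain ⟨C, hC⟩ := hκ.exists_norm_sub_le hφ χ
  rw [AddChar.sum_eq_ite, if_neg hχ] at hC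
  exact ⟨C, fun t => by simpa using hC t⟩

lemma SmoothCount.exists_norm_sub_le_of_zero (hκ : SmoothCount K κ) (hφ : IsTest φ) :
    ∃ C, ∀ t, ‖smoothSum (charSeries (0 : ClassChar K)) φ t -
      (Fintype.card (AddClassGroup K) * (κ * ∫ y, φ y * exp y) : ℝ) *
        exp t‖ ≤ C := by
  classical
  obtain ⟨C, hC⟩ := hκ.exists_norm_sub_le hφ (0 : ClassChar K)
  rw [AddChar.sum_eq_ite, if_pos rfl] at hC
  exact ⟨C, fun t => by simpa using hC t⟩

lemma SmoothCount.polyBounded (hκ : SmoothCount K κ) (hφ : IsTest φ) (hχ : χ ≠ 0) :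
    PolyBounded (smoothSum (charSeries χ) φ) := by
  obtain ⟨C, hC⟩ := hκ.exists_norm_le hφ hχ
  obtain ⟨R, hR0, hR⟩ := hφ.exists_radius
  exact ⟨R, C, 0, hR0, fun t ht => smoothSum_of_le hR ht, by simpa using hC⟩

lemma SmoothCount.exists_mul_charProd (hκ : SmoothCount K κ) {a : MvPowerSeries (PrimeIdeal K) ℂ}
    (hφ : IsBump φ) (ha : PolyBounded (smoothSum a φ))
    (F : Finset (ClassChar K)) (hF : 0 ∉ F) :
    ∃ ψ, IsBump ψ ∧ PolyBounded (smoothSum (a * charProd F) ψ) := by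
  classical
  induction F using Finset.induction_on with
  | empty => exact ⟨φ, hφ, by simpa [charProd] using ha⟩
  | insert χ F hχ ih =>
    rw [mem_insert, not_or] at hF
    obtain ⟨ψ, hψ, h⟩ := ih hF.2
    obtain ⟨R, -, hR⟩ := hφ.exists_radius
    obtain ⟨R', -, hR'⟩ := hψ.exists_radius
    refine ⟨conv ψ φ, hψ.conv hφ, ?_⟩
    rw [charProd, prod_insert hχ, mul_comm (charSeries χ), ← mul_assoc]
    have := h.conv (hκ.polyBounded hφ.toIsTest (Ne.symm hF.1))
    simp_rw [← smoothSum_conv hR' hR hψ.continuous hφ.continuous hψ.compact] at this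
    exact this

lemma not_polyBounded_charProd_univ (hκ0 : 0 < κ) (hκ : SmoothCount K κ) (hφ : IsBump φ) :
    ¬ PolyBounded (smoothSum (charProd (univ : Finset (ClassChar K))) φ) := by
  classical
  rintro ⟨-, C, k, -, -, hC⟩
  obtain ⟨r, hr, hr0, hr1⟩ := exists_coeff_charProd_univ (K := K)
  set h := Fintype.card (AddClassGroup K)
  have hh : 1 ≤ h := Fintype.card_pos
  have hh' : (1 : ℝ) ≤ h := by exact_mod_cast hh
  obtain ⟨R, hR0, hR⟩ := hφ.exists_radius
  have hφ' := hφ.comp_mul (c := h) (by positivity)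
  obtain ⟨C', hC'⟩ := hκ.exists_norm_sub_le_of_zero hφ'.toIsTest
  set c : ℝ := h * (κ * ∫ y, φ (h * y) * exp y)
  have hc : 0 < c := mul_pos (by positivity) (mul_pos hκ0 hφ'.integral_mul_exp_pos)
  have hle : ∀ t, ‖smoothSum (charSeries (0 : ClassChar K))
      (fun y => φ (h * y)) (t / h)‖ ≤ ‖smoothSum (charProd (univ : Finset (ClassChar K))) φ t‖ := by
    intro t
    set T := |t| + R
    have hR' : ∀ y, R ≤ |y| → φ (h * y) = 0 := fun y hy => hR _ (by
      rw [abs_mul, Nat.abs_cast]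
      exact hy.trans (le_mul_of_one_le_left (abs_nonneg y) hh'))
    have h1 : t / h + R ≤ T := by
      have : t / h ≤ |t| := (div_le_div_of_nonneg_right (le_abs_self t) (by positivity)).trans
        (div_le_self (abs_nonneg t) hh')
      simp only [T]
      linarith
    have h2 : t + R ≤ h * T := by
      have : 0 ≤ T := by positivity
      exact le_trans (by simp only [T]; linarith [le_abs_self t]) (le_mul_of_one_le_left this hh')
    rw [smoothSum_eq hR' h1, smoothSum_eq hR h2]
    simp_rw [hr, coeff_charSeries, AddChar.zero_apply, one_mul, ← Complex.ofReal_mul,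
      ← Complex.ofReal_sum, Complex.norm_real, Real.norm_eq_abs]
    rw [abs_of_nonneg (sum_nonneg fun m _ => hφ.nonneg _),
      abs_of_nonneg (sum_nonneg fun m _ => mul_nonneg (hr0 m) (hφ.nonneg _))]
    have hinj : Set.InjOn (fun m : PrimeIdeal K →₀ ℕ => h • m) (normBall K T) :=
      fun m _ m' _ he => smul_right_injective _ (by omega : h ≠ 0) he
    calc _ ≤ ∑ m ∈ normBall K T, r (h • m) * φ (logNorm (h • m) - t) := by
          refine sum_le_sum fun m _ => ?_
          rw [logNorm_nsmul, mul_sub, mul_div_cancel₀ _ (by positivity)]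
          exact le_mul_of_one_le_left (hφ.nonneg _) (hr1 m)
      _ = ∑ m ∈ (normBall K T).image (h • ·), r m * φ (logNorm m - t) := 
          (sum_image (f := fun m => r m * φ (logNorm m - t)) hinj).symm
      _ ≤ _ := by
          refine sum_le_sum_of_subset_of_nonneg (fun m hm => ?_) fun m _ _ =>
            mul_nonneg (hr0 m) (hφ.nonneg _)
          obtain ⟨m, hm', rfl⟩ := mem_image.mp hm
          rw [mem_normBall] at hm' ⊢
          rw [logNorm_nsmul]
          gcongr
  have hkey : ∀ t, 0 ≤ t → c * exp (t / h) ≤ (C + C') * (1 + t) ^ k := by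
    intro t ht
    have h1 := hC' (t / h)
    have h2 := (hle t).trans (hC t)
    have h3 : ‖((c : ℝ) : ℂ) * (exp (t / h) : ℂ)‖ = c * exp (t / h) := by
      rw [← Complex.ofReal_mul, Complex.norm_real, Real.norm_of_nonneg (by positivity)]
    have h4 := norm_sub_norm_le ((c : ℂ) * (exp (t / h) : ℂ))
      (smoothSum (charSeries (0 : ClassChar K)) (fun y => φ (h * y)) (t / h))
    rw [norm_sub_rev, h3] at h4
    have h5 : C' ≤ C' * (1 + t) ^ k := le_mul_of_one_le_right ((norm_nonneg _).trans (hC' 0))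
      (one_le_pow₀ (by linarith))
    rw [abs_of_nonneg ht] at h2
    linarith
  have hlo := isLittleO_pow_exp_pos_mul_atTop k (b := (h : ℝ)⁻¹) (by positivity)
  have hD : 0 < |C + C'| + 1 := by positivity
  obtain ⟨t, ht, ht1⟩ := ((hlo.bound (c := c * exp (-(h : ℝ)⁻¹) / (2 * (|C + C'| + 1)))
    (by positivity)).and (eventually_ge_atTop 1)).exists
  have h1 := hkey (t - 1) (by linarith)
  rw [add_sub_cancel, sub_div, div_eq_inv_mul, one_div, sub_eq_add_neg, exp_add] at h1
  rw [Real.norm_of_nonneg (by positivity), Real.norm_of_nonneg (by positivity), div_mul_eq_mul_div,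
    le_div_iff₀ (by positivity)] at ht
  have h2 : (C + C') * t ^ k ≤ (|C + C'| + 1) * t ^ k :=
    mul_le_mul_of_nonneg_right (by linarith [le_abs_self (C + C')]) (by positivity)
  have h3 : 0 < c * exp (-(h : ℝ)⁻¹) * exp ((h : ℝ)⁻¹ * t) := by positivity
  nlinarith

/-- Nonvanishing at `1` of the `L`-functions of the class group. -/
theorem SmoothCount.integral_ne_zero (hκ0 : 0 < κ) (hκ : SmoothCount K κ) (hφ : IsBump φ) (hχ : χ ≠ 0) :
    ∫ u, smoothSum (charSeries χ) φ u * exp (-u) ≠ 0 := by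
  classical
  intro hI
  obtain ⟨R, hR0, hR⟩ := hφ.exists_radius
  obtain ⟨C, hC⟩ := hκ.exists_norm_le hφ.toIsTest hχ
  obtain ⟨C', hC'⟩ := hκ.exists_norm_sub_le_of_zero hφ.toIsTest
  have h := polyBounded_conv_of_integral_eq_zero (continuous_smoothSum hR hφ.continuous)
    (continuous_smoothSum hR hφ.continuous) hR0 (fun t ht => smoothSum_of_le hR ht) hC
    (fun t ht => smoothSum_of_le hR ht) hC' hI
  simp_rw [← smoothSum_conv hR hR hφ.continuous hφ.continuous hφ.compact] at h
  obtain ⟨ψ, hψ, h'⟩ := hκ.exists_mul_charProd (hφ.conv hφ) h ((univ.erase χ).erase 0)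
    (notMem_erase _ _)
  refine not_polyBounded_charProd_univ hκ0 hκ hψ ?_
  rwa [charProd, mul_assoc, mul_prod_erase (univ.erase χ) charSeries (mem_erase.mpr ⟨hχ.symm, mem_univ _⟩),
    mul_prod_erase univ charSeries (mem_univ χ)] at h'

end Nonvanishing

section Chebyshev

variable (K) in
/-- Sums over prime ideal powers are controlled by sums over prime powers. -/
lemma exists_sum_mangoldt_le : ∃ C : ℝ, 0 ≤ C ∧ ∀ (x : ℝ) (G : ℕ → ℝ), (∀ j, 0 ≤ G j) →
    ∑ m ∈ normBall K x, mangoldt m * G (Ideal.absNorm (toIdeal m)) ≤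
      C * ∑ j ∈ Ioc 0 ⌊exp x⌋₊, ArithmeticFunction.vonMangoldt j * G j := by
  classical
  set n := finrank ℤ (𝓞 K)
  refine ⟨n * n, by positivity, fun x G hG => ?_⟩
  have hmap : ∀ m ∈ normBall K x, Ideal.absNorm (toIdeal m) ∈ Ioc 0 ⌊exp x⌋₊ := by
    intro m hm
    rw [mem_normBall, ← exp_le_exp, exp_logNorm, ← absNorm_toIdeal] at hm
    refine mem_Ioc.mpr ⟨?_, Nat.le_floor hm⟩
    have := one_le_expWt_pNorm m
    rw [← absNorm_toIdeal] at this
    exact_mod_cast this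
  rw [← sum_fiberwise_of_maps_to hmap, mul_sum]
  refine sum_le_sum fun j hj => ?_
  have hj' : ∀ m ∈ (normBall K x).filter fun m => Ideal.absNorm (toIdeal m) = j,
      mangoldt m * G (Ideal.absNorm (toIdeal m)) = mangoldt m * G j := by
    intro m hm
    rw [(mem_filter.mp hm).2]
  rw [sum_congr rfl hj', ← sum_mul, ← mul_assoc]
  refine mul_le_mul_of_nonneg_right ?_ (hG j)
  set s := ((normBall K x).filter fun m => Ideal.absNorm (toIdeal m) = j).filter fun m => mangoldt m ≠ 0
  rw [← sum_filter_ne_zero]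
  change ∑ m ∈ s, _ ≤ _
  obtain hs | ⟨m₀, hm₀⟩ := s.eq_empty_or_nonempty
  · rw [hs, sum_empty]
    have : 0 ≤ ArithmeticFunction.vonMangoldt j := ArithmeticFunction.vonMangoldt_nonneg
    positivity
  have hrep : ∀ m ∈ s, ∃ v k, k ≠ 0 ∧ m = single v k ∧ Ideal.absNorm v.asIdeal ^ k = j := by
    intro m hm
    obtain ⟨h1, h2⟩ := mem_filter.mp hm
    obtain ⟨v, k, hk, rfl⟩ := exists_of_mangoldt_ne_zero h2
    refine ⟨v, k, hk, rfl, ?_⟩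
    rw [← (mem_filter.mp h1).2, toIdeal_single, map_pow]
  obtain ⟨v₀, k₀, hk₀, -, hv₀⟩ := hrep m₀ hm₀
  obtain ⟨p, hp, hpv⟩ := exists_prime_mem_fiber v₀
  obtain ⟨f₀, hf₀, hf₀'⟩ := exists_absNorm_eq_pow hp hpv
  have hjp : j = p ^ (f₀ * k₀) := by rw [← hv₀, hf₀', pow_mul]
  have hjL : ArithmeticFunction.vonMangoldt j = log p := by
    rw [hjp, ArithmeticFunction.vonMangoldt_apply_pow (by positivity), ArithmeticFunction.vonMangoldt_apply_prime hp]
  have hrep' : ∀ m ∈ s, ∃ v ∈ fiber p, ∃ k, k ≠ 0 ∧ m = single v k ∧ Ideal.absNorm v.asIdeal ^ k = j := by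
    intro m hm
    obtain ⟨v, k, hk, hm, hv⟩ := hrep m hm
    refine ⟨v, ?_, k, hk, hm, hv⟩
    obtain ⟨q, hq, hqv⟩ := exists_prime_mem_fiber v
    obtain ⟨f, hf, hf'⟩ := exists_absNorm_eq_pow hq hqv
    have : q ∣ p := by
      refine hq.dvd_of_dvd_pow (n := f₀ * k₀) ?_
      rw [← hjp, ← hv, hf', ← pow_mul]
      exact dvd_pow_self _ (by positivity)
    rwa [← (Nat.prime_dvd_prime_iff_eq hq hp).mp this]
  have hcard : #s ≤ n := by
    refine le_trans ?_ (card_fiber_le (K := K) hp)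
    have : Nonempty (PrimeIdeal K) := ⟨v₀⟩
    choose! V hV using hrep'
    refine card_le_card_of_injOn V (fun m hm => (hV m hm).1) fun m hm m' hm' he => ?_
    obtain ⟨k, hk, h1, h2⟩ := (hV m hm).2
    obtain ⟨k', hk', h1', h2'⟩ := (hV m' hm').2
    rw [h1, h1', he]
    congr 1
    rw [← h2', he] at h2
    exact Nat.pow_right_injective (NumberField.HeightOneSpectrum.one_lt_absNorm (V m')) h2
  have hval : ∀ m ∈ s, mangoldt m ≤ n * log p := by
    intro m hm
    obtain ⟨v, hv, k, hk, rfl, -⟩ := hrep' m hm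
    rw [mangoldt_single v hk, ← log_pow]
    refine log_le_log (pNorm_pos v) ?_
    rw [pNorm]
    have h := map_dvd (Ideal.absNorm (S := 𝓞 K)) (Ideal.dvd_span_singleton.mpr ((mem_fiber hp.ne_zero).mp hv))
    rw [Ideal.absNorm_span_natCast] at h
    exact_mod_cast Nat.le_of_dvd (pow_pos hp.pos _) h
  calc _ ≤ #s • (n * log p) := sum_le_card_nsmul _ _ _ hval
    _ ≤ _ := by
      rw [nsmul_eq_mul, hjL, ← mul_assoc]
      have : 0 ≤ log p := log_natCast_nonneg p
      gcongr

variable (K) in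
lemma exists_sum_mangoldt_le_exp : ∃ C : ℝ, 0 ≤ C ∧ ∀ x, ∑ m ∈ normBall K x, mangoldt m ≤ C * exp x := by
  obtain ⟨C, hC, h⟩ := exists_sum_mangoldt_le K
  refine ⟨C * (log 4 + 4), by positivity, fun x => ?_⟩
  have := h x (fun _ => 1) fun _ => zero_le_one
  simp only [mul_one] at this
  refine this.trans ?_
  rw [mul_assoc]
  exact mul_le_mul_of_nonneg_left (Chebyshev.psi_le_const_mul_self (exp_pos x).le) hC

variable (K) in
lemma exists_sum_mangoldt_not_prime_le : ∃ C : ℝ, 0 ≤ C ∧ ∀ x,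
    ∑ m ∈ normBall K x, mangoldt m * ind (¬ ∃ v, m = single v 1) ≤ C * exp (x / 2) := by
  classical
  obtain ⟨C, hC, h⟩ := exists_sum_mangoldt_le K
  obtain ⟨C', hC'⟩ := Chebyshev.psi_sub_theta_le_mul_sqrt
  refine ⟨C * |C'|, by positivity, fun x => ?_⟩
  refine le_trans ?_ ((h x (fun j => ind (¬ j.Prime)) fun _ => ind_nonneg _).trans ?_)
  · refine sum_le_sum fun m _ => ?_
    by_cases h0 : mangoldt m = 0
    · simp [h0]
    refine mul_le_mul_of_nonneg_left (ind_mono fun hm hp => hm ?_) (mangoldt_nonneg m)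
    obtain ⟨v, k, hk, rfl⟩ := exists_of_mangoldt_ne_zero h0
    rw [toIdeal_single, map_pow] at hp
    exact ⟨v, by rw [hp.eq_one_of_pow]⟩
  · rw [mul_assoc]
    refine mul_le_mul_of_nonneg_left ?_ hC
    calc _ = Chebyshev.psi (exp x) - Chebyshev.theta (exp x) := by
          rw [Chebyshev.psi_sub_theta_eq_sum_not_prime, sum_filter]
          refine sum_congr rfl fun j _ => ?_
          by_cases hj : j.Prime <;> simp [ind, hj]
      _ ≤ C' * √(exp x) := hC' _
      _ ≤ _ := by
          rw [exp_half]
          gcongr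
          exact le_abs_self _

end Chebyshev

section Mertens

variable {φ : ℝ → ℝ} {R κ : ℝ} {χ : ClassChar K}

/-- The twist by a character of the von Mangoldt function. -/
noncomputable def mangoldtSeries (χ : ClassChar K) :
    MvPowerSeries (PrimeIdeal K) ℂ := fun m => χ (idealClass m) * mangoldt m

lemma coeff_mangoldtSeries (χ : ClassChar K) (m : PrimeIdeal K →₀ ℕ) :
    coeff m (mangoldtSeries χ) = χ (idealClass m) * mangoldt m := rfl

lemma norm_coeff_mangoldtSeries (χ : ClassChar K) (m : PrimeIdeal K →₀ ℕ) :
    ‖coeff m (mangoldtSeries χ)‖ = mangoldt m := by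
  rw [coeff_mangoldtSeries, norm_mul, AddChar.norm_apply, one_mul, Complex.norm_real,
    Real.norm_of_nonneg (mangoldt_nonneg m)]

lemma smoothSum_charSeries_mul_mangoldtSeries (hφ : ∀ y, R ≤ |y| → φ y = 0) (t : ℝ) :
    smoothSum (charSeries χ * mangoldtSeries χ) φ t =
      t * smoothSum (charSeries χ) φ t + smoothSum (charSeries χ) (fun y => y * φ y) t := by
  classical
  have hφ' : ∀ y, R ≤ |y| → y * φ y = 0 := fun y hy => by rw [hφ y hy, mul_zero]
  rw [smoothSum_eq hφ le_rfl, smoothSum_eq hφ le_rfl, smoothSum_eq hφ' le_rfl, mul_sum,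
    ← sum_add_distrib]
  refine sum_congr rfl fun m _ => ?_
  rw [MvPowerSeries.coeff_mul]
  simp_rw [coeff_charSeries, coeff_mangoldtSeries, ← logNorm_mul_charSeries χ m]
  push_cast
  ring

/-- Sums of a nontrivial character over prime ideals are bounded. -/
theorem SmoothCount.exists_norm_sum_mangoldt_le (hκ0 : 0 < κ) (hκ : SmoothCount K κ) (hχ : χ ≠ 0) :
    ∃ C, ∀ x, ‖∑ m ∈ normBall K x,
      coeff m (mangoldtSeries χ) * exp (-logNorm m)‖ ≤ C := by
  obtain ⟨φ, hφ⟩ := exists_isBump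
  obtain ⟨R, hR0, hR⟩ := hφ.exists_radius
  set J := smoothSum (charSeries χ) φ
  obtain ⟨C, hC⟩ := hκ.exists_norm_le hφ.toIsTest hχ
  obtain ⟨C₁, hC₁⟩ := hκ.exists_norm_le hφ.toIsTest.id_mul hχ
  obtain ⟨C₂, hC₂0, hC₂⟩ := exists_sum_mangoldt_le_exp K
  have hC0 : 0 ≤ C := (norm_nonneg _).trans (hC 0)
  have hC10 : 0 ≤ C₁ := (norm_nonneg _).trans (hC₁ 0)
  have hJc : Continuous J := continuous_smoothSum hR hφ.continuous
  have hJ0 : ∀ t, t ≤ -R → J t = 0 := fun t ht => smoothSum_of_le hR ht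
  have hI := hκ.integral_ne_zero hκ0 hφ hχ
  set I := ∫ u, J u * exp (-u)
  have hit : Integrable fun u => J u * (exp (-u) : ℂ) := by
    rw [← integrableOn_iff_integrable_of_support_subset (s := Set.Ioi (-R))]
    · refine ((integrableOn_exp_neg_Ioi (-R)).const_mul C).mono'
        (Continuous.aestronglyMeasurable (by fun_prop)) (Eventually.of_forall fun u => ?_)
      rw [norm_mul_ofReal_exp]
      gcongr
      exact hC u
    · intro u hu
      by_contra h
      exact hu (by simp [hJ0 u (not_lt.mp h)])
  have hP : ∀ a b, a ≤ -R → ‖(∫ u in a..b, J u * exp (-u)) - I‖ ≤ C * exp (-b) := by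
    intro a b ha
    have h0 : ∫ u in Set.Iic a, J u * exp (-u) = 0 :=
      setIntegral_eq_zero_of_forall_eq_zero fun u hu => by
        rw [hJ0 u (hu.trans ha), zero_mul]
    rw [← intervalIntegral.integral_Iic_sub_Iic hit.integrableOn hit.integrableOn, h0, sub_zero,
      ← show _ = I from intervalIntegral.integral_Iic_add_Ioi (b := b) hit.integrableOn hit.integrableOn,
      sub_add_cancel_left, norm_neg]
    refine (norm_integral_le_of_norm_le ((integrableOn_exp_neg_Ioi b).const_mul C)
      (Eventually.of_forall fun u => ?_)).trans ?_
    · rw [norm_mul_ofReal_exp]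
      gcongr
      exact hC u
    · rw [integral_const_mul, integral_exp_neg_Ioi]
  set C₃ := C * (2 * R + 1) + C₁ + 2 * C
  have hL : ∀ T, -R ≤ T → ‖∫ u in (-R)..T, smoothSum (charSeries χ * mangoldtSeries χ) φ u * exp (-u)‖
      ≤ 2 * (C₃ * exp (R / 2)) * exp (R / 2) := by
    intro T hT
    have hb : ∀ u, -R ≤ u → ‖smoothSum (charSeries χ * mangoldtSeries χ) φ u * exp (-u)‖ ≤
        (C₃ * exp (R / 2)) * exp (-u / 2) := by
      intro u hu
      rw [norm_mul_ofReal_exp,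
        smoothSum_charSeries_mul_mangoldtSeries hR]
      have h1 : |u| ≤ u + 2 * R := abs_le.mpr ⟨by linarith, by linarith⟩
      have h2 : u + 2 * R ≤ 2 * R + 2 * exp (u / 2) := by
        linarith [Real.add_one_le_exp (u / 2)]
      have h3 : 1 ≤ exp (R / 2) * exp (u / 2) := by
        rw [← exp_add]
        exact Real.one_le_exp (by linarith)
      have h4 : ‖(u : ℂ) * J u + smoothSum (charSeries χ) (fun y => y * φ y) u‖ ≤
          C₃ * (exp (R / 2) * exp (u / 2)) := by
        calc _ ≤ |u| * C + C₁ := by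
              refine (norm_add_le _ _).trans (add_le_add ?_ (hC₁ u))
              rw [norm_mul, Complex.norm_real, Real.norm_eq_abs]
              gcongr
              exact hC u
          _ ≤ (2 * R + 2 * exp (u / 2)) * C + C₁ := by
              gcongr
              exact h1.trans h2
          _ ≤ (2 * R * (exp (R / 2) * exp (u / 2)) + 2 * (exp (R / 2) * exp (u / 2))) * C
              + C₁ * (exp (R / 2) * exp (u / 2)) := by
              refine add_le_add (mul_le_mul_of_nonneg_right (add_le_add ?_ ?_) hC0) ?_
              · exact le_mul_of_one_le_right (by positivity) h3
              · have := le_mul_of_one_le_left (exp_pos (u / 2)).le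
                  (Real.one_le_exp (div_nonneg hR0 zero_le_two))
                linarith
              · exact le_mul_of_one_le_right hC10 h3
          _ ≤ _ := by
              simp only [C₃]
              nlinarith [mul_nonneg hC0 (zero_le_one.trans h3)]
      calc _ ≤ C₃ * (exp (R / 2) * exp (u / 2)) * exp (-u) := by gcongr
        _ = _ := by
          rw [mul_assoc, mul_assoc (exp _), ← exp_add, mul_assoc]
          ring_nf
    have hd : ∀ u, HasDerivAt (fun u => -2 * (C₃ * exp (R / 2)) * exp (-u / 2))
        ((C₃ * exp (R / 2)) * exp (-u / 2)) u := by
      intro u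
      have := (((hasDerivAt_id u).neg.div_const 2).exp).const_mul (-2 * (C₃ * exp (R / 2)))
      refine this.congr_deriv ?_
      simp only [Pi.neg_apply, id]
      ring
    refine (intervalIntegral.norm_integral_le_of_norm_le hT
      (Eventually.of_forall fun u hu => hb u hu.1.le) (Continuous.intervalIntegrable (by fun_prop) _ _)).trans ?_
    rw [intervalIntegral.integral_eq_sub_of_hasDerivAt (fun u _ => hd u)
      (Continuous.intervalIntegrable (by fun_prop) _ _)]
    have : 0 ≤ 2 * (C₃ * exp (R / 2)) * exp (-T / 2) := by positivity
    rw [neg_neg]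
    linarith
  refine ⟨(2 * (C₃ * exp (R / 2)) * exp (R / 2) + C₂ * C * exp R) / ‖I‖, fun x => ?_⟩
  rw [le_div_iff₀ (norm_pos_iff.mpr hI), ← norm_mul]
  obtain hx | hx := lt_or_ge x 0
  · rw [sum_eq_zero, zero_mul, norm_zero]
    · positivity
    · intro m hm
      linarith [mem_normBall.mp hm, logNorm_nonneg m]
  set T := x - R
  have hT : -R ≤ T := by simp only [T]; linarith
  have hexp : ∫ u in (-R)..T, smoothSum (charSeries χ * mangoldtSeries χ) φ u * exp (-u) =
      ∑ m ∈ normBall K x, coeff m (mangoldtSeries χ) * exp (-logNorm m) *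
        ∫ u in (-R - logNorm m)..(T - logNorm m), J u * exp (-u) := by
    have h1 : Set.EqOn (fun u => smoothSum (charSeries χ * mangoldtSeries χ) φ u * (exp (-u) : ℂ))
        (fun u => ∑ m ∈ normBall K x, coeff m (mangoldtSeries χ) * exp (-logNorm m) *
          (J (u - logNorm m) * exp (-(u - logNorm m)))) (Set.uIcc (-R) T) := by
      intro u hu
      rw [Set.uIcc_of_le hT] at hu
      dsimp only
      rw [smoothSum_mul hR (x := x) (by linarith [hu.2]), sum_mul]
      refine sum_congr rfl fun m _ => ?_
      rw [neg_sub, show -u = -logNorm m + (logNorm m - u) by ring, exp_add]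
      push_cast
      ring
    rw [intervalIntegral.integral_congr h1, intervalIntegral.integral_finsetSum]
    · refine sum_congr rfl fun m _ => ?_
      rw [intervalIntegral.integral_const_mul,
        intervalIntegral.integral_comp_sub_right fun u => J u * (exp (-u) : ℂ)]
    · intro m _
      exact Continuous.intervalIntegrable (by fun_prop) _ _
  have hdiff : (∑ m ∈ normBall K x, coeff m (mangoldtSeries χ) * exp (-logNorm m)) * I =
      (∫ u in (-R)..T, smoothSum (charSeries χ * mangoldtSeries χ) φ u * exp (-u)) -
      ∑ m ∈ normBall K x, coeff m (mangoldtSeries χ) * exp (-logNorm m) *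
        ((∫ u in (-R - logNorm m)..(T - logNorm m), J u * exp (-u)) - I) := by
    rw [hexp, sum_mul, ← sum_sub_distrib]
    exact sum_congr rfl fun m _ => by ring
  rw [hdiff]
  refine (norm_sub_le _ _).trans (add_le_add (hL T hT) ((norm_sum_le _ _).trans ?_))
  calc _ ≤ ∑ m ∈ normBall K x, mangoldt m * (C * exp (-T)) := by
        refine sum_le_sum fun m _ => ?_
        rw [norm_mul, norm_mul, norm_coeff_mangoldtSeries, Complex.norm_real,
          Real.norm_of_nonneg (exp_pos _).le, mul_assoc]
        refine mul_le_mul_of_nonneg_left ?_ (mangoldt_nonneg m)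
        calc _ ≤ exp (-logNorm m) * (C * exp (-(T - logNorm m))) := by
              gcongr
              exact hP _ _ (by linarith [logNorm_nonneg m])
          _ = _ := by
              rw [mul_left_comm, ← exp_add]
              ring_nf
    _ = (∑ m ∈ normBall K x, mangoldt m) * (C * exp (-T)) := (sum_mul _ _ _).symm
    _ ≤ C₂ * exp x * (C * exp (-T)) := by
        gcongr
        exact hC₂ x
    _ = C₂ * C * (exp x * exp (-T)) := by ring
    _ = _ := by
        rw [← exp_add]
        simp only [T]
        ring_nf

/-- Mertens' theorem for prime ideals. -/
theorem SmoothCount.exists_norm_sum_mangoldt_sub_le (hκ0 : 0 < κ) (hκ : SmoothCount K κ) :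
    ∃ C, ∀ x, 0 ≤ x → ‖∑ m ∈ normBall K x,
      coeff m (mangoldtSeries (0 : ClassChar K)) *
        exp (-logNorm m) - x‖ ≤ C := by
  obtain ⟨φ, hφ⟩ := exists_isBump
  obtain ⟨R, hR0, hR⟩ := hφ.exists_radius
  set χ : ClassChar K := 0
  obtain ⟨C, hC⟩ := hκ.exists_norm_sub_le_of_zero hφ.toIsTest
  obtain ⟨C₁, hC₁⟩ := hκ.exists_norm_sub_le_of_zero hφ.toIsTest.id_mul
  set D : ℝ := Fintype.card (AddClassGroup K) * (κ * ∫ y, φ y * exp y)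
  set D₁ : ℝ := Fintype.card (AddClassGroup K) * (κ * ∫ y, y * φ y * exp y)
  have hD : 0 < D := mul_pos (by exact_mod_cast Fintype.card_pos) (mul_pos hκ0 hφ.integral_mul_exp_pos)
  obtain ⟨C₂, hC₂0, hC₂⟩ := exists_sum_mangoldt_le_exp K
  have hC0 : 0 ≤ C := (norm_nonneg _).trans (hC 0)
  have hC10 : 0 ≤ C₁ := (norm_nonneg _).trans (hC₁ 0)
  refine ⟨(C₂ * C + (1 + R) * C + (|D₁| + C₁) + R * D) / (D * exp (-R)), fun x hx => ?_⟩
  set T := x - R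
  have hTx : T ≤ x := by simp only [T]; linarith
  set S := ∑ m ∈ normBall K x, coeff m (mangoldtSeries χ) * exp (-logNorm m)
  clear_value D D₁
  have hDT : D * exp T = D * exp (-R) * exp x := by
    rw [mul_assoc, ← exp_add]
    simp only [T]
    ring_nf
  have hx1 : 1 ≤ exp x := Real.one_le_exp hx
  have hkey : (S - x) * (D * exp T : ℝ) =
      (∑ m ∈ normBall K x, -(coeff m (mangoldtSeries χ) *
        (smoothSum (charSeries χ) φ (T - logNorm m) - D * exp (T - logNorm m)))) +
      T * (smoothSum (charSeries χ) φ T - D * exp T) +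
      smoothSum (charSeries χ) (fun y => y * φ y) T - (R * (D * exp T) : ℝ) := by
    have h1 := smoothSum_mul (a := charSeries χ) (b := mangoldtSeries χ) hR (t := T) (x := x)
      (by simp [T])
    rw [smoothSum_charSeries_mul_mangoldtSeries hR] at h1
    simp_rw [mul_sub, neg_sub, sum_sub_distrib]
    rw [← h1, sub_mul, sum_mul]
    have h2 : ∀ m : PrimeIdeal K →₀ ℕ, coeff m (mangoldtSeries χ) * exp (-logNorm m) *
        (D * exp T : ℝ) =
        coeff m (mangoldtSeries χ) * (D * exp (T - logNorm m)) := by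
      intro m
      rw [sub_eq_add_neg, exp_add]
      push_cast
      ring
    rw [sum_congr rfl fun m _ => h2 m, show (x : ℂ) = T + R by simp [T]]
    push_cast
    ring
  rw [le_div_iff₀ (by positivity)]
  refine le_of_mul_le_mul_right ?_ (exp_pos x)
  rw [mul_assoc, ← hDT]
  calc _ = ‖(S - x) * (D * exp T : ℝ)‖ := by
        rw [norm_mul, Complex.norm_real, Real.norm_of_nonneg (by positivity)]
    _ ≤ C₂ * exp x * C + (x + R) * C + (|D₁| * exp x + C₁) + R * (D * exp T) := by
        rw [hkey]
        refine (norm_sub_le _ _).trans (add_le_add ((norm_add_le _ _).trans (add_le_add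
          ((norm_add_le _ _).trans (add_le_add ((norm_sum_le _ _).trans ?_) ?_)) ?_)) ?_)
        · calc _ ≤ ∑ m ∈ normBall K x, mangoldt m * C := by
                refine sum_le_sum fun m _ => ?_
                rw [norm_neg, norm_mul, norm_coeff_mangoldtSeries]
                exact mul_le_mul_of_nonneg_left (hC _) (mangoldt_nonneg m)
            _ = (∑ m ∈ normBall K x, mangoldt m) * C := (sum_mul _ _ _).symm
            _ ≤ _ := mul_le_mul_of_nonneg_right (hC₂ x) hC0
        · rw [norm_mul, Complex.norm_real, Real.norm_eq_abs]
          exact mul_le_mul (abs_le.mpr ⟨by simp only [T]; linarith, by simp only [T]; linarith⟩) (hC T)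
            (norm_nonneg _) (by positivity)
        · have h1 := (norm_le_norm_add_norm_sub' _ _).trans (add_le_add_right (hC₁ T) _)
          refine h1.trans ?_
          rw [norm_mul, Complex.norm_real, Complex.norm_real, Real.norm_eq_abs,
            Real.norm_of_nonneg (exp_pos _).le]
          gcongr
        · rw [Complex.norm_real, Real.norm_of_nonneg (by positivity)]
    _ ≤ C₂ * exp x * C + (1 + R) * exp x * C + (|D₁| * exp x + C₁ * exp x) +
          R * (D * exp x) := by
        have h1 : x + R ≤ (1 + R) * exp x := by
          nlinarith [Real.add_one_le_exp x]
        have h2 : C₁ ≤ C₁ * exp x := le_mul_of_one_le_right hC10 hx1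
        gcongr
    _ = _ := by ring

open Classical in
/-- Mertens' theorem for principal prime ideals. -/
theorem SmoothCount.exists_abs_sum_mangoldt_sub_le (hκ0 : 0 < κ) (hκ : SmoothCount K κ) :
    ∃ C, ∀ x, 0 ≤ x → |Fintype.card (AddClassGroup K) *
      ∑ m ∈ normBall K x with idealClass m = 0, mangoldt m * exp (-logNorm m) - x| ≤ C := by
  classical
  obtain ⟨C₀, hC₀⟩ := hκ.exists_norm_sum_mangoldt_sub_le hκ0
  choose! C hC using fun (χ : ClassChar K) (hχ : χ ≠ 0) =>
    hκ.exists_norm_sum_mangoldt_le hκ0 hχ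
  refine ⟨C₀ + ∑ χ ∈ univ.erase 0, C χ, fun x hx => ?_⟩
  have h1 : ((Fintype.card (AddClassGroup K) *
      ∑ m ∈ normBall K x with idealClass m = 0, mangoldt m * exp (-logNorm m) : ℝ) : ℂ) =
      ∑ χ : ClassChar K, ∑ m ∈ normBall K x,
        coeff m (mangoldtSeries χ) * exp (-logNorm m) := by
    rw [sum_comm, mul_sum, sum_filter, Complex.ofReal_sum]
    refine sum_congr rfl fun m _ => ?_
    simp_rw [coeff_mangoldtSeries, ← sum_mul]
    rw [AddChar.sum_apply_eq_ite]
    split_ifs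
    · push_cast
      ring
    · simp
  rw [← Real.norm_eq_abs, ← Complex.norm_real, Complex.ofReal_sub, h1, ← add_sum_erase _ _ (mem_univ 0),
    add_sub_right_comm]
  exact (norm_add_le _ _).trans (add_le_add (hC₀ x hx) ((norm_sum_le _ _).trans
    (sum_le_sum fun χ hχ => hC χ (ne_of_mem_erase hχ) x)))

/-- Principal prime ideals have positive lower density among the primes. -/
theorem SmoothCount.exists_principal_primes (hκ0 : 0 < κ) (hκ : SmoothCount K κ) :
    ∃ A c X₀ : ℝ, 1 < A ∧ 0 < c ∧ ∀ X, X₀ ≤ X → ∃ Q : Finset (PrimeIdeal K),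
      (∀ v ∈ Q, idealClass (single v 1) = 0 ∧ X < pNorm v ∧ pNorm v ≤ A * X) ∧
        c * X / log X ≤ #Q := by
  classical
  obtain ⟨C, hC⟩ := hκ.exists_abs_sum_mangoldt_sub_le hκ0
  obtain ⟨C', hC'0, hC'⟩ := exists_sum_mangoldt_not_prime_le K
  have hC0 : 0 ≤ C := (abs_nonneg _).trans (hC 0 le_rfl)
  set h := Fintype.card (AddClassGroup K)
  have hh : (0 : ℝ) < h := by exact_mod_cast Fintype.card_pos
  set a := 2 * C + 2 * h
  have ha : 0 < a := by positivity
  refine ⟨exp a, 1 / 2, max (exp a) ((C' * exp (a / 2)) ^ 2), Real.one_lt_exp_iff.mpr ha,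
    by positivity, fun X hX => ?_⟩
  have hXa : exp a ≤ X := (le_max_left _ _).trans hX
  have hX0 : 0 < X := (exp_pos a).trans_le hXa
  set x := log X
  have hx : exp x = X := exp_log hX0
  have hxa : a ≤ x := by rwa [← hx, exp_le_exp] at hXa
  have hsub : normBall K x ⊆ normBall K (x + a) := fun m hm => by
    rw [mem_normBall] at hm ⊢
    linarith
  set F : (PrimeIdeal K →₀ ℕ) → ℝ := fun m => mangoldt m * exp (-logNorm m)
  have hF : ∀ m, 0 ≤ F m := fun m => mul_nonneg (mangoldt_nonneg m) (exp_pos _).le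
  set B := normBall K (x + a) \ normBall K x
  have hB : ∀ m ∈ B, x < logNorm m ∧ logNorm m ≤ x + a := fun m hm => by
    simpa [B, and_comm] using hm
  have h2 : 2 ≤ ∑ m ∈ B with idealClass m = 0, F m := by
    have h1 := abs_le.mp (hC x (by linarith))
    have h2 := abs_le.mp (hC (x + a) (by linarith))
    have h3 : ∑ m ∈ B with idealClass m = 0, F m = (∑ m ∈ normBall K (x + a) with idealClass m = 0, F m) -
        ∑ m ∈ normBall K x with idealClass m = 0, F m := by
      simp_rw [sum_filter]
      exact sum_sdiff_eq_sub hsub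
    refine le_of_mul_le_mul_left ?_ hh
    rw [h3, mul_sub]
    linarith [h1.2, h2.1, show a = 2 * C + 2 * h from rfl]
  have hnp : ∑ m ∈ B, F m * ind (¬ ∃ v, m = single v 1) ≤ 1 := by
    calc _ ≤ ∑ m ∈ B, mangoldt m * ind (¬ ∃ v, m = single v 1) * exp (-x) := by
          refine sum_le_sum fun m hm => ?_
          rw [mul_right_comm]
          have := (hB m hm).1
          have h1 := mul_nonneg (mangoldt_nonneg m) (ind_nonneg (¬ ∃ v, m = single v 1))
          gcongr
      _ ≤ ∑ m ∈ normBall K (x + a), mangoldt m * ind (¬ ∃ v, m = single v 1) * exp (-x) :=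
          sum_le_sum_of_subset_of_nonneg sdiff_subset fun m _ _ =>
            mul_nonneg (mul_nonneg (mangoldt_nonneg m) (ind_nonneg _)) (exp_pos _).le
      _ ≤ C' * exp ((x + a) / 2) * exp (-x) := by
          rw [← sum_mul]
          exact mul_le_mul_of_nonneg_right (hC' _) (exp_pos _).le
      _ = C' * exp (a / 2) * exp (-(x / 2)) := by
          rw [mul_assoc, mul_assoc, ← exp_add, ← exp_add]
          ring_nf
      _ ≤ exp (x / 2) * exp (-(x / 2)) := by
          gcongr
          refine (pow_le_pow_iff_left₀ (by positivity) (exp_pos _).le two_ne_zero).mp ?_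
          rw [← exp_nat_mul]
          refine ((le_max_right _ _).trans hX).trans (le_of_eq ?_)
          rw [← hx]
          push_cast
          ring_nf
      _ = 1 := by rw [← exp_add, add_neg_cancel, exp_zero]
  set M := {m ∈ B | idealClass m = 0 ∧ ∃ v, m = single v 1}
  have hM1 : 1 ≤ ∑ m ∈ M, F m := by
    have : ∑ m ∈ B with idealClass m = 0, F m ≤
        (∑ m ∈ M, F m) + ∑ m ∈ B, F m * ind (¬ ∃ v, m = single v 1) := by
      simp only [M]
      rw [sum_filter, sum_filter, ← sum_add_distrib]
      refine sum_le_sum fun m _ => ?_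
      by_cases h1 : idealClass m = 0 <;> by_cases h2 : ∃ v, m = single v 1 <;>
        simp [ind, h1, h2, hF m]
    linarith
  have hinj : Injective fun v : PrimeIdeal K => single v 1 := Finsupp.single_left_injective one_ne_zero
  refine ⟨M.preimage _ hinj.injOn, fun v hv => ?_, ?_⟩
  · obtain ⟨h1, h2, -⟩ := mem_filter.mp (mem_preimage.mp hv)
    have h3 := hB _ h1
    rw [logNorm_single, Nat.cast_one, one_mul, Real.lt_log_iff_exp_lt (pNorm_pos v), hx,
      log_le_iff_le_exp (pNorm_pos v), exp_add, hx, mul_comm X] at h3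
    exact ⟨h2, h3⟩
  · have hcard : #M ≤ #(M.preimage _ hinj.injOn) := by
      refine card_le_card_of_surjOn (fun v => single v 1) fun m hm => ?_
      obtain ⟨-, -, v, rfl⟩ := mem_filter.mp hm
      exact ⟨v, mem_preimage.mpr hm, rfl⟩
    have hFM : ∀ m ∈ M, F m ≤ 2 * x * X⁻¹ := by
      intro m hm
      obtain ⟨h1, -, v, rfl⟩ := mem_filter.mp hm
      have h3 := hB _ h1
      have h4 : mangoldt (single v 1) = logNorm (single v 1) := by
        rw [mangoldt_single v one_ne_zero, logNorm_single, Nat.cast_one, one_mul]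
      simp only [F]
      rw [h4, ← hx, ← exp_neg]
      exact mul_le_mul (by linarith) (exp_le_exp.mpr (by linarith)) (exp_pos _).le (by linarith)
    have h4 := hM1.trans (sum_le_card_nsmul _ _ _ hFM)
    rw [nsmul_eq_mul] at h4
    have hx0 : 0 < x := ha.trans_le hxa
    have h5 : (#M : ℝ) ≤ #(M.preimage _ hinj.injOn) := by exact_mod_cast hcard
    refine le_trans ?_ h5
    rw [div_le_iff₀ hx0]
    have h6 := mul_le_mul_of_nonneg_right h4 hX0.le
    have h7 : #M * (2 * x * X⁻¹) * X = #M * (2 * x) := by field_simp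
    rw [h7] at h6
    linarith

/-- The harmonic sum over the ideals grows at least logarithmically. -/
theorem SmoothCount.exists_le_sum_exp (hκ0 : 0 < κ) (hκ : SmoothCount K κ) :
    ∃ c x₀ : ℝ, 0 < c ∧ ∀ x, x₀ ≤ x → c * x ≤ ∑ m ∈ normBall K x, exp (-logNorm m) := by
  obtain ⟨φ, hφ⟩ := exists_isBump
  obtain ⟨R, hR0, hR⟩ := hφ.exists_radius
  obtain ⟨C, hC⟩ := hκ φ hφ.toIsTest 0
  have hC0 : 0 ≤ C := (abs_nonneg _).trans (hC 0)
  set E := ∫ y, φ y * exp y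
  have hE : 0 < E := hφ.integral_mul_exp_pos
  have hφc := hφ.continuous
  refine ⟨κ / 2, R + (κ * R * E + C) * 2 / (κ * E) + R, by positivity, fun x hx => ?_⟩
  set T := x - R
  have hT : 0 ≤ T := by
    have : 0 ≤ (κ * R * E + C) * 2 / (κ * E) := by positivity
    simp only [T]
    linarith
  have hit : Integrable fun y => φ y * exp y :=
    Continuous.integrable_of_hasCompactSupport (by fun_prop) hφ.compact.mul_right
  have hterm : ∀ m : PrimeIdeal K →₀ ℕ, ∫ u in 0..T, φ (logNorm m - u) * exp (-u) ≤
      exp (-logNorm m) * E := by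
    intro m
    have h1 : ∀ u, φ (logNorm m - u) * exp (-u) =
        exp (-logNorm m) * (φ (logNorm m - u) * exp (logNorm m - u)) := by
      intro u
      rw [show -u = -logNorm m + (logNorm m - u) by ring, exp_add]
      ring
    simp_rw [h1]
    rw [intervalIntegral.integral_const_mul,
      intervalIntegral.integral_comp_sub_left fun y => φ y * exp y,
      intervalIntegral.integral_of_le (by linarith)]
    exact mul_le_mul_of_nonneg_left (setIntegral_le_integral hit
      (Eventually.of_forall fun y => mul_nonneg (hφ.nonneg y) (exp_pos y).le)) (exp_pos _).le
  have hlow : ∫ u in 0..T, (κ * E - C * exp (-u)) ≤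
      ∫ u in 0..T, ∑ m ∈ normBall K x, ind (idealClass m = 0) * (φ (logNorm m - u) * exp (-u)) := by
    refine intervalIntegral.integral_mono_on hT (Continuous.intervalIntegrable (by fun_prop) _ _)
      (Continuous.intervalIntegrable (by fun_prop) _ _) fun u hu => ?_
    have h1 := (abs_le.mp (hC u)).1
    rw [classSum_eq 0 hR (x := x) (by simp only [T] at hu; linarith [hu.2])] at h1
    simp_rw [← mul_assoc]
    rw [← sum_mul]
    have h2 : κ * E - C * exp (-u) = (κ * E * exp u - C) * exp (-u) := by
      rw [sub_mul, mul_assoc (κ * E), ← exp_add, add_neg_cancel, exp_zero, mul_one]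
    rw [h2]
    exact mul_le_mul_of_nonneg_right (by linarith) (exp_pos _).le
  rw [intervalIntegral.integral_finsetSum
    fun m _ => Continuous.intervalIntegrable (by fun_prop) _ _] at hlow
  have hup : ∑ m ∈ normBall K x, ∫ u in 0..T, ind (idealClass m = 0) * (φ (logNorm m - u) * exp (-u)) ≤
      (∑ m ∈ normBall K x, exp (-logNorm m)) * E := by
    rw [sum_mul]
    refine sum_le_sum fun m _ => ?_
    rw [intervalIntegral.integral_const_mul]
    refine (mul_le_of_le_one_left ?_ (ind_le_one _)).trans (hterm m)
    exact intervalIntegral.integral_nonneg hT fun u _ => mul_nonneg (hφ.nonneg _) (exp_pos _).le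
  have hval : κ * E * T - C ≤ ∫ u in 0..T, (κ * E - C * exp (-u)) := by
    have hd : ∀ u, HasDerivAt (fun u => κ * E * u + C * exp (-u)) (κ * E - C * exp (-u)) u := by
      intro u
      refine (((hasDerivAt_id u).const_mul (κ * E)).add ((hasDerivAt_neg u).exp.const_mul C)).congr_deriv ?_
      ring
    rw [intervalIntegral.integral_eq_sub_of_hasDerivAt (fun u _ => hd u)
      (Continuous.intervalIntegrable (by fun_prop) _ _)]
    have := mul_nonneg hC0 (exp_pos (-T)).le
    simp
    linarith
  refine le_of_mul_le_mul_right ?_ hE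
  refine le_trans ?_ (hval.trans (hlow.trans hup))
  have h3 : (κ * R * E + C) * 2 ≤ x * (κ * E) := by
    rw [← div_le_iff₀ (by positivity)]
    linarith
  simp only [T]
  linarith

end Mertens

section Smear

open scoped ContDiff

variable {E : Type*} [NormedAddCommGroup E] [NormedSpace ℝ E] [FiniteDimensional ℝ E]
  [MeasurableSpace E] [BorelSpace E] {ν : Measure E} [IsProbabilityMeasure ν] {D h R : ℝ}
  {f g : E → ℝ}

/-- The average of `f` over a random translate, distributed as `h • ν`. -/
noncomputable def smear (ν : Measure E) (h : ℝ) (f : E → ℝ) (x : E) : ℝ := ∫ u, f (x + h • u) ∂ν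

/-- The difference between a function and its average. -/
noncomputable def roughen (ν : Measure E) (h : ℝ) (f : E → ℝ) (x : E) : ℝ := f x - smear ν h f x

theorem integrable_translate (hν : ∀ᵐ u ∂ν, ‖u‖ ≤ D) (hf : Continuous f) (x : E) :
    Integrable (fun u => f (x + h • u)) ν := by
  have h1 : ν.restrict (Metric.closedBall 0 D) = ν :=
    Measure.restrict_eq_self_of_ae_mem (by simpa using hν)
  rw [← h1]
  exact (Continuous.continuousOn (by fun_prop)).integrableOn_compact (isCompact_closedBall 0 D)

theorem continuous_smear (hν : ∀ᵐ u ∂ν, ‖u‖ ≤ D) (hf : Continuous f) :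
    Continuous (smear ν h f) := by
  have h1 : ν.restrict (Metric.closedBall 0 D) = ν :=
    Measure.restrict_eq_self_of_ae_mem (by simpa using hν)
  unfold smear
  rw [← h1]
  exact continuous_parametric_integral_of_continuous (by fun_prop) (isCompact_closedBall 0 D)

theorem continuous_roughen_iterate (hν : ∀ᵐ u ∂ν, ‖u‖ ≤ D) (hf : Continuous f) (k : ℕ) :
    Continuous ((roughen ν h)^[k] f) := by
  induction k with
  | zero => exact hf
  | succ k ih =>
    rw [iterate_succ_apply']
    exact ih.sub (continuous_smear hν ih)

omit [FiniteDimensional ℝ E] [BorelSpace E] [IsProbabilityMeasure ν] in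
theorem smear_eq_zero (hν : ∀ᵐ u ∂ν, ‖u‖ ≤ D) (h0 : 0 ≤ h) (h1 : h ≤ 1)
    (hf : ∀ x, R < ‖x‖ → f x = 0) (x : E) (hx : R + D < ‖x‖) : smear ν h f x = 0 := by
  refine integral_eq_zero_of_ae ?_
  filter_upwards [hν] with u hu
  refine hf _ ?_
  have h2 := norm_sub_le (x + h • u) (h • u)
  rw [add_sub_cancel_right, norm_smul, Real.norm_of_nonneg h0] at h2
  nlinarith [norm_nonneg u]

omit [FiniteDimensional ℝ E] [BorelSpace E] [IsProbabilityMeasure ν] in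
theorem roughen_iterate_eq_zero (hν : ∀ᵐ u ∂ν, ‖u‖ ≤ D) (hD : 0 ≤ D) (h0 : 0 ≤ h) (h1 : h ≤ 1)
    (hf : ∀ x, R < ‖x‖ → f x = 0) (k : ℕ) (x : E) (hx : R + k * D < ‖x‖) :
    (roughen ν h)^[k] f x = 0 := by
  induction k generalizing x with
  | zero => exact hf x (by simpa using hx)
  | succ k ih =>
    push_cast at hx
    rw [iterate_succ_apply', roughen, ih x (by linarith),
      smear_eq_zero hν h0 h1 ih x (by linarith), sub_zero]

theorem roughen_iterate_sub (hν : ∀ᵐ u ∂ν, ‖u‖ ≤ D) (hf : Continuous f) (hg : Continuous g)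
    (k : ℕ) : (roughen ν h)^[k] (fun x => f x - g x) =
      fun x => (roughen ν h)^[k] f x - (roughen ν h)^[k] g x := by
  induction k with
  | zero => rfl
  | succ k ih =>
    simp only [iterate_succ_apply']
    rw [ih]
    ext x
    simp only [roughen, smear]
    rw [integral_sub (integrable_translate hν (continuous_roughen_iterate hν hf k) x)
      (integrable_translate hν (continuous_roughen_iterate hν hg k) x)]
    ring

omit [FiniteDimensional ℝ E] [BorelSpace E] [IsProbabilityMeasure ν] in
theorem roughen_iterate_translate (v : E) (k : ℕ) : (roughen ν h)^[k] (fun x => f (x + v)) =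
      fun x => (roughen ν h)^[k] f (x + v) := by
  induction k with
  | zero => rfl
  | succ k ih =>
    simp only [iterate_succ_apply']
    rw [ih]
    ext x
    simp only [roughen, smear, add_right_comm]

theorem abs_roughen_iterate_le (hν : ∀ᵐ u ∂ν, ‖u‖ ≤ D) (h0 : 0 ≤ h) (k : ℕ) {C : ℝ}
    (hf : ContDiff ℝ ∞ f) (hC : ∀ x, ‖iteratedFDeriv ℝ k f x‖ ≤ C) (x : E) :
    |(roughen ν h)^[k] f x| ≤ C * (D * h) ^ k := by
  induction k generalizing f C x with
  | zero => simpa using hC x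
  | succ k ih =>
    have h1 : ∀ v, ‖v‖ ≤ D →
        |(roughen ν h)^[k] f x - (roughen ν h)^[k] f (x + h • v)| ≤ C * (D * h) ^ (k + 1) := by
      intro v hv
      have h2 := roughen_iterate_sub (h := h) hν hf.continuous
        (hf.continuous.comp (continuous_add_const (h • v))) k
      have h3 := ih (f := fun x => f x - f (x + h • v)) (C := C * (D * h))
        (hf.sub (hf.comp (contDiff_id.add contDiff_const))) ?_ x
      · simp only [Function.comp_def] at h2
        rw [h2, roughen_iterate_translate] at h3
        refine h3.trans (le_of_eq ?_)
        ring
      · intro y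
        have hd : ContDiff ℝ ∞ (fun x => f (x + h • v)) :=
          hf.comp (contDiff_id.add contDiff_const)
        have h4 : iteratedFDeriv ℝ k (fun x => f x - f (x + h • v)) y
            = iteratedFDeriv ℝ k f y - iteratedFDeriv ℝ k f (y + h • v) := by
          rw [← iteratedFDeriv_comp_add_right k (h • v) y]
          exact iteratedFDeriv_sub_apply (hf.of_le (by exact_mod_cast le_top)).contDiffAt
            (hd.of_le (by exact_mod_cast le_top)).contDiffAt
        rw [h4]
        have h5 := Convex.norm_image_sub_le_of_norm_fderiv_le (𝕜 := ℝ)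
          (f := iteratedFDeriv ℝ k f) (C := C) (s := Set.univ) (x := y + h • v) (y := y)
          (fun z _ => (hf.differentiable_iteratedFDeriv (by exact_mod_cast ENat.natCast_lt_top k)) z)
          (fun z _ => by rw [norm_fderiv_iteratedFDeriv]; exact hC z) convex_univ trivial trivial
        refine h5.trans (mul_le_mul_of_nonneg_left ?_ ((norm_nonneg _).trans (hC y)))
        rw [sub_add_cancel_left, norm_neg, norm_smul, Real.norm_of_nonneg h0, mul_comm]
        exact mul_le_mul_of_nonneg_right hv h0
    have h6 : (roughen ν h)^[k + 1] f x
        = ∫ u, ((roughen ν h)^[k] f x - (roughen ν h)^[k] f (x + h • u)) ∂ν := by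
      rw [integral_sub (integrable_const _)
        (integrable_translate hν (continuous_roughen_iterate hν hf.continuous k) x),
        iterate_succ_apply']
      simp [roughen, smear]
    rw [h6, ← Real.norm_eq_abs]
    refine (norm_integral_le_of_norm_le_const (C := C * (D * h) ^ (k + 1)) ?_).trans (by simp)
    filter_upwards [hν] with u hu
    exact h1 u hu

theorem integral_smear {μ : Measure E} [μ.IsAddHaarMeasure] (hf : Continuous f)
    (hi : Integrable f μ) : ∫ x, smear ν h f x ∂μ = ∫ x, f x ∂μ := by
  unfold smear
  rw [integral_integral_swap]
  · simp [integral_add_right_eq_self (μ := μ) f]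
  · rw [integrable_prod_iff']
    · refine ⟨.of_forall fun u => hi.comp_add_right (h • u), ?_⟩
      simp only [uncurry]
      simp [integral_add_right_eq_self (μ := μ) (fun x => |f x|)]
    · exact Continuous.aestronglyMeasurable (by fun_prop)

end Smear

section Lattice

open scoped ContDiff

variable {E ι : Type*} [NormedAddCommGroup E] [NormedSpace ℝ E] [FiniteDimensional ℝ E]
  [MeasurableSpace E] [BorelSpace E] [Finite ι] (b : Module.Basis ι ℝ E) (μ : Measure E)
  [μ.IsAddHaarMeasure] {f : E → ℝ} {h R : ℝ}

/-- The lattice spanned by a basis. -/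
abbrev intSpan {E ι : Type*} [NormedAddCommGroup E] [NormedSpace ℝ E] (b : Module.Basis ι ℝ E) :=
  Submodule.span ℤ (Set.range b)

omit [MeasurableSpace E] [BorelSpace E] in
theorem finite_lattice_norm_le (hh : 0 < h) (R : ℝ) :
    {l : intSpan b | ‖h • (l : E)‖ ≤ R}.Finite := by
  have := FiniteDimensional.proper_real E
  refine Set.Finite.of_finite_image (f := Subtype.val) ?_ Subtype.val_injective.injOn
  refine (ZSpan.setFinite_inter b (Metric.isBounded_closedBall (x := 0) (r := R / h))).subset ?_
  rintro _ ⟨l, hl, rfl⟩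
  refine ⟨?_, l.2⟩
  rw [Set.mem_ofPred_eq, norm_smul, Real.norm_of_nonneg hh.le] at hl
  rw [mem_closedBall_zero_iff, le_div_iff₀ hh, mul_comm]
  exact hl

omit [MeasurableSpace E] [BorelSpace E] in
theorem finite_support_lattice (hh : 0 < h) (hf : ∀ x, R < ‖x‖ → f x = 0) :
    (support fun l : intSpan b => f (h • (l : E))).Finite := by
  refine (finite_lattice_norm_le b hh R).subset fun l hl => ?_
  by_contra hlt
  exact hl (hf _ (not_le.1 hlt))

/-- The uniform probability measure on the fundamental cell. -/
noncomputable def cellMeasure : Measure E := ProbabilityTheory.cond μ (ZSpan.fundamentalDomain b)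

omit [FiniteDimensional ℝ E] in
theorem cell_ne_zero : μ (ZSpan.fundamentalDomain b) ≠ 0 := by
  exact ZSpan.measure_fundamentalDomain_ne_zero b

omit [BorelSpace E] in
theorem cell_ne_top : μ (ZSpan.fundamentalDomain b) ≠ ⊤ := by
  have := FiniteDimensional.proper_real E
  exact (ZSpan.fundamentalDomain_isBounded b).measure_lt_top.ne

instance : IsProbabilityMeasure (cellMeasure b μ) :=
  ProbabilityTheory.cond_isProbabilityMeasure_of_finite (cell_ne_zero b μ) (cell_ne_top b μ)

omit [FiniteDimensional ℝ E] [μ.IsAddHaarMeasure] in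
theorem exists_norm_le_cellMeasure : ∃ D : ℝ, 0 ≤ D ∧ ∀ᵐ u ∂cellMeasure b μ, ‖u‖ ≤ D := by
  obtain ⟨D, hD⟩ := (ZSpan.fundamentalDomain_isBounded b).exists_norm_le
  refine ⟨max D 0, le_max_right _ _, ?_⟩
  filter_upwards [ProbabilityTheory.ae_cond_mem (μ := μ)
    (ZSpan.fundamentalDomain_measurableSet b)] with u hu
  exact (hD u hu).trans (le_max_left _ _)

theorem finsum_smear (hh : 0 < h) (h1 : h ≤ 1) (hf : Continuous f)
    (hR : ∀ x, R < ‖x‖ → f x = 0) :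
    ∑ᶠ l : intSpan b, smear (cellMeasure b μ) h f (h • (l : E)) =
      (μ.real (ZSpan.fundamentalDomain b))⁻¹ * (h ^ finrank ℝ E)⁻¹ * ∫ x, f x ∂μ := by
  have := FiniteDimensional.proper_real E
  have hfi : Integrable f μ := hf.integrable_of_hasCompactSupport
    (HasCompactSupport.intro (isCompact_closedBall (0 : E) R)
      fun x hx => hR x (by simpa using hx))
  obtain ⟨D, -, hD⟩ := exists_norm_le_cellMeasure b μ
  rw [← tsum_eq_finsum (L := .unconditional _) (finite_support_lattice b hh
    (fun x hx => smear_eq_zero (ν := cellMeasure b μ) hD hh.le h1 hR x hx))]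
  have h2 := Measure.integral_comp_smul_of_nonneg μ f h (hR := hh.le)
  have : VAddInvariantMeasure (intSpan b) E μ :=
    inferInstanceAs (VAddInvariantMeasure (intSpan b).toAddSubgroup E μ)
  have hd := ZSpan.isAddFundamentalDomain b μ
  rw [hd.integral_eq_tsum'' (fun x => f (h • x)) (hfi.comp_smul hh.ne')] at h2
  rw [mul_assoc, ← smul_eq_mul (_⁻¹ : ℝ) (∫ x, f x ∂μ), ← h2, ← tsum_mul_left]
  refine tsum_congr fun l => ?_
  simp only [smear, cellMeasure, ProbabilityTheory.cond, integral_smul_measure,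
    ENNReal.toReal_inv, smul_eq_mul]
  congr 1
  refine integral_congr_ae (.of_forall fun u => ?_)
  simp [Submodule.vadd_def, smul_add]

/-- Sums of a smooth function over a dilated lattice. -/
theorem exists_abs_lattice_sum_sub_le (hf : ContDiff ℝ ∞ f) (hc : HasCompactSupport f) :
    ∃ c C : ℝ, ∀ s : ℝ, 0 < s → |∑ᶠ l : intSpan b, f (s⁻¹ • (l : E))
      - c * s ^ finrank ℝ E| ≤ C := by
  classical
  set n := finrank ℝ E with hn
  set μ : Measure E := Measure.addHaar
  set V := (μ.real (ZSpan.fundamentalDomain b))⁻¹ with hV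
  set ν := cellMeasure b μ with hν
  obtain ⟨D, hD0, hD⟩ := exists_norm_le_cellMeasure b μ
  rw [← hν] at hD
  have := FiniteDimensional.proper_real E
  obtain ⟨R₀, hR₀⟩ := hc.isCompact.isBounded.exists_norm_le
  have hR : ∀ x, R₀ < ‖x‖ → f x = 0 := by
    intro x hx
    by_contra h
    exact (hR₀ x (subset_tsupport f h)).not_gt hx
  obtain ⟨M, hM⟩ := hc.exists_bound_of_continuous hf.continuous
  obtain ⟨C₁, hC₁⟩ := (hc.iteratedFDeriv (n + 1)).exists_bound_of_continuous
    (hf.continuous_iteratedFDeriv (by exact_mod_cast le_top))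
  set R := max R₀ 0 + (n + 1 : ℕ) * D with hRdef
  have hC1 : 0 ≤ C₁ := (norm_nonneg _).trans (hC₁ 0)
  have hM0 : 0 ≤ M := (norm_nonneg _).trans (hM 0)
  have hR0 : 0 < R + D + 1 := by positivity
  set β : ContDiffBump (0 : E) := ⟨R + D + 1, R + D + 2, hR0, by linarith⟩
  set c := V * ∫ x, f x ∂μ with hcdef
  set P := {l : intSpan b | ‖(1 : ℝ) • (l : E)‖ ≤ R}
  have hP : P.Finite := finite_lattice_norm_le b one_pos R
  have hfr : ∀ x, R < ‖x‖ → f x = 0 := fun x hx =>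
    hR x ((le_max_left R₀ 0).trans_lt (lt_of_le_of_lt (by rw [hRdef]; nlinarith) hx))
  -- the number of lattice points in a ball times a uniform bound
  have hcount : ∀ (h : ℝ) (hh : 0 < h) (F : E → ℝ) (B : ℝ), (∀ x, |F x| ≤ B) →
      (∀ x, R < ‖x‖ → F x = 0) → |∑ᶠ l : intSpan b, F (h • (l : E))|
        ≤ #(finite_lattice_norm_le b hh R).toFinset * B := by
    intro h hh F B hB hF
    rw [finsum_eq_sum_of_support_subset (s := (finite_lattice_norm_le b hh R).toFinset)]
    · exact (abs_sum_le_sum_abs _ _).trans ((sum_le_card_nsmul _ _ B fun l _ => hB _).trans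
        (by rw [nsmul_eq_mul]))
    · intro l hl
      simp only [Set.Finite.coe_toFinset, Set.mem_ofPred_eq]
      by_contra hlt
      exact hl (hF _ (not_le.1 hlt))
  have hball : ∀ h, ∀ hh : 0 < h, h ≤ 1 → (#(finite_lattice_norm_le b hh R).toFinset : ℝ)
      ≤ V * (h ^ n)⁻¹ * ∫ x, β x ∂μ := by
    intro h hh h1
    have hβ : ∀ x, R + D + 2 < ‖x‖ → β x = 0 := fun x hx =>
      β.zero_of_le_dist (by rw [dist_zero_right]; exact hx.le)
    rw [hV, hn, ← finsum_smear b μ hh h1 β.continuous hβ]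
    have hfin := finite_support_lattice b hh
      (fun x hx => smear_eq_zero (ν := ν) hD hh.le h1 hβ x hx)
    have h0 : ∀ x, 0 ≤ smear ν h β x := fun x => integral_nonneg fun u => β.nonneg
    rw [finsum_eq_sum_of_support_subset (s := (finite_lattice_norm_le b hh R).toFinset ∪
      hfin.toFinset) _ (by intro l hl; simp only [coe_union, Set.Finite.coe_toFinset]; exact .inr hl)]
    refine le_trans ?_ (sum_le_sum_of_subset_of_nonneg subset_union_left fun l _ _ => h0 _)
    rw [card_eq_sum_ones, Nat.cast_sum]
    refine sum_le_sum fun l hl => ?_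
    simp only [Set.Finite.mem_toFinset, Set.mem_ofPred_eq] at hl
    have h3 : smear ν h β (h • (l : E)) = 1 := by
      have : ∀ᵐ u ∂ν, β (h • (l : E) + h • u) = 1 := by
        filter_upwards [hD] with u hu
        refine β.one_of_mem_closedBall ?_
        rw [mem_closedBall_zero_iff]
        refine (norm_add_le _ _).trans ?_
        rw [norm_smul h u, Real.norm_of_nonneg hh.le]
        change _ ≤ R + D + 1
        nlinarith [norm_nonneg u]
      rw [smear, integral_congr_ae this]
      simp
    rw [h3, Nat.cast_one]
  have hit : ∀ h, 0 < h → h ≤ 1 → ∀ k, Integrable ((roughen ν h)^[k] f) μ := by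
    intro h hh h1 k
    exact (continuous_roughen_iterate hD hf.continuous k).integrable_of_hasCompactSupport
      (HasCompactSupport.intro (isCompact_closedBall (0 : E) (R₀ + k * D))
        fun x hx => roughen_iterate_eq_zero hD hD0 hh.le h1 hR k x (by simpa using hx))
  have hzero : ∀ h, 0 < h → h ≤ 1 → ∀ k, ∫ x, (roughen ν h)^[k + 1] f x ∂μ = 0 := by
    intro h hh h1 k
    have hck := continuous_roughen_iterate (h := h) hD hf.continuous k
    have hsi : Integrable (smear ν h ((roughen ν h)^[k] f)) μ :=
      (continuous_smear hD hck).integrable_of_hasCompactSupport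
      (HasCompactSupport.intro (isCompact_closedBall (0 : E) (R₀ + k * D + D))
        fun x hx => smear_eq_zero hD hh.le h1
          (roughen_iterate_eq_zero hD hD0 hh.le h1 hR k) x (by simpa using hx))
    simp only [iterate_succ_apply', roughen]
    rw [integral_sub (hit h hh h1 k) hsi, integral_smear hck (hit h hh h1 k), sub_self]
  have hsum : ∀ h, 0 < h → h ≤ 1 → ∀ k,
      ∑ᶠ l : intSpan b, (roughen ν h)^[k + 1] f (h • (l : E)) =
        ∑ᶠ l : intSpan b, f (h • (l : E)) - c * (h ^ n)⁻¹ := by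
    intro h hh h1 k
    have hstep : ∀ k, ∑ᶠ l : intSpan b, (roughen ν h)^[k + 1] f (h • (l : E))
        = ∑ᶠ l : intSpan b, (roughen ν h)^[k] f (h • (l : E))
          - V * (h ^ n)⁻¹ * ∫ x, (roughen ν h)^[k] f x ∂μ := by
      intro k
      have hz := roughen_iterate_eq_zero hD hD0 hh.le h1 hR k
      rw [hV, hn, ← finsum_smear b μ hh h1 (continuous_roughen_iterate hD hf.continuous k) hz,
        ← finsum_sub_distrib (finite_support_lattice b hh hz) (finite_support_lattice b hh
          (fun x hx => smear_eq_zero (ν := ν) hD hh.le h1 hz x hx))]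
      simp only [iterate_succ_apply', roughen, hν]
    induction k with
    | zero =>
      rw [hstep, hcdef]
      simp only [iterate_zero, id]
      ring
    | succ k ih => rw [hstep, hzero h hh h1, ih, mul_zero, sub_zero]
  refine ⟨c, max (#hP.toFinset * M + |c|) (V * (∫ x, β x ∂μ) * (C₁ * D ^ (n + 1))), fun s hs => ?_⟩
  rcases lt_or_ge s 1 with hs1 | hs1
  · refine le_trans ?_ (le_max_left _ _)
    refine (abs_sub _ _).trans (add_le_add ?_ ?_)
    · refine (hcount s⁻¹ (inv_pos.2 hs) f M hM hfr).trans (mul_le_mul_of_nonneg_right ?_ hM0)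
      refine Nat.cast_le.2 (card_le_card ?_)
      intro l
      simp only [Set.Finite.mem_toFinset, Set.mem_ofPred_eq, P]
      rw [norm_smul, one_smul, norm_inv, Real.norm_of_nonneg hs.le]
      refine fun hl => le_trans ?_ hl
      exact le_mul_of_one_le_left (norm_nonneg _) ((one_le_inv₀ hs).2 hs1.le)
    · rw [abs_mul, abs_of_nonneg (pow_nonneg hs.le n)]
      exact mul_le_of_le_one_right (abs_nonneg c) (pow_le_one₀ hs.le hs1.le)
  · refine le_trans ?_ (le_max_right _ _)
    have hh : 0 < s⁻¹ := inv_pos.2 hs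
    have h1 : s⁻¹ ≤ 1 := inv_le_one_of_one_le₀ hs1
    have h2 := hsum _ hh h1 n
    rw [inv_pow, inv_inv] at h2
    rw [← h2]
    refine (hcount _ hh _ (C₁ * (D * s⁻¹) ^ (n + 1))
      (abs_roughen_iterate_le hD hh.le (n + 1) hf hC₁) ?_).trans ?_
    · intro x hx
      refine roughen_iterate_eq_zero hD hD0 hh.le h1 (R := max R₀ 0) ?_ (n + 1) x hx
      exact fun y hy => hR y ((le_max_left _ _).trans_lt hy)
    · have hDs : 0 ≤ C₁ * (D * s⁻¹) ^ (n + 1) := by positivity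
      refine (mul_le_mul_of_nonneg_right (hball _ hh h1) hDs).trans ?_
      have hβ0 : 0 ≤ ∫ x, β x ∂μ := integral_nonneg fun x => β.nonneg
      have hV0 : 0 ≤ V := by positivity
      have h5 : V * (s⁻¹ ^ n)⁻¹ * (∫ x, β x ∂μ) * (C₁ * (D * s⁻¹) ^ (n + 1))
          = V * (∫ x, β x ∂μ) * (C₁ * D ^ (n + 1)) * s⁻¹ := by
        rw [mul_pow, pow_succ s⁻¹]
        have : s⁻¹ ^ n ≠ 0 := by positivity
        field_simp
      rw [h5]
      exact mul_le_of_le_one_right (by positivity) h1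

end Lattice

section Units

open scoped ContDiff Classical
open mixedEmbedding renaming norm → mixedNorm

variable (K)

/-- Multiplying by a unit makes all the absolute values of an element comparable. -/
theorem exists_unit_smul_norm_le : ∃ R : ℝ, 0 < R ∧ ∀ x : mixedSpace K,
    mixedNorm x ≠ 0 → ∃ u : (𝓞 K)ˣ, ∀ s : ℝ, 0 < s →
      mixedNorm x ≤ s ^ finrank ℚ K → ‖u • x‖ ≤ R * s := by
  obtain ⟨R, hR⟩ := (mixedEmbedding.fundamentalCone.isBounded_normLeOne K).exists_norm_le
  refine ⟨max R 1, by positivity, fun x hx => ?_⟩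
  obtain ⟨u, hu⟩ := mixedEmbedding.fundamentalCone.exists_unit_smul_mem hx
  refine ⟨u, fun s hs hxs => ?_⟩
  have h1 : s⁻¹ • (u • x) ∈ mixedEmbedding.fundamentalCone.normLeOne K := by
    rw [mixedEmbedding.fundamentalCone.mem_normLeOne]
    refine ⟨(mixedEmbedding.fundamentalCone.smul_mem_iff_mem (inv_ne_zero hs.ne')).2 hu, ?_⟩
    rw [mixedEmbedding.norm_smul, mixedEmbedding.unitSMul_smul, map_mul, mixedEmbedding.norm_unit,
      one_mul, abs_of_nonneg (inv_nonneg.2 hs.le), inv_pow, inv_mul_le_iff₀ (by positivity)]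
    simpa using hxs
  have h2 := hR _ h1
  rw [norm_smul, norm_inv, Real.norm_of_nonneg hs.le, inv_mul_le_iff₀ hs, mul_comm] at h2
  exact h2.trans (mul_le_mul_of_nonneg_right (le_max_left _ _) hs.le)

variable {K}

theorem normAtPlace_le_norm (w : InfinitePlace K) (x : mixedSpace K) :
    normAtPlace w x ≤ ‖x‖ := by
  rw [mixedEmbedding.norm_eq_sup'_normAtPlace]
  exact le_sup' (fun w => normAtPlace w x) (mem_univ w)

theorem finite_units_le (B : ℝ) :
    {u : (𝓞 K)ˣ | ∀ w : InfinitePlace K, w ((u : 𝓞 K) : K) ≤ B}.Finite := by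
  refine Set.Finite.of_finite_image (f := fun u : (𝓞 K)ˣ => ((u : 𝓞 K) : K)) ?_
    fun u _ v _ h => Units.ext (RingOfIntegers.ext h)
  refine (Embeddings.finite_of_norm_le K ℂ B).subset ?_
  rintro _ ⟨u, hu, rfl⟩
  exact ⟨RingOfIntegers.isIntegral_coe _, fun σ => by
    simpa [InfinitePlace.apply] using hu (InfinitePlace.mk σ)⟩

omit [NumberField K] in
theorem normAtPlace_unit_smul (w : InfinitePlace K) (u : (𝓞 K)ˣ)
    (x : mixedSpace K) : normAtPlace w (u • x) =
      w ((u : 𝓞 K) : K) * normAtPlace w x := by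
  rw [mixedEmbedding.unitSMul_smul, map_mul, mixedEmbedding.normAtPlace_apply]

theorem contDiffAt_norm {x : mixedSpace K} (hx : mixedNorm x ≠ 0) :
    ContDiffAt ℝ ∞ (mixedNorm : mixedSpace K → ℝ) x := by
  have h1 : (mixedNorm : mixedSpace K → ℝ) =
      fun x => ∏ w, normAtPlace w x ^ w.mult :=
    funext fun y => mixedEmbedding.norm_apply y
  rw [h1]
  refine contDiffAt_prod fun w _ => ContDiffAt.pow ?_ _
  have hw : normAtPlace w x ≠ 0 := fun h =>
    hx (mixedEmbedding.norm_eq_zero_iff.2 ⟨w, h⟩)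
  rcases w.isReal_or_isComplex with h | h
  · have h2 := funext fun y : mixedSpace K =>
      mixedEmbedding.normAtPlace_apply_of_isReal h y
    rw [h2] at hw ⊢
    exact ContDiffAt.norm ℝ ((contDiff_apply ℝ ℝ _).comp contDiff_fst).contDiffAt
      (norm_ne_zero_iff.1 hw)
  · have h2 := funext fun y : mixedSpace K =>
      mixedEmbedding.normAtPlace_apply_of_isComplex h y
    rw [h2] at hw ⊢
    exact ContDiffAt.norm ℝ ((contDiff_apply ℝ ℂ _).comp contDiff_snd).contDiffAt
      (norm_ne_zero_iff.1 hw)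

/-- Only finitely many units matter near a point of nonzero norm. -/
theorem exists_finite_units (R : ℝ) {x : mixedSpace K}
    (hx : mixedNorm x ≠ 0) : ∃ U : Finset (𝓞 K)ˣ, ∀ᶠ y in nhds x,
      ∀ u : (𝓞 K)ˣ, ‖u • y‖ ≤ R → u ∈ U := by
  have hpos : ∀ w, 0 < normAtPlace w x := fun w =>
    lt_of_le_of_ne (mixedEmbedding.normAtPlace_nonneg w x) fun h =>
      hx (mixedEmbedding.norm_eq_zero_iff.2 ⟨w, h.symm⟩)
  obtain ⟨w₀, -, hw₀⟩ := exists_min_image univ (fun w => normAtPlace w x)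
    univ_nonempty
  set ε := normAtPlace w₀ x / 2 with hε
  have hε0 : 0 < ε := half_pos (hpos w₀)
  refine ⟨(finite_units_le (K := K) (R / ε)).toFinset, ?_⟩
  have h1 : ∀ᶠ y in nhds x, ∀ w, ε < normAtPlace w y := by
    rw [eventually_all]
    intro w
    refine (mixedEmbedding.continuous_normAtPlace w).continuousAt.eventually_const_lt ?_
    have := hw₀ w (mem_univ w)
    linarith [hpos w₀]
  filter_upwards [h1] with y hy u hu
  rw [Set.Finite.mem_toFinset]
  intro w
  rw [le_div_iff₀ hε0]
  have h2 := (normAtPlace_le_norm w (u • y)).trans hu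
  rw [normAtPlace_unit_smul] at h2
  exact (mul_le_mul_of_nonneg_left (hy w).le (apply_nonneg w _)).trans h2

/-- A function of the norm is an average over units of a compactly supported function. -/
theorem exists_unit_average {φ : ℝ → ℝ} (hφ : IsTest φ) :
    ∃ Ψ : mixedSpace K → ℝ, ContDiff ℝ ∞ Ψ ∧ HasCompactSupport Ψ ∧
      (∀ x, mixedNorm x = 0 → Ψ x = 0) ∧
      ∀ x, mixedNorm x ≠ 0 →
        ∑ᶠ u : (𝓞 K)ˣ, Ψ (u • x) = φ (log (mixedNorm x)) := by
  obtain ⟨r, hr0, hr⟩ := hφ.exists_radius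
  obtain ⟨R, hR0, hR⟩ := exists_unit_smul_norm_le K
  set n := finrank ℚ K
  have hn : 0 < n := Module.finrank_pos
  set s := exp (r / n) with hs
  have hsn : s ^ n = exp r := by
    rw [hs, ← exp_nat_mul]
    congr 1
    field_simp
  have hRs : 0 < R * s := mul_pos hR0 (exp_pos _)
  set β : ContDiffBump (0 : mixedSpace K) := ⟨R * s, R * s + 1, hRs, by linarith⟩
  have hβ : ∀ x, β x ≠ 0 → ‖x‖ ≤ R * s + 1 := by
    intro x hx
    by_contra h
    exact hx (β.zero_of_le_dist (by rw [dist_zero_right]; exact (not_le.1 h).le))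
  set P : mixedSpace K → ℝ := fun x => ∑ᶠ u : (𝓞 K)ˣ, β (u • x) with hP
  have hPinv : ∀ (u : (𝓞 K)ˣ) x, P (u • x) = P x := by
    intro u x
    simp only [hP, smul_smul]
    exact finsum_comp_equiv (Equiv.mulRight u) (f := fun v => β (v • x))
  have hPsum : ∀ x, mixedNorm x ≠ 0 → ∃ U : Finset (𝓞 K)ˣ, ∀ᶠ y in nhds x,
      P y = ∑ u ∈ U, β (u • y) := by
    intro x hx
    obtain ⟨U, hU⟩ := exists_finite_units (K := K) (R * s + 1) hx
    refine ⟨U, hU.mono fun y hy => finsum_eq_sum_of_support_subset _ fun u hu => hy u (hβ _ hu)⟩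
  have hPfin : ∀ x, mixedNorm x ≠ 0 →
      (support fun u : (𝓞 K)ˣ => β (u • x)).Finite := by
    intro x hx
    obtain ⟨U, hU⟩ := exists_finite_units (K := K) (R * s + 1) hx
    exact (finite_toSet U).subset fun u hu => hU.self_of_nhds u (hβ _ hu)
  have hPpos : ∀ x, mixedNorm x ≠ 0 → mixedNorm x ≤ exp r → 0 < P x := by
    intro x hx hxr
    obtain ⟨u, hu⟩ := hR x hx
    refine finsum_pos (fun u => β.nonneg) ⟨u, ?_⟩ (hPfin x hx)
    rw [β.one_of_mem_closedBall]
    · exact one_pos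
    · rw [mem_closedBall_zero_iff]
      exact hu s (exp_pos _) (by rwa [hsn])
  set Ψ : mixedSpace K → ℝ := fun x => if mixedNorm x = 0 then 0 else
    φ (log (mixedNorm x)) * (β x / P x) with hΨ
  have hlarge : ∀ x : mixedSpace K, mixedNorm x ≠ 0 → exp r ≤ mixedNorm x →
      φ (log (mixedNorm x)) = 0 := by
    intro x hx hxr
    refine hr _ (((Real.le_log_iff_exp_le ?_).2 hxr).trans (le_abs_self _))
    exact lt_of_le_of_ne (mixedEmbedding.norm_nonneg x) (Ne.symm hx)
  have hsmall : ∀ x : mixedSpace K, mixedNorm x < exp (-r) → Ψ x = 0 := by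
    intro x hxr
    simp only [hΨ]
    split_ifs with hx
    · rfl
    · have h0 : 0 < mixedNorm x :=
        lt_of_le_of_ne (mixedEmbedding.norm_nonneg x) (Ne.symm hx)
      have h1 := (log_le_iff_le_exp h0).2 hxr.le
      rw [hr _ ((by linarith : r ≤ -log (mixedNorm x)).trans (neg_le_abs _)),
        zero_mul]
  refine ⟨Ψ, ?_, ?_, fun x hx => if_pos hx, ?_⟩
  · rw [contDiff_iff_contDiffAt]
    intro x
    have hcont := mixedEmbedding.continuous_norm K
    rcases lt_or_ge (mixedNorm x) (exp (-r)) with h1 | h1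
    · refine (contDiffAt_const (c := (0 : ℝ))).congr_of_eventuallyEq ?_
      filter_upwards [hcont.continuousAt.eventually_lt_const h1] with y hy using hsmall y hy
    have hx : mixedNorm x ≠ 0 := ((exp_pos _).trans_le h1).ne'
    rcases lt_or_ge (exp r) (mixedNorm x) with h2 | h2
    · refine (contDiffAt_const (c := (0 : ℝ))).congr_of_eventuallyEq ?_
      filter_upwards [hcont.continuousAt.eventually_const_lt h2] with y hy
      have hy0 : mixedNorm y ≠ 0 := ((exp_pos _).trans hy).ne'
      simp only [hΨ, if_neg hy0, hlarge y hy0 hy.le, zero_mul]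
    · obtain ⟨U, hU⟩ := hPsum x hx
      have hPd : ContDiffAt ℝ ∞ P x := by
        refine ContDiffAt.congr_of_eventuallyEq ?_ hU
        refine ContDiffAt.sum fun u _ => ?_
        refine β.contDiff.contDiffAt.comp x ?_
        change ContDiffAt ℝ ∞ (fun y => mixedEmbedding K ((u : 𝓞 K) : K) * y) x
        exact contDiffAt_const.mul contDiffAt_id
      have hd : ContDiffAt ℝ ∞ (fun x => φ (log (mixedNorm x)) * (β x / P x)) x :=
        (hφ.contDiff.contDiffAt.comp x ((contDiffAt_norm hx).log hx)).mul
          (β.contDiff.contDiffAt.div hPd (hPpos x hx h2).ne')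
      refine hd.congr_of_eventuallyEq ?_
      filter_upwards [hcont.continuousAt.eventually_ne hx] with y hy
      simp only [hΨ, if_neg hy]
  · refine β.hasCompactSupport.mono fun x hx => ?_
    rw [mem_support] at hx ⊢
    contrapose! hx
    simp [hΨ, hx]
  · intro x hx
    have h1 : ∀ u : (𝓞 K)ˣ, Ψ (u • x) =
        φ (log (mixedNorm x)) / P x * β (u • x) := by
      intro u
      have h2 : mixedNorm (u • x) = mixedNorm x := by
        rw [mixedEmbedding.unitSMul_smul, map_mul, mixedEmbedding.norm_unit, one_mul]
      simp only [hΨ, h2, if_neg hx, hPinv]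
      ring
    simp_rw [h1]
    rw [← mul_finsum]
    change _ * P x = _
    rcases le_total (exp r) (mixedNorm x) with h2 | h2
    · rw [hlarge x hx h2]
      simp
    · rw [div_mul_cancel₀ _ (hPpos x hx h2).ne']

end Units

section ClassCount

open scoped ContDiff

lemma idealClass_eq_zero_iff {m : PrimeIdeal K →₀ ℕ} :
    idealClass m = 0 ↔ (toIdeal m).IsPrincipal := by
  rw [← ClassGroup.mk0_eq_one_iff (mem_nonZeroDivisors_of_ne_zero (toIdeal_ne_zero m))]
  exact ofMul_eq_zero

lemma exists_span_eq_toIdeal {m : PrimeIdeal K →₀ ℕ} (hm : idealClass m = 0) :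
    ∃ x : 𝓞 K, x ≠ 0 ∧ Ideal.span {x} = toIdeal m := by
  obtain ⟨x, hx⟩ := (idealClass_eq_zero_iff.1 hm).principal
  refine ⟨x, ?_, hx.symm⟩
  rintro rfl
  exact toIdeal_ne_zero m (by simpa using hx)

lemma norm_mixedEmbedding_eq {x : 𝓞 K} {m : PrimeIdeal K →₀ ℕ}
    (hx : Ideal.span {x} = toIdeal m) :
    mixedEmbedding.norm (mixedEmbedding K (x : K)) = exp (logNorm m) := by
  rw [exp_logNorm, ← absNorm_toIdeal, ← hx, Ideal.absNorm_span_singleton,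
    mixedEmbedding.norm_eq_norm, ← Algebra.coe_norm_int, Nat.cast_natAbs]
  push_cast
  rfl

lemma exists_idealClass_eq (g : AddClassGroup K) : ∃ m, idealClass m = g := by
  obtain ⟨I, hI⟩ := ClassGroup.mk0_surjective g.toMul
  obtain ⟨m, hm⟩ := exists_toIdeal_eq (nonZeroDivisors.ne_zero I.2)
  refine ⟨m, ?_⟩
  apply Additive.toMul.injective
  rw [← hI]
  exact congrArg ClassGroup.mk0 (Subtype.ext hm)

theorem exists_classSum_asymptotic {φ : ℝ → ℝ} (hφ : IsTest φ) (g : AddClassGroup K) :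
    ∃ c C : ℝ, ∀ t, |classSum g φ t - c * exp t| ≤ C := by
  classical
  obtain ⟨Ψ, hΨ, hΨc, hΨ0, hΨu⟩ := exists_unit_average (K := K) hφ
  obtain ⟨β, hβ⟩ := exists_idealClass_eq (-g)
  set I : (FractionalIdeal (nonZeroDivisors (𝓞 K)) K)ˣ := FractionalIdeal.mk0 K
    ⟨toIdeal β, mem_nonZeroDivisors_of_ne_zero (toIdeal_ne_zero β)⟩ with hI
  set b := mixedEmbedding.fractionalIdealLatticeBasis K I with hb
  have hmem : ∀ y, y ∈ Submodule.span ℤ (Set.range b) ↔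
      ∃ x ∈ toIdeal β, mixedEmbedding K (x : K) = y := by
    intro y
    rw [mixedEmbedding.mem_span_fractionalIdealLatticeBasis]
    simp [hI, FractionalIdeal.mem_coeIdeal]
  clear_value b I
  obtain ⟨c, C, hc⟩ := exists_abs_lattice_sum_sub_le b hΨ hΨc
  have hx : ∀ m : {m : PrimeIdeal K →₀ ℕ // idealClass m = g},
      ∃ x : 𝓞 K, x ≠ 0 ∧ Ideal.span {x} = toIdeal (m.1 + β) := fun m =>
    exists_span_eq_toIdeal (by rw [map_add, m.2, hβ, add_neg_cancel])
  choose x hx0 hx using hx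
  have hxu : ∀ m (u : (𝓞 K)ˣ), Ideal.span {(u : 𝓞 K) * x m} = toIdeal (m.1 + β) := by
    intro m u
    rw [← hx, Ideal.span_singleton_mul_left_unit u.isUnit]
  have hxm : ∀ p : {m : PrimeIdeal K →₀ ℕ // idealClass m = g} × (𝓞 K)ˣ,
      ∃ l : intSpan b, (l : mixedSpace K) =
        mixedEmbedding K (((p.2 : 𝓞 K) * x p.1 : 𝓞 K) : K) := by
    intro p
    have h := hxu p.1 p.2
    rw [toIdeal_add] at h
    have h' := Ideal.mul_le_right (h ▸ Ideal.mem_span_singleton_self _)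
    exact ⟨⟨_, (hmem (mixedEmbedding K (((p.2 : 𝓞 K) * x p.1 : 𝓞 K) : K))).2 ⟨_, h', rfl⟩⟩, rfl⟩
  choose G hGv using hxm
  have hG : Injective G := by
    rintro ⟨m, u⟩ ⟨m', u'⟩ h
    have h0 := congrArg Subtype.val h
    rw [hGv, hGv] at h0
    have h1 : (u : 𝓞 K) * x m = u' * x m' := RingOfIntegers.ext (mixedEmbedding_injective K h0)
    have h2 : m = m' := Subtype.ext (add_right_cancel
      (toIdeal_injective ((hxu m u).symm.trans ((congrArg (fun z => Ideal.span {z}) h1).trans (hxu m' u')))))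
    subst h2
    rw [Units.ext (mul_right_cancel₀ (hx0 m) h1)]
  have hn : finrank ℝ (mixedSpace K) = finrank ℚ K :=
    mixedEmbedding.finrank K
  have hn0 : (finrank ℚ K : ℝ) ≠ 0 := Nat.cast_ne_zero.2 Module.finrank_pos.ne'
  obtain ⟨R, -, hR⟩ := hΨc.exists_pos_le_norm
  refine ⟨c * exp (logNorm β), C, fun t => ?_⟩
  set s := exp ((t + logNorm β) / finrank ℚ K) with hs
  have hs0 : 0 < s := exp_pos _
  have hsn : s ^ finrank ℚ K = exp (t + logNorm β) := by
    rw [hs, ← exp_nat_mul, mul_div_cancel₀ _ hn0]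
  have key : ∑ᶠ l : intSpan b,
      Ψ (s⁻¹ • (l : mixedSpace K)) = classSum g φ t := by
    have hsupp : (support fun l : intSpan b =>
        Ψ (s⁻¹ • (l : mixedSpace K))) ⊆ Set.range G := by
      rintro ⟨y, hy⟩ hΨy
      obtain ⟨z, hz, rfl⟩ := (hmem y).1 hy
      have hz0 : z ≠ 0 := by
        rintro rfl
        refine hΨy (hΨ0 _ ?_)
        simp
      obtain ⟨k, hk⟩ := exists_toIdeal_eq (K := K) (I := Ideal.span {z}) (by simpa using hz0)
      obtain ⟨J, hJ⟩ := Ideal.dvd_iff_le.2 ((Ideal.span_singleton_le_iff_mem _).2 hz)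
      have hJ0 : J ≠ 0 := by
        rintro rfl
        simp [hz0] at hJ
      obtain ⟨m, rfl⟩ := exists_toIdeal_eq hJ0
      have hkm : k = m + β := toIdeal_injective (by rw [hk, hJ, toIdeal_add, mul_comm])
      have hmg : idealClass m = g := by
        have h : idealClass k = 0 := idealClass_eq_zero_iff.2 (hk ▸ ⟨z, rfl⟩)
        rw [hkm, map_add, hβ, ← sub_eq_add_neg, sub_eq_zero] at h
        exact h
      have h := hx ⟨m, hmg⟩
      rw [← hkm, hk, Ideal.span_singleton_eq_span_singleton] at h
      obtain ⟨u, hu⟩ := h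
      refine ⟨(⟨m, hmg⟩, u), Subtype.ext ?_⟩
      rw [hGv]
      dsimp only
      rw [mul_comm, hu]
    have h1 : ∑ᶠ l : intSpan b, Ψ (s⁻¹ • (l : mixedSpace K)) =
        ∑ᶠ p, Ψ (s⁻¹ • (G p : mixedSpace K)) := by
      rw [← finsum_mem_range (f := fun l : intSpan b =>
        Ψ (s⁻¹ • (l : mixedSpace K))) hG, finsum_mem_def,
        Set.indicator_eq_self.2 hsupp]
    have hfin : (support fun p => Ψ (s⁻¹ • (G p : mixedSpace K))).Finite := by
      refine ((finite_support_lattice b (inv_pos.2 hs0) (R := R)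
        fun x hx => hR x hx.le).preimage hG.injOn).subset fun p hp => hp
    rw [h1, finsum_curry _ hfin]
    have h2 : ∀ m : {m : PrimeIdeal K →₀ ℕ // idealClass m = g},
        ∑ᶠ u, Ψ (s⁻¹ • (G (m, u) : mixedSpace K)) = φ (logNorm m.1 - t) := by
      intro m
      set y := s⁻¹ • mixedEmbedding K (x m : K) with hy
      have hnorm : mixedEmbedding.norm y = exp (logNorm m.1 - t) := by
        rw [hy, mixedEmbedding.norm_smul, norm_mixedEmbedding_eq (hx m), abs_of_pos (inv_pos.2 hs0),
          inv_pow, hsn, ← exp_neg, ← exp_add, logNorm_add]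
        congr 1
        ring
      have h3 := hΨu y (by rw [hnorm]; exact (exp_pos _).ne')
      rw [hnorm, log_exp] at h3
      rw [← h3]
      refine finsum_congr fun u => ?_
      rw [hGv, hy, mixedEmbedding.unitSMul_smul, mul_smul_comm, ← map_mul]
      rfl
    simp_rw [h2]
    refine (finsum_set_coe_eq_finsum_mem (f := fun m => φ (logNorm m - t))
      {m | idealClass m = g}).trans ?_
    rw [finsum_mem_def]
    refine finsum_congr fun m => ?_
    by_cases hm : idealClass m = g
    · rw [Set.indicator_of_mem (Set.mem_ofPred_eq.symm ▸ hm), ind_true hm, one_mul]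
    · rw [Set.indicator_of_notMem (Set.mem_ofPred_eq.symm ▸ hm), ind_false hm, zero_mul]
  have h := hc s hs0
  rwa [key, hn, hsn, add_comm, exp_add, ← mul_assoc] at h

noncomputable def classCount (g : AddClassGroup K) (x : ℝ) : ℝ :=
  ∑ m ∈ normBall K x, ind (idealClass m = g)

variable (K) in
lemma exists_tendsto_classCount : ∃ κ : ℝ, 0 < κ ∧ ∀ g : AddClassGroup K,
    Tendsto (fun x => classCount g x * exp (-x)) atTop (nhds κ) := by
  classical
  refine ⟨(2 ^ InfinitePlace.nrRealPlaces K * (2 * Real.pi) ^ InfinitePlace.nrComplexPlaces K *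
    Units.regulator K) / (Units.torsionOrder K * Real.sqrt |discr K|), ?_, fun g => ?_⟩
  · have h1 := Units.regulator_pos K
    have h2 : (0 : ℝ) < Units.torsionOrder K := by exact_mod_cast Nat.pos_of_neZero _
    have h3 : (0 : ℝ) < |(discr K : ℝ)| := abs_pos.2 (by exact_mod_cast discr_ne_zero K)
    positivity
  · refine ((Ideal.tendsto_norm_le_and_mk_eq_div_atTop K (C := g.toMul)).comp
      Real.tendsto_exp_atTop).congr fun x => ?_
    rw [Function.comp, exp_neg, ← div_eq_mul_inv]
    congr 1
    let e : {m : PrimeIdeal K →₀ ℕ // logNorm m ≤ x ∧ idealClass m = g} →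
        {I : nonZeroDivisors (Ideal (𝓞 K)) // (Ideal.absNorm (I : Ideal (𝓞 K)) : ℝ) ≤ exp x ∧
          ClassGroup.mk0 I = g.toMul} := fun m =>
      ⟨⟨toIdeal m.1, mem_nonZeroDivisors_of_ne_zero (toIdeal_ne_zero m.1)⟩, by
        rw [absNorm_toIdeal, ← exp_logNorm]
        exact exp_le_exp.2 m.2.1, congrArg Additive.toMul m.2.2⟩
    have he : Bijective e := by
      constructor
      · intro m m' h
        exact Subtype.ext (toIdeal_injective (congrArg (fun I => (I.1 : Ideal (𝓞 K))) h))
      · rintro ⟨⟨I, hI⟩, h1, h2⟩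
        obtain ⟨m, rfl⟩ := exists_toIdeal_eq (nonZeroDivisors.ne_zero hI)
        refine ⟨⟨m, ?_, congrArg Additive.ofMul h2⟩, rfl⟩
        rw [absNorm_toIdeal, ← exp_logNorm] at h1
        exact exp_le_exp.1 h1
    rw [← Nat.card_congr (Equiv.ofBijective e he), Nat.subtype_card
      ((normBall K x).filter fun m => idealClass m = g) (by simp), classCount, card_filter]
    push_cast
    refine sum_congr rfl fun m _ => ?_
    by_cases hm : idealClass m = g
    · rw [if_pos hm, ind_true hm]
    · rw [if_neg hm, ind_false hm]

lemma classCount_mono (g : AddClassGroup K) : Monotone (classCount g) := by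
  intro x y hxy
  refine sum_le_sum_of_subset_of_nonneg (fun m hm => ?_) fun m _ _ => ind_nonneg _
  rw [mem_normBall] at hm ⊢
  exact hm.trans hxy

lemma classSum_eq_integral {φ : ℝ → ℝ} (hφ : IsTest φ) (g : AddClassGroup K) (t : ℝ) :
    classSum g φ t = -∫ y, deriv φ y * classCount g (t + y) := by
  classical
  obtain ⟨R, -, hR⟩ := hφ.exists_radius
  have hd : ∀ y, R < |y| → deriv φ y = 0 := by
    intro y hy
    refine (EventuallyEq.deriv_eq (f := fun _ => 0) ?_).trans (deriv_const y 0)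
    filter_upwards [continuous_abs.continuousAt.eventually_const_lt hy] with z hz using hR z hz.le
  have hit : Integrable (deriv φ) :=
    (hφ.contDiff.continuous_deriv (by simp)).integrable_of_hasCompactSupport hφ.compact.deriv
  have h1 : ∀ u, φ u = -∫ y, (Set.Ici u).indicator (deriv φ) y := by
    intro u
    rw [integral_indicator measurableSet_Ici, integral_Ici_eq_integral_Ioi,
      hφ.compact.integral_Ioi_deriv_eq (hφ.contDiff.of_le (by simp)), neg_neg]
  rw [classSum_eq g hR le_rfl]
  simp_rw [h1, mul_neg, sum_neg_distrib, ← integral_const_mul]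
  rw [← integral_finsetSum]
  · congr 2 with y
    rw [classCount, mul_sum]
    rcases le_or_gt y R with hy | hy
    · rw [← sum_subset (s₁ := normBall K (t + y))]
      · refine sum_congr rfl fun m hm => ?_
        rw [mem_normBall] at hm
        rw [Set.indicator_of_mem (by rw [Set.mem_Ici]; linarith), mul_comm]
      · intro m hm
        rw [mem_normBall] at hm ⊢
        linarith
      · intro m _ hm
        rw [mem_normBall] at hm
        rw [Set.indicator_of_notMem (by rw [Set.mem_Ici]; intro h; apply hm; linarith), mul_zero]
    · have h0 := hd y (hy.trans_le (le_abs_self y))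
      simp [h0, Set.indicator_apply]
  · exact fun m _ => (hit.indicator measurableSet_Ici).const_mul _

lemma tendsto_classSum {φ : ℝ → ℝ} (hφ : IsTest φ) {g : AddClassGroup K} {κ : ℝ}
    (hκ : Tendsto (fun x => classCount g x * exp (-x)) atTop (nhds κ)) :
    Tendsto (fun t => classSum g φ t * exp (-t)) atTop
      (nhds (κ * ∫ y, φ y * exp y)) := by
  have hcd : Continuous (deriv φ) := hφ.contDiff.continuous_deriv (by simp)
  have hparts : ∫ y, φ y * exp y = -∫ y, deriv φ y * exp y := by
    have h0 := (hφ.continuous.mul Real.continuous_exp).integrable_of_hasCompactSupport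
      (μ := volume) hφ.compact.mul_right
    refine integral_mul_deriv_eq_deriv_mul_of_integrable
      (fun y _ => (hφ.contDiff.differentiable (by simp) y).hasDerivAt)
      (fun y _ => Real.hasDerivAt_exp y) h0 ?_ h0
    exact (hcd.mul Real.continuous_exp).integrable_of_hasCompactSupport hφ.compact.deriv.mul_right
  obtain ⟨R, hR⟩ := hφ.compact.deriv.exists_pos_le_norm
  obtain ⟨x₀, hx₀⟩ := eventually_atTop.1
    (hκ.abs.eventually_le_const (lt_add_one |κ|))
  have h : Tendsto (fun t => ∫ y, deriv φ y * exp y *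
      (classCount g (t + y) * exp (-(t + y)))) atTop
      (nhds (∫ y, deriv φ y * exp y * κ)) := by
    refine tendsto_integral_filter_of_dominated_convergence
      (fun y => |deriv φ y * exp y| * (|κ| + 1)) ?_ ?_ ?_ ?_
    · refine Eventually.of_forall fun t => Measurable.aestronglyMeasurable ?_
      exact (hcd.measurable.mul Real.measurable_exp).mul
        (((classCount_mono g).measurable.comp (measurable_const_add t)).mul (by fun_prop))
    · filter_upwards [eventually_ge_atTop (x₀ + R)] with t ht
      refine Eventually.of_forall fun y => ?_
      rw [norm_mul, Real.norm_eq_abs, Real.norm_eq_abs]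
      rcases le_or_gt R ‖y‖ with hy | hy
      · rw [hR.2 y hy]
        simp
      · refine mul_le_mul_of_nonneg_left (hx₀ _ ?_) (abs_nonneg _)
        have := neg_abs_le y
        rw [Real.norm_eq_abs] at hy
        linarith
    · exact ((hcd.mul Real.continuous_exp).integrable_of_hasCompactSupport
        hφ.compact.deriv.mul_right).abs.mul_const _
    · refine Eventually.of_forall fun y => Tendsto.const_mul _ ?_
      exact hκ.comp (tendsto_atTop_add_const_right _ y tendsto_id)
  rw [integral_mul_const, mul_comm] at h
  rw [hparts, mul_neg]
  refine h.neg.congr fun t => ?_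
  rw [classSum_eq_integral hφ, neg_mul, ← integral_mul_const]
  congr 2 with y
  rw [neg_add, exp_add, exp_neg y]
  field_simp

variable (K) in
theorem exists_smoothCount : ∃ κ : ℝ, 0 < κ ∧ SmoothCount K κ := by
  obtain ⟨κ, hκ0, hκ⟩ := exists_tendsto_classCount K
  refine ⟨κ, hκ0, fun φ hφ g => ?_⟩
  obtain ⟨c, C, hc⟩ := exists_classSum_asymptotic hφ g
  have h1 := tendsto_classSum hφ (hκ g)
  have h2 : Tendsto (fun t => classSum g φ t * exp (-t)) atTop (nhds c) := by
    rw [tendsto_iff_norm_sub_tendsto_zero]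
    have h3 := Real.tendsto_exp_neg_atTop_nhds_zero.const_mul C
    rw [mul_zero] at h3
    refine squeeze_zero (fun _ => norm_nonneg _) (fun t => ?_) h3
    have h4 : classSum g φ t * exp (-t) - c =
        (classSum g φ t - c * exp t) * exp (-t) := by
      rw [sub_mul, mul_assoc, ← exp_add, add_neg_cancel, exp_zero, mul_one]
    rw [h4, norm_mul, Real.norm_eq_abs, Real.norm_eq_abs, Real.abs_exp]
    exact mul_le_mul_of_nonneg_right (hc t) (exp_pos _).le
  rw [tendsto_nhds_unique h1 h2]
  exact ⟨C, hc⟩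

end ClassCount

section Forms

lemma exists_forall_notMem_fiber {d : Idx K → ℤ} (hd : d ≠ 0) :
    ∃ w : ℕ, ∀ p, w < p → p.Prime → ∀ v ∈ fiber (K := K) p, intEquiv K d ∉ v.asIdeal := by
  refine ⟨Ideal.absNorm (Ideal.span {intEquiv K d}), fun p hp hpp v hv hdv => hp.not_ge ?_⟩
  have h1 := (Ideal.span_singleton_le_iff_mem _).2 hdv (Ideal.absNorm_mem _)
  rw [← Int.cast_natCast, natCast_mem_iff hpp hv, Int.natCast_dvd_natCast] at h1
  refine Nat.le_of_dvd (Nat.pos_of_ne_zero fun h0 => ?_) h1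
  rw [Ideal.absNorm_eq_zero_iff, Ideal.span_singleton_eq_bot] at h0
  exact hd ((map_eq_zero_iff _ (intEquiv K).injective).1 h0)

lemma av_line_sieveSet_le {w p : ℕ} (hw : w < p) (hp : p.Prime) (b : Idx K → ℤ) {d : Idx K → ℤ}
    (hd : ∀ v ∈ fiber (K := K) p, intEquiv K d ∉ v.asIdeal) (ξ : Idx K → ZMod p) :
    (av fun t : ZMod p => ind (ξ + t • red p d ∈ sieveSet K (primorial w) b p)) ≤
      finrank ℤ (𝓞 K) / p := by
  have : Fact p.Prime := ⟨hp⟩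
  have h := av_line_nonunit_le (d := (primorial w : ℤ) • d) (fun v hv h => ?_)
    ((primorial w : ZMod p) • ξ + red p b)
  · refine le_trans (le_of_eq (av_congr fun t => ?_)) h
    refine congrArg (fun x => ind (x ∈ nonunitResidues K p)) (funext fun i => ?_)
    simp only [Pi.add_apply, Pi.smul_apply, smul_eq_mul, red]
    push_cast
    ring
  · rw [map_smul, zsmul_eq_mul] at h
    refine (v.isPrime.mem_or_mem h).elim (fun h => ?_) (hd v hv)
    rw [natCast_mem_iff hp hv, Int.natCast_dvd_natCast, hp.dvd_primorial_iff] at h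
    omega

/-- The normalized Selberg majorant of the `x` for which `W x + b` has no small prime factor. -/
noncomputable def primeMajorant (w R : ℕ) (b x : Idx K → ℤ) : ℝ :=
  sieveMajorant (sieveSet K (primorial w) b) w R x

lemma exists_nearOne_primeMajorant {D I : Type} [Fintype D] [DecidableEq D] [Fintype I]
    (A : I → Finset D) (u : I → D → Idx K → ℤ)
    (hu : ∀ a a', a ≠ a' → ∃ p : D × Bool, (if p.2 = decide (p.1 ∈ A a) then u a p.1 else 0) ≠
      (if p.2 = decide (p.1 ∈ A a') then u a' p.1 else 0)) {ε : ℝ} (hε : 0 < ε) :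
    ∃ w₀ N₀ : ℕ, ∀ w ≥ w₀, ∀ N ≥ N₀, ∀ [Fact N.Prime], ∀ R : ℕ, 1 ≤ R →
      R ^ (8 * Fintype.card I) ≤ N → ∀ b : Idx K → ℤ,
      NearOne (fun (a : I) (ω : (Idx K → ZMod N) × (D × Bool → ZMod N)) =>
        primeMajorant w R b (lift (ω.1 + ∑ d, sel ω.2 (A a) d • red N (u a d)))) univ ε := by
  classical
  set c : I → D × Bool → Idx K → ℤ := fun a p => if p.2 = decide (p.1 ∈ A a) then u a p.1 else 0
    with hc
  have hw : ∀ a a', ∃ w : ℕ, a ≠ a' → ∃ q, ∀ p, w < p → p.Prime →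
      ∀ v ∈ fiber (K := K) p, intEquiv K (c a' q - c a q) ∉ v.asIdeal := by
    intro a a'
    by_cases h : a = a'
    · exact ⟨0, fun h' => (h' h).elim⟩
    · obtain ⟨q, hq⟩ := hu a a' h
      obtain ⟨w, hw⟩ := exists_forall_notMem_fiber (sub_ne_zero.2 hq.symm)
      exact ⟨w, fun _ => ⟨q, hw⟩⟩
  choose w₁ hw₁ using hw
  obtain ⟨w₂, N₂, h⟩ := exists_nearOne_sieveMajorant c (finrank ℤ (𝓞 K)) hε
  refine ⟨max w₂ (univ.sup fun p : I × I => w₁ p.1 p.2), N₂,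
    fun w hw N hN _ R hR hRN b C hC => ?_⟩
  have h1 := h w ((le_max_left _ _).trans hw) N hN R hR hRN (sieveSet K (primorial w) b) ?_ ?_ C hC
  · refine (congrArg (fun x : ℝ => |x - 1|) (av_congr fun ω => prod_congr rfl fun a _ => ?_)).trans_le h1
    dsimp only [primeMajorant, affForm]
    rw [zero_add, Fintype.sum_prod_type]
    congr 3
    refine sum_congr rfl fun d _ => ?_
    have h0 : red N (0 : Idx K → ℤ) = 0 := funext fun _ => Int.cast_zero
    by_cases hd : d ∈ A a <;> simp [hc, sel, hd, h0]
  · intro p hp hpp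
    have : Fact p.Prime := ⟨hpp⟩
    have h2 : ¬ p ∣ primorial w := fun h2 => by
      rw [hpp.dvd_primorial_iff] at h2
      omega
    rw [av_sieveSet h2, unitDensity_eq, sub_sub_cancel]
    exact av_nonunit_le K p
  · intro p hp hpp a a' ha
    obtain ⟨q, hq⟩ := hw₁ a a' ha
    refine ⟨q, fun ξ => ?_⟩
    have h3 : w₁ a a' ≤ w := ((le_sup (f := fun p : I × I => w₁ p.1 p.2) (mem_univ (a, a'))).trans
      (le_max_right _ _)).trans hw
    have h4 : red p (c a' q) - red p (c a q) = red p (c a' q - c a q) :=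
      funext fun i => (Int.cast_sub _ _).symm
    rw [h4]
    exact av_line_sieveSet_le hp hpp b (hq p (h3.trans_lt hp) hpp) ξ

variable {J : Type} [Fintype J] [DecidableEq J] {s : J → Idx K → ℤ}

lemma exists_linForms_primeMajorant (hs : Injective s) {ε : ℝ} (hε : 0 < ε) :
    ∃ w₀ N₀ : ℕ, ∀ w ≥ w₀, ∀ N ≥ N₀, ∀ [Fact N.Prime], ∀ R : ℕ, 1 ≤ R →
      R ^ (8 * #(cubePairs J)) ≤ N → ∀ b : Idx K → ℤ,
      LinForms (fun j (z : Idx K → ZMod N) (y : J → ZMod N) =>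
        primeMajorant w R b (lift (configForm (fun j => red N (s j)) j z y))) ε := by
  have hu : ∀ a a' : {p // p ∈ cubePairs J}, a ≠ a' → ∃ q : J × Bool,
      (if q.2 = decide (q.1 ∈ a.1.2) then s q.1 - s a.1.1 else 0) ≠
        (if q.2 = decide (q.1 ∈ a'.1.2) then s q.1 - s a'.1.1 else 0) := by
    rintro ⟨⟨j, A⟩, h⟩ ⟨⟨j', A'⟩, h'⟩ hne
    simp only [cubePairs, mem_sigma, mem_univ, true_and, mem_powerset, subset_erase] at h h'
    dsimp only
    by_cases hj : j = j'
    · subst hj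
      have hA : A ≠ A' := by
        rintro rfl
        exact hne rfl
      obtain ⟨i, hi⟩ : ∃ i, ¬ (i ∈ A ↔ i ∈ A') := by
        by_contra! h0
        exact hA (ext h0)
      refine ⟨(i, true), ?_⟩
      have hij : s i - s j ≠ 0 := by
        rw [sub_ne_zero]
        refine fun hij => hi ?_
        rw [hs hij]
        exact iff_of_false h.2 h'.2
      by_cases h1 : i ∈ A <;> by_cases h2 : i ∈ A'
      · exact (hi (iff_of_true h1 h2)).elim
      · simpa [h1, h2] using hij
      · simpa [h1, h2] using hij.symm
      · exact (hi (iff_of_false h1 h2)).elim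
    · refine ⟨(j, decide (j ∈ A')), ?_⟩
      rw [if_pos rfl, sub_self, ite_self]
      exact fun h0 => hj (hs (sub_eq_zero.1 h0.symm))
  obtain ⟨w₀, N₀, h⟩ := exists_nearOne_primeMajorant
    (fun p : {p // p ∈ cubePairs J} => p.1.2) (fun p i => s i - s p.1.1) hu hε
  refine ⟨w₀, N₀, fun w hw N hN _ R hR hRN b C hC => ?_⟩
  have h1 := h w hw N hN R hR (by rwa [Fintype.card_coe]) b (C.subtype (· ∈ cubePairs J))
    (subset_univ _)
  convert h1 using 5 with ω
  refine Eq.trans (prod_congr rfl fun p _ => ?_) (prod_subtype_of_mem (fun p : Σ _ : J, Finset J =>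
    primeMajorant w R b (lift (ω.1 + ∑ d, sel ω.2 p.2 d • red N (s d - s p.1))))
    fun p hp => hC hp).symm
  dsimp only [configForm]
  congr 3
  refine sum_congr rfl fun i _ => ?_
  congr 1
  exact funext fun i => (Int.cast_sub _ _).symm

lemma exists_nearOne_primeMajorant_powerset {D : Type} [Fintype D] [DecidableEq D]
    {v : D → Idx K → ℤ} (hv : ∀ d, v d ≠ 0) {ε : ℝ} (hε : 0 < ε) :
    ∃ w₀ N₀ : ℕ, ∀ w ≥ w₀, ∀ N ≥ N₀, ∀ [Fact N.Prime], ∀ R : ℕ, 1 ≤ R →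
      R ^ (8 * Fintype.card (Finset D)) ≤ N → ∀ b : Idx K → ℤ,
      NearOne (fun (A : Finset D) (ω : (Idx K → ZMod N) × (D × Bool → ZMod N)) =>
        primeMajorant w R b (lift (ω.1 + ∑ d, sel ω.2 A d • red N (v d)))) univ ε := by
  refine exists_nearOne_primeMajorant (fun A : Finset D => A) (fun _ => v) (fun A A' hA => ?_) hε
  obtain ⟨i, hi⟩ : ∃ i, ¬ (i ∈ A ↔ i ∈ A') := by
    by_contra! h0
    exact hA (ext h0)
  refine ⟨(i, true), ?_⟩
  by_cases h1 : i ∈ A <;> by_cases h2 : i ∈ A'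
  · exact (hi (iff_of_true h1 h2)).elim
  · simpa [h1, h2] using hv i
  · simpa [h1, h2] using (hv i).symm
  · exact (hi (iff_of_false h1 h2)).elim

end Forms

section PrimeElements

variable (K)

lemma finrank_int_pos : 0 < finrank ℤ (𝓞 K) := by
  rw [RingOfIntegers.rank]
  exact Module.finrank_pos

open scoped Classical in
lemma exists_abs_coord_le : ∃ C : ℝ, 0 < C ∧ ∀ (x : Idx K → ℤ) (i : Idx K),
    |(x i : ℝ)| ≤ C * ‖mixedEmbedding K (intEquiv K x : K)‖ := by
  set β := RingOfIntegers.basis K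
  set φ := fun k => LinearMap.toContinuousLinearMap ((mixedEmbedding.latticeBasis K).coord k)
  set a := fun k i => |((intEquiv K).symm (β k) i : ℝ)|
  have ha : ∀ k i, 0 ≤ a k i := fun _ _ => abs_nonneg _
  refine ⟨1 + ∑ i, ∑ k, ‖φ k‖ * a k i, ?_, fun x i => ?_⟩
  · have : 0 ≤ ∑ i, ∑ k, ‖φ k‖ * a k i :=
      sum_nonneg fun i _ => sum_nonneg fun k _ => mul_nonneg (norm_nonneg _) (ha k i)
    linarith
  set α := intEquiv K x
  have h1 : ∀ k, φ k (mixedEmbedding K (α : K)) = (β.repr α k : ℝ) := fun k => by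
    have h := mixedEmbedding.latticeBasis_repr_apply K (α : K) k
    rw [integralBasis_repr_apply] at h
    refine h.trans ?_
    simp [β]
  have h2 : x i = ∑ k, β.repr α k * (intEquiv K).symm (β k) i := by
    have h : (intEquiv K).symm α = ∑ k, β.repr α k • (intEquiv K).symm (β k) := by
      conv_lhs => rw [← β.sum_repr α, map_sum]
      simp_rw [map_smul]
    rw [LinearEquiv.symm_apply_apply] at h
    rw [h]
    simp
  rw [h2]
  push_cast
  have h3 : ∑ k, ‖φ k‖ * a k i ≤ 1 + ∑ i, ∑ k, ‖φ k‖ * a k i := by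
    have := single_le_sum (f := fun i => ∑ k, ‖φ k‖ * a k i)
      (fun i _ => sum_nonneg fun k _ => mul_nonneg (norm_nonneg _) (ha k i)) (mem_univ i)
    linarith
  refine le_trans ?_ (mul_le_mul_of_nonneg_right h3 (norm_nonneg _))
  rw [sum_mul]
  refine (abs_sum_le_sum_abs _ _).trans (sum_le_sum fun k _ => ?_)
  rw [abs_mul, ← h1, mul_right_comm, ← Real.norm_eq_abs]
  exact mul_le_mul_of_nonneg_right ((φ k).le_opNorm _) (ha k i)

open scoped Classical in
/-- There are many prime elements with small coordinates. -/
theorem exists_prime_elements : ∃ C c Y₀ : ℝ, 0 < C ∧ 0 < c ∧ ∀ Y, Y₀ ≤ Y →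
    ∃ Q : Finset (PrimeIdeal K), (∀ v ∈ Q, Y ^ finrank ℤ (𝓞 K) < pNorm v ∧
      ∃ x : Idx K → ℤ, Ideal.span {intEquiv K x} = v.asIdeal ∧ ∀ i, |(x i : ℝ)| ≤ C * Y) ∧
    c * Y ^ finrank ℤ (𝓞 K) / log Y ≤ #Q := by
  obtain ⟨κ, hκ0, hκ⟩ := exists_smoothCount K
  obtain ⟨A, c, X₀, hA, hc, hQ⟩ := hκ.exists_principal_primes hκ0
  obtain ⟨C, hC, hcoord⟩ := exists_abs_coord_le K
  obtain ⟨R, hR, hunit⟩ := exists_unit_smul_norm_le K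
  set n := finrank ℤ (𝓞 K) with hn
  have hn0 : n ≠ 0 := (finrank_int_pos K).ne'
  refine ⟨C * (R * A), c / n, max 1 X₀, by positivity, by positivity, fun Y hY => ?_⟩
  have hY1 : 1 ≤ Y := (le_max_left _ _).trans hY
  have hYn : Y ≤ Y ^ n := le_self_pow₀ hY1 hn0
  obtain ⟨Q, hQ1, hQ2⟩ := hQ (Y ^ n) (((le_max_right _ _).trans hY).trans hYn)
  refine ⟨Q, fun v hv => ⟨(hQ1 v hv).2.1, ?_⟩, ?_⟩
  · obtain ⟨x, hx0, hx⟩ := exists_span_eq_toIdeal (K := K) (hQ1 v hv).1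
    have hnorm := norm_mixedEmbedding_eq hx
    obtain ⟨u, hu⟩ := hunit (mixedEmbedding K (x : K)) (by rw [hnorm]; positivity)
    refine ⟨(intEquiv K).symm ((u : 𝓞 K) * x), ?_, fun i => ?_⟩
    · rw [LinearEquiv.apply_symm_apply, Ideal.span_singleton_mul_left_unit u.isUnit, hx,
        toIdeal_single, pow_one]
    · refine (hcoord _ i).trans ?_
      rw [LinearEquiv.apply_symm_apply, mul_assoc, mul_assoc]
      refine mul_le_mul_of_nonneg_left ?_ hC.le
      rw [RingOfIntegers.coe_eq_algebraMap, map_mul, map_mul]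
      refine hu (A * Y) (by positivity) ?_
      rw [hnorm, exp_logNorm, ← absNorm_toIdeal, toIdeal_single, pow_one, ← RingOfIntegers.rank,
        ← hn, mul_pow]
      refine (hQ1 v hv).2.2.trans ?_
      gcongr
      exact le_self_pow₀ hA.le hn0
  · refine le_trans (le_of_eq ?_) hQ2
    rw [log_pow, div_mul_eq_mul_div, div_div]

variable {K}

lemma pNorm_le_pow {m : ℕ} (hm : m ≠ 0) {v : PrimeIdeal K} (h : (m : 𝓞 K) ∈ v.asIdeal) :
    pNorm v ≤ (m : ℝ) ^ finrank ℤ (𝓞 K) := by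
  have h1 := Ideal.absNorm_dvd_absNorm_of_le ((Ideal.span_singleton_le_iff_mem _).2 h)
  rw [Ideal.absNorm_span_natCast] at h1
  rw [pNorm]
  exact_mod_cast Nat.le_of_dvd (by positivity) h1

lemma eq_of_mem_of_span_eq {v v' : PrimeIdeal K} {x : 𝓞 K} (hx : Ideal.span {x} = v.asIdeal)
    (h : x ∈ v'.asIdeal) : v = v' :=
  HeightOneSpectrum.ext (v.isMaximal.eq_of_le v'.isPrime.ne_top
    (hx ▸ (Ideal.span_singleton_le_iff_mem _).2 h))

/-- The residues `z` for which `W z + b` is a prime element of norm more than `H`, where `z` is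
lifted to a vector with coordinates at most `L`. -/
def PrimePoint (W : ℕ) (b : Idx K → ℤ) {N : ℕ} (L H : ℝ) (z : Idx K → ZMod N) : Prop :=
  (∀ i, |(lift z i : ℝ)| ≤ L) ∧ ∃ v : PrimeIdeal K,
    Ideal.span {intEquiv K ((W : ℤ) • lift z + b)} = v.asIdeal ∧ H < pNorm v

/-- Some residue class modulo `W` contains its fair share of the given prime elements. -/
lemma exists_card_le_av_primePoint {W N : ℕ} (hW : W ≠ 0) {L H B : ℝ} (hWH : (W : ℝ) ^ finrank ℤ (𝓞 K) ≤ H)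
    (hB : B / W + 1 ≤ L) (hL : 2 * L < N) {Q : Finset (PrimeIdeal K)}
    (hQ : ∀ v ∈ Q, H < pNorm v ∧ ∃ x : Idx K → ℤ, Ideal.span {intEquiv K x} = v.asIdeal ∧
      ∀ i, |(x i : ℝ)| ≤ B) (hQ0 : Q.Nonempty) :
    ∃ b : Idx K → ℤ, (#Q : ℝ) ≤ unitDensity K W * (W * N : ℝ) ^ finrank ℤ (𝓞 K) *
      av fun z : Idx K → ZMod N => ind (PrimePoint W b L H z) := by
  classical
  have : NeZero W := ⟨hW⟩
  have hW0 : (0 : ℝ) < W := by exact_mod_cast Nat.pos_of_ne_zero hW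
  choose! hH x hx hxB using hQ
  obtain ⟨v₀, hv₀⟩ := hQ0
  have hBL : 2 * (B / W + 1) < N := by linarith
  have hN0 : (0 : ℝ) < N := by
    have : 0 ≤ B := (abs_nonneg _).trans (hxB v₀ hv₀ ⟨0, finrank_int_pos K⟩)
    have : 0 ≤ B / W := by positivity
    linarith
  have : NeZero N := ⟨by exact_mod_cast hN0.ne'⟩
  set U : Finset (Idx K → ZMod W) := {r | r ∉ nonunitResidues K W} with hU
  have hUc : (#U : ℝ) = (W : ℝ) ^ finrank ℤ (𝓞 K) * unitDensity K W := by
    have h := card_mul_av fun r : Idx K → ZMod W => ind (r ∉ nonunitResidues K W)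
    simp only [Fintype.card_fun, ZMod.card, Fintype.card_fin, Nat.cast_pow] at h
    rw [unitDensity, h, hU, card_filter]
    push_cast
    refine sum_congr rfl fun r _ => ?_
    by_cases h : r ∉ nonunitResidues K W
    · rw [ind_true h, if_pos h]
    · rw [ind_false h, if_neg h]
  have hmaps : ∀ v ∈ Q, red W (x v) ∈ U := fun v hv => by
    rw [hU, mem_filter]
    refine ⟨mem_univ _, fun h => ?_⟩
    obtain ⟨v', hv', hxv'⟩ := red_mem_nonunitResidues.1 h
    rw [← eq_of_mem_of_span_eq (hx v hv) hxv'] at hv'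
    exact ((pNorm_le_pow hW hv').trans hWH).not_gt (hH v hv)
  have hU0 : U.Nonempty := ⟨_, hmaps v₀ hv₀⟩
  have hUp : (0 : ℝ) < #U := by exact_mod_cast hU0.card_pos
  obtain ⟨r, -, hr⟩ := exists_le_card_fiber_of_nsmul_le_card_of_maps_to (M := ℝ) (b := #Q / #U)
    hmaps hU0 (by rw [nsmul_eq_mul, mul_div_cancel₀ _ hUp.ne'])
  have hbW : ∀ i, |lift r i| ≤ (W : ℤ) := fun i => by
    have := ZMod.natAbs_valMinAbs_le (r i)
    rw [lift, Int.abs_eq_natAbs]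
    omega
  set y : PrimeIdeal K → Idx K → ℤ := fun v i => (x v i - lift r i) / W with hy
  have hy1 : ∀ v, red W (x v) = r → (W : ℤ) • y v + lift r = x v := fun v hv => by
    funext i
    have h1 : (W : ℤ) ∣ x v i - lift r i := by
      rw [← ZMod.intCast_eq_intCast_iff_dvd_sub]
      exact (congrFun (red_lift r) i).trans (congrFun hv i).symm
    simp only [Pi.add_apply, Pi.smul_apply, smul_eq_mul, hy, Int.mul_ediv_cancel' h1]
    ring
  have hy2 : ∀ v ∈ Q, red W (x v) = r → ∀ i, |(y v i : ℝ)| ≤ B / W + 1 := fun v hv hvr i => by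
    have h1 : (W : ℝ) * y v i = x v i - lift r i := by
      have := congrFun (hy1 v hvr) i
      simp only [Pi.add_apply, Pi.smul_apply, smul_eq_mul] at this
      rw [← this]
      push_cast
      ring
    have h2 : |(lift r i : ℝ)| ≤ W := by exact_mod_cast hbW i
    have h3 : (W : ℝ) * |(y v i : ℝ)| ≤ B + W := by
      rw [← abs_of_pos hW0, ← abs_mul, h1, abs_of_pos hW0]
      exact (abs_sub _ _).trans (add_le_add (hxB v hv i) h2)
    rw [div_add_one hW0.ne', le_div_iff₀ hW0]
    linarith
  have hlift : ∀ v ∈ Q, red W (x v) = r → lift (red N (y v)) = y v := fun v hv hvr => by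
    funext i
    have h1 : |2 * (y v i : ℝ)| < N := by
      rw [abs_mul, abs_two]
      linarith [hy2 v hv hvr i]
    rw [abs_lt] at h1
    refine (ZMod.valMinAbs_spec _ _).2 ⟨rfl, ?_⟩
    have h2 : -(N : ℤ) < 2 * y v i ∧ 2 * y v i < N := by exact_mod_cast h1
    rw [Set.mem_Ioc]
    omega
  refine ⟨lift r, ?_⟩
  have h1 : #{v ∈ Q | red W (x v) = r} ≤
      #{z : Idx K → ZMod N | PrimePoint W (lift r) L H z} := by
    refine card_le_card_of_injOn (fun v => red N (y v)) (fun v hv => ?_) fun v hv v' hv' h => ?_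
    · obtain ⟨hv, hvr⟩ := mem_filter.1 hv
      refine mem_filter.2 ⟨mem_univ _, fun i => ?_, v, ?_, hH v hv⟩
      · rw [hlift v hv hvr]
        exact (hy2 v hv hvr i).trans hB
      · rw [hlift v hv hvr, hy1 v hvr, hx v hv]
    · obtain ⟨hv, hvr⟩ := mem_filter.1 hv
      obtain ⟨hv', hvr'⟩ := mem_filter.1 hv'
      have h2 := congrArg lift h
      simp only [hlift v hv hvr, hlift v' hv' hvr'] at h2
      refine HeightOneSpectrum.ext ?_
      rw [← hx v hv, ← hx v' hv', ← hy1 v hvr, ← hy1 v' hvr', h2]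
  have h2 : (N : ℝ) ^ finrank ℤ (𝓞 K) * (av fun z : Idx K → ZMod N =>
      ind (PrimePoint W (lift r) L H z)) =
        #{z : Idx K → ZMod N | PrimePoint W (lift r) L H z} := by
    have h := card_mul_av fun z : Idx K → ZMod N => ind (PrimePoint W (lift r) L H z)
    simp only [Fintype.card_fun, ZMod.card, Fintype.card_fin, Nat.cast_pow] at h
    rw [h, card_filter]
    push_cast
    refine sum_congr rfl fun z _ => ?_
    by_cases h : PrimePoint W (lift r) L H z
    · rw [ind_true h, if_pos h]
    · rw [ind_false h, if_neg h]
  calc (#Q : ℝ) ≤ #U * #{v ∈ Q | red W (x v) = r} := by rwa [← div_le_iff₀' hUp]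
    _ ≤ #U * #{z : Idx K → ZMod N | PrimePoint W (lift r) L H z} := by gcongr
    _ = _ := by
      rw [← h2, hUc, mul_pow]
      ring

end PrimeElements

section Density

/-- The value of `primeMajorant` at the points without small prime factors. -/
noncomputable def primeMass (w R : ℕ) (b : Idx K → ℤ) : ℝ :=
  sieveMass (fun p : SievePrime w R => sieveSet K (primorial w) b p) (levels w R)

lemma av_sieveSet_le_half {w R : ℕ} (hw : 2 * finrank ℤ (𝓞 K) ≤ w) (b : Idx K → ℤ)
    (p : SievePrime w R) : (av fun x => ind (x ∈ sieveSet K (primorial w) b p)) ≤ 1 / 2 := by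
  have hp : p.1.Prime := Fact.out
  have hwp : w < p.1 := (mem_Ioc.1 (mem_filter.1 p.2).1).1
  have h : ¬ p.1 ∣ primorial w := by
    rw [hp.dvd_primorial_iff]
    omega
  rw [av_sieveSet h, unitDensity_eq, sub_sub_cancel]
  refine (av_nonunit_le K p.1).trans ?_
  have h2 : (2 * finrank ℤ (𝓞 K) : ℝ) ≤ p.1 := by exact_mod_cast hw.trans hwp.le
  rw [div_le_div_iff₀ (by exact_mod_cast hp.pos) two_pos]
  linarith

lemma primeMass_nonneg {w : ℕ} (hw : 2 * finrank ℤ (𝓞 K) ≤ w) (R : ℕ) (b : Idx K → ℤ) :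
    0 ≤ primeMass w R b := by
  rw [primeMass, sieveMass]
  exact sum_nonneg fun _ _ => prod_nonneg fun p _ => selbergWt_nonneg (av_sieveSet_le_half hw b p)

lemma primeMass_le {w : ℕ} (hw : 2 * finrank ℤ (𝓞 K) ≤ w) (R : ℕ) (b : Idx K → ℤ) :
    primeMass w R b ≤ R := by
  rw [primeMass, sieveMass]
  refine (sum_le_card_nsmul _ _ 1 fun _ _ => prod_le_one
    (fun p _ => selbergWt_nonneg (av_sieveSet_le_half hw b p)) fun p _ =>
      (selbergWt_le (av_sieveSet_le_half hw b p) le_rfl).trans (by norm_num)).trans ?_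
  rw [nsmul_one]
  exact_mod_cast card_levels_le w R

lemma primeMajorant_nonneg {w : ℕ} (hw : 2 * finrank ℤ (𝓞 K) ≤ w) (R : ℕ)
    (b x : Idx K → ℤ) : 0 ≤ primeMajorant w R b x :=
  div_nonneg (sq_nonneg _) (primeMass_nonneg hw R b)

variable (K) in
lemma exists_le_primeMass : ∃ c x₀ : ℝ, 0 < c ∧ ∀ (w R : ℕ) (b : Idx K → ℤ), 0 < R →
    x₀ ≤ log R → unitDensity K (primorial w) * (c * log R) ≤ primeMass w R b := by
  obtain ⟨κ, hκ0, hκ⟩ := exists_smoothCount K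
  obtain ⟨c, x₀, hc, h⟩ := hκ.exists_le_sum_exp hκ0
  refine ⟨c, x₀, hc, fun w R b hR hx => ?_⟩
  have h0 : 0 < unitDensity K (primorial w) := by
    rw [unitDensity_primorial]
    refine prod_pos fun p hp => ?_
    have : Fact p.Prime := ⟨(mem_filter.1 hp).2⟩
    exact unitDensity_pos K p
  have h1 := sum_inv_norm_le_sieveMass w R b (normBall K (log R)) fun m hm => by
    rw [← exp_logNorm, ← exp_log (Nat.cast_pos (α := ℝ).2 hR)]
    exact exp_le_exp.2 (mem_normBall.1 hm)
  rw [inv_mul_eq_div, le_div_iff₀' h0] at h1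
  refine le_trans (mul_le_mul_of_nonneg_left ((h _ hx).trans (le_of_eq ?_)) h0.le) h1
  exact sum_congr rfl fun m _ => by rw [exp_neg, exp_logNorm]

lemma PrimePoint.primeMajorant_eq {w R N : ℕ} {b : Idx K → ℤ} {L H : ℝ}
    (hH : (R : ℝ) ^ finrank ℤ (𝓞 K) ≤ H) {z : Idx K → ZMod N}
    (hz : PrimePoint (primorial w) b L H z) (h0 : primeMass w R b ≠ 0) :
    primeMajorant w R b (lift z) = primeMass w R b := by
  refine majorant_of_notMem (fun r _ p _ hp => ?_) h0
  obtain ⟨-, v, hv, hHv⟩ := hz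
  have h1 : red p.1 ((primorial w : ℤ) • lift z + b) ∈ nonunitResidues K p := by
    have e : red p.1 ((primorial w : ℤ) • lift z + b) =
        (primorial w : ZMod p.1) • red p.1 (lift z) + red p.1 b := funext fun i => by simp [red]
    rw [e]
    exact hp
  obtain ⟨v', hpv, hv'⟩ := red_mem_nonunitResidues.1 h1
  rw [← eq_of_mem_of_span_eq hv hv'] at hpv
  have hp' := mem_filter.1 p.2
  have h2 : (p.1 : ℝ) ≤ R := by exact_mod_cast (mem_Ioc.1 hp'.1).2
  refine hHv.not_ge ((pNorm_le_pow hp'.2.ne_zero hpv).trans (le_trans ?_ hH))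
  gcongr

variable (K) in
/-- The weighted density of the prime points is bounded below. -/
theorem exists_le_av_primePoint (D M : ℕ) (hD : 2 ≤ D) : ∃ δ : ℝ, 0 < δ ∧ ∀ w, ∃ R₀ : ℕ, ∀ R ≥ R₀, ∀ N : ℕ,
    R ^ D < N → N ≤ 2 * R ^ D → ∃ b : Idx K → ℤ, 0 < primeMass w R b ∧
      δ ≤ primeMass w R b * av fun z : Idx K → ZMod N =>
        ind (PrimePoint (primorial w) b (N / (4 * M + 4)) ((R : ℝ) ^ finrank ℤ (𝓞 K)) z) := by
  obtain ⟨c₁, x₀, hc₁, hmass⟩ := exists_le_primeMass K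
  obtain ⟨C, c, Y₀, hC, hc, hprimes⟩ := exists_prime_elements K
  set n := finrank ℤ (𝓞 K) with hn
  set η : ℝ := (C * (8 * M + 8) + 1)⁻¹ with hη
  have hη0 : 0 < η := by positivity
  have hη1 : η ≤ 1 := inv_le_one_of_one_le₀ (le_add_of_nonneg_left (by positivity))
  have hCη : C * η ≤ 1 / (8 * M + 8) := by
    rw [hη, ← div_eq_mul_inv, div_le_div_iff₀ (by positivity) (by positivity)]
    linarith
  refine ⟨c₁ * c * η ^ n / (2 * (D + 1)), by positivity, fun w => ?_⟩
  set W := primorial w with hW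
  have hW0 : W ≠ 0 := (primorial_pos w).ne'
  have hW1 : (1 : ℝ) ≤ W := by exact_mod_cast Nat.one_le_iff_ne_zero.2 hW0
  refine ⟨2 + ⌈exp x₀⌉₊ + ⌈Y₀⌉₊ + ⌈η⁻¹⌉₊ + W + (8 * M + 8), fun R hR N hRN hNR => ?_⟩
  have hR' : 2 + ⌈exp x₀⌉₊ + ⌈Y₀⌉₊ + ⌈η⁻¹⌉₊ + W + (8 * M + 8) ≤ (R : ℝ) := by
    exact_mod_cast hR
  have e1 := Nat.le_ceil (exp x₀)
  have e2 := Nat.le_ceil Y₀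
  have e3 := Nat.le_ceil η⁻¹
  have p1 := (Nat.cast_nonneg ⌈exp x₀⌉₊ : (0 : ℝ) ≤ _)
  have p2 := (Nat.cast_nonneg ⌈Y₀⌉₊ : (0 : ℝ) ≤ _)
  have p3 := (Nat.cast_nonneg ⌈η⁻¹⌉₊ : (0 : ℝ) ≤ _)
  have p4 := (Nat.cast_nonneg M : (0 : ℝ) ≤ _)
  have hR2 : (2 : ℝ) ≤ R := by linarith
  have hN : (R : ℝ) ^ D < N := by exact_mod_cast hRN
  have hN' : (N : ℝ) ≤ 2 * R ^ D := by exact_mod_cast hNR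
  have hRR : (R : ℝ) * R ≤ N := by
    rw [← sq]
    exact (pow_le_pow_right₀ (by linarith) hD).trans hN.le
  have hRleN : (R : ℝ) ≤ N := (le_mul_of_one_le_left (by linarith) (by linarith)).trans hRR
  have hN0 : (0 : ℝ) < N := by linarith
  have hηN : (R : ℝ) ≤ η * N := by
    have : 1 ≤ η * R := by
      rw [← mul_inv_cancel₀ hη0.ne']
      gcongr
      linarith
    calc (R : ℝ) ≤ η * R * R := le_mul_of_one_le_left (by linarith) this
      _ = η * (R * R) := by ring
      _ ≤ η * N := by gcongr
  set Y : ℝ := η * (W * N) with hY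
  have hYR : R ≤ Y := hηN.trans (by rw [hY]; gcongr; exact le_mul_of_one_le_left hN0.le hW1)
  have hYN : Y ≤ N ^ 2 := by
    have h1 : (W : ℝ) ≤ N := by linarith
    calc Y ≤ 1 * (N * N) := by rw [hY]; gcongr
      _ = N ^ 2 := by ring
  obtain ⟨Q, hQ, hQc⟩ := hprimes Y (by linarith)
  have hlogY : 0 < log Y := log_pos (by linarith)
  have hlogR : 0 < log R := log_pos (by linarith)
  have hlog : log Y ≤ 2 * ((D + 1) * log R) := by
    have h1 := log_le_log (by linarith) hYN
    have h2 : log N ≤ log (R ^ (D + 1)) := log_le_log hN0 (hN'.trans (by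
      rw [pow_succ']; gcongr))
    rw [log_pow] at h1 h2
    push_cast at h1 h2
    linarith
  have hQ0 : (0 : ℝ) < #Q := lt_of_lt_of_le (by positivity) hQc
  have hL : C * Y / W + 1 ≤ N / (4 * M + 4) := by
    have h1 : C * Y / W = C * η * N := by
      rw [hY]
      field_simp
    have h2 : C * η * N ≤ 1 / (8 * M + 8) * N := by gcongr
    have h3 : 1 ≤ 1 / (8 * M + 8) * (N : ℝ) := by
      rw [one_div_mul_eq_div, one_le_div (by positivity)]
      linarith
    have h4 : (N : ℝ) / (4 * M + 4) = 1 / (8 * M + 8) * N + 1 / (8 * M + 8) * N := by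
      field_simp
      ring
    linarith
  have hLN : 2 * ((N : ℝ) / (4 * M + 4)) < N := by
    rw [mul_div_assoc', div_lt_iff₀ (by positivity)]
    linarith [mul_nonneg hN0.le p4]
  have hQ' : ∀ v ∈ Q, (R : ℝ) ^ n < pNorm v ∧ ∃ x : Idx K → ℤ,
      Ideal.span {intEquiv K x} = v.asIdeal ∧ ∀ i, |(x i : ℝ)| ≤ C * Y := fun v hv =>
    ⟨lt_of_le_of_lt (by gcongr) (hQ v hv).1, (hQ v hv).2⟩
  obtain ⟨b, hb⟩ := exists_card_le_av_primePoint (N := N) hW0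
    (by rw [← hn]; gcongr; linarith) hL hLN hQ' (card_pos.1 (by exact_mod_cast hQ0))
  have : NeZero N := ⟨by exact_mod_cast hN0.ne'⟩
  have : NeZero W := ⟨hW0⟩
  have hm := hmass w R b (by exact_mod_cast (by linarith : (0 : ℝ) < R)) ?_
  · set α := av fun z : Idx K → ZMod N => ind (PrimePoint W b (N / (4 * M + 4)) ((R : ℝ) ^ n) z)
    have hα : 0 ≤ α := av_nonneg fun _ => ind_nonneg _
    have hu : 0 < unitDensity K W := by
      refine lt_of_le_of_ne (av_nonneg fun _ => ind_nonneg _) fun h0 => ?_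
      rw [← h0, zero_mul, zero_mul] at hb
      linarith
    refine ⟨b, lt_of_lt_of_le (by positivity) hm, le_trans ?_ (mul_le_mul_of_nonneg_right hm hα)⟩
    have h3 : c * Y ^ n / (2 * ((D + 1) * log R)) ≤ unitDensity K W * (W * N : ℝ) ^ n * α := by
      refine le_trans ?_ (hQc.trans hb)
      gcongr
    have h4 : (0 : ℝ) < (W * N : ℝ) ^ n := by positivity
    rw [hY, mul_pow, div_le_iff₀ (by positivity)] at h3
    rw [div_le_iff₀ (by positivity)]
    refine le_of_mul_le_mul_right ?_ h4
    calc _ = c₁ * (c * (η ^ n * (W * N : ℝ) ^ n)) := by ring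
      _ ≤ c₁ * (unitDensity K W * (W * N : ℝ) ^ n * α * (2 * ((D + 1) * log R))) := by gcongr
      _ = _ := by ring
  · rw [← exp_le_exp, exp_log (by linarith)]
    linarith

end Density

section Progressions

theorem exists_primePoint_progression {J : Type} [Fintype J] [DecidableEq J] [Nonempty J]
    {s : J → Idx K → ℤ} (hs : Injective s) (M : ℕ) :
    ∃ (W N : ℕ) (b : Idx K → ℤ) (H : ℝ), W ≠ 0 ∧ N ≠ 0 ∧ ∃ (z : Idx K → ZMod N) (k : ZMod N),
      k ≠ 0 ∧ ∀ j, PrimePoint W b (N / (4 * M + 4)) H (z + k • red N (s j)) := by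
  set n := finrank ℤ (𝓞 K) with hn
  set D := 2 + 8 * #(cubePairs J) + 8 * Fintype.card (Finset (J × J)) + (Fintype.card J + 1)
    with hD
  set v : J × J → Idx K → ℤ := fun d => if d.1 = d.2 then 1 else s d.1 - s d.2 with hv
  have hv0 : ∀ d, v d ≠ 0 := fun d h0 => by
    simp only [hv] at h0
    split_ifs at h0 with h
    · exact one_ne_zero (congrFun h0 ⟨0, finrank_int_pos K⟩)
    · exact h (hs (sub_eq_zero.1 h0))
  obtain ⟨δ, hδ, hdens⟩ := exists_le_av_primePoint K D M (by omega)
  obtain ⟨c, hc, ε, hε, N₀, hSz⟩ := relative_szemeredi J hδ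
  obtain ⟨w₁, N₁, h₁⟩ := exists_linForms_primeMajorant hs hε
  obtain ⟨w₂, N₂, h₂⟩ := exists_nearOne_primeMajorant_powerset hv0 hε
  set w := 2 * n + w₁ + w₂
  obtain ⟨R₀, hR₀⟩ := hdens w
  set R := R₀ + N₀ + N₁ + N₂ + ⌈c⁻¹⌉₊ + 2 with hR
  have hRpos : 1 ≤ R := by omega
  obtain ⟨N, hN, hRN, hN2⟩ := Nat.exists_prime_lt_and_le_two_mul (R ^ D) (by positivity)
  have : Fact N.Prime := ⟨hN⟩
  have hRD : ∀ m ≤ D, R ^ m ≤ N := fun m hm => (Nat.pow_le_pow_right hRpos hm).trans hRN.le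
  have hRleN : R ≤ N := by simpa using hRD 1 (by omega)
  obtain ⟨b, hm0, hb⟩ := hR₀ R (by omega) N hRN hN2
  set H : ℝ := (R : ℝ) ^ n
  set P : (Idx K → ZMod N) → Prop := PrimePoint (primorial w) b (N / (4 * M + 4)) H
  refine ⟨primorial w, N, b, H, (primorial_pos w).ne', hN.ne_zero, ?_⟩
  by_contra! hcon
  have hw : 2 * n ≤ w := by omega
  set f : (Idx K → ZMod N) → ℝ := fun z => primeMass w R b * ind (P z) with hf
  have hf0 : ∀ z, 0 ≤ f z := fun z => mul_nonneg hm0.le (ind_nonneg _)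
  have hfR : ∀ z, f z ≤ R := fun z =>
    (mul_le_of_le_one_right hm0.le (ind_le_one _)).trans (primeMass_le hw R b)
  have hmain := hSz (ZMod N) (Idx K → ZMod N) (fun m hm hmN h0 => by
      have := Nat.le_of_dvd hm ((ZMod.natCast_eq_zero_iff _ _).1 h0)
      omega)
    (fun j => red N (s j)) (fun d => red N (v d)) (fun i j hij => funext fun l => by
      simp [hv, hij, red]) (fun z => primeMajorant w R b (lift z)) f hf0 (fun z => by
        by_cases hz : P z
        · rw [hz.primeMajorant_eq le_rfl hm0.ne']
          exact mul_le_of_le_one_right hm0.le (ind_le_one _)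
        · simp only [hf, ind_false hz, mul_zero]
          exact primeMajorant_nonneg hw R b _)
    (h₁ w (by omega) N (by omega) R hRpos (hRD _ (by omega)) b)
    (h₂ w (by omega) N (by omega) R hRpos (hRD _ (by omega)) b)
    (by rwa [av_mul_left])
  have hN0 : (0 : ℝ) < N := by exact_mod_cast hN.pos
  have hle : ∀ z, (av fun k : ZMod N => ∏ j, f (z + k • red N (s j))) ≤
      (R : ℝ) ^ Fintype.card J / N := fun z => by
    rw [av_eq, ZMod.card, Fintype.sum_eq_single 0]
    · gcongr
      exact (prod_le_prod (fun j _ => hf0 _) fun j _ => hfR _).trans (by simp)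
    · intro k hk
      obtain ⟨j, hj⟩ := hcon z k hk
      refine prod_eq_zero (mem_univ j) ?_
      simp only [hf]
      rw [ind_false hj, mul_zero]
  have h3 := hmain.trans (av_le hle)
  rw [le_div_iff₀ hN0] at h3
  have h4 : (R : ℝ) ^ Fintype.card J * R < N := by
    rw [← pow_succ]
    exact_mod_cast (Nat.pow_le_pow_right hRpos (by omega)).trans_lt hRN
  have h5 : 1 ≤ c * R := by
    rw [← mul_inv_cancel₀ hc.ne']
    gcongr
    refine (Nat.le_ceil _).trans ?_
    exact_mod_cast (by omega : ⌈c⁻¹⌉₊ ≤ R)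
  have hRp : (0 : ℝ) < (R : ℝ) ^ Fintype.card J := by positivity
  have h6 : (R : ℝ) ^ Fintype.card J ≤ c * ((R : ℝ) ^ Fintype.card J * R) := by
    rw [mul_left_comm]
    exact le_mul_of_one_le_right hRp.le h5
  linarith [mul_lt_mul_of_pos_left h4 hc]

/-- A finite configuration of lifts of prime points is an honest dilate of the configuration. -/
lemma exists_lift_eq_add_smul {S : Finset (Idx K → ℤ)} (h0 : 0 ∈ S) (h1 : 1 ∈ S) {M N : ℕ}
    (hN : N ≠ 0) (hM : ∀ t ∈ S, ∀ i, |t i| ≤ M) {z : Idx K → ZMod N} {k : ZMod N} (hk : k ≠ 0)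
    (hz : ∀ t ∈ S, ∀ i, |(lift (z + k • red N t) i : ℝ)| ≤ N / (4 * M + 4)) :
    ∃ (y : Idx K → ℤ) (l : ℤ), l ≠ 0 ∧ ∀ t ∈ S, lift (z + k • red N t) = y + l • t := by
  set u : (Idx K → ℤ) → Idx K → ℤ := fun t => lift (z + k • red N t) with hu
  set i₀ : Idx K := ⟨0, finrank_int_pos K⟩
  have hcast : ∀ t i, (u t i : ZMod N) = z i + k * t i := fun t i => congrFun (red_lift _) i
  have hl : ((u 1 i₀ - u 0 i₀ : ℤ) : ZMod N) = k := by
    rw [Int.cast_sub, hcast, hcast]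
    simp
  refine ⟨u 0, u 1 i₀ - u 0 i₀, fun h => hk ?_, fun t ht => funext fun i => ?_⟩
  · rw [← hl, h, Int.cast_zero]
  set l := u 1 i₀ - u 0 i₀ with hl'
  have hd : (N : ℤ) ∣ u t i - u 0 i - l * t i := by
    rw [← ZMod.intCast_zmod_eq_zero_iff_dvd]
    push_cast
    rw [hl, hcast, hcast]
    simp
  have hN0 : (0 : ℝ) < N := by exact_mod_cast Nat.pos_of_ne_zero hN
  have hL : |(l : ℝ)| ≤ 2 * (N / (4 * M + 4)) := by
    rw [hl', Int.cast_sub, two_mul]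
    exact (abs_sub _ _).trans (add_le_add (hz 1 h1 _) (hz 0 h0 _))
  have hd2 : |u t i - u 0 i - l * t i| < (N : ℤ) := by
    have h2 : |(t i : ℝ)| ≤ M := by exact_mod_cast hM t ht i
    have h3 : |(u t i - u 0 i - l * t i : ℝ)| ≤
        N / (4 * M + 4) + N / (4 * M + 4) + 2 * (N / (4 * M + 4)) * M := by
      refine (abs_sub _ _).trans (add_le_add ((abs_sub _ _).trans
        (add_le_add (hz t ht i) (hz 0 h0 i))) ?_)
      rw [abs_mul]
      gcongr
    have h4 : (N : ℝ) / (4 * M + 4) + N / (4 * M + 4) + 2 * (N / (4 * M + 4)) * M = N / 2 := by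
      field_simp
      ring
    have h5 : |(u t i - u 0 i - l * t i : ℝ)| < N := by linarith
    exact_mod_cast h5
  have h6 := Int.eq_zero_of_abs_lt_dvd hd hd2
  change u t i = u 0 i + l * t i
  linarith

lemma PrimePoint.prime {W N : ℕ} {b : Idx K → ℤ} {L H : ℝ} {z : Idx K → ZMod N}
    (hz : PrimePoint W b L H z) : Prime (intEquiv K ((W : ℤ) • lift z + b)) := by
  obtain ⟨-, v, hv, -⟩ := hz
  refine (Ideal.span_singleton_prime fun h => v.ne_bot ?_).1 (hv ▸ v.isPrime)
  rw [← hv, h, Ideal.span_singleton_eq_bot]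

end Progressions

end Constellation

open Constellation

theorem constellations_in_prime_elements
    (K : Type*) [Field K] [NumberField K] (S : Finset (RingOfIntegers K)) :
    ∃ (α : RingOfIntegers K) (k : ℕ), 0 < k ∧ ∀ s ∈ S, Prime (α + k • s) := by
  classical
  set φ := (intEquiv K).symm
  set T : Finset (Idx K → ℤ) := insert 0 (insert 1 (S.image (fun s => φ s) ∪ S.image fun s => -φ s))
    with hT
  have h0 : 0 ∈ T := by simp [hT]
  have h1 : 1 ∈ T := by simp [hT]
  have : Nonempty T := ⟨⟨0, h0⟩⟩
  set M := T.sup fun t => Finset.univ.sup fun i => (t i).natAbs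
  have hM : ∀ t ∈ T, ∀ i, |t i| ≤ M := fun t ht i => by
    rw [Int.abs_eq_natAbs]
    exact_mod_cast (Finset.le_sup (f := fun i => (t i).natAbs) (Finset.mem_univ i)).trans
      (Finset.le_sup (f := fun t => Finset.univ.sup fun i => (t i).natAbs) ht)
  obtain ⟨W, N, b, H, hW, hN, z, k, hk, hP⟩ :=
    exists_primePoint_progression (s := fun t : T => t.1) Subtype.val_injective M
  obtain ⟨y, l, hl, hy⟩ := exists_lift_eq_add_smul h0 h1 hN hM hk fun t ht => (hP ⟨t, ht⟩).1
  refine ⟨intEquiv K ((W : ℤ) • y + b), W * l.natAbs,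
    Nat.mul_pos (Nat.pos_of_ne_zero hW) (Int.natAbs_pos.2 hl), fun s hs => ?_⟩
  obtain ⟨t, ht, hts⟩ : ∃ t ∈ T, l • t = (l.natAbs : ℤ) • φ s := by
    rcases le_total 0 l with h | h
    · exact ⟨φ s, by simp [hT, hs], by rw [Int.natAbs_of_nonneg h]⟩
    · refine ⟨-φ s, ?_, by rw [Int.ofNat_natAbs_of_nonpos h, smul_neg, neg_smul]⟩
      simp only [hT, Finset.mem_insert, Finset.mem_union, Finset.mem_image]
      exact .inr (.inr (.inr ⟨s, hs, rfl⟩))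
  convert (hP ⟨t, ht⟩).prime using 1
  have hφ : intEquiv K (φ s) = s := LinearEquiv.apply_symm_apply _ _
  rw [hy t ht, hts, smul_add, add_right_comm, map_add (intEquiv K) (_ + b), smul_smul,
    ← Nat.cast_mul, map_smul, hφ, natCast_zsmul s]
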